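/- Let (u, p) be a weak solution of the HHMO model with u* < Ψ(α). Assume p satisfies condition (P) and that there exists γ ≥ 0 such that lim_{x→∞} x·∫_x^∞ p*(ξ) dξ = γ. Then u converges uniformly to Φ_γ, i.e. lim_{t→∞} sup_{η≥0} |u(η√t, t) − Φ_γ(η)| = 0. Furthermore, Φ_γ(α) = u* if γ > 0, and 0 < Φ₀(α) ≤ u* if γ = 0. -/

import Mathlib

open MeasureTheory Filter Set

noncomputable section

/-- The precipitation-free self-similar solution `ψ(x,t)`. -/
def psi (α β x t : ℝ) : ℝ :=
  if 0 < t then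
    (α * β / 2) * Real.exp (α ^ 2 / 4) *
      ∫ ζ in Set.Ioi (max (|x| / Real.sqrt t) α), Real.exp (-ζ ^ 2 / 4)
  else 0

/-- The profile `Ψ(η)` in similarity coordinates. -/
def PsiP (α β η : ℝ) : ℝ :=
  (α * β / 2) * Real.exp (α ^ 2 / 4) * ∫ ζ in Set.Ioi (max η α), Real.exp (-ζ ^ 2 / 4)

/-- Regularity of a weak solution: `w` is the spatial derivative of `u - ψ`;
both are continuous on `ℝ × [0,∞)` and bounded on `ℝ × [0,T]` for every `T > 0`. -/
def AuxReg (α β : ℝ) (u w : ℝ → ℝ → ℝ) : Prop :=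
  (∀ t ∈ Set.Ici (0:ℝ), ∀ x : ℝ, HasDerivAt (fun y => u y t - psi α β y t) (w x t) x) ∧
  ContinuousOn (fun q : ℝ × ℝ => u q.1 q.2 - psi α β q.1 q.2) (Set.univ ×ˢ Set.Ici 0) ∧
  ContinuousOn (fun q : ℝ × ℝ => w q.1 q.2) (Set.univ ×ˢ Set.Ici 0) ∧
  ∀ T > (0:ℝ), ∃ C : ℝ, ∀ x : ℝ, ∀ t ∈ Set.Icc (0:ℝ) T,
    |u x t - psi α β x t| ≤ C ∧ |w x t| ≤ C

/-- A test function of class `C^{1,1}(ℝ × [0,T])`, vanishing for large `|x|` and at `t = T`,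
together with its partial derivatives `φt`, `φx`. -/
def IsTestFun (T : ℝ) (φ φt φx : ℝ → ℝ → ℝ) : Prop :=
  (∀ x : ℝ, ∀ t ∈ Set.Icc (0:ℝ) T,
    HasDerivWithinAt (fun s => φ x s) (φt x t) (Set.Icc 0 T) t) ∧
  (∀ x : ℝ, ∀ t ∈ Set.Icc (0:ℝ) T, HasDerivAt (fun y => φ y t) (φx x t) x) ∧
  ContinuousOn (fun q : ℝ × ℝ => φ q.1 q.2) (Set.univ ×ˢ Set.Icc 0 T) ∧
  ContinuousOn (fun q : ℝ × ℝ => φt q.1 q.2) (Set.univ ×ˢ Set.Icc 0 T) ∧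
  ContinuousOn (fun q : ℝ × ℝ => φx q.1 q.2) (Set.univ ×ˢ Set.Icc 0 T) ∧
  (∃ R : ℝ, ∀ x : ℝ, ∀ t ∈ Set.Icc (0:ℝ) T, R ≤ |x| → φ x t = 0) ∧
  (∀ x : ℝ, φ x T = 0)

/-- The weak form of the equation, relative to a given precipitation function `p` and
the spatial derivative `w` of `u - ψ`. -/
def WeakForm (α β : ℝ) (u p w : ℝ → ℝ → ℝ) : Prop :=
  ∀ T > (0:ℝ), ∀ φ φt φx : ℝ → ℝ → ℝ, IsTestFun T φ φt φx →
    (∫ t in Set.Ioc (0:ℝ) T, ∫ x : ℝ, φt x t * (u x t - psi α β x t))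
      = ∫ t in Set.Ioc (0:ℝ) T, ∫ x : ℝ, (φx x t * w x t + p x t * u x t * φ x t)

/-- A weak solution of the linear auxiliary problem with given precipitation function `p`. -/
def IsAuxSolution (α β : ℝ) (p u : ℝ → ℝ → ℝ) : Prop :=
  (∀ x t : ℝ, u (-x) t = u x t) ∧
  ∃ w : ℝ → ℝ → ℝ, AuxReg α β u w ∧ WeakForm α β u p w

/-- A weak solution `(u, p)` of the HHMO model. -/
def IsWeakSolution (α β ustar : ℝ) (u p : ℝ → ℝ → ℝ) : Prop :=
  (∀ x t : ℝ, u (-x) t = u x t) ∧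
  (∀ x t : ℝ, p (-x) t = p x t) ∧
  Measurable (fun q : ℝ × ℝ => p q.1 q.2) ∧
  (∀ x : ℝ, ∀ t ∈ Set.Ici (0:ℝ),
    (sSup ((fun s => u x s) '' Set.Icc 0 t) < ustar → p x t = 0) ∧
    (sSup ((fun s => u x s) '' Set.Icc 0 t) = ustar → p x t ∈ Set.Icc (0:ℝ) 1) ∧
    (ustar < sSup ((fun s => u x s) '' Set.Icc 0 t) → p x t = 1)) ∧
  (∀ x : ℝ, MonotoneOn (fun t => p x t) (Set.Ici (0:ℝ))) ∧
  ∃ w : ℝ → ℝ → ℝ, AuxReg α β u w ∧ WeakForm α β u p w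

/-- Condition (P): the precipitation function depends only on `x` beyond the parabola
`t = x²/α²`. -/
def CondP (α : ℝ) (p : ℝ → ℝ → ℝ) (pstar : ℝ → ℝ) : Prop :=
  Measurable pstar ∧
  ∀ᵐ x ∂(volume.restrict (Set.Ioi (0:ℝ))), ∀ t : ℝ, x ^ 2 / α ^ 2 < t → p x t = pstar x

/-- The admissible class `𝒜` of precipitation functions. -/
def IsAdmissible (p : ℝ → ℝ → ℝ) : Prop :=
  (∀ x t : ℝ, p (-x) t = p x t) ∧
  MeasureTheory.LocallyIntegrableOn (fun q : ℝ × ℝ => p q.1 q.2) (Set.Ioi 0 ×ˢ Set.Ici 0) ∧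
  ∀ T > (0:ℝ), ∃ R : ℝ, ∀ x ≥ R, ∀ t ∈ Set.Icc (0:ℝ) T, p x t = 0

/-- `u` converges uniformly, in parabolic similarity coordinates, to the profile `Φ`. -/
def ConvUnif (u : ℝ → ℝ → ℝ) (Φ : ℝ → ℝ) : Prop :=
  ∀ ε > (0:ℝ), ∃ T : ℝ, ∀ t ≥ T, ∀ η ≥ (0:ℝ), |u (η * Real.sqrt t) t - Φ η| < ε

/-- The error function. -/
def erf (x : ℝ) : ℝ := (2 / Real.sqrt Real.pi) * ∫ s in (0:ℝ)..x, Real.exp (-s ^ 2)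

/-- The complementary error function. -/
def erfc (x : ℝ) : ℝ := (2 / Real.sqrt Real.pi) * ∫ s in Set.Ioi x, Real.exp (-s ^ 2)

/-- Kummer's confluent hypergeometric function `M(a,b,z)` (real arguments). -/
def kummerM (a b z : ℝ) : ℝ :=
  ∑' n : ℕ, (Polynomial.eval a (ascPochhammer ℝ n) / Polynomial.eval b (ascPochhammer ℝ n))
    * z ^ n / (n.factorial : ℝ)

/-- `κ = (1 + √(4γ+1))/2`, the positive root of `κ(κ-1) = γ`. -/
def kappaOf (γ : ℝ) : ℝ := (1 + Real.sqrt (4 * γ + 1)) / 2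

/-- The value `u*_γ` determined by the derivative matching condition. -/
def ustarGamma (α β γ : ℝ) : ℝ :=
  (α * β / 2) *
    (kappaOf γ * kummerM (kappaOf γ / 2 + 1) (kappaOf γ + 1 / 2) (-α ^ 2 / 4) /
        (α * kummerM (kappaOf γ / 2) (kappaOf γ + 1 / 2) (-α ^ 2 / 4)) +
      Real.exp (-α ^ 2 / 4) / (Real.sqrt Real.pi * erfc (α / 2)))⁻¹

/-- The self-similar profile `Φ_γ`. -/
def Phi (α β γ η : ℝ) : ℝ :=
  if η < α then
    ustarGamma α β γ * η ^ kappaOf γ *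
      kummerM (kappaOf γ / 2) (kappaOf γ + 1 / 2) (-η ^ 2 / 4) /
      (α ^ kappaOf γ * kummerM (kappaOf γ / 2) (kappaOf γ + 1 / 2) (-α ^ 2 / 4))
  else ustarGamma α β γ * erfc (η / 2) / erfc (α / 2)

/-- Integrated form of `z_t + c ≤ z_xx` on the box `[a,b] × [t₁,t₂]`. -/
structure SubBal (c : ℝ) (z zx : ℝ → ℝ → ℝ) (a b t₁ t₂ : ℝ) : Prop where
  der : ∀ x ∈ Icc a b, ∀ t ∈ Icc t₁ t₂, HasDerivAt (fun y => z y t) (zx x t) x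
  cont : ContinuousOn (fun q : ℝ × ℝ => z q.1 q.2) (Icc a b ×ˢ Icc t₁ t₂)
  contx : ContinuousOn (fun q : ℝ × ℝ => zx q.1 q.2) (Icc a b ×ˢ Icc t₁ t₂)
  bal : ∀ x₁ x₂ s₁ s₂, a ≤ x₁ → x₁ ≤ x₂ → x₂ ≤ b → t₁ ≤ s₁ → s₁ ≤ s₂ → s₂ ≤ t₂ →
    (∫ y in x₁..x₂, (z y s₂ - z y s₁)) + c * ((x₂ - x₁) * (s₂ - s₁)) ≤
      ∫ s in s₁..s₂, (zx x₂ s - zx x₁ s)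

lemma continuousOn_slice_left {z : ℝ → ℝ → ℝ} {s : Set ℝ} {t : Set ℝ}
    (h : ContinuousOn (fun q : ℝ × ℝ => z q.1 q.2) (s ×ˢ t)) {y : ℝ} (hy : y ∈ t) :
    ContinuousOn (fun x => z x y) s :=
  h.comp (f := fun x => (x, y)) (by fun_prop) (fun x hx => ⟨hx, hy⟩)

lemma continuousOn_slice_right {z : ℝ → ℝ → ℝ} {s : Set ℝ} {t : Set ℝ}
    (h : ContinuousOn (fun q : ℝ × ℝ => z q.1 q.2) (s ×ˢ t)) {x : ℝ} (hx : x ∈ s) :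
    ContinuousOn (fun y => z x y) t :=
  h.comp (f := fun y => (x, y)) (by fun_prop) (fun y hy => ⟨hx, hy⟩)

/-- Clamp to an interval. -/
def clamp (a b x : ℝ) : ℝ := max a (min b x)

lemma continuous_clamp (a b : ℝ) : Continuous (clamp a b) := by unfold clamp; fun_prop

lemma clamp_mem {a b : ℝ} (h : a ≤ b) (x : ℝ) : clamp a b x ∈ Icc a b :=
  ⟨le_max_left _ _, max_le h (min_le_left _ _)⟩

lemma clamp_eq {a b x : ℝ} (h : x ∈ Icc a b) : clamp a b x = x := by
  unfold clamp; rw [min_eq_right h.2, max_eq_right h.1]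

lemma SubBal.no_interior_max {c : ℝ} {z zx : ℝ → ℝ → ℝ} {x₀ t₀ r M : ℝ} (hc : 0 < c)
    (hr : 0 < r) (H : SubBal c z zx (x₀ - r) (x₀ + r) (t₀ - r) t₀)
    (hM : M < z x₀ t₀)
    (hlat : ∀ t ∈ Icc (t₀ - r) t₀, z (x₀ - r) t ≤ M ∧ z (x₀ + r) t ≤ M)
    (hbot : ∀ x ∈ Icc (x₀ - r) (x₀ + r), ∀ t ∈ Icc (t₀ - r) (t₀ - r / 2), z x t ≤ M) : False := by
  set Z : ℝ → ℝ → ℝ := fun x t => z (clamp (x₀ - r) (x₀ + r) x) (clamp (t₀ - r) t₀ t) with hZ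
  have hZc : Continuous (fun q : ℝ × ℝ => Z q.1 q.2) := by
    refine H.cont.comp_continuous (f := fun q : ℝ × ℝ =>
      (clamp (x₀ - r) (x₀ + r) q.1, clamp (t₀ - r) t₀ q.2)) ?_ ?_
    · have := continuous_clamp (x₀ - r) (x₀ + r)
      have := continuous_clamp (t₀ - r) (t₀)
      fun_prop
    · intro q; exact ⟨clamp_mem (by linarith) _, clamp_mem (by linarith) _⟩
  have hZe : ∀ x ∈ Icc (x₀ - r) (x₀ + r), ∀ t ∈ Icc (t₀ - r) t₀, Z x t = z x t := by
    intro x hx t ht; simp only [hZ, clamp_eq hx, clamp_eq ht]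
  have hx0 : x₀ ∈ Icc (x₀ - r) (x₀ + r) := ⟨by linarith, by linarith⟩
  -- choice of the averaging length
  obtain ⟨h, hh, hhr, hhz⟩ : ∃ h, 0 < h ∧ h < r / 2 ∧
      ∀ s ∈ Icc (t₀ - h) t₀, (M + z x₀ t₀) / 2 ≤ Z x₀ s := by
    have h1 : Continuous (fun s => Z x₀ s) :=
      hZc.comp (by fun_prop : Continuous fun s : ℝ => (x₀, s))
    have h2 : ∀ᶠ s in nhds t₀, (M + z x₀ t₀) / 2 < Z x₀ s := by
      refine h1.continuousAt.eventually (lt_mem_nhds ?_)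
      simp only [hZe _ hx0 _ ⟨by linarith, le_rfl⟩]; linarith
    obtain ⟨δ, hδ, hδ2⟩ := Metric.eventually_nhds_iff.1 h2
    refine ⟨min (δ / 2) (r / 4), by positivity, ?_, ?_⟩
    · exact lt_of_le_of_lt (min_le_right _ _) (by linarith)
    · intro s hs
      refine (hδ2 ?_).le
      rw [Real.dist_eq, abs_lt]
      have := min_le_left (δ / 2) (r / 4)
      constructor <;> linarith [hs.1, hs.2]
  set Θ : ℝ × ℝ → ℝ := fun q => ∫ s in (q.2 - h)..q.2, Z q.1 s with hΘ
  have hint : ∀ x a b, IntervalIntegrable (fun s => Z x s) volume a b := fun x a b =>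
    (hZc.comp (by fun_prop : Continuous fun s : ℝ => (x, s))).intervalIntegrable _ _
  have hΘc : Continuous Θ := by
    have : Θ = fun q => ∫ s in (0:ℝ)..h, Z q.1 (s + (q.2 - h)) := by
      funext q
      rw [intervalIntegral.integral_comp_add_right (fun s => Z q.1 s)]
      simp [hΘ]
    rw [this]
    apply intervalIntegral.continuous_parametric_intervalIntegral_of_continuous'
    exact hZc.comp (by fun_prop : Continuous fun q : (ℝ × ℝ) × ℝ => (q.1.1, q.2 + (q.1.2 - h)))
  obtain ⟨⟨x', t'⟩, hmem, hmax⟩ :=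
    (isCompact_Icc.prod isCompact_Icc : IsCompact (Icc (x₀ - r) (x₀ + r) ×ˢ Icc (t₀ - r / 2) t₀)
      ).exists_isMaxOn ⟨(x₀, t₀), hx0, ⟨by linarith, le_rfl⟩⟩ hΘc.continuousOn
  have hmax' : ∀ x ∈ Icc (x₀ - r) (x₀ + r), ∀ t ∈ Icc (t₀ - r / 2) t₀, Θ (x, t) ≤ Θ (x', t') :=
    fun x hx t ht => hmax (⟨hx, ht⟩ : (x, t) ∈ Icc (x₀ - r) (x₀ + r) ×ˢ Icc (t₀ - r / 2) t₀)
  have hbig : h * M < Θ (x', t') := by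
    have h1 : h * ((M + z x₀ t₀) / 2) ≤ Θ (x₀, t₀) := by
      have : ∫ s in (t₀ - h)..t₀, (M + z x₀ t₀) / 2 ≤ Θ (x₀, t₀) := by
        apply intervalIntegral.integral_mono_on (by linarith) (by simp) (hint _ _ _) hhz
      rw [intervalIntegral.integral_const, smul_eq_mul] at this
      linarith
    have h2 := hmax' x₀ hx0 t₀ ⟨by linarith, le_rfl⟩
    nlinarith
  have hsmall : ∀ x t, (∀ s ∈ Icc (t - h) t, Z x s ≤ M) → Θ (x, t) ≤ h * M := by
    intro x t hs
    have : Θ (x, t) ≤ ∫ s in (t - h)..t, M :=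
      intervalIntegral.integral_mono_on (by linarith) (hint _ _ _) (by simp) hs
    simpa using this
  obtain ⟨hx', ht'⟩ := hmem
  simp only at hx' ht'
  have ht'1 : t₀ - r / 2 < t' := by
    rcases ht'.1.lt_or_eq with h | h
    · exact h
    · exfalso
      refine absurd (hsmall x' t' ?_) (not_le.2 hbig)
      intro s hs
      rw [hZe _ hx' _ ⟨by linarith [hs.1], by linarith [hs.2]⟩]
      exact hbot _ hx' _ ⟨by linarith [hs.1], by linarith [hs.2]⟩
  have hx'1 : x' ∈ Ioo (x₀ - r) (x₀ + r) := by
    have key : ∀ x, x = x₀ - r ∨ x = x₀ + r → Θ (x, t') ≤ h * M := by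
      intro x hx
      refine hsmall x t' fun s hs => ?_
      have hs' : s ∈ Icc (t₀ - r) t₀ := ⟨by linarith [hs.1], by linarith [hs.2, ht'.2]⟩
      rw [hZe _ (by rcases hx with rfl | rfl <;> constructor <;> linarith) _ hs']
      rcases hx with rfl | rfl
      · exact (hlat _ hs').1
      · exact (hlat _ hs').2
    constructor
    · rcases hx'.1.lt_or_eq with h | h
      · exact h
      · exact absurd (key x' (.inl h.symm)) (not_le.2 hbig)
    · rcases hx'.2.lt_or_eq with h | h
      · exact h
      · exact absurd (key x' (.inr h)) (not_le.2 hbig)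
  have hm1 : t' - h ∈ Icc (t₀ - r) t₀ := ⟨by linarith, by linarith [ht'.2]⟩
  have hm2 : t' ∈ Icc (t₀ - r) t₀ := ⟨by linarith, ht'.2⟩
  -- time monotonicity at the maximum
  have hD : Z x' (t' - h) ≤ Z x' t' := by
    have hcx : Continuous fun s => Z x' s :=
      hZc.comp (by fun_prop : Continuous fun s : ℝ => (x', s))
    have hd : HasDerivAt (fun t => Θ (x', t)) (Z x' t' - Z x' (t' - h)) t' := by
      have e : (fun t => Θ (x', t)) = fun t => (∫ s in (0:ℝ)..t, Z x' s) -
          ∫ s in (0:ℝ)..(t - h), Z x' s := by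
        funext t
        rw [intervalIntegral.integral_interval_sub_left (hint _ _ _) (hint _ _ _)]
      rw [e]
      refine HasDerivAt.sub (intervalIntegral.integral_hasDerivAt_right (hint _ _ _)
        hcx.stronglyMeasurable.stronglyMeasurableAtFilter hcx.continuousAt) ?_
      have := (intervalIntegral.integral_hasDerivAt_right (hint x' 0 (t' - h))
        hcx.stronglyMeasurable.stronglyMeasurableAtFilter hcx.continuousAt)
      simpa using HasDerivAt.comp_sub_const t' h this
    by_contra hcon
    push Not at hcon
    have hneg : Z x' t' - Z x' (t' - h) < 0 := by linarith
    have h1 := (hasDerivAt_iff_tendsto_slope.1 hd).eventually (gt_mem_nhds hneg)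
    have h2 : ∀ᶠ t in nhdsWithin t' (Iio t'), slope (fun t => Θ (x', t)) t' t < 0 :=
      h1.filter_mono (nhdsWithin_mono _ (fun t ht => ne_of_lt ht))
    have h3 : ∀ᶠ t in nhdsWithin t' (Iio t'), t ∈ Ioo (t₀ - r / 2) t' :=
      Ioo_mem_nhdsLT ht'1
    obtain ⟨t, h4, h5⟩ := (h2.and h3).exists
    rw [slope_def_field] at h4
    have h6 := hmax' x' hx' t ⟨h5.1.le, h5.2.le.trans ht'.2⟩
    have : 0 ≤ (Θ (x', t) - Θ (x', t')) / (t - t') :=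
      div_nonneg_of_nonpos (by linarith) (by linarith [h5.2])
    linarith
  -- the spatial derivative of the average
  set Y : ℝ → ℝ := fun x => ∫ s in (t' - h)..t', zx x s with hY
  have hsub : Icc (t' - h) t' ⊆ Icc (t₀ - r) t₀ := Icc_subset_Icc hm1.1 hm2.2
  have hxint : ∀ x ∈ Icc (x₀ - r) (x₀ + r), IntervalIntegrable (fun s => zx x s) volume
      (t' - h) t' := fun x hx =>
    ((continuousOn_slice_right H.contx hx).mono hsub).intervalIntegrable_of_Icc (by linarith)
  have hΘd : ∀ x ∈ Ioo (x₀ - r) (x₀ + r), HasDerivAt (fun x => Θ (x, t')) (Y x) x := by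
    intro x hx
    obtain ⟨C, hC⟩ := (isCompact_Icc.prod isCompact_Icc).exists_bound_of_continuousOn H.contx
    have huI : uIoc (t' - h) t' = Ioc (t' - h) t' := uIoc_of_le (by linarith)
    have hI : ∀ s ∈ uIoc (t' - h) t', s ∈ Icc (t₀ - r) t₀ := by
      intro s hs; rw [huI] at hs; exact hsub (Ioc_subset_Icc_self hs)
    show HasDerivAt (fun x => ∫ s in (t' - h)..t', Z x s) (∫ s in (t' - h)..t', zx x s) x
    refine (intervalIntegral.hasDerivAt_integral_of_dominated_loc_of_deriv_le
      (F := fun x s => Z x s) (F' := fun x s => zx x s) (s := Ioo (x₀ - r) (x₀ + r))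
      (bound := fun _ => C) (Ioo_mem_nhds hx.1 hx.2) ?_ (hint _ _ _) ?_ ?_ (by simp) ?_).2
    · exact Eventually.of_forall fun y => (hint y _ _).def'.aestronglyMeasurable
    · exact (hxint x (Ioo_subset_Icc_self hx)).def'.aestronglyMeasurable
    · refine Eventually.of_forall fun s hs y hy => ?_
      exact hC (y, s) ⟨Ioo_subset_Icc_self hy, hI s hs⟩
    · refine Eventually.of_forall fun s hs y hy => ?_
      refine (H.der y (Ioo_subset_Icc_self hy) s (hI s hs)).congr_of_eventuallyEq ?_
      filter_upwards [Ioo_mem_nhds hy.1 hy.2] with y' hy'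
      exact hZe _ (Ioo_subset_Icc_self hy') _ (hI s hs)
  have hY0 : Y x' = 0 := by
    refine IsLocalMax.hasDerivAt_eq_zero (f := fun x => Θ (x, t')) ?_ (hΘd x' hx'1)
    filter_upwards [Ioo_mem_nhds hx'1.1 hx'1.2] with y hy
    exact hmax' y (Ioo_subset_Icc_self hy) t' ht'
  obtain ⟨δ, hδ, hδb, hδD⟩ : ∃ δ > 0, x' + δ < x₀ + r ∧
      ∀ x ∈ Icc x' (x' + δ), -(c * h / 2) ≤ z x t' - z x (t' - h) := by
    have h1 : Continuous (fun x => Z x t' - Z x (t' - h)) :=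
      (hZc.comp (by fun_prop : Continuous fun s : ℝ => (s, t'))).sub
      (hZc.comp (by fun_prop : Continuous fun s : ℝ => (s, t' - h)))
    have h2 : ∀ᶠ s in nhds x', -(c * h / 2) < Z s t' - Z s (t' - h) := by
      refine h1.continuousAt.eventually (lt_mem_nhds ?_)
      have : 0 < c * h := by positivity
      linarith
    obtain ⟨δ, hδ, hδ2⟩ := Metric.eventually_nhds_iff.1 h2
    have hpos : 0 < x₀ + r - x' := by linarith [hx'1.2]
    have q1 := min_le_left (δ / 2) ((x₀ + r - x') / 2)
    have q2 := min_le_right (δ / 2) ((x₀ + r - x') / 2)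
    refine ⟨min (δ / 2) ((x₀ + r - x') / 2), by positivity, by linarith, ?_⟩
    intro x hx
    have hxm : x ∈ Icc (x₀ - r) (x₀ + r) := ⟨by linarith [hx.1, hx'.1], by linarith [hx.2]⟩
    rw [← hZe _ hxm _ hm2, ← hZe _ hxm _ hm1]
    refine (hδ2 ?_).le
    rw [Real.dist_eq, abs_lt]
    constructor <;> linarith [hx.1, hx.2]
  have hYpos : ∀ x ∈ Ioc x' (x' + δ), 0 < Y x := by
    intro x hx
    have hxm : x ∈ Icc (x₀ - r) (x₀ + r) := ⟨by linarith [hx.1, hx'.1], by linarith [hx.2]⟩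
    have hb := H.bal x' x (t' - h) t' hx'.1 hx.1.le hxm.2 hm1.1 (by linarith) hm2.2
    rw [intervalIntegral.integral_sub (hxint x hxm) (hxint x' hx')] at hb
    have e : Y x' = ∫ s in (t' - h)..t', zx x' s := rfl
    have e2 : Y x = ∫ s in (t' - h)..t', zx x s := rfl
    rw [← e, ← e2, hY0] at hb
    have hsubx : Icc x' x ⊆ Icc (x₀ - r) (x₀ + r) := Icc_subset_Icc hx'.1 hxm.2
    have h3 : ∫ y in x'..x, -(c * h / 2) ≤ ∫ y in x'..x, (z y t' - z y (t' - h)) := by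
      apply intervalIntegral.integral_mono_on hx.1.le (by simp)
      · exact (((continuousOn_slice_left H.cont hm2).sub
          (continuousOn_slice_left H.cont hm1)).mono hsubx).intervalIntegrable_of_Icc hx.1.le
      · intro y hy; exact hδD y ⟨hy.1, hy.2.trans hx.2⟩
    rw [intervalIntegral.integral_const, smul_eq_mul] at h3
    have : 0 < c * h * (x - x') := by have := hx.1; have : 0 < x - x' := by linarith
                                      positivity
    nlinarith
  have hmono : Θ (x', t') < Θ (x' + δ, t') := by
    refine strictMonoOn_of_deriv_pos (convex_Icc x' (x' + δ)) (f := fun x => Θ (x, t')) ?_ ?_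
      ⟨le_rfl, by linarith⟩ ⟨by linarith, le_rfl⟩ (by linarith)
    · exact (hΘc.comp (by fun_prop : Continuous fun x : ℝ => (x, t'))).continuousOn
    · intro x hx
      rw [interior_Icc] at hx
      rw [(hΘd x ⟨by linarith [hx.1, hx'1.1], by linarith [hx.2]⟩).deriv]
      exact hYpos x ⟨hx.1, hx.2.le⟩
  exact absurd (hmax' (x' + δ) ⟨by linarith [hx'.1], hδb.le⟩ t' ht') (not_le.2 hmono)

lemma SubBal.false_of_max {κ : ℝ} {z zx : ℝ → ℝ → ℝ} {x₀ t₀ r : ℝ} (hκ : 0 < κ)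
    (hr : 0 < r) (H : SubBal 0 z zx (x₀ - r) (x₀ + r) (t₀ - r) t₀)
    (hmax : ∀ x ∈ Icc (x₀ - r) (x₀ + r), ∀ t ∈ Icc (t₀ - r) t₀,
      z x t ≤ z x₀ t₀ - κ * (t₀ - t)) : False := by
  set θ : ℝ → ℝ → ℝ := fun x t => z x t - (κ / 2 * t + κ / 8 * (x - x₀) ^ 2) with hθ
  set θx : ℝ → ℝ → ℝ := fun x t => zx x t - κ / 4 * (x - x₀) with hθx
  have Hθ : SubBal (κ / 4) θ θx (x₀ - r) (x₀ + r) (t₀ - r) t₀ := by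
    refine ⟨?_, ?_, ?_, ?_⟩
    · intro x hx t ht
      have h1 : HasDerivAt (fun y => κ / 2 * t + κ / 8 * (y - x₀) ^ 2) (κ / 4 * (x - x₀)) x := by
        have := ((((hasDerivAt_id x).sub_const x₀).pow 2).const_mul (κ / 8)).const_add (κ / 2 * t)
        refine this.congr_deriv ?_
        simp; ring
      exact (H.der x hx t ht).sub h1
    · exact H.cont.sub (by fun_prop)
    · exact H.contx.sub (by fun_prop)
    · intro x₁ x₂ s₁ s₂ h1 h2 h3 h4 h5 h6
      have hb := H.bal x₁ x₂ s₁ s₂ h1 h2 h3 h4 h5 h6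
      have m1 : s₁ ∈ Icc (t₀ - r) t₀ := ⟨h4, h5.trans h6⟩
      have m2 : s₂ ∈ Icc (t₀ - r) t₀ := ⟨h4.trans h5, h6⟩
      have n1 : x₁ ∈ Icc (x₀ - r) (x₀ + r) := ⟨h1, h2.trans h3⟩
      have n2 : x₂ ∈ Icc (x₀ - r) (x₀ + r) := ⟨h1.trans h2, h3⟩
      have e1 : (∫ y in x₁..x₂, (θ y s₂ - θ y s₁)) =
          (∫ y in x₁..x₂, (z y s₂ - z y s₁)) - ∫ y in x₁..x₂, κ / 2 * (s₂ - s₁) := by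
        rw [← intervalIntegral.integral_sub]
        · congr 1; funext y; simp only [hθ]; ring
        · exact (((continuousOn_slice_left H.cont m2).sub
            (continuousOn_slice_left H.cont m1)).mono
              (Icc_subset_Icc h1 h3)).intervalIntegrable_of_Icc h2
        · simp
      have e2 : (∫ s in s₁..s₂, (θx x₂ s - θx x₁ s)) =
          (∫ s in s₁..s₂, (zx x₂ s - zx x₁ s)) - ∫ s in s₁..s₂, κ / 4 * (x₂ - x₁) := by
        rw [← intervalIntegral.integral_sub]
        · congr 1; funext y; simp only [hθx]; ring
        · exact (((continuousOn_slice_right H.contx n2).sub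
            (continuousOn_slice_right H.contx n1)).mono
              (Icc_subset_Icc h4 h6)).intervalIntegrable_of_Icc h5
        · simp
      rw [e1, e2, intervalIntegral.integral_const, intervalIntegral.integral_const, smul_eq_mul,
        smul_eq_mul]
      nlinarith
  have hx0 : x₀ ∈ Icc (x₀ - r) (x₀ + r) := ⟨by linarith, by linarith⟩
  set M := max (θ x₀ t₀ - κ / 8 * r ^ 2) (θ x₀ t₀ - κ / 4 * r) with hM
  have hgen : ∀ x ∈ Icc (x₀ - r) (x₀ + r), ∀ t ∈ Icc (t₀ - r) t₀,
      θ x t ≤ θ x₀ t₀ - κ / 2 * (t₀ - t) - κ / 8 * (x - x₀) ^ 2 := by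
    intro x hx t ht
    have := hmax x hx t ht
    simp only [hθ]; nlinarith
  refine Hθ.no_interior_max (M := M) (by positivity) hr ?_ ?_ ?_
  · refine max_lt ?_ ?_
    · have : 0 < κ / 8 * r ^ 2 := by positivity
      linarith
    · have : 0 < κ / 4 * r := by positivity
      linarith
  · intro t ht
    have q : 0 ≤ κ / 2 * (t₀ - t) := mul_nonneg (by positivity) (by linarith [ht.2])
    constructor
    · refine le_trans ?_ (le_max_left _ _)
      have := hgen (x₀ - r) ⟨le_rfl, by linarith⟩ t ht
      nlinarith
    · refine le_trans ?_ (le_max_left _ _)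
      have := hgen (x₀ + r) ⟨by linarith, le_rfl⟩ t ht
      nlinarith
  · intro x hx t ht
    refine le_trans ?_ (le_max_right _ _)
    have := hgen x hx t ⟨ht.1, by linarith [ht.2]⟩
    have q : 0 ≤ κ / 8 * (x - x₀) ^ 2 := by positivity
    have q2 : κ / 2 * (r / 2) ≤ κ / 2 * (t₀ - t) :=
      mul_le_mul_of_nonneg_left (by linarith [ht.2]) (by positivity)
    linarith

/-- The backward parabolic box of size `r` below `(x,t)`. -/
def pbox (x t r : ℝ) : Set (ℝ × ℝ) := Icc (x - r) (x + r) ×ˢ Icc (t - r) t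

/-- Weak maximum principle on a compact set `K`: at each point of `K` where `z` is positive,
either `z` is locally a subsolution or `z(·,t)` has no local maximum. -/
theorem max_principle {K : Set (ℝ × ℝ)} (hK : IsCompact K) {z : ℝ → ℝ → ℝ}
    (hz : ContinuousOn (fun q : ℝ × ℝ => z q.1 q.2) K)
    (h : ∀ x t, (x, t) ∈ K → 0 < z x t →
      (∃ r > 0, pbox x t r ⊆ K ∧ ∃ zx, SubBal 0 z zx (x - r) (x + r) (t - r) t) ∨
      ((∀ᶠ y in nhds x, (y, t) ∈ K) ∧ ¬ IsLocalMax (fun y => z y t) x)) :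
    ∀ x t, (x, t) ∈ K → z x t ≤ 0 := by
  intro x t hxt
  by_contra hcon
  push Not at hcon
  obtain ⟨τ, hτ⟩ : ∃ τ, ∀ q ∈ K, τ ≤ q.2 := by
    obtain ⟨τ, hτ⟩ := (hK.image continuous_snd).bddBelow
    exact ⟨τ, fun q hq => hτ ⟨q, hq, rfl⟩⟩
  have htτ : τ ≤ t := hτ _ hxt
  set κ := z x t / (2 * (t - τ + 1)) with hκ
  have hκ0 : 0 < κ := div_pos hcon (by linarith)
  have hκ1 : κ * (t - τ) < z x t := by
    have : κ * (2 * (t - τ + 1)) = z x t := by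
      rw [hκ]; field_simp [show (t - τ + 1) ≠ 0 by linarith]
    nlinarith
  obtain ⟨⟨x₀, t₀⟩, hm, hmax⟩ := hK.exists_isMaxOn ⟨_, hxt⟩
    (hz.sub (by fun_prop : ContinuousOn (fun q : ℝ × ℝ => κ * (q.2 - τ)) K))
  have hmax' : ∀ y s, (y, s) ∈ K → z y s - κ * (s - τ) ≤ z x₀ t₀ - κ * (t₀ - τ) :=
    fun y s hys => hmax hys
  have h0 : 0 < z x₀ t₀ := by
    have h1 := hmax' x t hxt
    have h2 : 0 ≤ κ * (t₀ - τ) := mul_nonneg hκ0.le (by linarith [hτ _ hm])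
    linarith
  rcases h x₀ t₀ hm h0 with ⟨r, hr, hsub, zx, H⟩ | ⟨h1, h2⟩
  · refine H.false_of_max hκ0 hr fun y hy s hs => ?_
    have := hmax' y s (hsub ⟨hy, hs⟩)
    linarith
  · apply h2
    filter_upwards [h1] with y hy
    have := hmax' y t₀ hy
    linarith

/-- A convex kink is not a local maximum. -/
lemma not_isLocalMax_of_kink {f : ℝ → ℝ} {x m₁ m₂ : ℝ} (h₁ : HasDerivWithinAt f m₁ (Iic x) x)
    (h₂ : HasDerivWithinAt f m₂ (Ici x) x) (h : m₁ < m₂) : ¬ IsLocalMax f x := by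
  intro hm
  have a1 : 0 ≤ m₁ := by
    have h3 : Tendsto (slope f x) (nhdsWithin x (Iio x)) (nhds m₁) := by
      have := hasDerivWithinAt_iff_tendsto_slope.1 h₁
      rwa [Iic_sdiff_right] at this
    refine ge_of_tendsto h3 ?_
    filter_upwards [self_mem_nhdsWithin, nhdsWithin_le_nhds hm] with y hy hy2
    rw [slope_def_field]
    exact div_nonneg_of_nonpos (by linarith) (by linarith [show y < x from hy])
  have a2 : m₂ ≤ 0 := by
    have h3 : Tendsto (slope f x) (nhdsWithin x (Ioi x)) (nhds m₂) := by
      have := hasDerivWithinAt_iff_tendsto_slope.1 h₂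
      rwa [Ici_sdiff_left] at this
    refine le_of_tendsto h3 ?_
    filter_upwards [self_mem_nhdsWithin, nhdsWithin_le_nhds hm] with y hy hy2
    rw [slope_def_field]
    exact div_nonpos_of_nonpos_of_nonneg (by linarith) (by linarith [show x < y from hy])
  linarith

/-- Integrated form of `z_t = z_xx + f` on the box `[a,b] × [t₁,t₂]`. -/
structure Bal (z zx f : ℝ → ℝ → ℝ) (a b t₁ t₂ : ℝ) : Prop where
  der : ∀ x ∈ Icc a b, ∀ t ∈ Icc t₁ t₂, HasDerivAt (fun y => z y t) (zx x t) x
  cont : ContinuousOn (fun q : ℝ × ℝ => z q.1 q.2) (Icc a b ×ˢ Icc t₁ t₂)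
  contx : ContinuousOn (fun q : ℝ × ℝ => zx q.1 q.2) (Icc a b ×ˢ Icc t₁ t₂)
  int : IntegrableOn (fun q : ℝ × ℝ => f q.1 q.2) (Icc a b ×ˢ Icc t₁ t₂)
  bal : ∀ x₁ x₂ s₁ s₂, a ≤ x₁ → x₁ ≤ x₂ → x₂ ≤ b → t₁ ≤ s₁ → s₁ ≤ s₂ → s₂ ≤ t₂ →
    (∫ y in x₁..x₂, (z y s₂ - z y s₁)) =
      (∫ s in s₁..s₂, (zx x₂ s - zx x₁ s)) + ∫ q in Icc x₁ x₂ ×ˢ Icc s₁ s₂, f q.1 q.2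

lemma Bal.sub {z zx f z' zx' f' : ℝ → ℝ → ℝ} {a b t₁ t₂ : ℝ} (H : Bal z zx f a b t₁ t₂)
    (H' : Bal z' zx' f' a b t₁ t₂) :
    Bal (fun x t => z x t - z' x t) (fun x t => zx x t - zx' x t)
      (fun x t => f x t - f' x t) a b t₁ t₂ := by
  refine ⟨fun x hx t ht => (H.der x hx t ht).sub (H'.der x hx t ht), H.cont.sub H'.cont,
    H.contx.sub H'.contx, H.int.sub H'.int, ?_⟩
  intro x₁ x₂ s₁ s₂ h1 h2 h3 h4 h5 h6
  have m1 : s₁ ∈ Icc t₁ t₂ := ⟨h4, h5.trans h6⟩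
  have m2 : s₂ ∈ Icc t₁ t₂ := ⟨h4.trans h5, h6⟩
  have n1 : x₁ ∈ Icc a b := ⟨h1, h2.trans h3⟩
  have n2 : x₂ ∈ Icc a b := ⟨h1.trans h2, h3⟩
  have key : ∀ {z : ℝ → ℝ → ℝ}, ContinuousOn (fun q : ℝ × ℝ => z q.1 q.2)
      (Icc a b ×ˢ Icc t₁ t₂) →
      IntervalIntegrable (fun y => z y s₂ - z y s₁) volume x₁ x₂ ∧
      IntervalIntegrable (fun s => z x₂ s - z x₁ s) volume s₁ s₂ := fun {z} hz =>
    ⟨(((continuousOn_slice_left hz m2).sub (continuousOn_slice_left hz m1)).mono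
      (Icc_subset_Icc h1 h3)).intervalIntegrable_of_Icc h2,
     (((continuousOn_slice_right hz n2).sub (continuousOn_slice_right hz n1)).mono
      (Icc_subset_Icc h4 h6)).intervalIntegrable_of_Icc h5⟩
  have hsub : Icc x₁ x₂ ×ˢ Icc s₁ s₂ ⊆ Icc a b ×ˢ Icc t₁ t₂ :=
    prod_mono (Icc_subset_Icc h1 h3) (Icc_subset_Icc h4 h6)
  have b1 := H.bal x₁ x₂ s₁ s₂ h1 h2 h3 h4 h5 h6
  have b2 := H'.bal x₁ x₂ s₁ s₂ h1 h2 h3 h4 h5 h6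
  have e1 := intervalIntegral.integral_sub (key H.cont).1 (key H'.cont).1
  have e2 := intervalIntegral.integral_sub (key H.contx).2 (key H'.contx).2
  rw [integral_sub (H.int.mono_set hsub) (H'.int.mono_set hsub)]
  have e3 : (∫ y in x₁..x₂, ((z y s₂ - z' y s₂) - (z y s₁ - z' y s₁))) =
      ∫ y in x₁..x₂, ((z y s₂ - z y s₁) - (z' y s₂ - z' y s₁)) := by
    congr 1; funext y; ring
  have e4 : (∫ s in s₁..s₂, ((zx x₂ s - zx' x₂ s) - (zx x₁ s - zx' x₁ s))) =
      ∫ s in s₁..s₂, ((zx x₂ s - zx x₁ s) - (zx' x₂ s - zx' x₁ s)) := by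
    congr 1; funext y; ring
  rw [e3, e4, e1, e2, b1, b2]; ring

lemma Bal.const_mul {z zx f : ℝ → ℝ → ℝ} {a b t₁ t₂ : ℝ} (c : ℝ) (H : Bal z zx f a b t₁ t₂) :
    Bal (fun x t => c * z x t) (fun x t => c * zx x t) (fun x t => c * f x t) a b t₁ t₂ := by
  refine ⟨fun x hx t ht => (H.der x hx t ht).const_mul c, H.cont.const_smul c,
    H.contx.const_smul c, H.int.const_mul c, ?_⟩
  intro x₁ x₂ s₁ s₂ h1 h2 h3 h4 h5 h6
  have b1 := H.bal x₁ x₂ s₁ s₂ h1 h2 h3 h4 h5 h6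
  simp only [← mul_sub, intervalIntegral.integral_const_mul, integral_const_mul, b1, mul_add]

lemma Bal.neg {z zx f : ℝ → ℝ → ℝ} {a b t₁ t₂ : ℝ} (H : Bal z zx f a b t₁ t₂) :
    Bal (fun x t => -z x t) (fun x t => -zx x t) (fun x t => -f x t) a b t₁ t₂ := by
  simpa using H.const_mul (-1)

lemma Bal.add {z zx f z' zx' f' : ℝ → ℝ → ℝ} {a b t₁ t₂ : ℝ} (H : Bal z zx f a b t₁ t₂)
    (H' : Bal z' zx' f' a b t₁ t₂) :
    Bal (fun x t => z x t + z' x t) (fun x t => zx x t + zx' x t)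
      (fun x t => f x t + f' x t) a b t₁ t₂ := by
  simpa using H.sub H'.neg

lemma Bal.subBal {z zx f : ℝ → ℝ → ℝ} {a b t₁ t₂ : ℝ} (H : Bal z zx f a b t₁ t₂)
    (hf : ∀ᵐ q : ℝ × ℝ, q ∈ Icc a b ×ˢ Icc t₁ t₂ → f q.1 q.2 ≤ 0) :
    SubBal 0 z zx a b t₁ t₂ := by
  refine ⟨H.der, H.cont, H.contx, ?_⟩
  intro x₁ x₂ s₁ s₂ h1 h2 h3 h4 h5 h6
  rw [H.bal x₁ x₂ s₁ s₂ h1 h2 h3 h4 h5 h6]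
  have : ∫ q in Icc x₁ x₂ ×ˢ Icc s₁ s₂, f q.1 q.2 ≤ 0 := by
    refine setIntegral_nonpos_of_ae_restrict ?_
    rw [EventuallyLE, ae_restrict_iff' (measurableSet_Icc.prod measurableSet_Icc)]
    filter_upwards [hf] with q hq hq2
    exact hq ((prod_mono (Icc_subset_Icc h1 h3) (Icc_subset_Icc h4 h6)) hq2)
  linarith

lemma setIntegral_prod_Icc {f : ℝ × ℝ → ℝ} {a b t₁ t₂ : ℝ} (hab : a ≤ b) (ht : t₁ ≤ t₂)
    (hf : IntegrableOn f (Icc a b ×ˢ Icc t₁ t₂)) :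
    ∫ q in Icc a b ×ˢ Icc t₁ t₂, f q = ∫ x in a..b, ∫ s in t₁..t₂, f (x, s) := by
  rw [Measure.volume_eq_prod, setIntegral_prod _ (by rwa [Measure.volume_eq_prod] at hf)]
  simp_rw [intervalIntegral.integral_of_le hab, intervalIntegral.integral_of_le ht,
    integral_Icc_eq_integral_Ioc]

lemma setIntegral_prod_Icc_symm {f : ℝ × ℝ → ℝ} {a b t₁ t₂ : ℝ} (hab : a ≤ b) (ht : t₁ ≤ t₂)
    (hf : IntegrableOn f (Icc a b ×ˢ Icc t₁ t₂)) :
    ∫ q in Icc a b ×ˢ Icc t₁ t₂, f q = ∫ s in t₁..t₂, ∫ x in a..b, f (x, s) := by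
  have hf' : Integrable f ((volume.restrict (Icc a b)).prod (volume.restrict (Icc t₁ t₂))) := by
    rwa [Measure.prod_restrict, ← Measure.volume_eq_prod]
  rw [Measure.volume_eq_prod, ← Measure.prod_restrict, integral_prod_symm _ hf']
  simp_rw [intervalIntegral.integral_of_le hab, intervalIntegral.integral_of_le ht,
    integral_Icc_eq_integral_Ioc]

lemma Bal.of_deriv {z zx zt zxx : ℝ → ℝ → ℝ} {a b t₁ t₂ : ℝ}
    (der : ∀ x ∈ Icc a b, ∀ t ∈ Icc t₁ t₂, HasDerivAt (fun y => z y t) (zx x t) x)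
    (cont : ContinuousOn (fun q : ℝ × ℝ => z q.1 q.2) (Icc a b ×ˢ Icc t₁ t₂))
    (contx : ContinuousOn (fun q : ℝ × ℝ => zx q.1 q.2) (Icc a b ×ˢ Icc t₁ t₂))
    (dert : ∀ x ∈ Icc a b, ∀ t ∈ Icc t₁ t₂, HasDerivAt (fun s => z x s) (zt x t) t)
    (contt : ContinuousOn (fun q : ℝ × ℝ => zt q.1 q.2) (Icc a b ×ˢ Icc t₁ t₂))
    (intxx : IntegrableOn (fun q : ℝ × ℝ => zxx q.1 q.2) (Icc a b ×ˢ Icc t₁ t₂))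
    (hxx : ∀ t ∈ Icc t₁ t₂, ∀ x₁ x₂, a ≤ x₁ → x₁ ≤ x₂ → x₂ ≤ b →
      zx x₂ t - zx x₁ t = ∫ y in x₁..x₂, zxx y t) :
    Bal z zx (fun x t => zt x t - zxx x t) a b t₁ t₂ := by
  have it : IntegrableOn (fun q : ℝ × ℝ => zt q.1 q.2) (Icc a b ×ˢ Icc t₁ t₂) :=
    contt.integrableOn_compact (isCompact_Icc.prod isCompact_Icc)
  refine ⟨der, cont, contx, it.sub intxx, ?_⟩
  intro x₁ x₂ s₁ s₂ h1 h2 h3 h4 h5 h6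
  have hsub : Icc x₁ x₂ ×ˢ Icc s₁ s₂ ⊆ Icc a b ×ˢ Icc t₁ t₂ :=
    prod_mono (Icc_subset_Icc h1 h3) (Icc_subset_Icc h4 h6)
  rw [integral_sub (it.mono_set hsub) (intxx.mono_set hsub),
    setIntegral_prod_Icc h2 h5 (it.mono_set hsub),
    setIntegral_prod_Icc_symm h2 h5 (intxx.mono_set hsub)]
  have e1 : (∫ y in x₁..x₂, (z y s₂ - z y s₁)) = ∫ y in x₁..x₂, ∫ s in s₁..s₂, zt y s := by
    refine intervalIntegral.integral_congr fun y hy => ?_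
    rw [uIcc_of_le h2] at hy
    have hy' : y ∈ Icc a b := Icc_subset_Icc h1 h3 hy
    refine (intervalIntegral.integral_eq_sub_of_hasDerivAt (fun s hs => ?_) ?_).symm
    · rw [uIcc_of_le h5] at hs
      exact dert y hy' s (Icc_subset_Icc h4 h6 hs)
    · exact ((continuousOn_slice_right contt hy').mono
        (Icc_subset_Icc h4 h6)).intervalIntegrable_of_Icc h5
  have e2 : (∫ s in s₁..s₂, (zx x₂ s - zx x₁ s)) = ∫ s in s₁..s₂, ∫ y in x₁..x₂, zxx y s := by
    refine intervalIntegral.integral_congr fun s hs => ?_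
    rw [uIcc_of_le h5] at hs
    exact hxx s (Icc_subset_Icc h4 h6 hs) x₁ x₂ h1 h2 h3
  rw [e1, e2]; ring

lemma Bal.of_smooth {z zx zt zxx : ℝ → ℝ → ℝ} {a b t₁ t₂ : ℝ}
    (der : ∀ x ∈ Icc a b, ∀ t ∈ Icc t₁ t₂, HasDerivAt (fun y => z y t) (zx x t) x)
    (derx : ∀ x ∈ Icc a b, ∀ t ∈ Icc t₁ t₂, HasDerivAt (fun y => zx y t) (zxx x t) x)
    (dert : ∀ x ∈ Icc a b, ∀ t ∈ Icc t₁ t₂, HasDerivAt (fun s => z x s) (zt x t) t)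
    (cont : ContinuousOn (fun q : ℝ × ℝ => z q.1 q.2) (Icc a b ×ˢ Icc t₁ t₂))
    (contx : ContinuousOn (fun q : ℝ × ℝ => zx q.1 q.2) (Icc a b ×ˢ Icc t₁ t₂))
    (contt : ContinuousOn (fun q : ℝ × ℝ => zt q.1 q.2) (Icc a b ×ˢ Icc t₁ t₂))
    (contxx : ContinuousOn (fun q : ℝ × ℝ => zxx q.1 q.2) (Icc a b ×ˢ Icc t₁ t₂)) :
    Bal z zx (fun x t => zt x t - zxx x t) a b t₁ t₂ := by
  refine Bal.of_deriv der cont contx dert contt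
    (contxx.integrableOn_compact (isCompact_Icc.prod isCompact_Icc)) ?_
  intro t ht x₁ x₂ h1 h2 h3
  refine Eq.symm (intervalIntegral.integral_eq_sub_of_hasDerivAt (f := fun y => zx y t)
    (fun s hs => ?_) ?_)
  · rw [uIcc_of_le h2] at hs
    exact derx s (Icc_subset_Icc h1 h3 hs) t ht
  · exact ((continuousOn_slice_left contxx ht).mono
      (Icc_subset_Icc h1 h3)).intervalIntegrable_of_Icc h2

/-- Integration by parts against the primitive of an integrable function. -/
lemma integral_parts_primitive {q g g' : ℝ → ℝ} {a b : ℝ} (C : ℝ) (hab : a ≤ b)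
    (hq : IntervalIntegrable q volume a b)
    (hg : ∀ x ∈ Icc a b, HasDerivWithinAt g (g' x) (Icc a b) x)
    (hg' : ContinuousOn g' (Icc a b)) :
    ∫ x in a..b, (q x * g x + (C + ∫ y in a..x, q y) * g' x) =
      (C + ∫ y in a..b, q y) * g b - C * g a := by
  have h1 : AbsolutelyContinuousOnInterval (fun x => C + ∫ y in a..x, q y) a b := by
    have h0 : AbsolutelyContinuousOnInterval (fun _ : ℝ => C) a b :=
      ((LipschitzWith.const C).lipschitzOnWith (s := uIcc a b)).absolutelyContinuousOnInterval
    exact h0.add (hq.absolutelyContinuousOnInterval_intervalIntegral left_mem_uIcc)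
  have h2 : AbsolutelyContinuousOnInterval g a b := by
    obtain ⟨K, hK⟩ := isCompact_Icc.exists_bound_of_continuousOn hg'
    have : LipschitzOnWith K.toNNReal g (Icc a b) := by
      refine (convex_Icc a b).lipschitzOnWith_of_nnnorm_hasDerivWithin_le hg fun x hx => ?_
      rw [← NNReal.coe_le_coe, coe_nnnorm]
      exact (hK x hx).trans (Real.le_coe_toNNReal K)
    rw [← uIcc_of_le hab] at this
    exact this.absolutelyContinuousOnInterval
  have h3 := h1.integral_deriv_mul_eq_sub h2
  simp only [intervalIntegral.integral_same, add_zero] at h3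
  rw [← h3]
  refine intervalIntegral.integral_congr_ae ?_
  have hne : ∀ᵐ x : ℝ, x ≠ b := by simp [ae_iff, measure_singleton]
  filter_upwards [hq.ae_hasDerivAt_integral, hne] with x hx hxb hxI
  have hxI' := hxI
  rw [uIoc_of_le hab] at hxI'
  have e1 : deriv (fun x => C + ∫ y in a..x, q y) x = q x :=
    ((hx (uIoc_subset_uIcc hxI) a left_mem_uIcc).const_add C).deriv
  have e2 : deriv g x = g' x :=
    ((hg x (Ioc_subset_Icc_self hxI')).hasDerivAt
      (Icc_mem_nhds hxI'.1 (lt_of_le_of_ne hxI'.2 hxb))).deriv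
  rw [e1, e2]

/-- Weak solutions of `v_t = v_xx - F` with zero initial data, in the regularity class used here. -/
structure HeatSol (v w F : ℝ → ℝ → ℝ) : Prop where
  der : ∀ t ∈ Ici (0 : ℝ), ∀ x, HasDerivAt (fun y => v y t) (w x t) x
  cont : ContinuousOn (fun q : ℝ × ℝ => v q.1 q.2) (univ ×ˢ Ici 0)
  contw : ContinuousOn (fun q : ℝ × ℝ => w q.1 q.2) (univ ×ˢ Ici 0)
  meas : AEStronglyMeasurable (fun q : ℝ × ℝ => F q.1 q.2) (volume.restrict (univ ×ˢ Ici 0))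
  bdd : ∀ T > (0 : ℝ), ∃ C : ℝ, ∀ x, ∀ t ∈ Icc (0 : ℝ) T, |v x t| ≤ C ∧ |w x t| ≤ C ∧ |F x t| ≤ C
  weak : ∀ T > (0:ℝ), ∀ φ φt φx : ℝ → ℝ → ℝ, IsTestFun T φ φt φx →
    (∫ t in Ioc (0:ℝ) T, ∫ x : ℝ, φt x t * v x t) =
      ∫ t in Ioc (0:ℝ) T, ∫ x : ℝ, (φx x t * w x t + F x t * φ x t)

namespace HeatSol
variable {v w F : ℝ → ℝ → ℝ}

lemma integrableOn_box (H : HeatSol v w F) {T : ℝ} (hT : 0 < T) {a b : ℝ} :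
    IntegrableOn (fun q : ℝ × ℝ => F q.1 q.2) (Icc a b ×ˢ Icc 0 T) := by
  obtain ⟨C, hC⟩ := H.bdd T hT
  have hm : MeasurableSet (Icc a b ×ˢ Icc (0:ℝ) T) := measurableSet_Icc.prod measurableSet_Icc
  have hsub : Icc a b ×ˢ Icc (0:ℝ) T ⊆ univ ×ˢ Ici 0 :=
    Set.prod_mono (subset_univ _) Icc_subset_Ici_self
  have hms := H.meas.mono_measure (Measure.restrict_mono hsub le_rfl)
  refine (integrableOn_const (C := C)
    (isCompact_Icc.prod isCompact_Icc).measure_lt_top.ne).mono' hms ?_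
  rw [ae_restrict_iff' hm]
  exact Eventually.of_forall fun q hq => (hC q.1 q.2 hq.2).2.2

lemma integrable_prod_test (H : HeatSol v w F) {T : ℝ} (hT : 0 < T) {χ χ' : ℝ → ℝ}
    (hχ : Continuous χ) (hχ' : Continuous χ') {R : ℝ} (hR : ∀ x, R ≤ |x| → χ x = 0 ∧ χ' x = 0) :
    Integrable (fun q : ℝ × ℝ => χ' q.1 * w q.1 q.2 + F q.1 q.2 * χ q.1)
      (volume.prod (volume.restrict (Ioc 0 T))) := by
  obtain ⟨C, hC⟩ := H.bdd T hT
  have hb : Integrable (fun x => |χ x| + |χ' x|) := by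
    refine Continuous.integrable_of_hasCompactSupport (by fun_prop) ?_
    refine HasCompactSupport.intro (isCompact_Icc (a := -R) (b := R)) fun x hx => ?_
    have : R ≤ |x| := by
      by_contra h
      exact hx (abs_le.1 (not_le.1 h).le)
    simp [hR x this]
  have hb2 : Integrable (fun q : ℝ × ℝ => (|χ q.1| + |χ' q.1|) * C)
      (volume.prod (volume.restrict (Ioc 0 T))) :=
    hb.mul_prod (f := fun x => |χ x| + |χ' x|) (g := fun _ : ℝ => C) (integrable_const _)
  have hle : (volume.prod (volume.restrict (Ioc 0 T)) : Measure (ℝ × ℝ)) ≤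
      volume.restrict (univ ×ˢ Ici 0) := by
    have : (volume.prod (volume.restrict (Ioc 0 T)) : Measure (ℝ × ℝ)) =
        volume.restrict (univ ×ˢ Ioc 0 T) := by
      rw [Measure.volume_eq_prod, ← Measure.prod_restrict, Measure.restrict_univ]
    rw [this]
    exact Measure.restrict_mono (Set.prod_mono le_rfl
      (Ioc_subset_Icc_self.trans Icc_subset_Ici_self)) le_rfl
  have hw : AEStronglyMeasurable (fun q : ℝ × ℝ => w q.1 q.2)
      (volume.restrict (univ ×ˢ Ici 0)) :=
    H.contw.aestronglyMeasurable (MeasurableSet.univ.prod measurableSet_Ici)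
  refine hb2.mono' ?_ ?_
  · refine AEStronglyMeasurable.add (AEStronglyMeasurable.mul ?_ (hw.mono_measure hle))
      (AEStronglyMeasurable.mul (H.meas.mono_measure hle) ?_)
    · exact (by fun_prop : Continuous fun q : ℝ × ℝ => χ' q.1).aestronglyMeasurable
    · exact (by fun_prop : Continuous fun q : ℝ × ℝ => χ q.1).aestronglyMeasurable
  · have : (volume.prod (volume.restrict (Ioc 0 T)) : Measure (ℝ × ℝ)) =
        volume.restrict (univ ×ˢ Ioc 0 T) := by
      rw [Measure.volume_eq_prod, ← Measure.prod_restrict, Measure.restrict_univ]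
    rw [this, ae_restrict_iff' (MeasurableSet.univ.prod measurableSet_Ioc)]
    refine Eventually.of_forall fun q hq => ?_
    obtain ⟨-, h2, h3⟩ := hC q.1 q.2 (Ioc_subset_Icc_self hq.2)
    rw [Real.norm_eq_abs]
    calc _ ≤ |χ' q.1 * w q.1 q.2| + |F q.1 q.2 * χ q.1| := abs_add_le _ _
      _ = |χ' q.1| * |w q.1 q.2| + |F q.1 q.2| * |χ q.1| := by rw [abs_mul, abs_mul]
      _ ≤ |χ' q.1| * C + C * |χ q.1| := by gcongr
      _ = _ := by ring

lemma integral_eq_interval {f : ℝ → ℝ} {R : ℝ} (hR0 : 0 ≤ R) (hR : ∀ x, R ≤ |x| → f x = 0) :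
    ∫ x, f x = ∫ x in (-R)..R, f x := by
  rw [intervalIntegral.integral_of_le (by linarith)]
  refine (setIntegral_eq_integral_of_forall_compl_eq_zero fun x hx => hR x ?_).symm
  by_contra h
  have := abs_lt.1 (not_le.1 h)
  exact hx ⟨this.1, this.2.le⟩

/-- The time-integrated identity against a spatial test function. -/
lemma test_identity (H : HeatSol v w F) {χ χ' : ℝ → ℝ} (hχ : ∀ x, HasDerivAt χ (χ' x) x)
    (hχ' : Continuous χ') {R : ℝ} (hR0 : 0 ≤ R) (hR : ∀ x, R ≤ |x| → χ x = 0 ∧ χ' x = 0)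
    {t : ℝ} (ht : 0 ≤ t) :
    ∫ x, χ x * v x t = -∫ s in (0:ℝ)..t, ∫ x, (χ' x * w x s + F x s * χ x) := by
  have hχc : Continuous χ := continuous_iff_continuousAt.2 fun x => (hχ x).continuousAt
  set T := t + 1 with hTdef
  have hT : 0 < T := by linarith
  set J : ℝ → ℝ := fun s => ∫ x, (χ' x * w x s + F x s * χ x) with hJ
  have hJi : IntervalIntegrable J volume 0 T := by
    rw [intervalIntegrable_iff_integrableOn_Ioc_of_le hT.le]
    exact (H.integrable_prod_test hT hχc hχ' hR).integral_prod_right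
  set V : ℝ → ℝ := fun t => ∫ x in (-R)..R, χ x * v x (clamp 0 T t) with hV
  have hVc : Continuous V := by
    apply intervalIntegral.continuous_parametric_intervalIntegral_of_continuous'
    have h1 : Continuous (fun q : ℝ × ℝ => v q.2 (clamp 0 T q.1)) := by
      refine H.cont.comp_continuous (f := fun q : ℝ × ℝ => (q.2, clamp 0 T q.1)) ?_ ?_
      · have := continuous_clamp 0 T; fun_prop
      · intro q; exact ⟨trivial, (clamp_mem hT.le _).1⟩
    exact (hχc.comp continuous_snd).mul h1
  have hVe : ∀ s ∈ Icc 0 T, ∫ x, χ x * v x s = V s := by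
    intro s hs
    simp only [hV, clamp_eq hs]
    exact integral_eq_interval hR0 fun x hx => by rw [(hR x hx).1, zero_mul]
  set I : ℝ → ℝ := fun t => 0 + ∫ s in (0:ℝ)..t, J s with hI
  have hIc : ContinuousOn I (Icc 0 T) := by
    have := intervalIntegral.continuousOn_primitive_interval' hJi left_mem_uIcc
    rw [uIcc_of_le hT.le] at this
    exact continuousOn_const.add this
  set ϑ : ℝ → ℝ := fun s => V s + I (clamp 0 T s) with hϑ
  have hϑc : Continuous ϑ := hVc.add (hIc.comp_continuous (continuous_clamp 0 T)
    fun s => clamp_mem hT.le s)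
  set θ : ℝ → ℝ := fun s => ∫ r in T..s, ϑ r with hθ
  have hθd : ∀ s, HasDerivAt θ (ϑ s) s := fun s =>
    intervalIntegral.integral_hasDerivAt_right (hϑc.intervalIntegrable _ _)
      hϑc.stronglyMeasurable.stronglyMeasurableAtFilter hϑc.continuousAt
  have hθc : Continuous θ := continuous_iff_continuousAt.2 fun x => (hθd x).continuousAt
  have hw := H.weak T hT (fun x s => χ x * θ s) (fun x s => χ x * ϑ s) (fun x s => χ' x * θ s) ?_
  swap
  · refine ⟨fun x s _ => ((hθd s).const_mul (χ x)).hasDerivWithinAt,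
      fun x s _ => (hχ x).mul_const _, by fun_prop, by fun_prop, by fun_prop,
      ⟨R, fun x s _ hx => by simp [(hR x hx).1]⟩, fun x => ?_⟩
    simp [hθ]
  have hpart := integral_parts_primitive 0 hT.le hJi
    (fun x _ => (hθd x).hasDerivWithinAt) hϑc.continuousOn
  have hθT : θ T = 0 := by simp [hθ]
  rw [hθT, mul_zero, zero_mul, sub_zero] at hpart
  have e1 : (∫ s in Ioc (0:ℝ) T, ∫ x : ℝ, χ x * ϑ s * v x s) = ∫ s in (0:ℝ)..T, V s * ϑ s := by
    rw [intervalIntegral.integral_of_le hT.le]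
    refine setIntegral_congr_fun measurableSet_Ioc fun s hs => ?_
    rw [← hVe s (Ioc_subset_Icc_self hs), ← integral_mul_const]
    congr 1; funext x; ring
  have e2 : (∫ s in Ioc (0:ℝ) T, ∫ x : ℝ, (χ' x * θ s * w x s + F x s * (χ x * θ s))) =
      ∫ s in (0:ℝ)..T, J s * θ s := by
    rw [intervalIntegral.integral_of_le hT.le]
    refine setIntegral_congr_fun measurableSet_Ioc fun s hs => ?_
    simp only [hJ]
    rw [← integral_mul_const]
    congr 1; funext x; ring
  rw [e1, e2] at hw
  have hIint : IntervalIntegrable (fun s => I s * ϑ s) volume 0 T :=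
    (hIc.mul hϑc.continuousOn).intervalIntegrable_of_Icc hT.le
  have hJθ : IntervalIntegrable (fun s => J s * θ s) volume 0 T :=
    hJi.mul_continuousOn hθc.continuousOn
  rw [intervalIntegral.integral_add hJθ hIint, ← hw,
    ← intervalIntegral.integral_add ((by fun_prop : Continuous fun s => V s * ϑ s).intervalIntegrable _ _) hIint] at hpart
  have hsq : ∫ s in (0:ℝ)..T, ϑ s ^ 2 = 0 := by
    refine Eq.trans ?_ hpart
    refine intervalIntegral.integral_congr fun s hs => ?_
    rw [uIcc_of_le hT.le] at hs
    simp only [hϑ, clamp_eq hs]; ring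
  have htm : t ∈ Icc 0 T := ⟨ht, by linarith⟩
  have hz : ϑ t = 0 := by
    by_contra hne
    have := intervalIntegral.integral_pos hT (f := fun s => ϑ s ^ 2) (by fun_prop)
      (fun x _ => sq_nonneg _) ⟨t, htm, by positivity⟩
    linarith
  simp only [hϑ, clamp_eq htm, hI] at hz
  rw [hVe t htm]
  linarith

lemma bump_deriv_primitive {k : ℝ → ℝ} (hk : Continuous k) (a x : ℝ) :
    HasDerivAt (fun x => ∫ y in a..x, k y) (k x) x :=
  intervalIntegral.integral_hasDerivAt_right (hk.intervalIntegrable _ _)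
    hk.stronglyMeasurable.stronglyMeasurableAtFilter hk.continuousAt

/-- A continuous function annihilated by the derivatives of all `C¹` bumps is constant. -/
lemma eq_of_integral_deriv_eq_zero {G : ℝ → ℝ} (hG : Continuous G)
    (h : ∀ χ χ' : ℝ → ℝ, (∀ x, HasDerivAt χ (χ' x) x) → Continuous χ' → ∀ a b, a < b →
      (∀ x, x ∉ Ioo a b → χ x = 0 ∧ χ' x = 0) → ∫ x in a..b, χ' x * G x = 0) (x₁ x₂ : ℝ) :
    G x₁ = G x₂ := by
  set a := min x₁ x₂ - 1
  set b := max x₁ x₂ + 1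
  have ha1 : a < x₁ := by have := min_le_left x₁ x₂; simp only [a]; linarith
  have ha2 : a < x₂ := by have := min_le_right x₁ x₂; simp only [a]; linarith
  have hb1 : x₁ < b := by have := le_max_left x₁ x₂; simp only [b]; linarith
  have hb2 : x₂ < b := by have := le_max_right x₁ x₂; simp only [b]; linarith
  have hab : a < b := by linarith
  set k : ℝ → ℝ := fun x => max 0 ((x - a) * (b - x)) with hk
  have hkc : Continuous k := by fun_prop
  have hkp : ∀ x ∈ Ioo a b, 0 < k x := fun x hx =>
    lt_max_of_lt_right (mul_pos (by linarith [hx.1]) (by linarith [hx.2]))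
  have hk0 : ∀ x, x ∉ Ioo a b → k x = 0 := by
    intro x hx
    refine max_eq_left ?_
    by_cases h1 : a < x
    · have : b ≤ x := by by_contra h2; exact hx ⟨h1, not_le.1 h2⟩
      exact mul_nonpos_of_nonneg_of_nonpos (by linarith) (by linarith)
    · exact mul_nonpos_of_nonpos_of_nonneg (by linarith) (by linarith)
  have hK : 0 < ∫ x in a..b, k x :=
    intervalIntegral.integral_pos hab hkc.continuousOn (fun x _ => le_max_left _ _)
      ⟨x₁, ⟨ha1.le, hb1.le⟩, hkp _ ⟨ha1, hb1⟩⟩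
  set m := (∫ x in a..b, k x * G x) / ∫ x in a..b, k x with hm
  set χ' : ℝ → ℝ := fun x => k x * (G x - m) with hχ'
  have hχ'c : Continuous χ' := by fun_prop
  have hχ'0 : ∫ x in a..b, χ' x = 0 := by
    have : ∫ x in a..b, χ' x = (∫ x in a..b, k x * G x) - (∫ x in a..b, k x) * m := by
      rw [← intervalIntegral.integral_mul_const, ← intervalIntegral.integral_sub
        ((by fun_prop : Continuous fun x => k x * G x).intervalIntegrable _ _)
        ((by fun_prop : Continuous fun x => k x * m).intervalIntegrable _ _)]
      congr 1; funext x; simp only [hχ']; ring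
    rw [this, hm]; field_simp; ring
  have h1 := h (fun x => ∫ y in a..x, χ' y) χ' (bump_deriv_primitive hχ'c a) hχ'c a b hab ?_
  swap
  · intro x hx
    have h0 : ∀ y, y ∉ Ioo a b → χ' y = 0 := fun y hy => by simp [hχ', hk0 y hy]
    refine ⟨?_, h0 x hx⟩
    by_cases hxa : a < x
    · have hxb : b ≤ x := by by_contra h2; exact hx ⟨hxa, not_le.1 h2⟩
      rw [← intervalIntegral.integral_add_adjacent_intervals (hχ'c.intervalIntegrable a b)
        (hχ'c.intervalIntegrable b x), hχ'0, zero_add]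
      refine (intervalIntegral.integral_congr fun y hy => ?_).trans
        intervalIntegral.integral_zero
      rw [uIcc_of_le hxb] at hy
      exact h0 y fun hy2 => absurd hy.1 (not_le.2 hy2.2)
    · refine (intervalIntegral.integral_congr fun y hy => ?_).trans
        intervalIntegral.integral_zero
      rw [uIcc_of_ge (not_lt.1 hxa)] at hy
      exact h0 y fun hy2 => absurd hy.2 (not_le.2 hy2.1)
  have h2 : ∫ x in a..b, k x * (G x - m) ^ 2 = 0 := by
    have : ∫ x in a..b, k x * (G x - m) ^ 2 =
        (∫ x in a..b, χ' x * G x) - (∫ x in a..b, χ' x) * m := by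
      rw [← intervalIntegral.integral_mul_const, ← intervalIntegral.integral_sub
        ((by fun_prop : Continuous fun x => χ' x * G x).intervalIntegrable _ _)
        ((by fun_prop : Continuous fun x => χ' x * m).intervalIntegrable _ _)]
      congr 1; funext x; simp only [hχ']; ring
    rw [this, h1, hχ'0]; ring
  have h3 : ∀ x ∈ Ioo a b, G x = m := by
    intro x hx
    by_contra hne
    have : 0 < (G x - m) ^ 2 := by have : G x - m ≠ 0 := sub_ne_zero.2 hne
                                   positivity
    have := intervalIntegral.integral_pos hab (f := fun x => k x * (G x - m) ^ 2) (by fun_prop)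
      (fun x _ => mul_nonneg (le_max_left _ _) (sq_nonneg _))
      ⟨x, Ioo_subset_Icc_self hx, mul_pos (hkp x hx) this⟩
    linarith
  rw [h3 x₁ ⟨ha1, hb1⟩, h3 x₂ ⟨ha2, hb2⟩]

lemma integrable_prod_Ioc (H : HeatSol v w F) {T : ℝ} (hT : 0 ≤ T) {a b : ℝ} :
    Integrable (fun q : ℝ × ℝ => F q.1 q.2)
      ((volume.restrict (Ioc a b)).prod (volume.restrict (Ioc 0 T))) := by
  have h := H.integrableOn_box (by linarith : 0 < T + 1) (a := a) (b := b)
  rw [Measure.prod_restrict, ← Measure.volume_eq_prod]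
  exact h.mono_set (Set.prod_mono Ioc_subset_Icc_self
    (Ioc_subset_Icc_self.trans (Icc_subset_Icc_right (by linarith))))

lemma flux_zero (H : HeatSol v w F) {t : ℝ} (ht : 0 ≤ t) {x₁ x₂ : ℝ} (hx : x₁ ≤ x₂) :
    ∫ y in x₁..x₂, v y t = (∫ s in (0:ℝ)..t, (w x₂ s - w x₁ s)) -
      ∫ s in (0:ℝ)..t, ∫ y in x₁..x₂, F y s := by
  set N : ℝ → ℝ := fun y => ∫ s in (0:ℝ)..t, F y s with hN
  have hNi : ∀ a b, IntervalIntegrable N volume a b := by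
    have : ∀ a b, IntegrableOn N (Ioc a b) := by
      intro a b
      have := (H.integrable_prod_Ioc ht (a := a) (b := b)).integral_prod_left
      simp only [hN, intervalIntegral.integral_of_le ht]
      exact this
    exact fun a b => ⟨this a b, this b a⟩
  have hvc : Continuous fun y => v y t :=
    H.cont.comp_continuous (f := fun y => (y, t)) (by fun_prop) fun y => ⟨trivial, ht⟩
  have hwc : ∀ x, ContinuousOn (fun s => w x s) (Icc 0 t) := fun x =>
    (continuousOn_slice_right H.contw (mem_univ x)).mono Icc_subset_Ici_self
  have hwi : ∀ x, IntervalIntegrable (fun s => w x s) volume 0 t := fun x =>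
    (hwc x).intervalIntegrable_of_Icc ht
  set A : ℝ → ℝ := fun x => ∫ s in (0:ℝ)..t, w x s with hA
  have hwcl : Continuous (fun q : ℝ × ℝ => w q.1 (clamp 0 t q.2)) := by
    refine H.contw.comp_continuous (f := fun q : ℝ × ℝ => (q.1, clamp 0 t q.2)) ?_ ?_
    · have := continuous_clamp 0 t; fun_prop
    · intro q; exact ⟨trivial, (clamp_mem ht _).1⟩
  have hA' : A = fun x => ∫ s in (0:ℝ)..t, w x (clamp 0 t s) := by
    funext x
    refine intervalIntegral.integral_congr fun s hs => ?_
    rw [uIcc_of_le ht] at hs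
    simp only [clamp_eq hs]
  have hAc : Continuous A := by
    rw [hA']
    exact intervalIntegral.continuous_parametric_intervalIntegral_of_continuous' hwcl 0 t
  set q : ℝ → ℝ := fun y => v y t + N y with hq
  have hqi : ∀ a b, IntervalIntegrable q volume a b := fun a b =>
    (hvc.intervalIntegrable a b).add (hNi a b)
  have hQc : Continuous fun x => ∫ y in (0:ℝ)..x, q y :=
    intervalIntegral.continuous_primitive hqi 0
  have key := eq_of_integral_deriv_eq_zero (G := fun x => (∫ y in (0:ℝ)..x, q y) - A x)
    (hQc.sub hAc) ?_ x₁ x₂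
  · have e1 : (∫ y in (0:ℝ)..x₂, q y) - (∫ y in (0:ℝ)..x₁, q y) = ∫ y in x₁..x₂, q y :=
      intervalIntegral.integral_interval_sub_left (hqi _ _) (hqi _ _)
    have e2 : ∫ y in x₁..x₂, q y = (∫ y in x₁..x₂, v y t) + ∫ y in x₁..x₂, N y :=
      intervalIntegral.integral_add (hvc.intervalIntegrable _ _) (hNi _ _)
    have e3 : ∫ y in x₁..x₂, N y = ∫ s in (0:ℝ)..t, ∫ y in x₁..x₂, F y s := by
      simp only [hN, intervalIntegral.integral_of_le ht, intervalIntegral.integral_of_le hx]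
      exact integral_integral_swap (H.integrable_prod_Ioc ht)
    rw [intervalIntegral.integral_sub (hwi _) (hwi _), ← e3]
    change _ = A x₂ - A x₁ - _
    linarith
  · intro χ χ' hχ hχ'c a b hab hsupp
    have hχc : Continuous χ := continuous_iff_continuousAt.2 fun x => (hχ x).continuousAt
    set R := max |a| |b|
    have hR : ∀ x, R ≤ |x| → χ x = 0 ∧ χ' x = 0 := by
      intro x hx
      refine hsupp x fun hxm => ?_
      have h1 := le_max_left |a| |b|
      have h2 := le_max_right |a| |b|
      rcases abs_cases x with ⟨h3, _⟩ | ⟨h3, _⟩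
      · have := le_abs_self b; linarith [hxm.2]
      · have := neg_abs_le a; linarith [hxm.1]
    have hR0 : 0 ≤ R := (abs_nonneg a).trans (le_max_left _ _)
    have hid := H.test_identity hχ hχ'c hR0 hR ht
    have hab' := hab.le
    have loc : ∀ f : ℝ → ℝ, (∀ x, x ∉ Ioo a b → f x = 0) → ∫ x, f x = ∫ x in a..b, f x := by
      intro f hf
      rw [intervalIntegral.integral_of_le hab']
      exact (setIntegral_eq_integral_of_forall_compl_eq_zero
        fun x hx => hf x fun hx2 => hx (Ioo_subset_Ioc_self hx2)).symm
    rw [loc _ fun x hx => by rw [(hsupp x hx).1, zero_mul]] at hid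
    have e1 : ∫ s in (0:ℝ)..t, ∫ x, (χ' x * w x s + F x s * χ x) =
        ∫ x in a..b, (χ' x * A x + N x * χ x) := by
      have hI : Integrable (fun q : ℝ × ℝ => χ' q.1 * w q.1 q.2 + F q.1 q.2 * χ q.1)
          ((volume.restrict (Ioc a b)).prod (volume.restrict (Ioc 0 t))) := by
        refine (H.integrable_prod_test (by linarith : 0 < t + 1) hχc hχ'c hR).mono_measure ?_
        exact Measure.prod_mono Measure.restrict_le_self
          (Measure.restrict_mono (Ioc_subset_Ioc_right (by linarith)) le_rfl)
      have hs : ∀ᵐ x ∂(volume.restrict (Ioc a b)), IntegrableOn (fun s => F x s) (Ioc 0 t) :=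
        (H.integrable_prod_Ioc ht).prod_right_ae
      have step : ∀ s, ∫ x, (χ' x * w x s + F x s * χ x) =
          ∫ x in Ioc a b, (χ' x * w x s + F x s * χ x) := by
        intro s
        rw [loc _ fun x hx => by rw [(hsupp x hx).1, (hsupp x hx).2]; ring,
          intervalIntegral.integral_of_le hab']
      simp only [step]
      rw [intervalIntegral.integral_of_le ht, intervalIntegral.integral_of_le hab']
      rw [← integral_integral_swap (f := fun x s => χ' x * w x s + F x s * χ x) hI]
      refine integral_congr_ae ?_
      filter_upwards [hs] with x hx
      have h1 : IntegrableOn (fun s => w x s) (Ioc 0 t) :=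
        (intervalIntegrable_iff_integrableOn_Ioc_of_le ht).1 (hwi x)
      rw [integral_add (h1.const_mul _) (hx.mul_const _), integral_const_mul, integral_mul_const]
      simp only [hA, hN, intervalIntegral.integral_of_le ht]
    have hχ0 : χ a = 0 ∧ χ b = 0 := ⟨(hsupp a (by simp)).1, (hsupp b (by simp)).1⟩
    have hp := integral_parts_primitive (∫ y in (0:ℝ)..a, q y) hab' (hqi a b)
      (fun x _ => (hχ x).hasDerivWithinAt) hχ'c.continuousOn
    rw [hχ0.1, hχ0.2, mul_zero, mul_zero, sub_zero] at hp
    have e2 : ∀ x, (∫ y in (0:ℝ)..a, q y) + ∫ y in a..x, q y = ∫ y in (0:ℝ)..x, q y := fun x =>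
      intervalIntegral.integral_add_adjacent_intervals (hqi _ _) (hqi _ _)
    simp only [e2] at hp
    have i1 : IntervalIntegrable (fun x => χ x * v x t) volume a b :=
      (hχc.mul hvc).intervalIntegrable _ _
    have i2 : IntervalIntegrable (fun x => N x * χ x) volume a b :=
      (hNi a b).mul_continuousOn hχc.continuousOn
    have i3 : IntervalIntegrable (fun x => χ' x * A x) volume a b :=
      (hχ'c.mul hAc).intervalIntegrable _ _
    have i4 : IntervalIntegrable (fun x => χ' x * ∫ y in (0:ℝ)..x, q y) volume a b :=
      (hχ'c.mul hQc).intervalIntegrable _ _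
    rw [e1, intervalIntegral.integral_add i3 i2] at hid
    have e3 : ∫ x in a..b, (q x * χ x + (∫ y in (0:ℝ)..x, q y) * χ' x) =
        ((∫ x in a..b, χ x * v x t) + ∫ x in a..b, N x * χ x) +
          ∫ x in a..b, χ' x * ∫ y in (0:ℝ)..x, q y := by
      rw [← intervalIntegral.integral_add i1 i2, ← intervalIntegral.integral_add (i1.add i2) i4]
      congr 1; funext x; simp only [hq]; ring
    have e4 : ∫ x in a..b, χ' x * ((∫ y in (0:ℝ)..x, q y) - A x) =
        (∫ x in a..b, χ' x * ∫ y in (0:ℝ)..x, q y) - ∫ x in a..b, χ' x * A x := by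
      rw [← intervalIntegral.integral_sub i4 i3]
      congr 1; funext x; ring
    rw [e4]; linarith

lemma init (H : HeatSol v w F) (x : ℝ) : v x 0 = 0 := by
  have hvc : Continuous fun y => v y 0 :=
    H.cont.comp_continuous (f := fun y => (y, (0:ℝ))) (by fun_prop) fun y => ⟨trivial, (le_rfl : (0:ℝ) ≤ 0)⟩
  have h1 : ∀ y ≥ x, ∫ z in x..y, v z 0 = 0 := by
    intro y hy
    have := H.flux_zero le_rfl hy
    simpa using this
  have h2 := (bump_deriv_primitive hvc x x).hasDerivWithinAt (s := Ici x)
  have h3 : HasDerivWithinAt (fun y => ∫ z in x..y, v z 0) 0 (Ici x) x :=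
    (hasDerivWithinAt_const x (Ici x) (0:ℝ)).congr (fun y hy => h1 y hy) (h1 x le_rfl)
  exact (uniqueDiffWithinAt_Ici x).eq_deriv _ h2 h3

lemma bal (H : HeatSol v w F) {a b t₁ t₂ : ℝ} (ht : 0 ≤ t₁) (ht2 : 0 < t₂) :
    Bal v w (fun x t => -F x t) a b t₁ t₂ := by
  have hsub : Icc a b ×ˢ Icc t₁ t₂ ⊆ univ ×ˢ Ici 0 :=
    Set.prod_mono (subset_univ _) fun t h => ht.trans h.1
  have hint : IntegrableOn (fun q : ℝ × ℝ => F q.1 q.2) (Icc a b ×ˢ Icc t₁ t₂) :=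
    (H.integrableOn_box ht2).mono_set (Set.prod_mono le_rfl (Icc_subset_Icc_left ht))
  refine ⟨fun x _ t h => H.der t (ht.trans h.1) x, H.cont.mono hsub, H.contw.mono hsub,
    hint.neg, ?_⟩
  intro x₁ x₂ s₁ s₂ h1 h2 h3 h4 h5 h6
  have hs1 : 0 ≤ s₁ := ht.trans h4
  have hs2 : 0 ≤ s₂ := hs1.trans h5
  have hvc : ∀ s, 0 ≤ s → Continuous fun y => v y s := fun s hs =>
    H.cont.comp_continuous (f := fun y => (y, s)) (by fun_prop) fun y => ⟨trivial, hs⟩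
  have hwi : ∀ x s, 0 ≤ s → IntervalIntegrable (fun s => w x s) volume 0 s := fun x s hs =>
    ((continuousOn_slice_right H.contw (mem_univ x)).mono
      Icc_subset_Ici_self).intervalIntegrable_of_Icc hs
  have hFi : ∀ s, 0 ≤ s → IntervalIntegrable (fun s => ∫ y in x₁..x₂, F y s) volume 0 s := by
    intro s hs
    rw [intervalIntegrable_iff_integrableOn_Ioc_of_le hs]
    simp only [intervalIntegral.integral_of_le h2]
    exact (H.integrable_prod_Ioc hs).integral_prod_right
  rw [integral_neg, setIntegral_prod_Icc_symm h2 h5 (hint.mono_set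
    (Set.prod_mono (Icc_subset_Icc h1 h3) (Icc_subset_Icc h4 h6)))]
  rw [intervalIntegral.integral_sub ((hvc _ hs2).intervalIntegrable _ _)
    ((hvc _ hs1).intervalIntegrable _ _), H.flux_zero hs2 h2, H.flux_zero hs1 h2]
  rw [← intervalIntegral.integral_interval_sub_left (hFi s₂ hs2) (hFi s₁ hs1),
    ← intervalIntegral.integral_interval_sub_left ((hwi x₂ s₂ hs2).sub (hwi x₁ s₂ hs2))
      ((hwi x₂ s₁ hs1).sub (hwi x₁ s₁ hs1))]
  ring

end HeatSol

lemma SubBal.mono {c : ℝ} {z zx : ℝ → ℝ → ℝ} {a b t₁ t₂ a' b' t₁' t₂' : ℝ}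
    (H : SubBal c z zx a b t₁ t₂) (ha : a ≤ a') (hb : b' ≤ b) (h1 : t₁ ≤ t₁') (h2 : t₂' ≤ t₂) :
    SubBal c z zx a' b' t₁' t₂' := by
  have sx : Icc a' b' ⊆ Icc a b := Icc_subset_Icc ha hb
  have st : Icc t₁' t₂' ⊆ Icc t₁ t₂ := Icc_subset_Icc h1 h2
  refine ⟨fun x hx t ht => H.der x (sx hx) t (st ht), H.cont.mono (Set.prod_mono sx st),
    H.contx.mono (Set.prod_mono sx st), ?_⟩
  intro x₁ x₂ s₁ s₂ k1 k2 k3 k4 k5 k6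
  exact H.bal x₁ x₂ s₁ s₂ (ha.trans k1) k2 (k3.trans hb) (h1.trans k4) k5 (k6.trans h2)

lemma pbox_subset_of_mem_nhds {U : Set (ℝ × ℝ)} {x t : ℝ} (hU : U ∈ nhds (x, t)) :
    ∃ r > 0, pbox x t r ⊆ U := by
  obtain ⟨ε, hε, h⟩ := Metric.mem_nhds_iff.1 hU
  refine ⟨ε / 2, by positivity, fun q hq => h ?_⟩
  rw [Metric.mem_ball, Prod.dist_eq, max_lt_iff, Real.dist_eq, Real.dist_eq, abs_lt, abs_lt]
  obtain ⟨⟨h1, h2⟩, h3, h4⟩ := hq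
  refine ⟨⟨?_, ?_⟩, ?_, ?_⟩ <;> dsimp only <;> linarith

/-- `z_t = z_xx + f` in integrated form, on every box contained in `U`. -/
def HasBal (z f : ℝ → ℝ → ℝ) (U : Set (ℝ × ℝ)) : Prop :=
  ∃ zx, ∀ a b t₁ t₂, a < b → t₁ < t₂ → Icc a b ×ˢ Icc t₁ t₂ ⊆ U → Bal z zx f a b t₁ t₂

namespace HasBal
variable {z f z' f' : ℝ → ℝ → ℝ} {U V : Set (ℝ × ℝ)}

lemma mono (h : HasBal z f U) (hV : V ⊆ U) : HasBal z f V :=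
  let ⟨zx, H⟩ := h
  ⟨zx, fun a b t₁ t₂ h1 h2 h3 => H a b t₁ t₂ h1 h2 (h3.trans hV)⟩

lemma sub (h : HasBal z f U) (h' : HasBal z' f' U) :
    HasBal (fun x t => z x t - z' x t) (fun x t => f x t - f' x t) U :=
  let ⟨_, H⟩ := h
  let ⟨_, H'⟩ := h'
  ⟨_, fun a b t₁ t₂ h1 h2 h3 => (H a b t₁ t₂ h1 h2 h3).sub (H' a b t₁ t₂ h1 h2 h3)⟩

lemma add (h : HasBal z f U) (h' : HasBal z' f' U) :
    HasBal (fun x t => z x t + z' x t) (fun x t => f x t + f' x t) U :=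
  let ⟨_, H⟩ := h
  let ⟨_, H'⟩ := h'
  ⟨_, fun a b t₁ t₂ h1 h2 h3 => (H a b t₁ t₂ h1 h2 h3).add (H' a b t₁ t₂ h1 h2 h3)⟩

lemma const_mul (c : ℝ) (h : HasBal z f U) :
    HasBal (fun x t => c * z x t) (fun x t => c * f x t) U :=
  let ⟨_, H⟩ := h
  ⟨_, fun a b t₁ t₂ h1 h2 h3 => (H a b t₁ t₂ h1 h2 h3).const_mul c⟩

lemma congr (h : HasBal z f U) (hU : IsOpen U) (hz : ∀ x t, (x, t) ∈ U → z' x t = z x t)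
    (hf : ∀ x t, (x, t) ∈ U → f' x t = f x t) : HasBal z' f' U := by
  obtain ⟨zx, H⟩ := h
  refine ⟨zx, fun a b t₁ t₂ h1 h2 h3 => ?_⟩
  have B := H a b t₁ t₂ h1 h2 h3
  have hm : MeasurableSet (Icc a b ×ˢ Icc t₁ t₂) := measurableSet_Icc.prod measurableSet_Icc
  refine ⟨fun x hx t ht => ?_, B.cont.congr fun q hq => hz _ _ (h3 hq), B.contx,
    B.int.congr_fun (fun q hq => (hf _ _ (h3 hq)).symm) hm, ?_⟩
  · refine (B.der x hx t ht).congr_of_eventuallyEq ?_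
    have : ∀ᶠ y in nhds x, (y, t) ∈ U :=
      (by fun_prop : Continuous fun y : ℝ => (y, t)).continuousAt.eventually
        (hU.mem_nhds (h3 ⟨hx, ht⟩))
    filter_upwards [this] with y hy using hz y t hy
  · intro x₁ x₂ s₁ s₂ k1 k2 k3 k4 k5 k6
    have sub : Icc x₁ x₂ ×ˢ Icc s₁ s₂ ⊆ Icc a b ×ˢ Icc t₁ t₂ :=
      Set.prod_mono (Icc_subset_Icc k1 k3) (Icc_subset_Icc k4 k6)
    have e1 : ∫ q in Icc x₁ x₂ ×ˢ Icc s₁ s₂, f' q.1 q.2 =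
        ∫ q in Icc x₁ x₂ ×ˢ Icc s₁ s₂, f q.1 q.2 :=
      setIntegral_congr_fun (measurableSet_Icc.prod measurableSet_Icc)
        fun q hq => hf _ _ (h3 (sub hq))
    rw [e1, ← B.bal x₁ x₂ s₁ s₂ k1 k2 k3 k4 k5 k6]
    refine intervalIntegral.integral_congr fun y hy => ?_
    rw [uIcc_of_le k2] at hy
    simp only [hz y s₂ (h3 (sub ⟨hy, k5, le_rfl⟩)), hz y s₁ (h3 (sub ⟨hy, le_rfl, k5⟩))]

lemma continuousAt (h : HasBal z f U) {q : ℝ × ℝ} (hU : U ∈ nhds q) :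
    ContinuousAt (fun q : ℝ × ℝ => z q.1 q.2) q := by
  obtain ⟨zx, H⟩ := h
  obtain ⟨ε, hε, h⟩ := Metric.mem_nhds_iff.1 hU
  have hsub : Icc (q.1 - ε / 2) (q.1 + ε / 2) ×ˢ Icc (q.2 - ε / 2) (q.2 + ε / 2) ⊆ U := by
    intro q' hq
    refine h ?_
    rw [Metric.mem_ball, Prod.dist_eq, max_lt_iff, Real.dist_eq, Real.dist_eq, abs_lt, abs_lt]
    obtain ⟨⟨h1, h2⟩, h3, h4⟩ := hq
    refine ⟨⟨?_, ?_⟩, ?_, ?_⟩ <;> linarith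
  have B := H _ _ _ _ (by linarith) (by linarith) hsub
  refine B.cont.continuousAt ?_
  rw [show q = (q.1, q.2) from rfl]
  exact prod_mem_nhds (Icc_mem_nhds (by linarith) (by linarith))
    (Icc_mem_nhds (by linarith) (by linarith))

end HasBal

/-- `z_t = z_xx + f` near `(x,t)`, with `f ≤ 0` a.e. on `{z > 0}` up to time `t`. -/
def LocSub (z : ℝ → ℝ → ℝ) (x t : ℝ) : Prop :=
  ∃ U ∈ nhds (x, t), ∃ f : ℝ → ℝ → ℝ, HasBal z f U ∧
    ∀ᵐ q : ℝ × ℝ, q ∈ U → q.2 ≤ t → 0 < z q.1 q.2 → f q.1 q.2 ≤ 0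

lemma LocSub.exists_subBal {z : ℝ → ℝ → ℝ} {x t : ℝ} (h : LocSub z x t) (hpos : 0 < z x t) :
    ∃ r > 0, ∃ zx, SubBal 0 z zx (x - r) (x + r) (t - r) t := by
  obtain ⟨U, hU, f, hB, hf⟩ := h
  have hz := hB.continuousAt hU
  obtain ⟨zx, hB⟩ := hB
  obtain ⟨r, hr, hsub⟩ := pbox_subset_of_mem_nhds
    (inter_mem hU (hz.eventually (lt_mem_nhds hpos)))
  refine ⟨r, hr, zx, (hB _ _ _ _ (by linarith) (by linarith)
    fun q hq => (hsub hq).1).subBal ?_⟩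
  filter_upwards [hf] with q hq hqm
  exact hq (hsub hqm).1 hqm.2.2 (hsub hqm).2

/-- Maximum principle on a compact set, local form. -/
theorem max_principle_compact {K : Set (ℝ × ℝ)} (hK : IsCompact K) {z : ℝ → ℝ → ℝ}
    (hz : ContinuousOn (fun q : ℝ × ℝ => z q.1 q.2) K)
    (h : ∀ x t, (x, t) ∈ K → 0 < z x t →
      ((∀ᶠ r in nhdsWithin 0 (Ioi 0), pbox x t r ⊆ K) ∧ LocSub z x t) ∨
      ((∀ᶠ y in nhds x, (y, t) ∈ K) ∧ ¬ IsLocalMax (fun y => z y t) x)) :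
    ∀ x t, (x, t) ∈ K → z x t ≤ 0 := by
  refine max_principle hK hz ?_
  intro x t hxt hpos
  rcases h x t hxt hpos with ⟨h1, h2⟩ | h2
  · left
    obtain ⟨r, hr, zx, H⟩ := h2.exists_subBal hpos
    obtain ⟨r', hr', hr'2⟩ := (h1.and (Ioc_mem_nhdsGT hr)).exists
    exact ⟨r', hr'2.1, hr', zx, H.mono (by linarith [hr'2.2]) (by linarith [hr'2.2])
      (by linarith [hr'2.2]) le_rfl⟩
  · exact .inr h2

lemma eventually_pbox_subset_rect {a b t₁ t₂ x t : ℝ} (hx : x ∈ Ioo a b) (ht : t ∈ Ioc t₁ t₂) :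
    ∀ᶠ r in nhdsWithin 0 (Ioi (0:ℝ)), pbox x t r ⊆ Icc a b ×ˢ Icc t₁ t₂ := by
  have hpos : 0 < min (min (x - a) (b - x)) (t - t₁) :=
    lt_min (lt_min (by linarith [hx.1]) (by linarith [hx.2])) (by linarith [ht.1])
  filter_upwards [Ioo_mem_nhdsGT hpos] with r hr
  have h0 := hr.2
  rw [lt_min_iff, lt_min_iff] at h0
  refine Set.prod_mono (Icc_subset_Icc ?_ ?_) (Icc_subset_Icc ?_ ht.2) <;>
    linarith [h0.1.1, h0.1.2, h0.2]

/-- Maximum principle on a rectangle. -/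
theorem max_principle_rect {a b t₁ t₂ : ℝ} {z : ℝ → ℝ → ℝ}
    (hz : ContinuousOn (fun q : ℝ × ℝ => z q.1 q.2) (Icc a b ×ˢ Icc t₁ t₂))
    (hinit : ∀ x ∈ Icc a b, z x t₁ ≤ 0) (hl : ∀ t ∈ Icc t₁ t₂, z a t ≤ 0)
    (hr : ∀ t ∈ Icc t₁ t₂, z b t ≤ 0)
    (h : ∀ x ∈ Ioo a b, ∀ t ∈ Ioc t₁ t₂, 0 < z x t →
      LocSub z x t ∨ ¬ IsLocalMax (fun y => z y t) x) :
    ∀ x ∈ Icc a b, ∀ t ∈ Icc t₁ t₂, z x t ≤ 0 := by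
  intro x hx t ht
  refine max_principle_compact (K := Icc a b ×ˢ Icc t₁ t₂) (isCompact_Icc.prod isCompact_Icc)
    hz ?_ x t ⟨hx, ht⟩
  rintro x t ⟨hx, ht⟩ hpos
  simp only at hx ht
  have hxa : a ≠ x := by rintro rfl; exact absurd (hl t ht) (not_le.2 hpos)
  have hxb : x ≠ b := by rintro rfl; exact absurd (hr t ht) (not_le.2 hpos)
  have htt : t₁ ≠ t := by rintro rfl; exact absurd (hinit x hx) (not_le.2 hpos)
  have hx' : x ∈ Ioo a b := ⟨lt_of_le_of_ne hx.1 hxa, lt_of_le_of_ne hx.2 hxb⟩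
  have ht' : t ∈ Ioc t₁ t₂ := ⟨lt_of_le_of_ne ht.1 htt, ht.2⟩
  rcases h x hx' t ht' hpos with h | h
  · exact .inl ⟨eventually_pbox_subset_rect hx' ht', h⟩
  · refine .inr ⟨?_, h⟩
    filter_upwards [Ioo_mem_nhds hx'.1 hx'.2] with y hy using ⟨Ioo_subset_Icc_self hy, ht⟩

/-! ### The Gaussian tail -/

/-- `∫_η^∞ e^{-ζ²/4} dζ`. -/
def gtail (η : ℝ) : ℝ := ∫ ζ in Ioi η, Real.exp (-ζ ^ 2 / 4)

lemma integrable_gauss : Integrable fun ζ : ℝ => Real.exp (-ζ ^ 2 / 4) := by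
  have := integrable_exp_neg_mul_sq (b := 1 / 4) (by norm_num)
  refine this.congr (Eventually.of_forall fun x => ?_)
  simp only; congr 1; ring

lemma continuous_gauss : Continuous fun ζ : ℝ => Real.exp (-ζ ^ 2 / 4) := by fun_prop

lemma gtail_sub (a b : ℝ) : gtail a - gtail b = ∫ ζ in a..b, Real.exp (-ζ ^ 2 / 4) := by
  have := intervalIntegral.integral_Iic_sub_Iic (μ := volume) (f := fun ζ : ℝ => Real.exp (-ζ ^ 2 / 4))
    (a := a) (b := b) integrable_gauss.integrableOn integrable_gauss.integrableOn
  have h := fun c : ℝ => intervalIntegral.integral_Iic_add_Ioi (μ := volume) (b := c)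
    (f := fun ζ : ℝ => Real.exp (-ζ ^ 2 / 4)) integrable_gauss.integrableOn
    integrable_gauss.integrableOn
  rw [← this]
  have h1 := h a
  have h2 := h b
  simp only [gtail]
  linarith

lemma hasDerivAt_gtail (η : ℝ) : HasDerivAt gtail (-Real.exp (-η ^ 2 / 4)) η := by
  have e : gtail = fun x => gtail 0 - ∫ ζ in (0:ℝ)..x, Real.exp (-ζ ^ 2 / 4) := by
    funext x; have := gtail_sub 0 x; linarith
  rw [e]
  exact (intervalIntegral.integral_hasDerivAt_right (continuous_gauss.intervalIntegrable _ _)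
    continuous_gauss.stronglyMeasurable.stronglyMeasurableAtFilter
    continuous_gauss.continuousAt).const_sub _

lemma continuous_gtail : Continuous gtail :=
  continuous_iff_continuousAt.2 fun x => (hasDerivAt_gtail x).continuousAt

lemma gtail_anti : Antitone gtail := by
  intro a b hab
  have := gtail_sub a b
  have h2 : 0 ≤ ∫ ζ in a..b, Real.exp (-ζ ^ 2 / 4) :=
    intervalIntegral.integral_nonneg hab fun x _ => (Real.exp_pos _).le
  linarith

lemma gtail_pos (η : ℝ) : 0 < gtail η := by
  have h1 : 0 ≤ gtail (η + 1) := setIntegral_nonneg measurableSet_Ioi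
    fun x _ => (Real.exp_pos _).le
  have h2 : 0 < ∫ ζ in η..(η + 1), Real.exp (-ζ ^ 2 / 4) :=
    intervalIntegral.intervalIntegral_pos_of_pos (continuous_gauss.intervalIntegrable _ _)
      (fun x => Real.exp_pos _) (by linarith)
  have := gtail_sub η (η + 1)
  linarith

lemma gtail_le (η : ℝ) (hη : 0 ≤ η) : gtail η ≤ gtail 0 * Real.exp (-η ^ 2 / 4) := by
  have e : gtail η = ∫ s in Ioi (0:ℝ), Real.exp (-(s + η) ^ 2 / 4) := by
    have := (measurePreserving_add_right volume η).setIntegral_preimage_emb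
      (measurableEmbedding_addRight η) (fun ζ : ℝ => Real.exp (-ζ ^ 2 / 4)) (Ioi η)
    rw [gtail, ← this]
    simp
  rw [e, gtail, ← integral_mul_const]
  refine setIntegral_mono_on ?_ ?_ measurableSet_Ioi ?_
  · exact (integrable_gauss.comp_add_right η).integrableOn
  · exact (integrable_gauss.mul_const _).integrableOn
  · intro s hs
    rw [← Real.exp_add]
    refine Real.exp_le_exp.2 ?_
    have : 0 ≤ s * η := mul_nonneg (le_of_lt hs) hη
    nlinarith

lemma gtail_lip (a b : ℝ) : |gtail a - gtail b| ≤ |a - b| := by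
  rw [gtail_sub, abs_sub_comm a b]
  refine (intervalIntegral.norm_integral_le_of_norm_le_const (f := fun ζ => Real.exp (-ζ ^ 2 / 4))
    (C := 1) fun x _ => ?_).trans
    (by rw [one_mul])
  rw [Real.norm_eq_abs, abs_of_pos (Real.exp_pos _)]
  exact Real.exp_le_one_iff.2 (by nlinarith [sq_nonneg x])

lemma erfc_half (η : ℝ) : erfc (η / 2) = gtail η / Real.sqrt Real.pi := by
  have h := integral_comp_mul_left_Ioi (fun s : ℝ => Real.exp (-s ^ 2)) η
    (b := 1 / 2) (by norm_num)
  have e : ∀ x : ℝ, Real.exp (-(1 / 2 * x) ^ 2) = Real.exp (-x ^ 2 / 4) := fun x => by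
    congr 1; ring
  simp only [e, smul_eq_mul] at h
  rw [erfc, gtail, h, show (1 / 2 * η : ℝ) = η / 2 by ring]
  ring

lemma hasDerivAt_sim_x {t : ℝ} (x : ℝ) : HasDerivAt (fun y => y / √t) (1 / √t) x :=
  (hasDerivAt_id x).div_const _

lemma hasDerivAt_sim_t {t : ℝ} (ht : 0 < t) (x : ℝ) :
    HasDerivAt (fun s => x / √s) (-(x / √t) / (2 * t)) t := by
  have h := (Real.hasDerivAt_sqrt ht.ne').inv (Real.sqrt_pos.2 ht).ne'
  refine (h.const_mul x).congr_deriv ?_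
  have h1 := (Real.sqrt_pos.2 ht).ne'
  have h2 := Real.sq_sqrt ht.le
  have e : t = √t * √t := by rw [← sq, h2]
  rw [h2]
  field_simp

/-- Integral balance for `θ(t) e^{c(x)} g(x/√t)`, where `c'` is the primitive of `q`. -/
lemma bal_profile {g g₁ g₂ θ θ' c c₁ q : ℝ → ℝ} {S : Set ℝ} {a b t₁ t₂ : ℝ}
    (hg : ∀ η ∈ S, HasDerivAt g (g₁ η) η) (hg₁ : ∀ η ∈ S, HasDerivAt g₁ (g₂ η) η)
    (hg₂ : ContinuousOn g₂ S) (hθ : ∀ t ∈ Icc t₁ t₂, HasDerivAt θ (θ' t) t)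
    (hθ' : ContinuousOn θ' (Icc t₁ t₂)) (ht : 0 < t₁)
    (hc : ∀ x ∈ Icc a b, HasDerivAt c (c₁ x) x)
    (hq : IntegrableOn q (Icc a b))
    (hc₁ : ∀ x₁ x₂, a ≤ x₁ → x₁ ≤ x₂ → x₂ ≤ b → c₁ x₂ - c₁ x₁ = ∫ y in x₁..x₂, q y)
    (hS : ∀ x ∈ Icc a b, ∀ t ∈ Icc t₁ t₂, x / √t ∈ S) :
    Bal (fun x t => θ t * (Real.exp (c x) * g (x / √t)))
      (fun x t => θ t * (Real.exp (c x) * (c₁ x * g (x / √t) + g₁ (x / √t) / √t)))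
      (fun x t => Real.exp (c x) * (θ' t * g (x / √t) -
        θ t * (g₁ (x / √t) * (x / √t) / (2 * t) + q x * g (x / √t) + c₁ x ^ 2 * g (x / √t)
          + 2 * c₁ x * g₁ (x / √t) / √t + g₂ (x / √t) / t))) a b t₁ t₂ := by
  rcases lt_or_ge b a with hba | hab
  · refine ⟨?_, ?_, ?_, ?_, ?_⟩
    · intro x hx; exact absurd (hx.1.trans hx.2) (not_le.2 hba)
    · rw [Icc_eq_empty (not_le.2 hba)]; simp
    · rw [Icc_eq_empty (not_le.2 hba)]; simp
    · rw [Icc_eq_empty (not_le.2 hba)]; simp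
    · intros; linarith
  set R := Icc a b ×ˢ Icc t₁ t₂ with hR
  have pos : ∀ t ∈ Icc t₁ t₂, 0 < t := fun t h => ht.trans_le h.1
  have spos : ∀ t ∈ Icc t₁ t₂, 0 < √t := fun t h => Real.sqrt_pos.2 (pos t h)
  have c_fst : ∀ {f : ℝ → ℝ}, ContinuousOn f (Icc a b) →
      ContinuousOn (fun q : ℝ × ℝ => f q.1) R := fun h => h.comp continuousOn_fst fun q hq => hq.1
  have c_snd : ∀ {f : ℝ → ℝ}, ContinuousOn f (Icc t₁ t₂) →
      ContinuousOn (fun q : ℝ × ℝ => f q.2) R := fun h => h.comp continuousOn_snd fun q hq => hq.2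
  have cη : ContinuousOn (fun q : ℝ × ℝ => q.1 / √q.2) R :=
    continuousOn_fst.div (by fun_prop) fun q hq => (spos _ hq.2).ne'
  have c_sim : ∀ {f : ℝ → ℝ}, ContinuousOn f S →
      ContinuousOn (fun q : ℝ × ℝ => f (q.1 / √q.2)) R :=
    fun h => h.comp cη fun q hq => hS _ hq.1 _ hq.2
  have Cg := c_sim fun η h => (hg η h).continuousAt.continuousWithinAt
  have Cg1 := c_sim fun η h => (hg₁ η h).continuousAt.continuousWithinAt
  have Cg2 := c_sim hg₂
  have Cc : ContinuousOn (fun q : ℝ × ℝ => Real.exp (c q.1)) R :=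
    Real.continuous_exp.comp_continuousOn
      (c_fst fun x h => (hc x h).continuousAt.continuousWithinAt)
  have Cs : ContinuousOn (fun q : ℝ × ℝ => √q.2) R := by fun_prop
  have Cθ := c_snd fun t h => (hθ t h).continuousAt.continuousWithinAt
  have Cθ' := c_snd hθ'
  have hqi : ∀ x₁ x₂, a ≤ x₁ → x₁ ≤ x₂ → x₂ ≤ b → IntervalIntegrable q volume x₁ x₂ := by
    intro x₁ x₂ h1 h2 h3
    rw [intervalIntegrable_iff_integrableOn_Icc_of_le h2]
    exact hq.mono_set (Icc_subset_Icc h1 h3)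
  have cc1 : ContinuousOn c₁ (Icc a b) := by
    have : ContinuousOn (fun x => c₁ a + ∫ y in a..x, q y) (Icc a b) :=
      continuousOn_const.add (intervalIntegral.continuousOn_primitive_interval
        (by rwa [uIcc_of_le hab]) |>.mono (by rw [uIcc_of_le hab]))
    refine this.congr fun x hx => ?_
    have := hc₁ a x le_rfl hx.1 hx.2
    simp only; linarith
  have Cc1 := c_fst cc1
  have Ct : ContinuousOn (fun q : ℝ × ℝ => q.2) R := continuousOn_snd
  have hs0 : ∀ q ∈ R, √q.2 ≠ 0 := fun q hq => (spos _ hq.2).ne'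
  have ht0 : ∀ q ∈ R, q.2 ≠ 0 := fun q hq => (pos _ hq.2).ne'
  have hEg : ∀ t ∈ Icc t₁ t₂, ∀ x ∈ Icc a b,
      HasDerivAt (fun y => Real.exp (c y) * g (y / √t))
        (Real.exp (c x) * (c₁ x * g (x / √t) + g₁ (x / √t) / √t)) x := by
    intro t ht' x hx
    refine ((hc x hx).exp.mul ((hg _ (hS x hx t ht')).comp x (hasDerivAt_sim_x x))).congr_deriv ?_
    simp only [Function.comp]; ring
  have hEg1 : ∀ t ∈ Icc t₁ t₂, ∀ x ∈ Icc a b,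
      HasDerivAt (fun y => Real.exp (c y) * (g₁ (y / √t) / √t))
        (Real.exp (c x) * (c₁ x * g₁ (x / √t) / √t + g₂ (x / √t) / t)) x := by
    intro t ht' x hx
    refine ((hc x hx).exp.mul (((hg₁ _ (hS x hx t ht')).comp x
      (hasDerivAt_sim_x x)).div_const _)).congr_deriv ?_
    have e : t = √t * √t := (Real.mul_self_sqrt (pos t ht').le).symm
    have h1 := (spos t ht').ne'
    simp only [Function.comp]
    have e2 : g₂ (x / √t) / t = g₂ (x / √t) * (1 / √t) / √t := by
      rw [mul_one_div, div_div, ← e]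
    rw [e2]; ring
  have H := Bal.of_deriv (a := a) (b := b) (t₁ := t₁) (t₂ := t₂)
    (z := fun x t => θ t * (Real.exp (c x) * g (x / √t)))
    (zx := fun x t => θ t * (Real.exp (c x) * (c₁ x * g (x / √t) + g₁ (x / √t) / √t)))
    (zt := fun x t => θ' t * (Real.exp (c x) * g (x / √t)) +
      θ t * (Real.exp (c x) * (g₁ (x / √t) * (-(x / √t) / (2 * t)))))
    (zxx := fun x t => θ t * (Real.exp (c x) * (q x * g (x / √t) + c₁ x ^ 2 * g (x / √t)
          + 2 * c₁ x * g₁ (x / √t) / √t + g₂ (x / √t) / t))) ?_ ?_ ?_ ?_ ?_ ?_ ?_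
  · convert H using 3
    ring
  · intro x hx t ht'
    exact (hEg t ht' x hx).const_mul _
  · exact Cθ.mul (Cc.mul Cg)
  · exact Cθ.mul (Cc.mul ((Cc1.mul Cg).add (Cg1.div Cs hs0)))
  · intro x hx t ht'
    have := ((hg _ (hS x hx t ht')).comp t (hasDerivAt_sim_t (pos t ht') x)).const_mul
      (Real.exp (c x))
    exact (hθ t ht').mul this
  · exact (Cθ'.mul (Cc.mul Cg)).add (Cθ.mul (Cc.mul (Cg1.mul
      (cη.neg.div (continuousOn_const.mul Ct) fun q hq => mul_ne_zero two_ne_zero (ht0 q hq)))))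
  · have i1 : IntegrableOn (fun z : ℝ × ℝ => q z.1) R := by
      have : Integrable (fun z : ℝ × ℝ => q z.1 * (1:ℝ))
          ((volume.restrict (Icc a b)).prod (volume.restrict (Icc t₁ t₂))) :=
        Integrable.mul_prod (f := q) (g := fun _ => (1:ℝ)) hq
          (integrableOn_const (isCompact_Icc.measure_lt_top.ne))
      rw [Measure.prod_restrict, ← Measure.volume_eq_prod] at this
      simp only [mul_one] at this
      exact this
    have hK : IsCompact R := isCompact_Icc.prod isCompact_Icc
    have i2 : IntegrableOn (fun z : ℝ × ℝ =>
        q z.1 * (θ z.2 * (Real.exp (c z.1) * g (z.1 / √z.2)))) R :=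
      IntegrableOn.mul_continuousOn i1 (Cθ.mul (Cc.mul Cg)) hK
    have i3 : IntegrableOn (fun z : ℝ × ℝ => θ z.2 * (Real.exp (c z.1) *
        (c₁ z.1 ^ 2 * g (z.1 / √z.2) + 2 * c₁ z.1 * g₁ (z.1 / √z.2) / √z.2
          + g₂ (z.1 / √z.2) / z.2))) R := by
      refine ContinuousOn.integrableOn_compact hK ?_
      exact Cθ.mul (Cc.mul ((((Cc1.pow 2).mul Cg).add
        (((continuousOn_const.mul Cc1).mul Cg1).div Cs hs0)).add (Cg2.div Ct ht0)))
    refine (i2.add i3).congr (Eventually.of_forall fun z => ?_)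
    simp only [Pi.add_apply]; ring
  · intro t ht' x₁ x₂ h1 h2 h3
    have sub : Icc x₁ x₂ ⊆ Icc a b := Icc_subset_Icc h1 h3
    have cE : ContinuousOn (fun x => Real.exp (c x)) (Icc a b) :=
      Real.continuous_exp.comp_continuousOn
        fun x h => (hc x h).continuousAt.continuousWithinAt
    have cg := continuousOn_slice_left (z := fun x t => g (x / √t)) Cg ht'
    have cg1 := continuousOn_slice_left (z := fun x t => g₁ (x / √t)) Cg1 ht'
    have cg2 := continuousOn_slice_left (z := fun x t => g₂ (x / √t)) Cg2 ht'
    have k1 := integral_parts_primitive (c₁ x₁) h2 (hqi x₁ x₂ h1 h2 h3)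
      (fun x hx => (hEg t ht' x (sub hx)).hasDerivWithinAt)
      (((cE.mul ((cc1.mul cg).add (cg1.div_const _))).mono sub))
    have k2 := intervalIntegral.integral_eq_sub_of_hasDerivAt (a := x₁) (b := x₂)
      (fun x hx => hEg1 t ht' x (sub (by rwa [uIcc_of_le h2] at hx)))
      ((cE.mul (((cc1.mul cg1).div_const _).add (cg2.div_const _))).mono
        sub |>.intervalIntegrable_of_Icc h2)
    have e1 : ∀ x ∈ Icc x₁ x₂, c₁ x₁ + ∫ y in x₁..x, q y = c₁ x := by
      intro x hx
      have := hc₁ x₁ x h1 hx.1 (hx.2.trans h3); linarith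
    rw [e1 x₂ ⟨h2, le_rfl⟩] at k1
    have k3 : ∫ x in x₁..x₂, (q x * (Real.exp (c x) * g (x / √t)) + c₁ x *
        (Real.exp (c x) * (c₁ x * g (x / √t) + g₁ (x / √t) / √t))) =
        c₁ x₂ * (Real.exp (c x₂) * g (x₂ / √t)) - c₁ x₁ * (Real.exp (c x₁) * g (x₁ / √t)) := by
      rw [← k1]
      refine intervalIntegral.integral_congr fun x hx => ?_
      rw [uIcc_of_le h2] at hx
      simp only [e1 x hx]
    have i4 : IntervalIntegrable (fun x => q x * (Real.exp (c x) * g (x / √t)) + c₁ x *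
        (Real.exp (c x) * (c₁ x * g (x / √t) + g₁ (x / √t) / √t))) volume x₁ x₂ := by
      refine IntervalIntegrable.add ?_ ?_
      · refine (hqi x₁ x₂ h1 h2 h3).mul_continuousOn ?_
        rw [uIcc_of_le h2]
        exact (cE.mul cg).mono sub
      · exact ((cc1.mul (cE.mul ((cc1.mul cg).add (cg1.div_const _)))).mono
          sub).intervalIntegrable_of_Icc h2
    have i5 : IntervalIntegrable (fun x => Real.exp (c x) * (c₁ x * g₁ (x / √t) / √t
        + g₂ (x / √t) / t)) volume x₁ x₂ :=
      (cE.mul (((cc1.mul cg1).div_const _).add (cg2.div_const _))).mono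
        sub |>.intervalIntegrable_of_Icc h2
    rw [intervalIntegral.integral_const_mul]
    have k4 := intervalIntegral.integral_add i4 i5
    have e2 : (∫ y in x₁..x₂, Real.exp (c y) * (q y * g (y / √t) + c₁ y ^ 2 * g (y / √t)
          + 2 * c₁ y * g₁ (y / √t) / √t + g₂ (y / √t) / t)) =
        ∫ x in x₁..x₂, ((q x * (Real.exp (c x) * g (x / √t)) + c₁ x *
        (Real.exp (c x) * (c₁ x * g (x / √t) + g₁ (x / √t) / √t))) +
        Real.exp (c x) * (c₁ x * g₁ (x / √t) / √t + g₂ (x / √t) / t)) := by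
      congr 1; funext x; ring
    rw [e2, k4, k3, k2]; ring

/-- Integral balance for `θ(t) g(x/√t)`. -/
lemma bal_similarity {g g₁ g₂ θ θ' : ℝ → ℝ} {S : Set ℝ} {a b t₁ t₂ : ℝ}
    (hg : ∀ η ∈ S, HasDerivAt g (g₁ η) η) (hg₁ : ∀ η ∈ S, HasDerivAt g₁ (g₂ η) η)
    (hg₂ : ContinuousOn g₂ S) (hθ : ∀ t ∈ Icc t₁ t₂, HasDerivAt θ (θ' t) t)
    (hθ' : ContinuousOn θ' (Icc t₁ t₂)) (ht : 0 < t₁)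
    (hS : ∀ x ∈ Icc a b, ∀ t ∈ Icc t₁ t₂, x / √t ∈ S) :
    Bal (fun x t => θ t * g (x / √t)) (fun x t => θ t * (g₁ (x / √t) / √t))
      (fun x t => θ' t * g (x / √t) -
        θ t * (g₁ (x / √t) * (x / √t) / (2 * t) + g₂ (x / √t) / t)) a b t₁ t₂ := by
  simpa using bal_profile (c := 0) (c₁ := 0) (q := 0) hg hg₁ hg₂ hθ hθ' ht
    (fun x _ => hasDerivAt_const x (0:ℝ)) integrableOn_zero
    (by simp) hS

lemma mem_of_box_left {a b t₁ t₂ : ℝ} {U : Set (ℝ × ℝ)} (hab : a < b)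
    (h : Icc a b ×ˢ Icc t₁ t₂ ⊆ U) {t : ℝ} (ht : t ∈ Icc t₁ t₂) : (a, t) ∈ U :=
  h ⟨⟨le_rfl, hab.le⟩, ht⟩

lemma hasBal_similarity {g g₁ g₂ θ θ' : ℝ → ℝ} {S : Set ℝ} {U : Set (ℝ × ℝ)}
    (hg : ∀ η ∈ S, HasDerivAt g (g₁ η) η) (hg₁ : ∀ η ∈ S, HasDerivAt g₁ (g₂ η) η)
    (hg₂ : ContinuousOn g₂ S) (hθ : ∀ t > 0, HasDerivAt θ (θ' t) t)
    (hθ' : ContinuousOn θ' (Ioi 0)) (hU : ∀ q ∈ U, 0 < q.2 ∧ q.1 / √q.2 ∈ S) :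
    HasBal (fun x t => θ t * g (x / √t)) (fun x t => θ' t * g (x / √t) -
        θ t * (g₁ (x / √t) * (x / √t) / (2 * t) + g₂ (x / √t) / t)) U := by
  refine ⟨_, fun a b t₁ t₂ hab ht hsub => bal_similarity hg hg₁ hg₂ (fun t h => hθ t ?_)
    (hθ'.mono fun t h => ?_) ?_ fun x hx t h => ?_⟩
  · exact (hU _ (mem_of_box_left hab hsub h)).1
  · exact (hU _ (mem_of_box_left hab hsub h)).1
  · exact (hU _ (mem_of_box_left hab hsub ⟨le_rfl, ht.le⟩)).1
  · exact (hU (x, t) (hsub ⟨hx, h⟩)).2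

/-- A general smooth example: `A + B (x-c)² + D t`. -/
lemma hasBal_quad (A B c D : ℝ) (U : Set (ℝ × ℝ)) :
    HasBal (fun x t => A + B * (x - c) ^ 2 + D * t) (fun _ _ => D - 2 * B) U := by
  refine ⟨_, fun a b t₁ t₂ _ _ _ => Bal.of_smooth (z := fun x t => A + B * (x - c) ^ 2 + D * t)
    (zx := fun x _ => 2 * B * (x - c))
    (zt := fun _ _ => D) (zxx := fun _ _ => 2 * B) ?_ ?_ ?_ ?_ ?_ ?_ ?_⟩
  · intro x _ t _
    refine ((((((hasDerivAt_id x).sub_const c).pow 2).const_mul B).const_add A).add_const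
      (D * t)).congr_deriv ?_
    simp; ring
  · intro x _ t _
    refine (((hasDerivAt_id x).sub_const c).const_mul (2 * B)).congr_deriv ?_
    simp
  · intro x _ t _
    refine (((hasDerivAt_id t).const_mul D).const_add (A + B * (x - c) ^ 2)).congr_deriv ?_
    simp
  all_goals fun_prop

lemma hasDerivAt_gaussExp (η : ℝ) :
    HasDerivAt (fun η : ℝ => Real.exp (-η ^ 2 / 4)) (-(η / 2) * Real.exp (-η ^ 2 / 4)) η := by
  refine ((((hasDerivAt_id η).pow 2).neg.div_const 4).exp).congr_deriv ?_
  simp; ring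

/-- Heat-equation solution built from the Gaussian tail, on either half line. -/
lemma hasBal_gtail {σ : ℝ} (hσ : σ ^ 2 = 1) (C : ℝ) :
    HasBal (fun x t => C * gtail (σ * x / √t)) (fun _ _ => 0) {q | 0 < q.2} := by
  have H := hasBal_similarity (g := fun η => gtail (σ * η))
    (g₁ := fun η => -Real.exp (-η ^ 2 / 4) * σ)
    (g₂ := fun η => -(-(η / 2) * Real.exp (-η ^ 2 / 4)) * σ) (θ := fun _ => C) (θ' := fun _ => 0)
    (S := univ) (U := {q | 0 < q.2}) ?_ ?_ (by fun_prop) (fun t _ => hasDerivAt_const _ _)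
    continuousOn_const fun q hq => ⟨hq, trivial⟩
  · refine H.congr (isOpen_lt continuous_const continuous_snd) ?_ ?_
    · intro x t _
      simp only [mul_div_assoc]
    · intro x t ht
      have : t ≠ 0 := ne_of_gt ht
      field_simp; ring
  · intro η _
    have h1 : HasDerivAt (fun η : ℝ => σ * η) σ η := by
      simpa using (hasDerivAt_id η).const_mul σ
    have := (hasDerivAt_gtail (σ * η)).comp η h1
    rwa [show -(σ * η) ^ 2 / 4 = -η ^ 2 / 4 by rw [mul_pow, hσ]; ring] at this
  · intro η _
    exact (hasDerivAt_gaussExp η).neg.mul_const σ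

/-! ### The source profile -/

section psi
variable {α β : ℝ}

/-- The coefficient of the Gaussian tail in `ψ`. -/
def psiC (α β : ℝ) : ℝ := (α * β / 2) * Real.exp (α ^ 2 / 4)

lemma psiC_pos (hα : 0 < α) (hβ : 0 < β) : 0 < psiC α β := by unfold psiC; positivity

lemma psiC_mul_exp : psiC α β * Real.exp (-α ^ 2 / 4) = α * β / 2 := by
  rw [psiC, mul_assoc, ← Real.exp_add]
  simp [neg_div]

lemma psi_eq {x t : ℝ} (ht : 0 < t) : psi α β x t = psiC α β * gtail (max (|x| / √t) α) := by
  rw [psi, if_pos ht]; rfl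

lemma psi_zero (x : ℝ) : psi α β x 0 = 0 := by simp [psi]

lemma PsiP_eq (η : ℝ) : PsiP α β η = psiC α β * gtail (max η α) := rfl

lemma PsiP_self : PsiP α β α = psiC α β * gtail α := by rw [PsiP_eq, max_self]

lemma psi_behind {x t : ℝ} (ht : 0 < t) (hx : |x| ≤ α * √t) : psi α β x t = PsiP α β α := by
  rw [psi_eq ht, PsiP_self, max_eq_right]
  rwa [div_le_iff₀ (Real.sqrt_pos.2 ht)]

lemma psi_ahead {x t : ℝ} (ht : 0 < t) (hx : α * √t ≤ |x|) :
    psi α β x t = psiC α β * gtail (|x| / √t) := by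
  rw [psi_eq ht, max_eq_left]
  rwa [le_div_iff₀ (Real.sqrt_pos.2 ht)]

lemma psi_nonneg (hα : 0 < α) (hβ : 0 < β) (x t : ℝ) : 0 ≤ psi α β x t := by
  by_cases ht : 0 < t
  · rw [psi_eq ht]; exact mul_nonneg (psiC_pos hα hβ).le (gtail_pos _).le
  · simp [psi, ht]

lemma PsiP_pos (hα : 0 < α) (hβ : 0 < β) : 0 < PsiP α β α := by
  rw [PsiP_self]; exact mul_pos (psiC_pos hα hβ) (gtail_pos _)

lemma psi_le (hα : 0 < α) (hβ : 0 < β) (x t : ℝ) : psi α β x t ≤ PsiP α β α := by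
  by_cases ht : 0 < t
  · rw [psi_eq ht, PsiP_self]
    exact mul_le_mul_of_nonneg_left (gtail_anti (le_max_right _ _)) (psiC_pos hα hβ).le
  · simp only [psi, ht, if_false]; exact (PsiP_pos hα hβ).le

lemma psi_continuousAt {q : ℝ × ℝ} (hq : 0 < q.2) :
    ContinuousAt (fun q : ℝ × ℝ => psi α β q.1 q.2) q := by
  have : ContinuousAt (fun q : ℝ × ℝ => psiC α β * gtail (max (|q.1| / √q.2) α)) q := by
    have h1 : ContinuousAt (fun q : ℝ × ℝ => |q.1| / √q.2) q :=
      ContinuousAt.div (by fun_prop) (by fun_prop) (Real.sqrt_pos.2 hq).ne'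
    exact continuousAt_const.mul (continuous_gtail.continuousAt.comp
      (h1.max continuousAt_const))
  refine this.congr_of_eventuallyEq ?_
  filter_upwards [continuous_snd.continuousAt.eventually (lt_mem_nhds hq)] with q' h
  exact psi_eq h

lemma psi_measurable : Measurable (fun q : ℝ × ℝ => psi α β q.1 q.2) := by
  have h : (fun q : ℝ × ℝ => psi α β q.1 q.2) = fun q : ℝ × ℝ =>
      if 0 < q.2 then psiC α β * gtail (max (|q.1| / √q.2) α) else 0 := by
    funext q
    split_ifs with h
    · exact psi_eq h
    · simp [psi, h]
  rw [h]
  refine Measurable.ite (measurableSet_lt measurable_const measurable_snd) ?_ measurable_const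
  refine (continuous_gtail.measurable.comp (Measurable.max ?_ measurable_const)).const_mul _
  exact (continuous_abs.measurable.comp measurable_fst).div
    (Real.continuous_sqrt.measurable.comp measurable_snd)

lemma psi_kink_left (hα : 0 < α) {t : ℝ} (ht : 0 < t) :
    HasDerivWithinAt (fun y => psi α β y t) 0 (Iic (α * √t)) (α * √t) := by
  have hpos : 0 < α * √t := mul_pos hα (Real.sqrt_pos.2 ht)
  refine (hasDerivWithinAt_const _ _ (PsiP α β α)).congr_of_eventuallyEq ?_
    (psi_behind ht (by rw [abs_of_pos hpos]))
  filter_upwards [mem_nhdsWithin_of_mem_nhds (lt_mem_nhds hpos), self_mem_nhdsWithin] with y h1 h2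
  exact psi_behind ht (by rwa [abs_of_pos h1])

lemma psi_kink_right (hα : 0 < α) {t : ℝ} (ht : 0 < t) :
    HasDerivWithinAt (fun y => psi α β y t) (-(α * β / 2) / √t) (Ici (α * √t)) (α * √t) := by
  have hs := Real.sqrt_pos.2 ht
  have hpos : 0 < α * √t := mul_pos hα hs
  have h1 := (((hasDerivAt_gtail (α * √t / √t)).comp (α * √t)
    (hasDerivAt_sim_x (t := t) (α * √t))).const_mul (psiC α β)).hasDerivWithinAt
    (s := Ici (α * √t))
  have e : α * √t / √t = α := by field_simp
  have h2 : HasDerivWithinAt (fun y => psiC α β * gtail (y / √t)) (-(α * β / 2) / √t)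
      (Ici (α * √t)) (α * √t) := by
    refine h1.congr_deriv ?_
    rw [e, ← psiC_mul_exp]; ring
  refine h2.congr (fun y hy => ?_) ?_
  · have hy0 : 0 < y := hpos.trans_le hy
    rw [psi_ahead ht (by rwa [abs_of_pos hy0]), abs_of_pos hy0]
  · rw [psi_ahead ht (by rw [abs_of_pos hpos]), abs_of_pos hpos]

/-- The region behind the moving source. -/
def behind (α : ℝ) : Set (ℝ × ℝ) := {q | 0 < q.2 ∧ |q.1| < α * √q.2}

/-- The region ahead of the moving source. -/
def ahead (α σ : ℝ) : Set (ℝ × ℝ) := {q | 0 < q.2 ∧ α * √q.2 < σ * q.1}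

lemma isOpen_behind : IsOpen (behind α) :=
  (isOpen_lt continuous_const continuous_snd).inter
    (isOpen_lt (f := fun q : ℝ × ℝ => |q.1|) (g := fun q => α * √q.2)
      (by fun_prop) (by fun_prop))

lemma isOpen_ahead {σ : ℝ} : IsOpen (ahead α σ) :=
  (isOpen_lt continuous_const continuous_snd).inter
    (isOpen_lt (f := fun q : ℝ × ℝ => α * √q.2) (g := fun q => σ * q.1)
      (by fun_prop) (by fun_prop))

lemma psi_hasBal_behind : HasBal (psi α β) (fun _ _ => 0) (behind α) := by
  refine (hasBal_quad (PsiP α β α) 0 0 0 _).congr isOpen_behind ?_ ?_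
  · rintro x t ⟨h1, h2⟩
    rw [psi_behind h1 h2.le]; ring
  · intros; ring

lemma psi_hasBal_ahead (hα : 0 < α) {σ : ℝ} (hσ : σ ^ 2 = 1) :
    HasBal (psi α β) (fun _ _ => 0) (ahead α σ) := by
  refine ((hasBal_gtail hσ (psiC α β)).mono fun q hq => hq.1).congr isOpen_ahead ?_ ?_
  · rintro x t ⟨h1, h2⟩
    have h0 : 0 < σ * x := lt_of_le_of_lt (by positivity) h2
    have e : |x| = σ * x := by
      rw [← abs_of_pos h0, abs_mul, show |σ| = 1 by
        rw [← sq_abs] at hσ; nlinarith [abs_nonneg σ], one_mul]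
    rw [psi_ahead h1 (by rw [e]; exact h2.le), e]
  · intros; rfl

end psi

/-- The consequences of the hypotheses of the main theorem that are used in the proof. -/
structure Sol (α β ustar : ℝ) (u p w : ℝ → ℝ → ℝ) (ps : ℝ → ℝ) : Prop where
  hα : 0 < α
  hβ : 0 < β
  hu : 0 < ustar
  hsub : ustar < PsiP α β α
  heat : HeatSol (fun x t => u x t - psi α β x t) w (fun x t => p x t * u x t)
  even : ∀ x t, u (-x) t = u x t
  p_even : ∀ x t, p (-x) t = p x t
  p01 : ∀ x, ∀ t ≥ 0, p x t ∈ Icc (0:ℝ) 1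
  p_one : ∀ x s t, 0 ≤ s → s ≤ t → ustar < u x s → p x t = 1
  p_zero : ∀ x t, x ≠ 0 → 0 ≤ t → (∀ s ∈ Icc 0 t, u x s < ustar) → p x t = 0
  p_mono : ∀ x, MonotoneOn (fun t => p x t) (Ici 0)
  p_meas : Measurable (fun q : ℝ × ℝ => p q.1 q.2)
  ps_meas : Measurable ps
  ps01 : ∀ x, ps x ∈ Icc (0:ℝ) 1
  ps_eq : ∀ᵐ x ∂(volume.restrict (Ioi (0:ℝ))), ∀ t : ℝ, x ^ 2 / α ^ 2 < t → p x t = ps x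

lemma psi_continuousOn_slice {α β x : ℝ} (hα : 0 < α) (hβ : 0 < β) (hx : x ≠ 0) :
    ContinuousOn (fun s => psi α β x s) (Ici 0) := by
  intro s hs
  rcases eq_or_lt_of_le (show (0:ℝ) ≤ s from hs) with rfl | hs
  · rw [ContinuousWithinAt, psi_zero]
    have h0 : Tendsto (fun s : ℝ => psiC α β * (gtail 0 * Real.exp (-(|x| / √s) ^ 2 / 4)))
        (nhdsWithin 0 (Ioi 0)) (nhds 0) := by
      have h1 : Tendsto (fun s : ℝ => (x ^ 2 / 4) * s⁻¹) (nhdsWithin 0 (Ioi 0)) atTop :=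
        tendsto_inv_nhdsGT_zero.const_mul_atTop (by positivity)
      have h2 := ((Real.tendsto_exp_neg_atTop_nhds_zero.comp h1).const_mul (gtail 0)).const_mul
        (psiC α β)
      rw [mul_zero, mul_zero] at h2
      refine h2.congr' ?_
      filter_upwards [self_mem_nhdsWithin] with s hs
      simp only [Function.comp, div_pow, sq_abs, Real.sq_sqrt (le_of_lt hs)]
      congr 3; ring
    have h3 : Tendsto (fun s => psi α β x s) (nhdsWithin 0 (Ioi 0)) (nhds 0) := by
      refine tendsto_of_tendsto_of_tendsto_of_le_of_le' tendsto_const_nhds h0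
        (Eventually.of_forall fun s => psi_nonneg hα hβ x s) ?_
      filter_upwards [self_mem_nhdsWithin] with s hs
      rw [psi_eq hs]
      refine mul_le_mul_of_nonneg_left ?_ (psiC_pos hα hβ).le
      exact (gtail_anti (le_max_left _ _)).trans (gtail_le _ (by positivity))
    rw [← Ioi_insert, nhdsWithin_insert]
    exact tendsto_sup.2 ⟨by rw [tendsto_pure_left]; intro U hU; rw [psi_zero]; exact mem_of_mem_nhds hU, h3⟩
  · have := (psi_continuousAt (α := α) (β := β) (q := (x, s)) hs).comp
      (f := fun s : ℝ => (x, s)) (by fun_prop)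
    exact this.continuousWithinAt

theorem Sol.of_hyp {α β ustar : ℝ} (hα : 0 < α) (hβ : 0 < β)
    (hu : 0 < ustar) (hsub : ustar < PsiP α β α)
    {u p : ℝ → ℝ → ℝ} (hsol : IsWeakSolution α β ustar u p)
    {pstar : ℝ → ℝ} (hP : CondP α p pstar) : ∃ w ps, Sol α β ustar u p w ps ∧
      ps =ᵐ[volume.restrict (Ioi 0)] pstar := by
  obtain ⟨he, hpe, hpm, hp, hmono, w, ⟨hr1, hr2, hr3, hr4⟩, hweak⟩ := hsol
  have p01 : ∀ x, ∀ t ≥ 0, p x t ∈ Icc (0:ℝ) 1 := by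
    intro x t ht
    obtain ⟨h1, h2, h3⟩ := hp x t ht
    rcases lt_trichotomy (sSup ((fun s => u x s) '' Icc 0 t)) ustar with h | h | h
    · rw [h1 h]; simp
    · exact h2 h
    · rw [h3 h]; simp
  have ubd : ∀ T > 0, ∃ C, ∀ x, ∀ t ∈ Icc 0 T, |u x t| ≤ C := by
    intro T hT
    obtain ⟨C, hC⟩ := hr4 T hT
    refine ⟨C + PsiP α β α, fun x t ht => ?_⟩
    have h1 := (hC x t ht).1
    have h2 := psi_nonneg hα hβ x t
    have h3 := psi_le hα hβ x t
    have : u x t = (u x t - psi α β x t) + psi α β x t := by ring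
    rw [this]
    refine (abs_add_le _ _).trans (add_le_add h1 ?_)
    rwa [abs_of_nonneg h2]
  have umeas : AEStronglyMeasurable (fun q : ℝ × ℝ => u q.1 q.2)
      (volume.restrict (univ ×ˢ Ici 0)) := by
    have h1 := hr2.aestronglyMeasurable (μ := volume) (MeasurableSet.univ.prod measurableSet_Ici)
    have h2 := (psi_measurable (α := α) (β := β)).aestronglyMeasurable
      (μ := volume.restrict (univ ×ˢ Ici 0))
    refine (h1.add h2).congr (Eventually.of_forall fun q => ?_)
    simp
  have heq : ∀ᵐ x ∂(volume.restrict (Ioi (0:ℝ))), max 0 (min 1 (pstar x)) = pstar x := by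
    filter_upwards [hP.2] with x hx
    have h1 := p01 x (x ^ 2 / α ^ 2 + 1) (by positivity)
    rw [hx _ (by linarith)] at h1
    rw [min_eq_right h1.2, max_eq_right h1.1]
  have hps : ∀ᵐ x ∂(volume.restrict (Ioi (0:ℝ))), ∀ t : ℝ, x ^ 2 / α ^ 2 < t →
      p x t = max 0 (min 1 (pstar x)) := by
    filter_upwards [hP.2, heq] with x hx h t ht
    rw [h, hx t ht]
  refine ⟨w, fun x => max 0 (min 1 (pstar x)), ⟨hα, hβ, hu, hsub, ⟨hr1, hr2, hr3, hpm.aestronglyMeasurable.mul umeas, ?_, ?_⟩, he,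
    hpe, p01, ?_, ?_, hmono, hpm,
    measurable_const.max (measurable_const.min hP.1), fun x => ⟨le_max_left _ _,
    max_le zero_le_one (min_le_left _ _)⟩, hps⟩, heq⟩
  · intro T hT
    obtain ⟨C, hC⟩ := hr4 T hT
    obtain ⟨C', hC'⟩ := ubd T hT
    refine ⟨max C C', fun x t ht => ⟨(hC x t ht).1.trans (le_max_left _ _),
      (hC x t ht).2.trans (le_max_left _ _), ?_⟩⟩
    have h1 := p01 x t ht.1
    rw [abs_mul, abs_of_nonneg h1.1]
    exact (mul_le_of_le_one_left (abs_nonneg _) h1.2).trans ((hC' x t ht).trans (le_max_right _ _))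
  · intro T hT φ φt φx hφ
    rw [hweak T hT φ φt φx hφ]
  · intro x s t hs hst hus
    refine (hp x t (hs.trans hst)).2.2 (hus.trans_le (le_csSup ?_ ⟨s, ⟨hs, hst⟩, rfl⟩))
    obtain ⟨C, hC⟩ := ubd (t + 1) (by linarith)
    refine ⟨C, ?_⟩
    rintro _ ⟨r, hr, rfl⟩
    exact (le_abs_self _).trans (hC x r ⟨hr.1, by linarith [hr.2]⟩)
  · intro x t hx ht h
    refine (hp x t ht).1 ?_
    have hc : ContinuousOn (fun s => u x s) (Icc 0 t) := by
      have h1 := continuousOn_slice_right (z := fun x t => u x t - psi α β x t) hr2 (mem_univ x)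
      have h2 := h1.add (psi_continuousOn_slice (α := α) (β := β) hα hβ hx)
      refine (h2.mono Icc_subset_Ici_self).congr fun s _ => ?_
      simp
    rw [(isCompact_Icc).sSup_lt_iff_of_continuous ⟨0, le_rfl, ht⟩ hc]
    exact h

namespace Sol
variable {α β ustar : ℝ} {u p w : ℝ → ℝ → ℝ} {ps : ℝ → ℝ}

lemma u_zero (H : Sol α β ustar u p w ps) (x : ℝ) : u x 0 = 0 := by
  have := H.heat.init x
  simpa [psi_zero] using this

lemma continuousAt (H : Sol α β ustar u p w ps) {x t : ℝ} (ht : 0 < t) :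
    ContinuousAt (fun q : ℝ × ℝ => u q.1 q.2) (x, t) := by
  have h1 : ContinuousAt (fun q : ℝ × ℝ => u q.1 q.2 - psi α β q.1 q.2) (x, t) :=
    H.heat.cont.continuousAt (prod_mem_nhds univ_mem (Ici_mem_nhds ht))
  refine (h1.add (psi_continuousAt (α := α) (β := β) (q := (x, t)) ht)).congr
    (Eventually.of_forall fun q => ?_)
  simp

lemma v_hasBal (H : Sol α β ustar u p w ps) :
    HasBal (fun x t => u x t - psi α β x t) (fun x t => -(p x t * u x t)) {q | 0 < q.2} :=
  ⟨w, fun _ _ _ _ hab ht hsub => H.heat.bal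
    (le_of_lt (mem_of_box_left (U := {q | 0 < q.2}) hab hsub ⟨le_rfl, ht.le⟩))
    (mem_of_box_left (U := {q | 0 < q.2}) hab hsub ⟨ht.le, le_rfl⟩)⟩

lemma u_hasBal_behind (H : Sol α β ustar u p w ps) :
    HasBal u (fun x t => -(p x t * u x t)) (behind α) :=
  ((H.v_hasBal.mono fun q hq => hq.1).add psi_hasBal_behind).congr isOpen_behind
    (fun x t _ => by ring) (fun x t _ => by ring)

lemma u_hasBal_ahead (H : Sol α β ustar u p w ps) {σ : ℝ} (hσ : σ ^ 2 = 1) :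
    HasBal u (fun x t => -(p x t * u x t)) (ahead α σ) :=
  ((H.v_hasBal.mono fun q hq => hq.1).add (psi_hasBal_ahead H.hα hσ)).congr isOpen_ahead
    (fun x t _ => by ring) (fun x t _ => by ring)

lemma u_kink_left (H : Sol α β ustar u p w ps) {t : ℝ} (ht : 0 < t) :
    HasDerivWithinAt (fun y => u y t) (w (α * √t) t) (Iic (α * √t)) (α * √t) := by
  have h := (H.heat.der t ht.le (α * √t)).hasDerivWithinAt (s := Iic (α * √t))
  have := h.add (psi_kink_left (β := β) H.hα ht)
  simp only [add_zero] at this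
  exact this.congr (fun y _ => by simp) (by simp)

lemma u_kink_right (H : Sol α β ustar u p w ps) {t : ℝ} (ht : 0 < t) :
    HasDerivWithinAt (fun y => u y t) (w (α * √t) t - α * β / 2 / √t) (Ici (α * √t)) (α * √t) := by
  have h := (H.heat.der t ht.le (α * √t)).hasDerivWithinAt (s := Ici (α * √t))
  have := h.add (psi_kink_right (β := β) H.hα ht)
  refine (this.congr (fun y _ => by simp) (by simp)).congr_deriv (by ring)

/-- `u - ψ` is uniformly small for small times on compact sets. -/
lemma v_small (H : Sol α β ustar u p w ps) (R : ℝ) {ε : ℝ} (hε : 0 < ε) :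
    ∃ δ > 0, ∀ x, |x| ≤ R → ∀ t ∈ Icc 0 δ, |u x t - psi α β x t| ≤ ε := by
  have hc : ContinuousOn (fun q : ℝ × ℝ => u q.1 q.2 - psi α β q.1 q.2)
      (Icc (-R) R ×ˢ Icc 0 1) :=
    H.heat.cont.mono (Set.prod_mono (subset_univ _) Icc_subset_Ici_self)
  obtain ⟨δ, hδ, h⟩ := Metric.uniformContinuousOn_iff.1
    ((isCompact_Icc.prod isCompact_Icc).uniformContinuousOn_of_continuous hc) ε hε
  refine ⟨min (δ / 2) 1, by positivity, fun x hx t ht => ?_⟩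
  have hx' : x ∈ Icc (-R) R := abs_le.1 hx
  have h1 := h (x, t) ⟨hx', ht.1, ht.2.trans (min_le_right _ _)⟩ (x, 0)
    ⟨hx', le_rfl, zero_le_one⟩ ?_
  · simp only [H.heat.init x, Real.dist_eq, sub_zero] at h1
    exact h1.le
  · rw [Prod.dist_eq, dist_self, Real.dist_eq, sub_zero, abs_of_nonneg ht.1]
    exact max_lt hδ (by linarith [ht.2.trans (min_le_left _ _)])

end Sol

namespace Sol
variable {α β ustar : ℝ} {u p w : ℝ → ℝ → ℝ} {ps : ℝ → ℝ}

lemma le_of_forall_delta {a b : ℝ} (hb : 0 ≤ b) (h : ∀ δ > 0, a ≤ δ * b) : a ≤ 0 := by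
  by_contra hc
  push Not at hc
  have := h (a / (2 * (b + 1))) (by positivity)
  have h2 : a / (2 * (b + 1)) * b < a := by
    rw [div_mul_eq_mul_div, div_lt_iff₀ (by positivity)]
    nlinarith
  linarith

lemma le_psi (H : Sol α β ustar u p w ps) (x : ℝ) {t : ℝ} (ht : 0 ≤ t) : u x t ≤ psi α β x t := by
  suffices u x t - psi α β x t ≤ 0 by linarith
  refine le_of_forall_delta (b := 1 + x ^ 2 + 2 * t) (by positivity) fun δ hδ => ?_
  obtain ⟨C, hC⟩ := H.heat.bdd (t + 1) (by linarith)
  set R := |x| + |C| / δ + 1 with hR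
  have hR0 : 1 ≤ R := by have := abs_nonneg x; have : 0 ≤ |C| / δ := by positivity
                         linarith
  have hRC : C ≤ δ * R ^ 2 := by
    have h1 : |C| / δ ≤ R := by linarith [abs_nonneg x]
    rw [div_le_iff₀ hδ] at h1
    have h2 : 0 ≤ δ * R * (R - 1) := mul_nonneg (by positivity) (by linarith)
    linarith [le_abs_self C]
  have key := max_principle_rect (a := -R) (b := R) (t₁ := 0) (t₂ := t)
    (z := fun x t => (u x t - psi α β x t) - (δ + δ * (x - 0) ^ 2 + (2 * δ) * t)) ?_ ?_ ?_ ?_ ?_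
    x ?_ t ⟨ht, le_rfl⟩
  · linarith
  · exact (H.heat.cont.mono (Set.prod_mono (subset_univ _) Icc_subset_Ici_self)).sub (by fun_prop)
  · intro y _
    have := H.heat.init y
    nlinarith [sq_nonneg (y - 0)]
  · intro s hs
    have := (hC (-R) s ⟨hs.1, by linarith [hs.2]⟩).1
    have := le_abs_self (u (-R) s - psi α β (-R) s)
    nlinarith [mul_nonneg hδ.le hs.1]
  · intro s hs
    have := (hC R s ⟨hs.1, by linarith [hs.2]⟩).1
    have := le_abs_self (u R s - psi α β R s)
    nlinarith [mul_nonneg hδ.le hs.1]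
  · intro y hy s hs _
    left
    refine ⟨{q | 0 < q.2}, (isOpen_lt continuous_const continuous_snd).mem_nhds hs.1, _,
      H.v_hasBal.sub (hasBal_quad δ δ 0 (2 * δ) _), Eventually.of_forall fun q hq _ hpos => ?_⟩
    replace hq : 0 < q.2 := hq
    have h1 := psi_nonneg H.hα H.hβ q.1 q.2
    have h2 : 0 ≤ δ * (q.1 - 0) ^ 2 := by positivity
    have h3 : 0 ≤ 2 * δ * q.2 := by positivity
    have h4 : 0 ≤ u q.1 q.2 := by linarith
    have := mul_nonneg (H.p01 q.1 q.2 hq.le).1 h4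
    linarith
  · constructor <;> linarith [neg_abs_le x, le_abs_self x, show 0 ≤ |C| / δ by positivity]

lemma nonneg (H : Sol α β ustar u p w ps) (x : ℝ) {t : ℝ} (ht : 0 ≤ t) : 0 ≤ u x t := by
  rcases eq_or_lt_of_le ht with rfl | ht
  · rw [H.u_zero]
  suffices -u x t ≤ 0 by linarith
  refine le_of_forall_delta (b := 1 + x ^ 2 + 2 * t) (by positivity) fun δ hδ => ?_
  obtain ⟨C, hC⟩ := H.heat.bdd (t + 1) (by linarith)
  set R := |x| + |C| / δ + 1 with hR
  have hR0 : 1 ≤ R := by have := abs_nonneg x; have : 0 ≤ |C| / δ := by positivity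
                         linarith
  have hRC : C ≤ δ * R ^ 2 := by
    have h1 : |C| / δ ≤ R := by linarith [abs_nonneg x]
    rw [div_le_iff₀ hδ] at h1
    have h2 : 0 ≤ δ * R * (R - 1) := mul_nonneg (by positivity) (by linarith)
    linarith [le_abs_self C]
  obtain ⟨t₀, ht₀, hsmall⟩ := H.v_small R hδ
  set t₁ := min t₀ t with ht₁
  have ht₁0 : 0 < t₁ := lt_min ht₀ ht
  have lat : ∀ y s, s ∈ Icc t₁ t → y ^ 2 = R ^ 2 →
      -u y s - (δ + δ * (y - 0) ^ 2 + (2 * δ) * s) ≤ 0 := by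
    intro y s hs hy
    have hs0 : 0 < s := ht₁0.trans_le hs.1
    have := (hC y s ⟨hs0.le, by linarith [hs.2]⟩).1
    have := neg_abs_le (u y s - psi α β y s)
    have h1 := psi_nonneg H.hα H.hβ y s
    rw [sub_zero, hy]
    nlinarith [mul_nonneg hδ.le hs0.le]
  have key := max_principle_rect (a := -R) (b := R) (t₁ := t₁) (t₂ := t)
    (z := fun x t => -u x t - (δ + δ * (x - 0) ^ 2 + (2 * δ) * t)) ?_ ?_ ?_ ?_ ?_
    x ?_ t ⟨min_le_right _ _, le_rfl⟩
  · linarith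
  · refine ContinuousOn.sub ?_ (by fun_prop)
    exact fun q hq => (H.continuousAt (ht₁0.trans_le hq.2.1)).neg.continuousWithinAt
  · intro y hy
    have h0 := hsmall y (abs_le.2 hy) t₁ ⟨ht₁0.le, min_le_left _ _⟩
    have := neg_abs_le (u y t₁ - psi α β y t₁)
    have h1 := psi_nonneg H.hα H.hβ y t₁
    have h2 : 0 ≤ δ * (y - 0) ^ 2 := by positivity
    have h3 : 0 ≤ 2 * δ * t₁ := by positivity
    linarith
  · intro s hs; exact lat _ s hs (by ring)
  · intro s hs; exact lat _ s hs rfl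
  · intro y hy s hs hpos
    have hs0 : 0 < s := ht₁0.trans hs.1
    have fin : ∀ {U : Set (ℝ × ℝ)}, U ∈ nhds (y, s) → (∀ q ∈ U, 0 < q.2) →
        HasBal u (fun x t => -(p x t * u x t)) U →
        LocSub (fun x t => -u x t - (δ + δ * (x - 0) ^ 2 + (2 * δ) * t)) y s := by
      intro U hU hUt hB
      refine ⟨U, hU, fun x t => (p x t * u x t) - (2 * δ - 2 * δ), ?_,
        Eventually.of_forall fun q hq _ hpos => ?_⟩
      · have := (hB.const_mul (-1)).sub (hasBal_quad δ δ 0 (2 * δ) U)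
        simpa using this
      · have hq2 := hUt q hq
        have h2 : 0 ≤ δ * (q.1 - 0) ^ 2 := by positivity
        have h3 : 0 ≤ 2 * δ * q.2 := by positivity
        have h4 : u q.1 q.2 ≤ 0 := by linarith
        have := mul_nonpos_of_nonneg_of_nonpos (H.p01 q.1 q.2 hq2.le).1 h4
        linarith
    have kink : ¬ IsLocalMax (fun x => -u x s - (δ + δ * (x - 0) ^ 2 + (2 * δ) * s))
        (α * √s) := by
      have hq : HasDerivAt (fun x => δ + δ * (x - 0) ^ 2 + (2 * δ) * s)
          (2 * δ * (α * √s)) (α * √s) := by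
        refine ((((((hasDerivAt_id (α * √s)).sub_const 0).pow 2).const_mul δ).const_add
          δ).add_const (2 * δ * s)).congr_deriv ?_
        simp; ring
      refine not_isLocalMax_of_kink ((H.u_kink_left hs0).neg.sub hq.hasDerivWithinAt)
        ((H.u_kink_right hs0).neg.sub hq.hasDerivWithinAt) ?_
      have := H.hα; have := H.hβ
      have : 0 < α * β / 2 / √s := by positivity
      linarith
    rcases lt_trichotomy |y| (α * √s) with h | h | h
    · exact .inl (fin (isOpen_behind.mem_nhds ⟨hs0, h⟩) (fun q hq => hq.1) H.u_hasBal_behind)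
    · right
      rcases abs_choice y with h' | h'
      · rw [h'] at h; rw [h]; exact kink
      · rw [h'] at h
        intro hm
        apply kink
        have hm' : IsLocalMax (fun x => -u x s - (δ + δ * (x - 0) ^ 2 + (2 * δ) * s)) (-(α * √s)) := by
          rw [← h, neg_neg]; exact hm
        have h2 := hm'.comp_continuous (g := fun x : ℝ => -x) (b := α * √s)
          continuous_neg.continuousAt
        refine h2.congr (Eventually.of_forall fun x => ?_)
        simp [H.even]
    · left
      rcases abs_choice y with h' | h'
      · exact fin (isOpen_ahead.mem_nhds (show (y, s) ∈ ahead α 1 from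
          ⟨hs0, by rw [h'] at h; simpa using h⟩)) (fun q hq => hq.1) (H.u_hasBal_ahead (by norm_num))
      · exact fin (isOpen_ahead.mem_nhds (show (y, s) ∈ ahead α (-1) from
          ⟨hs0, by rw [h'] at h; simpa using h⟩)) (fun q hq => hq.1) (H.u_hasBal_ahead (by norm_num))
  · constructor <;> linarith [neg_abs_le x, le_abs_self x, show 0 ≤ |C| / δ by positivity]

lemma le_Psi (H : Sol α β ustar u p w ps) (x : ℝ) {t : ℝ} (ht : 0 ≤ t) : u x t ≤ PsiP α β α :=
  (H.le_psi x ht).trans (psi_le H.hα H.hβ x t)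

end Sol

lemma tendsto_gtail : Tendsto gtail atTop (nhds 0) := by
  have h1 : Tendsto (fun η : ℝ => η ^ 2 / 4) atTop atTop :=
    (tendsto_pow_atTop two_ne_zero).atTop_div_const (by norm_num)
  have h2 := (Real.tendsto_exp_neg_atTop_nhds_zero.comp h1).const_mul (gtail 0)
  rw [mul_zero] at h2
  refine tendsto_of_tendsto_of_tendsto_of_le_of_le' tendsto_const_nhds h2
    (Eventually.of_forall fun η => (gtail_pos η).le) ?_
  filter_upwards [eventually_ge_atTop 0] with η hη
  refine (gtail_le η hη).trans (le_of_eq ?_)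
  simp only [Function.comp, neg_div]

lemma psi_osc {α β L x₀ t₀ y t R : ℝ} (hα : 0 < α) (hβ : 0 < β) (hL : 0 ≤ L) (hx₀ : 0 < x₀)
    (ht₀ : 0 < t₀) (hL' : x₀ ≤ L * √t₀) (hy : |y - x₀| ≤ R) (hR : R ≤ x₀) (ht : t ≤ t₀)
    (htR : t₀ - t ≤ 3 * R ^ 2) (ht4 : t₀ / 4 ≤ t) :
    |psi α β y t - psi α β x₀ t₀| ≤ psiC α β * (2 * L + 6 * L ^ 3) * R / x₀ := by
  have htp : 0 < t := by linarith
  have hR0 : 0 ≤ R := (abs_nonneg _).trans hy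
  set s := √t with hs
  set s₀ := √t₀ with hs₀
  have hsp : 0 < s := Real.sqrt_pos.2 htp
  have hs₀p : 0 < s₀ := Real.sqrt_pos.2 ht₀
  have e1 : s ^ 2 = t := Real.sq_sqrt htp.le
  have e2 : s₀ ^ 2 = t₀ := Real.sq_sqrt ht₀.le
  have hss : s ≤ s₀ := Real.sqrt_le_sqrt ht
  have hs2 : s₀ ≤ 2 * s := by
    refine le_of_sq_le_sq ?_ (by positivity)
    nlinarith
  have hyp : |y| / s = y / s := by
    rw [abs_of_nonneg]; linarith [neg_abs_le (y - x₀)]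
  rw [psi_eq htp, psi_eq ht₀, ← mul_sub, abs_mul, abs_of_pos (psiC_pos hα hβ), mul_assoc,
    mul_div_assoc]
  refine mul_le_mul_of_nonneg_left ?_ (psiC_pos hα hβ).le
  refine (gtail_lip _ _).trans ((abs_max_sub_max_le_abs _ _ _).trans ?_)
  rw [← hs, ← hs₀, hyp, abs_of_pos hx₀]
  have d1 : y / s - x₀ / s₀ = (y - x₀) / s + x₀ * (s₀ - s) / (s * s₀) := by
    field_simp; ring
  rw [d1]
  have b1 : |(y - x₀) / s| ≤ 2 * L * R / x₀ := by
    rw [abs_div, abs_of_pos hsp, div_le_div_iff₀ hsp hx₀]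
    have : |y - x₀| * x₀ ≤ R * (L * s₀) := mul_le_mul hy hL' hx₀.le hR0
    nlinarith [mul_nonneg hR0 hL]
  have b2 : |x₀ * (s₀ - s) / (s * s₀)| ≤ 6 * L ^ 3 * R / x₀ := by
    have hd : 0 ≤ s₀ - s := by linarith
    rw [abs_of_nonneg (by positivity), div_le_div_iff₀ (by positivity) hx₀]
    have k1 : (s₀ - s) * s₀ ≤ 3 * R ^ 2 := by nlinarith
    have k2 : x₀ ^ 3 ≤ L ^ 3 * s₀ ^ 3 := by
      rw [← mul_pow]; exact pow_le_pow_left₀ hx₀.le hL' 3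
    have k3 : R ^ 2 ≤ R * x₀ := by nlinarith
    have k4 : x₀ * (s₀ - s) * x₀ * s₀ ≤ 6 * L ^ 3 * R * s * s₀ * s₀ := by
      calc x₀ * (s₀ - s) * x₀ * s₀ = x₀ ^ 2 * ((s₀ - s) * s₀) := by ring
        _ ≤ x₀ ^ 2 * (3 * (R * x₀)) :=
          mul_le_mul_of_nonneg_left (by linarith) (sq_nonneg _)
        _ = 3 * R * x₀ ^ 3 := by ring
        _ ≤ 3 * R * (L ^ 3 * s₀ ^ 3) := by gcongr
        _ = 3 * L ^ 3 * R * s₀ ^ 2 * s₀ := by ring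
        _ ≤ 3 * L ^ 3 * R * s₀ ^ 2 * (2 * s) := by gcongr
        _ = _ := by ring
    have := le_of_mul_le_mul_right (a := s₀) (b := x₀ * (s₀ - s) * x₀)
      (c := 6 * L ^ 3 * R * (s * s₀)) (by linarith) hs₀p
    exact this
  refine (abs_add_le _ _).trans ((add_le_add b1 b2).trans (le_of_eq ?_))
  ring

namespace Sol
variable {α β ustar : ℝ} {u p w : ℝ → ℝ → ℝ} {ps : ℝ → ℝ}

lemma exists_reach (H : Sol α β ustar u p w ps) : ∃ L, 1 ≤ L ∧ α ≤ L ∧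
    ∀ x t, 0 < x → 0 ≤ t → ustar ≤ u x t → 0 < t ∧ x ≤ L * √t := by
  have hC := psiC_pos H.hα H.hβ
  have h := tendsto_gtail.const_mul (psiC α β)
  rw [mul_zero] at h
  obtain ⟨L, hL1, hL2, hL3⟩ := ((h.eventually (gt_mem_nhds H.hu)).and
    ((eventually_ge_atTop 1).and (eventually_ge_atTop α))).exists
  refine ⟨L, hL2, hL3, fun x t hx ht hux => ?_⟩
  have ht : 0 < t := by
    rcases eq_or_lt_of_le ht with rfl | h
    · rw [H.u_zero] at hux; linarith [H.hu]
    · exact h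
  refine ⟨ht, ?_⟩
  by_contra hc
  push Not at hc
  have h1 := H.le_psi x ht.le
  have hs := Real.sqrt_pos.2 ht
  rw [psi_ahead ht, abs_of_pos hx] at h1
  · have := mul_le_mul_of_nonneg_left (gtail_anti (a := L) (b := x / √t)
      (by rw [le_div_iff₀ hs]; exact hc.le)) hC.le
    linarith
  · rw [abs_of_pos hx]
    exact (mul_le_mul_of_nonneg_right hL3 hs.le).trans hc.le

lemma excess_step (H : Sol α β ustar u p w ps) : ∃ C > 0, ∀ E > 0, ∃ X > 0, ∀ x₀ ≥ X,
    ∀ e ∈ Ioc 0 E, (∀ y ≥ x₀ / 2, ∀ t ≥ 0, u y t ≤ ustar + e) →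
    ∀ t₀ ≥ 0, u x₀ t₀ ≤ ustar + C * √e / x₀ := by
  obtain ⟨L, hL1, hLα, hL⟩ := H.exists_reach
  have hC := psiC_pos H.hα H.hβ
  have hu := H.hu
  refine ⟨psiC α β * (2 * L + 6 * L ^ 3) * √(8 / ustar), by positivity, fun E hE => ?_⟩
  refine ⟨4 * L * √(8 * E / ustar), by positivity, fun x₀ hx₀ e he hue t₀ ht₀ => ?_⟩
  set R := √(8 * e / ustar) with hR
  have he0 := he.1
  have hRp : 0 < R := by positivity
  have hR2 : R ^ 2 = 8 * e / ustar := Real.sq_sqrt (by positivity)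
  have hRu : ustar * R ^ 2 = 8 * e := by rw [hR2]; field_simp
  have hRx : 4 * L * R ≤ x₀ := by
    refine le_trans ?_ hx₀
    have : R ≤ √(8 * E / ustar) := Real.sqrt_le_sqrt (by gcongr; exact he.2)
    gcongr
  have hx₀p : 0 < x₀ := lt_of_lt_of_le (by positivity) hRx
  have hRx' : 4 * R ≤ x₀ := by nlinarith
  have hRe : √(8 / ustar) * √e = R := by
    rw [← Real.sqrt_mul (by positivity)]; congr 1; ring
  rw [mul_assoc (psiC α β * (2 * L + 6 * L ^ 3)), hRe]
  set ω := psiC α β * (2 * L + 6 * L ^ 3) * R / x₀ with hω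
  have hω0 : 0 ≤ ω := by positivity
  by_contra hcon
  push Not at hcon
  obtain ⟨ht₀p, hreach⟩ := hL x₀ t₀ hx₀p ht₀ (by linarith)
  have hst : √t₀ ^ 2 = t₀ := Real.sq_sqrt ht₀
  have ht₀R : 16 * R ^ 2 ≤ t₀ := by
    have : 4 * R ≤ √t₀ := by
      have : L * (4 * R) ≤ L * √t₀ := by linarith
      exact le_of_mul_le_mul_left this (by linarith)
    nlinarith
  have osc : ∀ y ∈ Icc (x₀ - R) (x₀ + R), ∀ t ∈ Icc (t₀ - R ^ 2 / 2) t₀,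
      psi α β x₀ t₀ - psi α β y t ≤ ω := by
    intro y hy t ht
    have := psi_osc (R := R) (y := y) (t := t) H.hα H.hβ (by linarith) hx₀p ht₀p hreach
      (abs_le.2 ⟨by linarith [hy.1], by linarith [hy.2]⟩) (by linarith) ht.2
      (by linarith [ht.1, sq_nonneg R]) (by linarith [ht.1, sq_nonneg R])
    linarith [neg_abs_le (psi α β y t - psi α β x₀ t₀)]
  have tpos : ∀ t, t₀ - R ^ 2 / 2 ≤ t → 0 < t := fun t h => by nlinarith
  have ub : ∀ y ∈ Icc (x₀ - R) (x₀ + R), ∀ t ∈ Icc (t₀ - R ^ 2 / 2) t₀, u y t ≤ ustar + e :=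
    fun y hy t ht => hue y (by linarith [hy.1]) t (tpos t ht.1).le
  have key := max_principle_rect (a := x₀ - R) (b := x₀ + R) (t₁ := t₀ - R ^ 2 / 2) (t₂ := t₀)
    (z := fun y t => (u y t - psi α β y t) -
      ((ustar - psi α β x₀ t₀ + ustar / 4 * t₀ + ω) + (ustar / 8) * (y - x₀) ^ 2
        + (-(ustar / 4)) * t)) ?_ ?_ ?_ ?_ ?_
    x₀ ⟨by linarith, by linarith⟩ t₀ ⟨by linarith [sq_nonneg R], le_rfl⟩
  · simp only [sub_self] at key; nlinarith
  · refine (H.heat.cont.mono (Set.prod_mono (subset_univ _) fun t ht => ?_)).sub (by fun_prop)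
    exact (tpos t ht.1).le
  · intro y hy
    have ht : t₀ - R ^ 2 / 2 ∈ Icc (t₀ - R ^ 2 / 2) t₀ := ⟨le_rfl, by linarith [sq_nonneg R]⟩
    have h1 := osc y hy _ ht
    have h2 := ub y hy _ ht
    nlinarith [mul_nonneg hu.le (sq_nonneg (y - x₀))]
  · intro t ht
    have hy : x₀ - R ∈ Icc (x₀ - R) (x₀ + R) := ⟨le_rfl, by linarith⟩
    have h1 := osc _ hy _ ht
    have h2 := ub _ hy _ ht
    nlinarith [mul_nonneg hu.le (sub_nonneg.2 ht.2)]
  · intro t ht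
    have hy : x₀ + R ∈ Icc (x₀ - R) (x₀ + R) := ⟨by linarith, le_rfl⟩
    have h1 := osc _ hy _ ht
    have h2 := ub _ hy _ ht
    nlinarith [mul_nonneg hu.le (sub_nonneg.2 ht.2)]
  · intro y hy t ht _
    left
    refine ⟨Ioo (x₀ - R) (x₀ + R) ×ˢ Ioi (t₀ - R ^ 2 / 2),
      (isOpen_Ioo.prod isOpen_Ioi).mem_nhds ⟨hy, ht.1⟩, _,
      (H.v_hasBal.mono fun q hq => tpos _ (le_of_lt hq.2)).sub (hasBal_quad _ _ _ _ _),
      Eventually.of_forall fun q hq hq2 hpos => ?_⟩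
    replace hq2 : q.2 ≤ t₀ := hq2.trans ht.2
    have h1 := osc q.1 ⟨hq.1.1.le, hq.1.2.le⟩ q.2 ⟨le_of_lt hq.2, hq2⟩
    have h2 : ustar < u q.1 q.2 := by
      nlinarith [mul_nonneg hu.le (sub_nonneg.2 hq2), mul_nonneg hu.le (sq_nonneg (q.1 - x₀))]
    rw [H.p_one q.1 q.2 q.2 (tpos _ (le_of_lt hq.2)).le le_rfl h2]
    linarith

lemma excess_one (H : Sol α β ustar u p w ps) : ∃ C > 0, ∃ X > 0, ∀ x ≥ X, ∀ t ≥ 0,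
    u x t ≤ ustar + C / x := by
  obtain ⟨C, hC, h⟩ := H.excess_step
  have hE := PsiP_pos H.hα H.hβ
  obtain ⟨X, hX, h⟩ := h _ hE
  refine ⟨C * √(PsiP α β α), by positivity, X, hX, fun x hx t ht => ?_⟩
  exact h x hx _ ⟨hE, le_rfl⟩ (fun y _ s hs => by linarith [H.le_Psi y hs, H.hu]) t ht

/-- Away from the origin, `u` exceeds the threshold by at most `O(x^{-3/2})`. -/
lemma excess (H : Sol α β ustar u p w ps) : ∃ C > 0, ∃ X ≥ 1, ∀ x ≥ X, ∀ t ≥ 0,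
    u x t ≤ ustar + C / (x * √x) := by
  obtain ⟨C, hC, h⟩ := H.excess_step
  obtain ⟨C₁, hC₁, X₁, hX₁, h₁⟩ := H.excess_one
  obtain ⟨X, hX, h⟩ := h (C₁ / X₁) (by positivity)
  refine ⟨C * √(2 * C₁), by positivity, max (max X 1) (2 * X₁), (le_max_right _ _).trans
    (le_max_left _ _), fun x hx t ht => ?_⟩
  have hx1 : X ≤ x := (le_max_left _ _).trans ((le_max_left _ _).trans hx)
  have hx2 : 2 * X₁ ≤ x := (le_max_right _ _).trans hx
  have hxp : 0 < x := by linarith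
  have := h x hx1 (2 * C₁ / x) ⟨by positivity, ?_⟩ (fun y hy s hs => ?_) t ht
  · rw [Real.sqrt_div (by positivity)] at this
    refine this.trans (le_of_eq ?_)
    have : 0 < √x := by positivity
    field_simp
  · rw [div_le_div_iff₀ hxp hX₁]; nlinarith
  · refine (h₁ y (by linarith) s hs).trans ?_
    have hyp : 0 < y := by linarith
    have : C₁ / y ≤ 2 * C₁ / x := by
      rw [div_le_div_iff₀ hyp hxp]; nlinarith
    linarith

end Sol

lemma hasDerivAt_mul_gaussExp (η : ℝ) : HasDerivAt (fun η : ℝ => η * Real.exp (-η ^ 2 / 4))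
    ((1 - η ^ 2 / 2) * Real.exp (-η ^ 2 / 4)) η := by
  refine ((hasDerivAt_id η).mul (hasDerivAt_gaussExp η)).congr_deriv ?_
  simp only [id]; ring

lemma hasDerivAt_mul_gaussExp' (η : ℝ) :
    HasDerivAt (fun η : ℝ => (1 - η ^ 2 / 2) * Real.exp (-η ^ 2 / 4))
    ((η ^ 3 / 4 - 3 * η / 2) * Real.exp (-η ^ 2 / 4)) η := by
  have h : HasDerivAt (fun η : ℝ => 1 - η ^ 2 / 2) (-η) η := by
    refine (((hasDerivAt_id η).pow 2).div_const 2).const_sub 1 |>.congr_deriv ?_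
    simp
  refine (h.mul (hasDerivAt_gaussExp η)).congr_deriv ?_
  ring

lemma hasDerivAt_rpow_decay (A : ℝ) {t : ℝ} (ht : 0 < t) :
    HasDerivAt (fun t : ℝ => A * t ^ (-(3 / 4) : ℝ)) (A * (-(3 / 4) * t ^ (-(3 / 4) - 1 : ℝ))) t :=
  (Real.hasDerivAt_rpow_const (.inl ht.ne')).const_mul A

lemma hasBal_decay (A : ℝ) : HasBal
    (fun x t => A * t ^ (-(3 / 4) : ℝ) * ((x / √t) * Real.exp (-(x / √t) ^ 2 / 4)))
    (fun x t => A * t ^ (-(3 / 4) : ℝ) / t * ((x / √t) * Real.exp (-(x / √t) ^ 2 / 4)) / 4)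
    {q | 0 < q.2} := by
  have h := hasBal_similarity (g := fun η => η * Real.exp (-η ^ 2 / 4))
    (θ := fun t : ℝ => A * t ^ (-(3 / 4) : ℝ))
    (θ' := fun t : ℝ => A * (-(3 / 4) * t ^ (-(3 / 4) - 1 : ℝ))) (S := univ)
    (U := {q : ℝ × ℝ | 0 < q.2})
    (fun η _ => hasDerivAt_mul_gaussExp η) (fun η _ => hasDerivAt_mul_gaussExp' η)
    (by fun_prop) (fun t ht => hasDerivAt_rpow_decay A ht) ?_ (fun q hq => ⟨hq, mem_univ _⟩)
  · refine h.congr (isOpen_lt continuous_const continuous_snd) (fun x t _ => rfl)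
      fun x t ht => ?_
    have ht : 0 < t := ht
    rw [Real.rpow_sub_one ht.ne']
    field_simp
    ring
  · refine continuousOn_const.mul (continuousOn_const.mul fun t ht => ?_)
    exact (Real.continuousAt_rpow_const t _ (.inl (ne_of_gt ht))).continuousWithinAt

namespace Sol
variable {α β ustar : ℝ} {u p w : ℝ → ℝ → ℝ} {ps : ℝ → ℝ}

lemma ahead_bound (H : Sol α β ustar u p w ps) : ∃ A > 0, ∀ t > 0, ∀ x, α * √t ≤ x →
    u x t ≤ ustar / gtail α * gtail (x / √t) +
      A * t ^ (-(3 / 4) : ℝ) * ((x / √t) * Real.exp (-(x / √t) ^ 2 / 4)) := by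
  obtain ⟨C, hC, X, hX, hex⟩ := H.excess
  have hα := H.hα
  have hu := H.hu
  have hC0 := psiC_pos H.hα H.hβ
  have hg0 := gtail_pos 0
  have hgα := gtail_pos α
  set T₀ := (X / α) ^ 2 with hT₀
  have hT₀p : 0 < T₀ := by positivity
  set A₁ := T₀ ^ (3 / 4 : ℝ) * (psiC α β * gtail 0 / α)
  set A₂ := C / (α * √α) / (α * Real.exp (-α ^ 2 / 4))
  have hA₁ : 0 < A₁ := by positivity
  have hA₂ : 0 < A₂ := by positivity
  have early : ∀ t > 0, t ≤ T₀ → ∀ x, α * √t ≤ x → u x t ≤ ustar / gtail α * gtail (x / √t) +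
      (A₁ + A₂) * t ^ (-(3 / 4) : ℝ) * ((x / √t) * Real.exp (-(x / √t) ^ 2 / 4)) := by
    intro t ht htT x hx
    have hs := Real.sqrt_pos.2 ht
    have hxp : 0 < x := (mul_pos hα hs).trans_le hx
    have h1 := H.le_psi x ht.le
    rw [psi_ahead ht (by rwa [abs_of_pos hxp]), abs_of_pos hxp] at h1
    have hη : α ≤ x / √t := by rwa [le_div_iff₀ hs]
    set η := x / √t
    have hηp : 0 < η := hα.trans_le hη
    have h2 := gtail_le η hηp.le
    have h3 : 1 ≤ T₀ ^ (3 / 4 : ℝ) * t ^ (-(3 / 4) : ℝ) := by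
      rw [Real.rpow_neg ht.le, ← div_eq_mul_inv, one_le_div (by positivity)]
      exact Real.rpow_le_rpow ht.le htT (by norm_num)
    have hE := Real.exp_pos (-η ^ 2 / 4)
    have h4 : psiC α β * gtail η ≤ (psiC α β * gtail 0 / α) * (η * Real.exp (-η ^ 2 / 4)) := by
      have : gtail 0 * Real.exp (-η ^ 2 / 4) ≤ gtail 0 / α * (η * Real.exp (-η ^ 2 / 4)) := by
        rw [div_mul_eq_mul_div, le_div_iff₀ hα]
        have := mul_le_mul_of_nonneg_left hη (mul_pos hg0 hE).le
        linarith
      calc psiC α β * gtail η ≤ psiC α β * (gtail 0 / α * (η * Real.exp (-η ^ 2 / 4))) := by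
            gcongr; exact h2.trans this
        _ = _ := by ring
    have h5 : (psiC α β * gtail 0 / α) * (η * Real.exp (-η ^ 2 / 4)) ≤
        A₁ * t ^ (-(3 / 4) : ℝ) * (η * Real.exp (-η ^ 2 / 4)) := by
      have := mul_le_mul_of_nonneg_right h3
        (show 0 ≤ (psiC α β * gtail 0 / α) * (η * Real.exp (-η ^ 2 / 4)) by positivity)
      calc _ ≤ _ := (by linarith : _ ≤ T₀ ^ (3 / 4 : ℝ) * t ^ (-(3 / 4) : ℝ) *
            ((psiC α β * gtail 0 / α) * (η * Real.exp (-η ^ 2 / 4))))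
        _ = _ := by ring
    have h6 : 0 ≤ ustar / gtail α * gtail η := by have := gtail_pos η; positivity
    have h7 : 0 ≤ A₂ * t ^ (-(3 / 4) : ℝ) * (η * Real.exp (-η ^ 2 / 4)) := by positivity
    linarith
  refine ⟨A₁ + A₂, by positivity, fun t ht x hx => ?_⟩
  rcases le_or_gt t T₀ with h | h
  · exact early t ht h x hx
  suffices u x t - (ustar / gtail α * gtail (x / √t) +
      (A₁ + A₂) * t ^ (-(3 / 4) : ℝ) * ((x / √t) * Real.exp (-(x / √t) ^ 2 / 4))) ≤ 0 by linarith
  refine le_of_forall_delta zero_le_one fun δ hδ => ?_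
  have hst := Real.sqrt_pos.2 ht
  obtain ⟨R, hRx, hR⟩ : ∃ R, x ≤ R ∧ psiC α β * gtail (R / √t) ≤ δ := by
    have h1 := (tendsto_gtail.comp (tendsto_id.atTop_div_const hst)).const_mul (psiC α β)
    rw [mul_zero] at h1
    obtain ⟨R, h2, h3⟩ := ((h1.eventually (gt_mem_nhds hδ)).and (eventually_ge_atTop x)).exists
    exact ⟨R, h3, h2.le⟩
  set K : Set (ℝ × ℝ) := {q | q ∈ Icc 0 R ×ˢ Icc T₀ t ∧ α * √q.2 ≤ q.1} with hK
  have hKc : IsCompact K := (isCompact_Icc.prod isCompact_Icc).inter_right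
    (isClosed_le (f := fun q : ℝ × ℝ => α * √q.2) (g := fun q => q.1) (by fun_prop) (by fun_prop))
  have key := max_principle_compact hKc (z := fun x t => u x t - (ustar / gtail α *
      gtail (1 * x / √t) + (A₁ + A₂) * t ^ (-(3 / 4) : ℝ) *
        ((x / √t) * Real.exp (-(x / √t) ^ 2 / 4))) - (δ + 0 * (x - 0) ^ 2 + 0 * t)) ?_ ?_ x t
      ⟨⟨⟨(mul_pos hα hst).le.trans hx, hRx⟩, h.le, le_rfl⟩, hx⟩
  · simp only [one_mul] at key; linarith
  · rintro ⟨y, s⟩ ⟨⟨_, hs, _⟩, _⟩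
    have hs : 0 < s := hT₀p.trans_le hs
    have hU : {q : ℝ × ℝ | 0 < q.2} ∈ nhds (y, s) :=
      (isOpen_lt continuous_const continuous_snd).mem_nhds hs
    exact (((H.continuousAt hs).sub (((hasBal_gtail (one_pow 2) _).continuousAt hU).add
      ((hasBal_decay _).continuousAt hU))).sub (by fun_prop)).continuousWithinAt
  · rintro y s ⟨⟨⟨hy0, hyR⟩, hsT, hst'⟩, hys⟩ hpos
    simp only at hy0 hyR hsT hst' hys
    rw [one_mul] at hpos
    have hs : 0 < s := hT₀p.trans_le hsT
    have hss := Real.sqrt_pos.2 hs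
    have hyp : 0 < y := (mul_pos hα hss).trans_le hys
    left
    have e1 : s ≠ T₀ := by
      rintro rfl
      linarith [early _ hs le_rfl y hys]
    have nn : ∀ y s, 0 < s → 0 ≤ y → 0 ≤ ustar / gtail α * gtail (y / √s) ∧
        0 ≤ (A₁ + A₂) * s ^ (-(3 / 4) : ℝ) * ((y / √s) * Real.exp (-(y / √s) ^ 2 / 4)) := by
      intro y s hs hy
      have := gtail_pos (y / √s)
      constructor <;> positivity
    have e2 : y ≠ R := by
      rintro rfl
      have h1 := H.le_psi y hs.le
      rw [psi_ahead hs (by rwa [abs_of_pos hyp]), abs_of_pos hyp] at h1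
      have h2 : gtail (y / √s) ≤ gtail (y / √t) :=
        gtail_anti (by gcongr)
      have h3 := mul_le_mul_of_nonneg_left h2 hC0.le
      have := nn y s hs hyp.le
      linarith
    have e3 : α * √s ≠ y := by
      intro h
      have h0 : y / √s = α := by rw [← h]; field_simp
      rw [h0] at hpos
      have hXy : X ≤ y := by
        have h1 : X / α ≤ √s := by
          rw [← Real.sqrt_sq (show 0 ≤ X / α by positivity)]
          exact Real.sqrt_le_sqrt hsT
        rw [div_le_iff₀ hα] at h1
        linarith
      have h1 := hex y hXy s hs.le
      have h2 : C / (y * √y) ≤ (A₁ + A₂) * s ^ (-(3 / 4) : ℝ) * (α * Real.exp (-α ^ 2 / 4)) := by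
        have h3 : s ^ (-(3 / 4) : ℝ) = 1 / (√s * √√s) := by
          rw [Real.rpow_neg hs.le, one_div, Real.sqrt_eq_rpow, Real.sqrt_eq_rpow,
            ← Real.rpow_mul hs.le, ← Real.rpow_add hs]
          norm_num
        have h4 : C / (y * √y) = A₂ * s ^ (-(3 / 4) : ℝ) * (α * Real.exp (-α ^ 2 / 4)) := by
          have : 0 < √α := by positivity
          have : 0 < √√s := by positivity
          have hE := Real.exp_pos (-α ^ 2 / 4)
          rw [h3, ← h, Real.sqrt_mul hα.le]
          simp only [A₂]
          field_simp
        rw [h4]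
        gcongr
        linarith
      have h5 : ustar / gtail α * gtail α = ustar := by field_simp
      linarith
    have hy1 : α * √s < y := lt_of_le_of_ne hys e3
    have hy2 : y < R := lt_of_le_of_ne hyR e2
    have hs1 : T₀ < s := lt_of_le_of_ne hsT (Ne.symm e1)
    refine ⟨?_, ahead α 1, isOpen_ahead.mem_nhds ⟨hs, by simpa using hy1⟩, _,
      ((H.u_hasBal_ahead (one_pow 2)).sub (((hasBal_gtail (one_pow 2) _).add
        (hasBal_decay _)).mono fun q hq => hq.1)).sub (hasBal_quad _ _ _ _ _),
      Eventually.of_forall fun q hq _ _ => ?_⟩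
    · have hd : 0 < min (y - α * √s) (min (R - y) (s - T₀)) :=
        lt_min (by linarith) (lt_min (by linarith) (by linarith))
      filter_upwards [Ioo_mem_nhdsGT hd] with r hr
      have h0 := hr.2
      rw [lt_min_iff, lt_min_iff] at h0
      rintro q ⟨⟨k1, k2⟩, k3, k4⟩
      have h1 : α * √q.2 ≤ q.1 := by
        have : α * √q.2 ≤ α * √s := by gcongr
        linarith
      exact ⟨⟨⟨le_trans (by positivity) h1, by linarith⟩, by linarith, by linarith⟩, h1⟩
    · have hq1 : 0 < q.2 := hq.1
      have hq2 := hq.2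
      rw [one_mul] at hq2
      have hq0 : 0 ≤ q.1 := le_trans (by positivity) hq2.le
      have h1 := mul_nonneg (H.p01 q.1 q.2 hq1.le).1 (H.nonneg q.1 hq1.le)
      have h2 : 0 ≤ (A₁ + A₂) * q.2 ^ (-(3 / 4) : ℝ) / q.2 *
        ((q.1 / √q.2) * Real.exp (-(q.1 / √q.2) ^ 2 / 4)) / 4 := by positivity
      linarith

/-- Points ahead of the source where `u` reaches the threshold are close to the source. -/
lemma ahead_reach (H : Sol α β ustar u p w ps) : ∃ C > 0, ∀ x t, 0 < x → 0 ≤ t →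
    ustar ≤ u x t → α * √t ≤ x → x ≤ α * √t + C / √x := by
  obtain ⟨A, hA, hb⟩ := H.ahead_bound
  obtain ⟨L, hL1, hLα, hL⟩ := H.exists_reach
  have hα := H.hα
  have hu := H.hu
  have hgα := gtail_pos α
  refine ⟨A * gtail α / ustar * (L * √L), by positivity, fun x t hx ht hux hax => ?_⟩
  obtain ⟨ht, hxL⟩ := hL x t hx ht hux
  have h := hux.trans (hb t ht x hax)
  have hs := Real.sqrt_pos.2 ht
  have hη : α ≤ x / √t := by rwa [le_div_iff₀ hs]
  have hE := Real.exp_pos (-(x / √t) ^ 2 / 4)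
  have h1 : (x / √t - α) * Real.exp (-(x / √t) ^ 2 / 4) ≤ gtail α - gtail (x / √t) := by
    rw [gtail_sub]
    have := intervalIntegral.integral_mono_on (μ := volume) (a := α) (b := x / √t)
      (f := fun _ => Real.exp (-(x / √t) ^ 2 / 4)) (g := fun ζ => Real.exp (-ζ ^ 2 / 4)) hη
      intervalIntegrable_const (continuous_gauss.intervalIntegrable _ _) (fun ζ hζ => ?_)
    · simpa using this
    · apply Real.exp_le_exp.2
      have : ζ ^ 2 ≤ (x / √t) ^ 2 := pow_le_pow_left₀ (hα.le.trans hζ.1) hζ.2 2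
      linarith
  set η := x / √t with hηdef
  have h2 : ustar * (gtail α - gtail η) ≤
      gtail α * (A * t ^ (-(3 / 4) : ℝ) * (η * Real.exp (-η ^ 2 / 4))) := by
    have h3 := mul_le_mul_of_nonneg_left h hgα.le
    have h4 : gtail α * (ustar / gtail α * gtail η) = ustar * gtail η := by field_simp
    rw [mul_add, h4] at h3
    linarith
  have h3 : ustar * (η - α) ≤ gtail α * A * t ^ (-(3 / 4) : ℝ) * η := by
    refine le_of_mul_le_mul_right ?_ hE
    have := mul_le_mul_of_nonneg_left h1 hu.le
    linarith
  have h4 : t ^ (-(3 / 4) : ℝ) ≤ L * √L / (x * √x) := by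
    have e : t ^ (-(3 / 4) : ℝ) = 1 / (√t * √√t) := by
      rw [Real.rpow_neg ht.le, one_div, Real.sqrt_eq_rpow, Real.sqrt_eq_rpow,
        ← Real.rpow_mul ht.le, ← Real.rpow_add ht]
      norm_num
    have hss : 0 < √√t := by positivity
    rw [e, div_le_div_iff₀ (by positivity) (by positivity)]
    have : √x ≤ √L * √√t := by
      rw [← Real.sqrt_mul (by linarith)]; exact Real.sqrt_le_sqrt hxL
    calc 1 * (x * √x) ≤ 1 * ((L * √t) * (√L * √√t)) := by gcongr
      _ = _ := by ring
  have h5 : η * √t = x := by rw [hηdef]; field_simp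
  have hsx : 0 < √x := Real.sqrt_pos.2 hx
  have h6 : ustar * (x - α * √t) ≤ gtail α * A * (L * √L / (x * √x)) * x := by
    have := mul_le_mul_of_nonneg_right h3 hs.le
    calc ustar * (x - α * √t) = ustar * (η - α) * √t := by rw [← h5]; ring
      _ ≤ gtail α * A * t ^ (-(3 / 4) : ℝ) * (η * √t) := by linarith
      _ ≤ _ := by rw [h5]; gcongr
  have h7 : gtail α * A * (L * √L / (x * √x)) * x = ustar * (A * gtail α / ustar * (L * √L) / √x) := by
    field_simp
  rw [h7] at h6
  linarith [le_of_mul_le_mul_left h6 hu]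

lemma continuousOn_time (H : Sol α β ustar u p w ps) {x : ℝ} (hx : x ≠ 0) :
    ContinuousOn (fun s => u x s) (Ici 0) := by
  have h1 := continuousOn_slice_right (z := fun x t => u x t - psi α β x t) H.heat.cont (mem_univ x)
  refine (h1.add (psi_continuousOn_slice H.hα H.hβ hx)).congr fun s _ => ?_
  simp

lemma exists_of_p_ne_zero (H : Sol α β ustar u p w ps) {x t : ℝ} (hx : x ≠ 0) (ht : 0 ≤ t)
    (h : p x t ≠ 0) : ∃ s ∈ Icc 0 t, ustar ≤ u x s := by
  by_contra hc
  push Not at hc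
  exact h (H.p_zero x t hx ht hc)

/-- If precipitation occurs just behind the source, the threshold is reached ahead of it. -/
lemma exists_ahead (H : Sol α β ustar u p w ps) {x T : ℝ} (hx : x ≠ 0) (hT : 0 ≤ T)
    (h : ∀ t > T, p x t ≠ 0) : ∃ s ∈ Icc 0 T, ustar ≤ u x s := by
  by_contra hc
  push Not at hc
  have h1 := (H.continuousOn_time hx) T hT
  have h2 := h1.eventually (gt_mem_nhds (hc T ⟨hT, le_rfl⟩))
  rw [eventually_nhdsWithin_iff] at h2
  obtain ⟨ε, hε, h3⟩ := Metric.eventually_nhds_iff.1 h2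
  obtain ⟨s, hs, hus⟩ := H.exists_of_p_ne_zero hx (by linarith) (h (T + ε / 2) (by linarith))
  rcases le_or_gt s T with hsT | hsT
  · exact absurd hus (not_le.2 (hc s ⟨hs.1, hsT⟩))
  · refine absurd hus (not_le.2 (h3 ?_ hs.1))
    rw [Real.dist_eq, abs_of_pos (by linarith)]; linarith [hs.2]

end Sol

lemma hasBal_steady {q h h₁ : ℝ → ℝ} (hq : LocallyIntegrable q)
    (hh : ∀ x, HasDerivAt h (h₁ x) x) (hc : Continuous h₁)
    (h₁q : ∀ x₁ x₂, h₁ x₂ - h₁ x₁ = ∫ y in x₁..x₂, q y) (U : Set (ℝ × ℝ)) :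
    HasBal (fun x _ => h x) (fun x _ => 0 - q x) U := by
  have hhc : Continuous h := continuous_iff_continuousAt.2 fun x => (hh x).continuousAt
  refine ⟨fun x _ => h₁ x, fun a b t₁ t₂ _ _ _ => Bal.of_deriv (z := fun x _ => h x)
    (zt := fun _ _ => 0) (zxx := fun x _ => q x)
    (fun x _ t _ => hh x) (by fun_prop) (by fun_prop)
    (fun x _ t _ => hasDerivAt_const _ _) (by fun_prop) ?_ (fun t _ x₁ x₂ _ _ _ => h₁q x₁ x₂)⟩
  have h1 : Integrable q (volume.restrict (Icc a b)) := hq.integrableOn_isCompact isCompact_Icc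
  have := h1.comp_fst (volume.restrict (Icc t₁ t₂))
  rwa [Measure.prod_restrict] at this

lemma hasBal_cos (A μ c t₀ : ℝ) (U : Set (ℝ × ℝ)) :
    HasBal (fun x t => A * Real.exp (-(μ ^ 2 * (t - t₀))) * Real.cos (μ * (x - c)))
      (fun _ _ => 0) U := by
  have e : (fun _ _ => 0 : ℝ → ℝ → ℝ) = fun x t =>
      (-(μ ^ 2)) * (A * Real.exp (-(μ ^ 2 * (t - t₀))) * Real.cos (μ * (x - c))) -
      A * Real.exp (-(μ ^ 2 * (t - t₀))) * (-Real.cos (μ * (x - c)) * μ * μ) := by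
    funext x t; ring
  rw [e]
  refine ⟨_, fun a b t₁ t₂ _ _ _ => Bal.of_smooth
    (zx := fun x t => A * Real.exp (-(μ ^ 2 * (t - t₀))) * (-Real.sin (μ * (x - c)) * μ))
    ?_ ?_ ?_ ?_ ?_ ?_ ?_⟩
  · intro x _ t _
    refine ((((((hasDerivAt_id x).sub_const c).const_mul μ).cos).const_mul _)).congr_deriv ?_
    simp
  · intro x _ t _
    refine (((((((hasDerivAt_id x).sub_const c).const_mul μ).sin.neg).mul_const μ).const_mul
      _)).congr_deriv ?_
    simp
  · intro x _ t _
    refine ((((((hasDerivAt_id t).sub_const t₀).const_mul (μ ^ 2)).neg.exp).const_mul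
      A).mul_const _).congr_deriv ?_
    simp; ring
  all_goals fun_prop

/-- A convex potential with second derivative `q`, normalised at the centre of its support. -/
lemma exists_potential {q : ℝ → ℝ} {c R : ℝ} (hR : 0 < R) (hq : LocallyIntegrable q)
    (hq0 : ∀ y, 0 ≤ q y) (hqs : ∀ y, R / 4 < |y - c| → q y = 0) :
    ∃ h h₁ : ℝ → ℝ, (∀ x, HasDerivAt h (h₁ x) x) ∧ Continuous h₁ ∧
      (∀ x₁ x₂, h₁ x₂ - h₁ x₁ = ∫ y in x₁..x₂, q y) ∧
      (∀ y ∈ Icc (c - R) (c + R), 0 ≤ h y) ∧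
      h c = R * (∫ y in (c - R)..(c + R), q y) / 8 ∧
      3 * R * (∫ y in (c - R)..(c + R), q y) / 8 ≤ h (c - R) ∧
      3 * R * (∫ y in (c - R)..(c + R), q y) / 8 ≤ h (c + R) := by
  set M := ∫ y in (c - R)..(c + R), q y with hM
  have hii : ∀ a b, IntervalIntegrable q volume a b := fun a b =>
    (hq.integrableOn_isCompact isCompact_uIcc).intervalIntegrable
  set h₁ : ℝ → ℝ := fun y => (∫ r in (c - R)..y, q r) - M / 2 with hh₁
  have hc : Continuous h₁ :=
    (intervalIntegral.continuous_primitive (fun a b => hii a b) _).sub continuous_const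
  have hdiff : ∀ x₁ x₂, h₁ x₂ - h₁ x₁ = ∫ y in x₁..x₂, q y := by
    intro x₁ x₂
    have := intervalIntegral.integral_interval_sub_left (hii (c - R) x₂) (hii (c - R) x₁)
    simp only [hh₁]; linarith
  have mono : Monotone h₁ := by
    intro x y hxy
    have := hdiff x y
    have h2 : 0 ≤ ∫ r in x..y, q r := intervalIntegral.integral_nonneg hxy fun r _ => hq0 r
    linarith
  have hL : ∀ y ≤ c - R / 4, h₁ y = -(M / 2) := by
    intro y hy
    have h0 : h₁ (c - R) = -(M / 2) := by simp [hh₁]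
    have : h₁ y - h₁ (c - R) = 0 := by
      rw [hdiff, intervalIntegral.integral_congr_ae (g := fun _ => 0), intervalIntegral.integral_zero]
      have hne : ∀ᵐ r : ℝ, r ≠ c - R / 4 := by simp [ae_iff, measure_singleton]
      filter_upwards [hne] with r hne hr
      refine hqs r ?_
      rw [mem_uIoc] at hr
      have : r < c - R / 4 := lt_of_le_of_ne (by rcases hr with h | h <;> linarith [h.2]) hne
      rw [abs_of_neg (by linarith)]; linarith
    linarith
  have hRt : ∀ y, c + R / 4 ≤ y → h₁ y = M / 2 := by
    intro y hy
    have h0 : h₁ (c + R) = M / 2 := by simp only [hh₁, ← hM]; ring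
    have : h₁ y - h₁ (c + R) = 0 := by
      rw [hdiff, intervalIntegral.integral_congr_ae (g := fun _ => 0), intervalIntegral.integral_zero]
      have hne : ∀ᵐ r : ℝ, r ≠ c + R / 4 := by simp [ae_iff, measure_singleton]
      filter_upwards [hne] with r hne hr
      refine hqs r ?_
      rw [mem_uIoc] at hr
      rw [abs_of_pos] <;> rcases hr with h | h <;> linarith [h.1]
    linarith
  have hlow : ∀ y, -(M / 2) ≤ h₁ y := fun y => by
    rw [← hL (min y (c - R / 4)) (min_le_right _ _)]; exact mono (min_le_left _ _)
  have hup : ∀ y, h₁ y ≤ M / 2 := fun y => by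
    rw [← hRt (max y (c + R / 4)) (le_max_right _ _)]; exact mono (le_max_left _ _)
  set h : ℝ → ℝ := fun y => (∫ r in c..y, h₁ r) + R * M / 8 with hh
  have hd : ∀ x y, h y - h x = ∫ r in x..y, h₁ r := by
    intro x y
    have := intervalIntegral.integral_interval_sub_left (μ := volume)
      (hc.intervalIntegrable c y) (hc.intervalIntegrable c x)
    simp only [hh]; linarith
  have hcc : h c = R * M / 8 := by simp [hh]
  have fwd : ∀ x y, x ≤ y → -(M / 2) * (y - x) ≤ h y - h x ∧ h y - h x ≤ M / 2 * (y - x) := by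
    intro x y hxy
    rw [hd]
    constructor
    · have := intervalIntegral.integral_mono_on (μ := volume) hxy
        (intervalIntegrable_const (c := -(M / 2))) (hc.intervalIntegrable x y) fun r _ => hlow r
      rw [intervalIntegral.integral_const, smul_eq_mul] at this
      linarith
    · have := intervalIntegral.integral_mono_on (μ := volume) hxy
        (hc.intervalIntegrable x y) (intervalIntegrable_const (c := M / 2)) fun r _ => hup r
      rw [intervalIntegral.integral_const, smul_eq_mul] at this
      linarith
  have right : ∀ y, c + R / 4 ≤ y → h y = h (c + R / 4) + M / 2 * (y - (c + R / 4)) := by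
    intro y hy
    have : h y - h (c + R / 4) = ∫ r in (c + R / 4)..y, M / 2 := by
      rw [hd]
      refine intervalIntegral.integral_congr fun r hr => ?_
      rw [uIcc_of_le hy] at hr
      exact hRt r hr.1
    rw [intervalIntegral.integral_const, smul_eq_mul] at this
    linarith
  have left : ∀ y ≤ c - R / 4, h y = h (c - R / 4) + M / 2 * (c - R / 4 - y) := by
    intro y hy
    have : h (c - R / 4) - h y = ∫ r in y..(c - R / 4), -(M / 2) := by
      rw [hd]
      refine intervalIntegral.integral_congr fun r hr => ?_
      rw [uIcc_of_le hy] at hr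
      exact hL r hr.2
    rw [intervalIntegral.integral_const, smul_eq_mul] at this
    linarith
  have hM0 : 0 ≤ M := intervalIntegral.integral_nonneg (by linarith) fun r _ => hq0 r
  have e1 := (fwd c (c + R / 4) (by linarith)).1
  have e2 := (fwd (c - R / 4) c (by linarith)).2
  refine ⟨h, h₁, fun x => ?_, hc, hdiff, ?_, hcc, ?_, ?_⟩
  · exact (intervalIntegral.integral_hasDerivAt_right (hc.intervalIntegrable _ _)
      (hc.stronglyMeasurableAtFilter _ _) hc.continuousAt).add_const _
  · intro y hy
    rcases le_total y (c - R / 4) with h1 | h1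
    · rw [left y h1]
      have : 0 ≤ M / 2 * (c - R / 4 - y) := mul_nonneg (by linarith) (by linarith)
      linarith
    rcases le_total (c + R / 4) y with h2 | h2
    · rw [right y h2]
      have : 0 ≤ M / 2 * (y - (c + R / 4)) := mul_nonneg (by linarith) (by linarith)
      linarith
    rcases le_total c y with h3 | h3
    · have := (fwd c y h3).1
      have : M / 2 * (y - c) ≤ M / 2 * (R / 4) := by gcongr; linarith
      linarith
    · have := (fwd y c h3).2
      have : M / 2 * (c - y) ≤ M / 2 * (R / 4) := by gcongr; linarith
      linarith
  · rw [left (c - R) (by linarith)]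
    linarith
  · rw [right (c + R) (by linarith)]
    linarith

namespace Sol
variable {α β ustar : ℝ} {u p w : ℝ → ℝ → ℝ} {ps : ℝ → ℝ}

/-- Absorption by a precipitation wall lowers `u` by a definite factor. -/
theorem wall (H : Sol α β ustar u p w ps) {c R s B ω : ℝ} {q : ℝ → ℝ} (hR : 0 < R)
    (hs : 0 < s - 3 * R ^ 2) (hq : LocallyIntegrable q) (hq0 : ∀ y, 0 ≤ q y)
    (hqs : ∀ y, R / 4 < |y - c| → q y = 0) (hB : 0 ≤ B)
    (hub : ∀ y ∈ Icc (c - R) (c + R), ∀ t ∈ Icc (s - 3 * R ^ 2) s, u y t ≤ B)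
    (hψ : ∀ y ∈ Icc (c - R) (c + R), ∀ t ∈ Icc (s - 3 * R ^ 2) s,
      PsiP α β α - ω ≤ psi α β y t)
    (hp : ∀ᵐ y, ∀ t ∈ Ioc (s - 3 * R ^ 2) s, q y ≤ p y t) {S : ℝ}
    (hS : S = 3 * R * (∫ y in (c - R)..(c + R), q y) / 8) :
    u c s ≤ ω + B * (1 + S / 2) / (1 + S) := by
  obtain ⟨h, h₁, hh, hc, h₁q, hnn, hcc, hl, hr⟩ := exists_potential hR hq hq0 hqs
  rw [← hS] at hl hr
  replace hcc : h c = S / 3 := by rw [hcc, hS]; ring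
  have hS0 : 0 ≤ S := by have := hnn c ⟨by linarith, by linarith⟩; linarith
  set m := B / (1 + S) with hm
  have hm0 : 0 ≤ m := by positivity
  have hmB : m * (1 + S) = B := by rw [hm]; field_simp
  set t₀ := s - 3 * R ^ 2 with ht₀
  have hR2 : 0 < R ^ 2 := by positivity
  have tpos : ∀ t, t₀ ≤ t → 0 < t := fun t h => hs.trans_le h
  have hhc : Continuous h := continuous_iff_continuousAt.2 fun x => (hh x).continuousAt
  have cos_ge : ∀ y ∈ Icc (c - R) (c + R), 1 / 2 ≤ Real.cos (R⁻¹ * (y - c)) := by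
    intro y hy
    refine le_trans ?_ Real.one_sub_sq_div_two_le_cos
    have : (R⁻¹ * (y - c)) ^ 2 ≤ 1 := by
      rw [sq_le_one_iff_abs_le_one, abs_mul, abs_of_pos (inv_pos.2 hR), inv_mul_le_iff₀ hR, mul_one]
      exact abs_le.2 ⟨by linarith [hy.1], by linarith [hy.2]⟩
    linarith
  have wave_nn : ∀ y ∈ Icc (c - R) (c + R), ∀ t, 0 ≤ 2 * m * S *
      Real.exp (-(R⁻¹ ^ 2 * (t - t₀))) * Real.cos (R⁻¹ * (y - c)) := by
    intro y hy t
    have := cos_ge y hy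
    have : 0 ≤ Real.cos (R⁻¹ * (y - c)) := by linarith
    positivity
  have upper : ∀ y ∈ Icc (c - R) (c + R), ∀ t ∈ Icc t₀ s,
      u y t - psi α β y t + PsiP α β α ≤ u y t + ω := fun y hy t ht => by
    linarith [hψ y hy t ht]
  have key := max_principle_rect (a := c - R) (b := c + R) (t₁ := t₀) (t₂ := s)
    (z := fun y t => (u y t - psi α β y t) - (((ω + m - PsiP α β α + 0 * (y - 0) ^ 2 + 0 * t) +
      m * h y) + 2 * m * S * Real.exp (-(R⁻¹ ^ 2 * (t - t₀))) * Real.cos (R⁻¹ * (y - c))))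
    ?_ ?_ ?_ ?_ ?_ c ⟨by linarith, by linarith⟩ s ⟨by linarith, le_rfl⟩
  · have e1 : R⁻¹ ^ 2 * (s - t₀) = 3 := by
      rw [ht₀]; field_simp; ring
    simp only [sub_self, mul_zero, Real.cos_zero, mul_one, e1, hcc] at key
    have e2 : Real.exp (-3) ≤ 1 / 12 := by
      rw [Real.exp_neg, inv_eq_one_div]
      refine one_div_le_one_div_of_le (by norm_num) ?_
      have h1 : (2.7:ℝ) ≤ Real.exp 1 := by linarith [Real.exp_one_gt_d9]
      have h2 : Real.exp 3 = Real.exp 1 ^ 3 := by rw [← Real.exp_nat_mul]; norm_num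
      rw [h2]
      calc (12:ℝ) ≤ 2.7 ^ 3 := by norm_num
        _ ≤ _ := pow_le_pow_left₀ (by norm_num) h1 3
    have e3 : 2 * m * S * Real.exp (-3) ≤ 2 * m * S * (1 / 12) := by gcongr
    have e4 := psi_le (α := α) (β := β) H.hα H.hβ c s
    have e5 : B * (1 + S / 2) / (1 + S) = m * (1 + S / 2) := by rw [hm]; ring
    rw [e5]
    linarith
  · refine (H.heat.cont.mono (Set.prod_mono (subset_univ _) fun t ht => (tpos t ht.1).le)).sub ?_
    fun_prop
  · intro y hy
    have h1 := upper y hy t₀ ⟨le_rfl, by linarith⟩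
    have h2 := hub y hy t₀ ⟨le_rfl, by linarith⟩
    simp only [sub_self, mul_zero, neg_zero, Real.exp_zero, mul_one, zero_mul, add_zero]
    have h3 := mul_le_mul_of_nonneg_left (cos_ge y hy) (show 0 ≤ 2 * m * S by positivity)
    have h4 := mul_nonneg hm0 (hnn y hy)
    linarith
  · intro t ht
    have hy : c - R ∈ Icc (c - R) (c + R) := ⟨le_rfl, by linarith⟩
    have h1 := upper _ hy t ht
    have h2 := hub _ hy t ht
    have h3 := wave_nn _ hy t
    have h4 := mul_le_mul_of_nonneg_left hl hm0
    linarith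
  · intro t ht
    have hy : c + R ∈ Icc (c - R) (c + R) := ⟨by linarith, le_rfl⟩
    have h1 := upper _ hy t ht
    have h2 := hub _ hy t ht
    have h3 := wave_nn _ hy t
    have h4 := mul_le_mul_of_nonneg_left hr hm0
    linarith
  · intro y hy t ht _
    left
    refine ⟨Ioo (c - R) (c + R) ×ˢ Ioi t₀, (isOpen_Ioo.prod isOpen_Ioi).mem_nhds ⟨hy, ht.1⟩, _,
      (H.v_hasBal.mono fun q hq => tpos _ (le_of_lt hq.2)).sub
        (((hasBal_quad _ _ _ _ _).add ((hasBal_steady hq hh hc h₁q _).const_mul m)).add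
          (hasBal_cos _ _ _ _ _)), ?_⟩
    filter_upwards [Measure.quasiMeasurePreserving_fst.ae hp] with q' hq' hqU hq2 hpos
    have hy' : q'.1 ∈ Icc (c - R) (c + R) := ⟨hqU.1.1.le, hqU.1.2.le⟩
    have ht2 : q'.2 ≤ s := hq2.trans ht.2
    have ht' : t₀ < q'.2 := hqU.2
    have h1 := upper _ hy' q'.2 ⟨ht'.le, ht2⟩
    have h3 := wave_nn _ hy' q'.2
    have h4 := mul_nonneg hm0 (hnn _ hy')
    have h5 : m ≤ u q'.1 q'.2 := by linarith
    have h6 := hq' q'.2 ⟨ht', ht2⟩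
    have h7 : m * q q'.1 ≤ u q'.1 q'.2 * p q'.1 q'.2 :=
      mul_le_mul h5 h6 (hq0 _) (hm0.trans h5)
    linarith

end Sol

namespace Sol
variable {α β ustar : ℝ} {u p w : ℝ → ℝ → ℝ} {ps : ℝ → ℝ}

lemma ps_integrableOn (H : Sol α β ustar u p w ps) {s : Set ℝ} (hm : volume s ≠ ⊤) :
    IntegrableOn ps s := by
  refine Integrable.mono' (g := fun _ => (1:ℝ)) (integrableOn_const hm)
    H.ps_meas.aestronglyMeasurable (Eventually.of_forall fun x => ?_)
  rw [Real.norm_eq_abs, abs_of_nonneg (H.ps01 x).1]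
  exact (H.ps01 x).2

lemma ps_locInt (H : Sol α β ustar u p w ps) : LocallyIntegrable ps := by
  intro x
  exact ⟨Icc (x - 1) (x + 1), Icc_mem_nhds (by linarith) (by linarith),
    H.ps_integrableOn (by simp)⟩

set_option maxHeartbeats 1000000 in
/-- Little precipitation lies behind a point at which precipitation occurs. -/
lemma wall_mass (H : Sol α β ustar u p w ps) : ∃ C > 0, ∃ θ ∈ Ioc (0:ℝ) 1, ∃ X ≥ 1, ∀ z ≥ X,
    (∀ t, z ^ 2 / α ^ 2 < t → p z t = ps z) → ps z ≠ 0 → ∀ R ∈ Icc 1 (θ * z),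
    ∫ y in Icc (z - R / 4) (z - (C / √z + C * R ^ 2 / z)), ps y ≤ C / z := by
  obtain ⟨L, hL1, hLα, hL⟩ := H.exists_reach
  obtain ⟨C₁, hC₁, hahead⟩ := H.ahead_reach
  obtain ⟨C₂, hC₂, X₂, hX₂, hex⟩ := H.excess_one
  have hα := H.hα
  have hu := H.hu
  have hC0 := psiC_pos H.hα H.hβ
  have hL0 : 0 < L := by linarith
  set Cω := psiC α β * (2 * L + 6 * L ^ 3) + psiC α β * C₁ * L with hCω
  have hCωp : 0 < Cω := by positivity
  set Ce := Cω + 2 * C₂ with hCe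
  have hCep : 0 < Ce := by positivity
  set C := C₁ + 1 + 3 * α * L + (32 / 3) * Ce / ustar with hC
  have hCp : 0 < C := by positivity
  refine ⟨C, hCp, min (1 / (2 * L)) (ustar / (4 * Ce)), ⟨by positivity, ?_⟩, max 1 (2 * X₂),
    le_max_left _ _, fun z hz hgood hps R hR => ?_⟩
  · refine (min_le_left _ _).trans ?_
    rw [div_le_one (by positivity)]; linarith
  have hz1 : 1 ≤ z := (le_max_left _ _).trans hz
  have hz2 : 2 * X₂ ≤ z := (le_max_right _ _).trans hz
  have hzp : 0 < z := by linarith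
  have hR1 := hR.1
  have hRp : 0 < R := by linarith
  obtain ⟨s, ⟨hs0, hsT⟩, hus⟩ := H.exists_ahead (x := z) (T := z ^ 2 / α ^ 2) hzp.ne'
    (by positivity) fun t ht => by rw [hgood t ht]; exact hps
  obtain ⟨hsp, hzL⟩ := hL z s hzp hs0 hus
  set a := √s with ha
  have hap : 0 < a := Real.sqrt_pos.2 hsp
  have ha2 : a ^ 2 = s := Real.sq_sqrt hs0
  have hαa : α * a ≤ z := by
    rw [le_div_iff₀ (by positivity), ← ha2] at hsT
    have : (α * a) ^ 2 ≤ z ^ 2 := by rw [mul_pow]; linarith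
    exact le_of_sq_le_sq this hzp.le
  have hza := hahead z s hzp hs0 hus hαa
  rw [← ha] at hza
  have hsz1 : 1 ≤ √z := Real.one_le_sqrt.2 hz1
  have hRz : R ≤ 1 / (2 * L) * z := hR.2.trans (by gcongr; exact min_le_left _ _)
  have hRz' : R ≤ ustar / (4 * Ce) * z := hR.2.trans (by gcongr; exact min_le_right _ _)
  have hRa : R ≤ a / 2 := by
    refine hRz.trans ?_
    rw [one_div_mul_eq_div, div_le_iff₀ (by positivity)]
    linarith
  have hRz2 : R ≤ z / 2 := by
    refine hRz.trans ?_
    rw [one_div_mul_eq_div, div_le_iff₀ (by positivity)]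
    linarith [mul_le_mul_of_nonneg_left hL1 hzp.le]
  have hR2 : 4 * R ^ 2 ≤ s := by rw [← ha2]; linarith [pow_le_pow_left₀ hRp.le hRa 2]
  have hRsq : 0 < R ^ 2 := by positivity
  have hgap : 0 ≤ PsiP α β α - psi α β z s ∧
      PsiP α β α - psi α β z s ≤ psiC α β * C₁ * L * R / z := by
    refine ⟨by linarith [psi_le (α := α) (β := β) H.hα H.hβ z s], ?_⟩
    rw [psi_ahead hsp (by rwa [abs_of_pos hzp]), PsiP_self, abs_of_pos hzp, ← mul_sub]
    have h1 : gtail α - gtail (z / √s) ≤ z / a - α := by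
      refine (le_abs_self _).trans ((gtail_lip _ _).trans ?_)
      rw [abs_sub_comm, abs_of_nonneg]
      rw [sub_nonneg, le_div_iff₀ hap]; exact hαa
    have h2 : z / a - α ≤ C₁ * L * R / z := by
      rw [div_sub' hap.ne', div_le_div_iff₀ hap hzp]
      have h3 : z - a * α ≤ C₁ := by
        have : C₁ / √z ≤ C₁ := div_le_self hC₁.le hsz1
        linarith
      have h4 : z ≤ L * R * a := by
        linarith [mul_le_mul_of_nonneg_left hR1 (show 0 ≤ L * a by positivity)]
      calc (z - a * α) * z ≤ C₁ * z := by gcongr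
        _ ≤ C₁ * (L * R * a) := by gcongr
        _ = _ := by ring
    calc _ ≤ psiC α β * (C₁ * L * R / z) := by gcongr; linarith
      _ = _ := by ring
  set D := C / √z + C * R ^ 2 / z with hD
  set q := (Icc (z - R / 4) (z - D)).indicator ps with hq
  have hDp : 0 < D := by positivity
  have hqint : ∀ c d, ∫ y in c..d, q y = ∫ y in c..d, q y := fun _ _ => rfl
  have hql : LocallyIntegrable q := H.ps_locInt.indicator measurableSet_Icc
  have hq0 : ∀ y, 0 ≤ q y := fun y => indicator_nonneg (fun y _ => (H.ps01 y).1) y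
  have hI : ∫ y in (z - R)..(z + R), q y = ∫ y in Icc (z - R / 4) (z - D), ps y := by
    rw [intervalIntegral.integral_of_le (by linarith), hq, setIntegral_indicator measurableSet_Icc]
    congr 2
    ext y
    simp only [mem_inter_iff, mem_Ioc, mem_Icc]
    refine ⟨fun h => h.2, fun h => ⟨⟨by linarith [h.1], by linarith [h.2]⟩, h⟩⟩
  have key := H.wall (c := z) (R := R) (s := s) (B := ustar + 2 * C₂ / z) (ω := Cω * R / z)
    (q := q) hRp (by linarith) hql hq0 ?_ (by positivity) ?_ ?_ ?_ rfl
  · rw [hI] at key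
    set I := ∫ y in Icc (z - R / 4) (z - D), ps y with hIdef
    have hI0 : 0 ≤ I := setIntegral_nonneg measurableSet_Icc fun y _ => (H.ps01 y).1
    set S := 3 * R * I / 8 with hS
    have hS0 : 0 ≤ S := by positivity
    have h1 : ustar ≤ Cω * R / z + (ustar + 2 * C₂ / z) * (1 + S / 2) / (1 + S) := hus.trans key
    have h2 : (ustar - Cω * R / z) * (1 + S) ≤ (ustar + 2 * C₂ / z) * (1 + S / 2) := by
      rw [← le_div_iff₀ (by positivity)]; linarith
    have h3 : Cω * R / z + 2 * C₂ / z ≤ Ce * R / z := by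
      rw [← add_div, hCe]; gcongr; linarith [mul_le_mul_of_nonneg_left hR1 hC₂.le]
    have h4 : Ce * R / z ≤ ustar / 4 := by
      rw [div_le_iff₀ hzp]
      calc Ce * R ≤ Ce * (ustar / (4 * Ce) * z) := by gcongr
        _ = _ := by field_simp
    have h5 : ustar * S / 4 ≤ Ce * R / z := by
      have h6 : 0 ≤ 2 * C₂ / z := by positivity
      have h7 : 0 ≤ Cω * R / z := by positivity
      have h8 : S * (Cω * R / z + 2 * C₂ / z) ≤ S * (ustar / 4) :=
        mul_le_mul_of_nonneg_left (h3.trans h4) hS0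
      have h9 : 0 ≤ S * (2 * C₂ / z) := by positivity
      linarith
    have h6 : I ≤ (32 / 3) * Ce / ustar / z := by
      rw [hS] at h5
      rw [div_div, le_div_iff₀ (by positivity)]
      rw [le_div_iff₀ hzp] at h5
      have : R * (I * (ustar * z)) ≤ R * ((32 / 3) * Ce) := by linarith
      exact le_of_mul_le_mul_left this hRp
    refine h6.trans ?_
    gcongr
    rw [hC]
    have : 0 < 3 * α * L := by positivity
    linarith
  · intro y hy
    rw [hq, indicator_of_notMem]
    rintro ⟨h1, h2⟩
    rw [abs_of_nonpos (by linarith)] at hy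
    linarith
  · intro y hy t ht
    have hy2 : z / 2 ≤ y := by linarith [hy.1]
    have ht0 : 0 ≤ t := by linarith [ht.1]
    refine (hex y (by linarith) t ht0).trans ?_
    rw [add_le_add_iff_left, div_le_div_iff₀ (by linarith) hzp]
    linarith [mul_le_mul_of_nonneg_left hy2 hC₂.le]
  · intro y hy t ht
    have := psi_osc (R := R) (y := y) (t := t) H.hα H.hβ hL0.le hzp hsp hzL
      (abs_le.2 ⟨by linarith [hy.1], by linarith [hy.2]⟩) (by linarith) ht.2
      (by linarith [ht.1]) (by linarith [ht.1])
    have h1 := (abs_le.1 this).1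
    have h2 := hgap.2
    have e : Cω * R / z = psiC α β * (2 * L + 6 * L ^ 3) * R / z + psiC α β * C₁ * L * R / z := by
      rw [hCω]; ring
    rw [e]; linarith
  · have hae := (ae_restrict_iff' measurableSet_Ioi).1 H.ps_eq
    filter_upwards [hae] with y hy t ht
    have ht0 : 0 < t := by linarith [ht.1]
    by_cases hyI : y ∈ Icc (z - R / 4) (z - D)
    · rw [hq, indicator_of_mem hyI]
      have hy0 : 0 < y := by linarith [hyI.1]
      refine (hy hy0 t ?_).ge
      rw [div_lt_iff₀ (by positivity)]
      have h1 : 3 * R ^ 2 / a ≤ 3 * L * R ^ 2 / z := by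
        rw [div_le_div_iff₀ hap hzp]
        calc 3 * R ^ 2 * z ≤ 3 * R ^ 2 * (L * a) := by gcongr
          _ = _ := by ring
      have h2 : (a - 3 * R ^ 2 / a) ^ 2 ≤ s - 3 * R ^ 2 := by
        have e1 : a * (3 * R ^ 2 / a) = 3 * R ^ 2 := by field_simp
        have e2 : 3 * R ^ 2 / a ≤ a := by
          rw [div_le_iff₀ hap]; linarith
        have e3 : 0 ≤ 3 * R ^ 2 / a := by positivity
        linarith [mul_le_mul_of_nonneg_left e2 e3]
      have h3 : y < α * (a - 3 * R ^ 2 / a) := by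
        have h4 : (3 * α * L) * R ^ 2 / z ≤ C * R ^ 2 / z := by
          gcongr
          rw [hC]
          have : 0 < (32 / 3) * Ce / ustar := by positivity
          linarith
        have h5 : C₁ / √z < C / √z := by
          gcongr
          rw [hC]
          have : 0 < (32 / 3) * Ce / ustar := by positivity
          have : 0 < 3 * α * L := by positivity
          linarith
        have h6 : α * (3 * R ^ 2 / a) ≤ 3 * α * L * R ^ 2 / z := by
          calc _ ≤ α * (3 * L * R ^ 2 / z) := by gcongr
            _ = _ := by ring
        have := hyI.2
        rw [mul_sub]; linarith
      calc y ^ 2 < (α * (a - 3 * R ^ 2 / a)) ^ 2 := by gcongr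
        _ = (a - 3 * R ^ 2 / a) ^ 2 * α ^ 2 := by ring
        _ ≤ (s - 3 * R ^ 2) * α ^ 2 := by gcongr
        _ ≤ _ := by gcongr; exact ht.1.le
    · rw [hq, indicator_of_notMem hyI]
      exact (H.p01 y t ht0.le).1

end Sol

namespace Sol
variable {α β ustar : ℝ} {u p w : ℝ → ℝ → ℝ} {ps : ℝ → ℝ}

lemma ps_ii (H : Sol α β ustar u p w ps) (a b : ℝ) : IntervalIntegrable ps volume a b :=
  (H.ps_integrableOn (by simp [uIcc])).intervalIntegrable

lemma ps_integral_nonneg (H : Sol α β ustar u p w ps) {a b : ℝ} (hab : a ≤ b) :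
    0 ≤ ∫ y in a..b, ps y :=
  intervalIntegral.integral_nonneg hab fun y _ => (H.ps01 y).1

lemma ps_integral_le (H : Sol α β ustar u p w ps) {a b : ℝ} (hab : a ≤ b) :
    ∫ y in a..b, ps y ≤ b - a := by
  have := intervalIntegral.integral_mono_on (μ := volume) hab (H.ps_ii a b)
    (intervalIntegrable_const (c := 1)) fun y _ => (H.ps01 y).2
  simpa using this

lemma ps_integral_mono_left (H : Sol α β ustar u p w ps) {a a' : ℝ} (b : ℝ) (h : a' ≤ a) :
    ∫ y in a..b, ps y ≤ ∫ y in a'..b, ps y := by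
  have := intervalIntegral.integral_add_adjacent_intervals (H.ps_ii a' a) (H.ps_ii a b)
  linarith [H.ps_integral_nonneg h]

set_option maxHeartbeats 500000 in
lemma window_mass (H : Sol α β ustar u p w ps) : ∃ K > 0, ∃ N : ℕ, 1 ≤ N ∧ ∀ n : ℕ, N ≤ n →
    ∫ y in ((n:ℝ) ^ 3)..((n + 1 : ℕ) : ℝ) ^ 3, ps y ≤ K / (n * √n) := by
  obtain ⟨C, hC, θ, ⟨hθ, hθ1⟩, X, hX, hw⟩ := H.wall_mass
  set K₂ := 3140 * C + 1 with hK₂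
  obtain ⟨N, hN⟩ := exists_nat_ge (max (max X (28 / θ)) (max (K₂ / θ) (4 * C * (1 + K₂ ^ 2))))
  refine ⟨5 * C + 1, by positivity, N + 1, by omega, fun n hn => ?_⟩
  have hnN : (N:ℝ) + 1 ≤ n := by exact_mod_cast hn
  set r : ℝ := (n : ℝ) with hr
  have hN0 : (0:ℝ) ≤ N := Nat.cast_nonneg N
  have hr1 : 1 ≤ r := by linarith
  have hrX : X ≤ r := by
    linarith [(le_max_left X (28 / θ)).trans ((le_max_left _ _).trans hN)]
  have hr28 : 28 ≤ r * θ := by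
    rw [← div_le_iff₀ hθ]; linarith [(le_max_right X (28 / θ)).trans ((le_max_left _ _).trans hN)]
  have hrK : K₂ ≤ r * θ := by
    rw [← div_le_iff₀ hθ]
    linarith [(le_max_left (K₂ / θ) (4 * C * (1 + K₂ ^ 2))).trans ((le_max_right _ _).trans hN)]
  have hrC : 4 * C * (1 + K₂ ^ 2) ≤ r := by
    linarith [(le_max_right (K₂ / θ) (4 * C * (1 + K₂ ^ 2))).trans ((le_max_right _ _).trans hN)]
  clear hN hnN hn
  have hrp : 0 < r := by linarith
  have hr2 : r ≤ r ^ 2 := by nlinarith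
  have hr3 : r ^ 2 ≤ r ^ 3 := by nlinarith
  push_cast
  rw [← hr]
  have hae := (ae_restrict_iff' measurableSet_Ioi).1 H.ps_eq
  set S := {z : ℝ | z ∈ Ioc (r ^ 3) ((r + 1) ^ 3) ∧ (∀ t, z ^ 2 / α ^ 2 < t → p z t = ps z) ∧
    ps z ≠ 0} with hS
  have r3 : r ^ 3 ≤ (r + 1) ^ 3 := by gcongr; linarith
  rcases S.eq_empty_or_nonempty with hE | hne
  · rw [intervalIntegral.integral_of_le r3,
      setIntegral_congr_ae (g := fun _ => (0:ℝ)) measurableSet_Ioc, integral_zero]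
    · positivity
    filter_upwards [hae] with z hz hzI
    by_contra h0
    have : z ∈ S := ⟨hzI, hz ((pow_pos hrp 3).trans hzI.1), h0⟩
    rw [hE] at this; exact this
  have hbdd : BddAbove S := ⟨_, fun z hz => hz.1.2⟩
  set σ := sSup S with hσ
  have hσle : σ ≤ (r + 1) ^ 3 := csSup_le hne fun z hz => hz.1.2
  obtain ⟨z, hzS, hzσ⟩ := exists_lt_of_lt_csSup hne (sub_lt_self σ (show 0 < 1 / (r * √r) by
    positivity))
  have hzσ' : z ≤ σ := le_csSup hbdd hzS
  obtain ⟨⟨hzl, hzr⟩, hzg, hz0⟩ := hzS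
  have htop : ∫ y in σ..((r + 1) ^ 3), ps y = 0 := by
    rw [intervalIntegral.integral_of_le hσle,
      setIntegral_congr_ae (g := fun _ => (0:ℝ)) measurableSet_Ioc, integral_zero]
    filter_upwards [hae] with y hy hyI
    by_contra h0
    have : y ∈ S := ⟨⟨by linarith [hyI.1], hyI.2⟩, hy (by
      have := hyI.1; have := pow_pos hrp 3; change 0 < y; linarith), h0⟩
    linarith [le_csSup hbdd this, hyI.1]
  have hzp : 0 < z := (pow_pos hrp 3).trans hzl
  have hzr2 : r ^ 2 ≤ z := by linarith
  have hzX : X ≤ z := by linarith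
  have hz1 : 1 ≤ z := by linarith
  have hsz : r ≤ √z := Real.le_sqrt_of_sq_le hzr2
  have hsz' : r * √r ≤ √z := by
    refine Real.le_sqrt_of_sq_le ?_
    rw [mul_pow, Real.sq_sqrt hrp.le]; linarith
  have hszz : √z ≤ z := by
    rw [Real.sqrt_le_left hzp.le]; nlinarith
  have hθz : θ * r ^ 3 ≤ θ * z := by gcongr
  have mass : ∀ R ∈ Icc 1 (θ * z),
      ∫ y in (z - R / 4)..(z - (C / √z + C * R ^ 2 / z)), ps y ≤ C / z := by
    intro R hR
    rcases le_total (z - R / 4) (z - (C / √z + C * R ^ 2 / z)) with h | h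
    · have := hw z hzX hzg hz0 R hR
      rwa [integral_Icc_eq_integral_Ioc, ← intervalIntegral.integral_of_le h] at this
    · rw [intervalIntegral.integral_symm]
      have := H.ps_integral_nonneg h
      have : 0 ≤ C / z := by positivity
      linarith
  have hK1 : 1 ≤ K₂ := by rw [hK₂]; linarith
  have hCsz : C / √z ≤ C / r := by gcongr
  have hCr : C / r ≤ C := div_le_self hC.le hr1
  have m1 := mass (28 * r ^ 2) ⟨by linarith,
    by linarith [mul_le_mul_of_nonneg_left hr28 (sq_nonneg r)]⟩
  have m2 := mass (K₂ * r) ⟨one_le_mul_of_one_le_of_one_le hK1 hr1,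
    by linarith [mul_le_mul_of_nonneg_left hrK hrp.le, mul_le_mul_of_nonneg_left hr3 hθ.le]⟩
  have m3 := mass 1 ⟨le_rfl, by linarith [mul_le_mul_of_nonneg_left (hr2.trans hr3) hθ.le]⟩
  set D₁ := C / √z + C * (28 * r ^ 2) ^ 2 / z with hD₁
  set D₂ := C / √z + C * (K₂ * r) ^ 2 / z with hD₂
  set D₃ := C / √z + C * 1 ^ 2 / z with hD₃
  have d1 : D₁ ≤ K₂ * r / 4 := by
    have : C * (28 * r ^ 2) ^ 2 / z ≤ 784 * C * r := by
      rw [div_le_iff₀ hzp]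
      calc C * (28 * r ^ 2) ^ 2 = 784 * C * r * r ^ 3 := by ring
        _ ≤ _ := by gcongr
    have : C ≤ C * r := le_mul_of_one_le_right hC.le hr1
    rw [hK₂]; linarith
  have d2 : D₂ ≤ 1 / 4 := by
    have h1 : C * (K₂ * r) ^ 2 / z ≤ C * K₂ ^ 2 / r := by
      rw [div_le_div_iff₀ hzp hrp]
      calc C * (K₂ * r) ^ 2 * r = C * K₂ ^ 2 * r ^ 3 := by ring
        _ ≤ _ := by gcongr
    have h2 : C / r + C * K₂ ^ 2 / r ≤ 1 / 4 := by
      rw [← add_div, div_le_iff₀ hrp]; linarith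
    linarith
  have e1 := H.ps_integral_mono_left (z - D₁) (show z - 28 * r ^ 2 / 4 ≤ r ^ 3 by linarith)
  have e2 := H.ps_integral_mono_left (z - D₂) (show z - K₂ * r / 4 ≤ z - D₁ by linarith)
  have e3 := H.ps_integral_mono_left (z - D₃) (show z - 1 / 4 ≤ z - D₂ by linarith)
  have hD₃0 : 0 ≤ D₃ := by positivity
  have e4 := H.ps_integral_le (show z - D₃ ≤ σ by linarith)
  have add := fun a b c => intervalIntegral.integral_add_adjacent_intervals (H.ps_ii a b)
    (H.ps_ii b c)
  have s1 := add (r ^ 3) (z - D₁) (z - D₂)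
  have s2 := add (r ^ 3) (z - D₂) (z - D₃)
  have s3 := add (r ^ 3) (z - D₃) σ
  have s4 := add (r ^ 3) σ ((r + 1) ^ 3)
  have f1 : C / z ≤ C / (r * √r) := by gcongr; linarith
  have f2 : C / √z ≤ C / (r * √r) := by gcongr
  have f3 : D₃ ≤ 2 * (C / (r * √r)) := by rw [hD₃, one_pow, mul_one]; linarith
  have f4 : (5 * C + 1) / (r * √r) = 5 * (C / (r * √r)) + 1 / (r * √r) := by ring
  rw [f4]; linarith

/-- The total amount of precipitation is finite. -/
theorem ps_integrable (H : Sol α β ustar u p w ps) : IntegrableOn ps (Ioi 0) := by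
  obtain ⟨K, hK, N, hN1, h⟩ := H.window_mass
  have hsum : Summable fun j : ℕ => K / (((j + N : ℕ) : ℝ) * √((j + N : ℕ) : ℝ)) := by
    have h1 : Summable fun j : ℕ => K * (1 / (j : ℝ) ^ (3 / 2 : ℝ)) :=
      (Real.summable_one_div_nat_rpow.2 (by norm_num)).mul_left K
    refine ((summable_nat_add_iff N).2 h1).congr fun j => ?_
    have hp : (0:ℝ) < (j + N : ℕ) := by exact_mod_cast (by omega)
    rw [show (3 / 2 : ℝ) = 1 + 1 / 2 by norm_num, Real.rpow_add hp, Real.rpow_one,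
      ← Real.sqrt_eq_rpow, mul_one_div]
  have hb : ∀ i : ℕ, ∫ y in ((N:ℝ) ^ 3)..((i + N : ℕ) : ℝ) ^ 3, ps y ≤
      ∑ j ∈ Finset.range i, K / (((j + N : ℕ) : ℝ) * √((j + N : ℕ) : ℝ)) := by
    intro i
    induction i with
    | zero => simp
    | succ i ih =>
      rw [Finset.sum_range_succ, ← intervalIntegral.integral_add_adjacent_intervals
        (H.ps_ii _ (((i + N : ℕ) : ℝ) ^ 3)) (H.ps_ii _ _)]
      have := h (i + N) (by omega)
      rw [show i + 1 + N = i + N + 1 by omega]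
      exact add_le_add ih this
  have htend : Tendsto (fun i : ℕ => ((i + N : ℕ) : ℝ) ^ 3) atTop atTop :=
    (tendsto_pow_atTop (by norm_num)).comp
      (tendsto_natCast_atTop_atTop.comp (tendsto_add_atTop_nat N))
  have hI : IntegrableOn ps (Ioi ((N:ℝ) ^ 3)) := by
    refine integrableOn_Ioi_of_intervalIntegral_norm_bounded
      (∑' j : ℕ, K / (((j + N : ℕ) : ℝ) * √((j + N : ℕ) : ℝ))) _
      (fun i => H.ps_integrableOn (by simp)) htend (Eventually.of_forall fun i => ?_)
    calc _ = ∫ y in ((N:ℝ) ^ 3)..((i + N : ℕ) : ℝ) ^ 3, ps y := by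
          congr 1; funext y; exact abs_of_nonneg (H.ps01 y).1
      _ ≤ _ := hb i
      _ ≤ _ := hsum.sum_le_tsum _ fun j _ => by positivity
  rw [← Ioc_union_Ioi_eq_Ioi (show (0:ℝ) ≤ (N:ℝ) ^ 3 by positivity)]
  exact (H.ps_integrableOn (by simp)).union hI

end Sol

namespace Sol
variable {α β ustar : ℝ} {u p w : ℝ → ℝ → ℝ} {ps : ℝ → ℝ}

lemma psi_le_of_p_zero (H : Sol α β ustar u p w ps) (h0 : ∀ᵐ y, ∀ t ≥ 0, p y t = 0) (x : ℝ)
    {t : ℝ} (ht : 0 ≤ t) : psi α β x t ≤ u x t := by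
  suffices -(u x t - psi α β x t) ≤ 0 by linarith
  refine le_of_forall_delta (b := 1 + x ^ 2 + 2 * t) (by positivity) fun δ hδ => ?_
  obtain ⟨C, hC⟩ := H.heat.bdd (t + 1) (by linarith)
  set R := |x| + |C| / δ + 1 with hR
  have hR0 : 1 ≤ R := by have := abs_nonneg x; have : 0 ≤ |C| / δ := by positivity
                         linarith
  have hRC : C ≤ δ * R ^ 2 := by
    have h1 : |C| / δ ≤ R := by linarith [abs_nonneg x]
    rw [div_le_iff₀ hδ] at h1
    have h2 : 0 ≤ δ * R * (R - 1) := mul_nonneg (by positivity) (by linarith)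
    linarith [le_abs_self C]
  have key := max_principle_rect (a := -R) (b := R) (t₁ := 0) (t₂ := t)
    (z := fun x t => -1 * (u x t - psi α β x t) - (δ + δ * (x - 0) ^ 2 + (2 * δ) * t)) ?_ ?_ ?_ ?_ ?_
    x ?_ t ⟨ht, le_rfl⟩
  · linarith
  · exact (continuousOn_const.mul
      (H.heat.cont.mono (Set.prod_mono (subset_univ _) Icc_subset_Ici_self))).sub (by fun_prop)
  · intro y _
    have := H.heat.init y
    nlinarith [sq_nonneg (y - 0)]
  · intro s hs
    have := (hC (-R) s ⟨hs.1, by linarith [hs.2]⟩).1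
    have := neg_abs_le (u (-R) s - psi α β (-R) s)
    nlinarith [mul_nonneg hδ.le hs.1]
  · intro s hs
    have := (hC R s ⟨hs.1, by linarith [hs.2]⟩).1
    have := neg_abs_le (u R s - psi α β R s)
    nlinarith [mul_nonneg hδ.le hs.1]
  · intro y hy s hs _
    left
    refine ⟨{q | 0 < q.2}, (isOpen_lt continuous_const continuous_snd).mem_nhds hs.1, _,
      (H.v_hasBal.const_mul (-1)).sub (hasBal_quad δ δ 0 (2 * δ) _), ?_⟩
    filter_upwards [Measure.quasiMeasurePreserving_fst.ae h0] with q hq0 hq _ hpos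
    replace hq : 0 < q.2 := hq
    rw [hq0 q.2 hq.le]; linarith
  · constructor <;> linarith [neg_abs_le x, le_abs_self x, show 0 ≤ |C| / δ by positivity]

/-- Some precipitation must occur. -/
lemma exists_mass (H : Sol α β ustar u p w ps) : ∃ b > 0, 0 < ∫ y in (0:ℝ)..b, ps y := by
  have hnn : 0 ≤ ∫ y in Ioi (0:ℝ), ps y :=
    setIntegral_nonneg measurableSet_Ioi fun y _ => (H.ps01 y).1
  rcases hnn.lt_or_eq with h | h
  · have ht := intervalIntegral_tendsto_integral_Ioi 0 H.ps_integrable tendsto_id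
    obtain ⟨b, h1, h2⟩ := ((ht.eventually (lt_mem_nhds h)).and (eventually_gt_atTop 0)).exists
    exact ⟨b, h2, h1⟩
  exfalso
  have hα := H.hα
  have h1 := (setIntegral_eq_zero_iff_of_nonneg_ae
    (ae_of_all _ fun y => (H.ps01 y).1) H.ps_integrable).1 h.symm
  have h2 : ∀ᵐ y : ℝ, 0 < y → ∀ t ≥ 0, p y t = 0 := by
    have h3 : ∀ᵐ y ∂(volume.restrict (Ioi (0:ℝ))), ∀ t ≥ 0, p y t = 0 := by
      filter_upwards [h1, H.ps_eq] with y hy hpy t ht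
      have e := hpy (max t (y ^ 2 / α ^ 2) + 1) (by linarith [le_max_right t (y ^ 2 / α ^ 2)])
      have hle : t ≤ max t (y ^ 2 / α ^ 2) + 1 := by linarith [le_max_left t (y ^ 2 / α ^ 2)]
      have := H.p_mono y (show t ∈ Ici 0 from ht) (show _ ∈ Ici (0:ℝ) from ht.le.trans hle) hle
      simp only [e, hy, Pi.zero_apply] at this
      exact le_antisymm this (H.p01 y t ht).1
    exact (ae_restrict_iff' measurableSet_Ioi).1 h3
  have h3 : ∀ᵐ y : ℝ, ∀ t ≥ 0, p y t = 0 := by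
    have hne : ∀ᵐ y : ℝ, y ≠ 0 := by simp [ae_iff, measure_singleton]
    filter_upwards [h2, (Measure.measurePreserving_neg (volume : Measure ℝ)).quasiMeasurePreserving.ae h2,
      hne] with y hy hy' hne t ht
    rcases hne.lt_or_gt with h | h
    · rw [← H.p_even]; exact hy' (by linarith) t ht
    · exact hy h t ht
  obtain ⟨x, hx, hx0⟩ := (Measure.dense_of_ae h3).exists_mem_open isOpen_Ioi (nonempty_Ioi (a := (0:ℝ)))
  replace hx0 : 0 < x := hx0
  set t := x ^ 2 / α ^ 2 with ht
  have htp : 0 < t := by positivity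
  have hst : α * √t = x := by
    rw [ht, Real.sqrt_div (by positivity), Real.sqrt_sq hx0.le, Real.sqrt_sq hα.le]
    field_simp
  have h4 := H.psi_le_of_p_zero h3 x htp.le
  rw [psi_behind htp (by rw [hst, abs_of_pos hx0])] at h4
  have := H.p_one x t t htp.le le_rfl (by linarith [H.hsub])
  rw [hx t htp.le] at this
  exact zero_ne_one this

lemma decay_step (H : Sol α β ustar u p w ps) (k : ℕ) : ∃ θ ∈ Ioc 0 (min α 1), ∃ T > 0,
    ∀ t ≥ T, ∀ x, |x| ≤ θ * √t → u x t ≤ (3 / 4) ^ k * PsiP α β α := by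
  have hα := H.hα
  have hΨ := PsiP_pos H.hα H.hβ
  induction k with
  | zero =>
    refine ⟨min α 1, ⟨by positivity, le_rfl⟩, 1, one_pos, fun t ht x _ => ?_⟩
    rw [pow_zero, one_mul]
    exact H.le_Psi x (by linarith)
  | succ k ih =>
    obtain ⟨θ, ⟨hθ0, hθ1⟩, T, hT, h⟩ := ih
    obtain ⟨b, hb, hm⟩ := H.exists_mass
    set m := ∫ y in (0:ℝ)..b, ps y with hmdef
    have hθα : θ ≤ α := hθ1.trans (min_le_left _ _)
    have hθ1' : θ ≤ 1 := hθ1.trans (min_le_right _ _)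
    set μ := θ / 4 with hμ
    have hμp : 0 < μ := by positivity
    set A := max (8 * b / μ) (max (8 / (3 * μ * m)) (max (2 * b / α) (2 * √T))) + 1 with hA
    have hA1 : 8 * b / μ < A := by
      linarith [le_max_left (8 * b / μ) (max (8 / (3 * μ * m)) (max (2 * b / α) (2 * √T)))]
    have hA' := le_max_right (8 * b / μ) (max (8 / (3 * μ * m)) (max (2 * b / α) (2 * √T)))
    have hA2 : 8 / (3 * μ * m) < A := by
      linarith [le_max_left (8 / (3 * μ * m)) (max (2 * b / α) (2 * √T))]
    have hA'' := le_max_right (8 / (3 * μ * m)) (max (2 * b / α) (2 * √T))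
    have hA3 : 2 * b / α < A := by linarith [le_max_left (2 * b / α) (2 * √T)]
    have hA4 : 2 * √T < A := by linarith [le_max_right (2 * b / α) (2 * √T)]
    have hAp : 0 < A := lt_trans (by positivity) hA1
    clear_value A
    refine ⟨μ / 8, ⟨by positivity, by linarith⟩, A ^ 2, by positivity, fun s hs x hx => ?_⟩
    set a := √s with ha
    have hsp : 0 < s := lt_of_lt_of_le (by positivity) hs
    have haA : A ≤ a := Real.le_sqrt_of_sq_le hs
    have hap : 0 < a := by linarith
    have ha2 : a ^ 2 = s := Real.sq_sqrt hsp.le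
    have b1 : b ≤ μ * a / 8 := by
      rw [div_lt_iff₀ hμp] at hA1
      linarith [mul_le_mul_of_nonneg_right haA hμp.le]
    have b2 : 8 ≤ 3 * (μ * a) * m := by
      rw [div_lt_iff₀ (by positivity)] at hA2
      linarith [mul_le_mul_of_nonneg_right haA (show 0 ≤ 3 * μ * m by positivity)]
    have b3 : 2 * b ≤ α * a := by
      rw [div_lt_iff₀ hα] at hA3
      linarith [mul_le_mul_of_nonneg_right haA hα.le]
    have b4 : T < s / 4 := by
      have : √T < a / 2 := by linarith
      rw [Real.sqrt_lt' (by positivity)] at this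
      linarith
    set R := μ * a with hR
    have hRp : 0 < R := by positivity
    have hRa : R ≤ a / 4 := by
      rw [hR, hμ]; linarith [mul_le_mul_of_nonneg_right hθ1' hap.le]
    have hR2 : 3 * R ^ 2 ≤ 3 * s / 16 := by
      linarith [pow_le_pow_left₀ hRp.le hRa 2]
    have hxR : |x| ≤ R / 8 := by rw [hR]; linarith
    have tlow : ∀ t, s - 3 * R ^ 2 ≤ t → s / 4 ≤ t := fun t ht => by linarith
    have inner : ∀ y ∈ Icc (x - R) (x + R), ∀ t ∈ Icc (s - 3 * R ^ 2) s, |y| ≤ θ * √t := by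
      intro y hy t ht
      have h1 : a / 2 ≤ √t := by
        refine Real.le_sqrt_of_sq_le ?_
        linarith [tlow t ht.1]
      have h2 : |y| ≤ 2 * R := by
        rw [abs_le] at hxR ⊢
        constructor <;> linarith [hy.1, hy.2, hxR.1, hxR.2]
      have h3 : θ * (a / 2) ≤ θ * √t := by gcongr
      rw [hR, hμ] at h2; linarith
    set q := (Ioc 0 b).indicator ps with hq
    have hI : ∫ y in (x - R)..(x + R), q y = m := by
      rw [intervalIntegral.integral_of_le (by linarith), hq,
        setIntegral_indicator measurableSet_Ioc, hmdef, intervalIntegral.integral_of_le hb.le]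
      congr 2
      ext y
      simp only [mem_inter_iff, mem_Ioc]
      rw [abs_le] at hxR
      exact ⟨fun h => h.2, fun h => ⟨⟨by linarith [h.1], by linarith [h.2]⟩, h⟩⟩
    have key := H.wall (c := x) (R := R) (s := s) (B := (3 / 4) ^ k * PsiP α β α) (ω := 0)
      (q := q) hRp (by linarith) (H.ps_locInt.indicator measurableSet_Ioc)
      (fun y => indicator_nonneg (fun y _ => (H.ps01 y).1) y) ?_ (by positivity)
      (fun y hy t ht => h t (by linarith [tlow t ht.1]) y (inner y hy t ht))
      (fun y hy t ht => ?_) ?_ rfl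
    · rw [hI] at key
      have hS : 1 ≤ 3 * R * m / 8 := by linarith
      set S := 3 * R * m / 8
      refine key.trans ?_
      rw [zero_add, pow_succ, div_le_iff₀ (by linarith)]
      have : 0 ≤ (3 / 4) ^ k * PsiP α β α * (S - 1) := mul_nonneg (by positivity) (by linarith)
      linarith
    · intro y hy
      rw [hq, indicator_of_notMem]
      rintro ⟨h1, h2⟩
      rw [abs_le] at hxR
      have : |y - x| ≤ R / 4 := abs_le.2 ⟨by linarith, by linarith⟩
      linarith
    · have htp : 0 < t := by linarith [tlow t ht.1]
      rw [psi_behind htp, sub_zero]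
      refine (inner y hy t ht).trans ?_
      gcongr
    · filter_upwards [(ae_restrict_iff' measurableSet_Ioi).1 H.ps_eq] with y hy t ht
      have htl := tlow t ht.1.le
      by_cases hyI : y ∈ Ioc 0 b
      · rw [hq, indicator_of_mem hyI]
        refine (hy hyI.1 t ?_).ge
        rw [div_lt_iff₀ (by positivity)]
        have h1 : (2 * y) ^ 2 ≤ (α * a) ^ 2 :=
          pow_le_pow_left₀ (by linarith [hyI.1]) (by linarith [hyI.2]) 2
        rw [mul_pow α, ha2] at h1
        have h2 : s / 2 * α ^ 2 ≤ t * α ^ 2 := by gcongr; linarith [ht.1]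
        linarith [pow_pos hyI.1 2]
      · rw [hq, indicator_of_notMem hyI]
        exact (H.p01 y t (by linarith)).1

/-- `u` tends to zero locally uniformly. -/
theorem decay (H : Sol α β ustar u p w ps) (X : ℝ) {ε : ℝ} (hε : 0 < ε) :
    ∃ T > 0, ∀ t ≥ T, ∀ x, |x| ≤ X → u x t ≤ ε := by
  have hΨ := PsiP_pos H.hα H.hβ
  obtain ⟨k, hk⟩ := exists_pow_lt_of_lt_one (show 0 < ε / PsiP α β α by positivity)
    (show (3 / 4 : ℝ) < 1 by norm_num)
  rw [lt_div_iff₀ hΨ] at hk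
  obtain ⟨θ, ⟨hθ, _⟩, T, hT, h⟩ := H.decay_step k
  refine ⟨max T ((X / θ) ^ 2), lt_of_lt_of_le hT (le_max_left _ _), fun t ht x hx => ?_⟩
  refine (h t ((le_max_left _ _).trans ht) x (hx.trans ?_)).trans hk.le
  have : X / θ ≤ √t := Real.le_sqrt_of_sq_le ((le_max_right _ _).trans ht)
  rw [div_le_iff₀ hθ] at this
  linarith

end Sol

/-- The exponential generating function of a sequence. -/
def egf (e : ℕ → ℝ) (z : ℝ) : ℝ := ∑' n : ℕ, e n * z ^ n / (n.factorial : ℝ)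

lemma egf_hasSum {e : ℕ → ℝ} (he : ∀ n, |e n| ≤ 1) (z : ℝ) :
    HasSum (fun n : ℕ => e n * z ^ n / (n.factorial : ℝ)) (egf e z) := by
  refine (Summable.of_norm_bounded (Real.summable_pow_div_factorial |z|) fun n => ?_).hasSum
  rw [Real.norm_eq_abs, abs_div, abs_mul, abs_pow, Nat.abs_cast]
  gcongr
  exact mul_le_of_le_one_left (by positivity) (he n)

lemma egf_shift_term (e : ℕ → ℝ) (z : ℝ) (n : ℕ) :
    ((n + 1 : ℕ) : ℝ) * e (n + 1) * z ^ n / ((n + 1).factorial : ℝ)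
      = e (n + 1) * z ^ n / (n.factorial : ℝ) := by
  rw [Nat.factorial_succ]
  have : (n.factorial : ℝ) ≠ 0 := by positivity
  push_cast
  field_simp

lemma egf_shift_hasSum {e : ℕ → ℝ} (he : ∀ n, |e (n + 1)| ≤ 1) (z : ℝ) :
    HasSum (fun n : ℕ => n * e n * z ^ n / (n.factorial : ℝ))
      (z * egf (fun n => e (n + 1)) z) := by
  rw [← hasSum_nat_add_iff' 1]
  simp only [Finset.range_one, Finset.sum_singleton, Nat.cast_zero, zero_mul, zero_div, sub_zero]
  refine ((egf_hasSum he z).mul_left z).congr_fun fun n => ?_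
  rw [← egf_shift_term]; ring

lemma hasDerivAt_egf {e : ℕ → ℝ} (he : ∀ n, |e n| ≤ 1) (z : ℝ) :
    HasDerivAt (egf e) (egf (fun n => e (n + 1)) z) z := by
  set R := |z| + 1 with hR
  have hR0 : 0 < R := by positivity
  have hz : z ∈ Metric.ball (0:ℝ) R := by simp [hR]
  have hs : Summable fun n : ℕ => (n:ℝ) * R ^ (n - 1) / (n.factorial : ℝ) := by
    rw [← summable_nat_add_iff 1]
    refine (Real.summable_pow_div_factorial R).congr fun n => ?_
    have := egf_shift_term (fun _ => 1) R n
    simp only [mul_one, one_mul] at this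
    simpa using this.symm
  have key := hasDerivAt_tsum_of_isPreconnected (𝕜 := ℝ)
    (g := fun n y => e n * y ^ n / (n.factorial : ℝ))
    (g' := fun n y => e n * (n * y ^ (n - 1)) / (n.factorial : ℝ)) hs Metric.isOpen_ball
    (convex_ball (0:ℝ) R).isPreconnected
    (fun n y _ => ((hasDerivAt_pow n y).const_mul (e n)).div_const _) (fun n y hy => ?_) hz
    (egf_hasSum he z).summable hz
  · refine key.congr_deriv ?_
    have hs2 : Summable fun n : ℕ => e n * (n * z ^ (n - 1)) / (n.factorial : ℝ) := by
      rw [← summable_nat_add_iff 1]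
      refine (egf_hasSum (fun n => he (n + 1)) z).summable.congr fun n => ?_
      rw [← egf_shift_term]; simp; ring
    rw [hs2.tsum_eq_zero_add]
    simp only [Nat.cast_zero, zero_mul, mul_zero, zero_div, zero_add]
    refine tsum_congr fun n => ?_
    rw [← egf_shift_term]; simp; ring
  · rw [Real.norm_eq_abs, abs_div, abs_mul, abs_mul, abs_pow, Nat.abs_cast, Nat.abs_cast]
    have hy' : |y| ≤ R := by simpa using (mem_ball_zero_iff.1 hy).le
    refine div_le_div_of_nonneg_right ?_ (by positivity)
    exact (mul_le_of_le_one_left (by positivity) (he n)).trans (by gcongr)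

/-- Quotients of rising factorials. -/
def pochQuot (a b : ℝ) (n : ℕ) : ℝ :=
  Polynomial.eval a (ascPochhammer ℝ n) / Polynomial.eval b (ascPochhammer ℝ n)

lemma kummerM_eq (a b : ℝ) : kummerM a b = egf (pochQuot a b) := rfl

lemma pochQuot_zero (a b : ℝ) : pochQuot a b 0 = 1 := by simp [pochQuot]

lemma pochQuot_succ (a b : ℝ) (n : ℕ) :
    pochQuot a b (n + 1) = pochQuot a b n * ((a + n) / (b + n)) := by
  simp only [pochQuot, ascPochhammer_succ_eval, div_mul_div_comm]

lemma abs_pochQuot_le {a b : ℝ} (ha : 0 < a) (hab : a ≤ b) (n : ℕ) : |pochQuot a b n| ≤ 1 := by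
  induction n with
  | zero => simp [pochQuot_zero]
  | succ n ih =>
    have h0 : 0 < a + n := by positivity
    have h1 : 0 < b + n := by linarith
    rw [pochQuot_succ, abs_mul, abs_of_nonneg (a := (a + n) / (b + n)) (by positivity)]
    exact mul_le_one₀ ih (by positivity) ((div_le_one h1).2 (by linarith))

lemma pochQuot_add_one (a b : ℝ) (n : ℕ) :
    a * pochQuot (a + 1) b n = (a + n) * pochQuot a b n := by
  induction n with
  | zero => simp [pochQuot_zero]
  | succ n ih =>
    rw [pochQuot_succ, pochQuot_succ, ← mul_assoc, ih]; push_cast; ring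

lemma kummerM_zero (a b : ℝ) : kummerM a b 0 = 1 := by
  rw [kummerM, tsum_eq_single 0 fun n hn => by simp [hn]]; simp

/-- The derivatives of contiguous Kummer functions. -/
lemma exists_kummerM_deriv {a b : ℝ} (ha : 0 < a) (hab : a + 1 ≤ b) (z : ℝ) :
    ∃ P' Q', HasDerivAt (kummerM a b) P' z ∧ HasDerivAt (kummerM (a + 1) b) Q' z ∧
      z * P' = a * (kummerM (a + 1) b z - kummerM a b z) ∧
      z * Q' = (z - (b - a - 1)) * kummerM (a + 1) b z + (b - a - 1) * kummerM a b z := by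
  have he := abs_pochQuot_le ha (show a ≤ b by linarith)
  have hd := abs_pochQuot_le (show 0 < a + 1 by linarith) hab
  refine ⟨_, _, hasDerivAt_egf he z, hasDerivAt_egf hd z, ?_, ?_⟩
  · refine (egf_shift_hasSum (fun n => he (n + 1)) z).unique
      ((((egf_hasSum hd z).sub (egf_hasSum he z)).mul_left a).congr_fun fun n => ?_)
    have := pochQuot_add_one a b n
    rw [show (n : ℝ) * pochQuot a b n = a * pochQuot (a + 1) b n - a * pochQuot a b n by
      rw [this]; ring]
    ring
  · have h1 := (egf_shift_hasSum (fun n => hd (n + 1)) z).add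
      (((egf_hasSum hd z).sub (egf_hasSum he z)).mul_left (b - a - 1))
    have h2 := egf_shift_hasSum (e := fun n => pochQuot (a + 1) b (n - 1)) (fun n => hd n) z
    have h3 := h1.unique (h2.congr_fun fun n => ?_)
    · simp only [Nat.add_sub_cancel] at h3
      rw [kummerM_eq, kummerM_eq]
      have h4 : egf (fun n => pochQuot (a + 1) b n) z = egf (pochQuot (a + 1) b) z := rfl
      rw [h4] at h3
      linarith
    · have hc : (n:ℝ) * pochQuot (a + 1) b n
          + (b - a - 1) * (pochQuot (a + 1) b n - pochQuot a b n)
          = n * pochQuot (a + 1) b (n - 1) := by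
        cases n with
        | zero => simp [pochQuot_zero]
        | succ n =>
          have hb : b + n ≠ 0 := by have : 0 ≤ (n:ℝ) := n.cast_nonneg
                                    linarith
          have hd' := pochQuot_add_one a b n
          rw [pochQuot_succ, pochQuot_succ, Nat.add_sub_cancel,
            show pochQuot a b n * ((a + n) / (b + n)) = (a + n) * pochQuot a b n / (b + n) by ring,
            ← hd']
          push_cast
          field_simp
          ring
      rw [← hc]; ring

lemma continuous_kummerM {a b : ℝ} (ha : 0 < a) (hab : a ≤ b) : Continuous (kummerM a b) :=
  continuous_iff_continuousAt.2 fun z =>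
    (hasDerivAt_egf (abs_pochQuot_le ha hab) z).continuousAt

/-- The profile solution of the similarity equation, regular at the origin, unnormalised. -/
def coreProfile (κ η : ℝ) : ℝ := η ^ κ * kummerM (κ / 2) (κ + 1 / 2) (-η ^ 2 / 4)

/-- The derivative of `coreProfile κ`. -/
def coreProfile₁ (κ η : ℝ) : ℝ := κ * η ^ (κ - 1) * kummerM (κ / 2 + 1) (κ + 1 / 2) (-η ^ 2 / 4)

section
variable {κ : ℝ}

lemma hasDerivAt_coreProfile (hκ : 1 ≤ κ) {η : ℝ} (hη : 0 < η) :
    HasDerivAt (coreProfile κ) (coreProfile₁ κ η) η := by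
  obtain ⟨P', Q', hP, -, h1, -⟩ := exists_kummerM_deriv (a := κ / 2) (b := κ + 1 / 2)
    (by linarith) (by linarith) (-η ^ 2 / 4)
  have hz : HasDerivAt (fun η : ℝ => -η ^ 2 / 4) (-η / 2) η := by
    refine (((hasDerivAt_pow 2 η).neg).div_const 4).congr_deriv ?_
    norm_num; ring
  have hr := Real.hasDerivAt_rpow_const (x := η) (p := κ) (Or.inl hη.ne')
  refine (hr.mul (hP.comp η hz)).congr_deriv ?_
  have e : η ^ κ = η ^ (κ - 1) * η := by
    rw [← Real.rpow_add_one hη.ne']; ring_nf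
  simp only [Function.comp, coreProfile₁]
  rw [e]
  linear_combination (2 * η ^ (κ - 1)) * h1

lemma hasDerivAt_coreProfile₁ (hκ : 1 ≤ κ) {η : ℝ} (hη : 0 < η) :
    HasDerivAt (coreProfile₁ κ) (κ * (κ - 1) / η ^ 2 * coreProfile κ η - η / 2 * coreProfile₁ κ η) η := by
  obtain ⟨P', Q', -, hQ, -, h2⟩ := exists_kummerM_deriv (a := κ / 2) (b := κ + 1 / 2)
    (by linarith) (by linarith) (-η ^ 2 / 4)
  have hz : HasDerivAt (fun η : ℝ => -η ^ 2 / 4) (-η / 2) η := by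
    refine (((hasDerivAt_pow 2 η).neg).div_const 4).congr_deriv ?_
    norm_num; ring
  have hr := (Real.hasDerivAt_rpow_const (x := η) (p := κ - 1) (Or.inl hη.ne')).const_mul κ
  refine (hr.mul (hQ.comp η hz)).congr_deriv ?_
  have e : η ^ (κ - 1) = η ^ (κ - 1 - 1) * η := by
    rw [← Real.rpow_add_one hη.ne']; ring_nf
  have e' : η ^ κ = η ^ (κ - 1) * η := by
    rw [← Real.rpow_add_one hη.ne']; ring_nf
  simp only [Function.comp, coreProfile₁, coreProfile]
  rw [e', e]
  generalize kummerM (κ / 2) (κ + 1 / 2) (-η ^ 2 / 4) = P at h2 ⊢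
  generalize kummerM (κ / 2 + 1) (κ + 1 / 2) (-η ^ 2 / 4) = Q at h2 ⊢
  generalize η ^ (κ - 1 - 1) = l
  field_simp
  linear_combination (4 * l) * h2

lemma exists_coreProfile_pos_near (hκ : 1 ≤ κ) :
    ∃ r > 0, ∀ η, 0 < η → η ≤ r → 0 < coreProfile κ η ∧ 0 < coreProfile₁ κ η := by
  have hP : Continuous fun η : ℝ => kummerM (κ / 2) (κ + 1 / 2) (-η ^ 2 / 4) :=
    (continuous_kummerM (by linarith) (by linarith)).comp (by fun_prop)
  have hQ : Continuous fun η : ℝ => kummerM (κ / 2 + 1) (κ + 1 / 2) (-η ^ 2 / 4) :=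
    (continuous_kummerM (by linarith) (by linarith)).comp (by fun_prop)
  have h1 : ∀ᶠ η in nhds (0:ℝ), 0 < kummerM (κ / 2) (κ + 1 / 2) (-η ^ 2 / 4) :=
    hP.continuousAt.eventually (lt_mem_nhds (by simp [kummerM_zero]))
  have h2 : ∀ᶠ η in nhds (0:ℝ), 0 < kummerM (κ / 2 + 1) (κ + 1 / 2) (-η ^ 2 / 4) :=
    hQ.continuousAt.eventually (lt_mem_nhds (by simp [kummerM_zero]))
  obtain ⟨r, hr, h⟩ := Metric.eventually_nhds_iff.1 (h1.and h2)
  refine ⟨r / 2, by positivity, fun η h0 h3 => ?_⟩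
  obtain ⟨h4, h5⟩ := h (y := η) (by rw [Real.dist_eq, sub_zero, abs_of_pos h0]; linarith)
  exact ⟨mul_pos (Real.rpow_pos_of_pos h0 _) h4,
    mul_pos (mul_pos (by linarith) (Real.rpow_pos_of_pos h0 _)) h5⟩

lemma coreProfile₁_pos_of (hκ : 1 ≤ κ) {s : ℝ} (hs : 0 < s) (h : ∀ η, 0 < η → η < s → 0 < coreProfile κ η) :
    0 < coreProfile₁ κ s := by
  obtain ⟨r, hr, hr'⟩ := exists_coreProfile_pos_near hκ
  set y := min r s with hy
  have hy0 : 0 < y := lt_min hr hs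
  have hd : ∀ η > 0, HasDerivAt (fun η => coreProfile₁ κ η * Real.exp (η ^ 2 / 4))
      (κ * (κ - 1) / η ^ 2 * coreProfile κ η * Real.exp (η ^ 2 / 4)) η := fun η hη => by
    have hz : HasDerivAt (fun η : ℝ => η ^ 2 / 4) (η / 2) η := by
      refine ((hasDerivAt_pow 2 η).div_const 4).congr_deriv ?_
      norm_num; ring
    refine ((hasDerivAt_coreProfile₁ hκ hη).mul hz.exp).congr_deriv ?_
    ring
  have hmono : MonotoneOn (fun η => coreProfile₁ κ η * Real.exp (η ^ 2 / 4)) (Icc y s) := by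
    refine monotoneOn_of_deriv_nonneg (convex_Icc y s)
      (fun η hη => (hd η (hy0.trans_le hη.1)).continuousAt.continuousWithinAt)
      (fun η hη => ?_) fun η hη => ?_
    · rw [interior_Icc] at hη
      exact (hd η (hy0.trans hη.1)).differentiableAt.differentiableWithinAt
    · rw [interior_Icc] at hη
      have := h η (hy0.trans hη.1) hη.2
      have h0 : 0 ≤ κ * (κ - 1) := mul_nonneg (by linarith) (by linarith)
      rw [(hd η (hy0.trans hη.1)).deriv]
      positivity
  have h1 := hmono ⟨le_rfl, min_le_right _ _⟩ ⟨min_le_right _ _, le_rfl⟩ (min_le_right r s)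
  have h2 := (hr' y hy0 (min_le_left _ _)).2
  have h3 : 0 < coreProfile₁ κ y * Real.exp (y ^ 2 / 4) := by positivity
  exact pos_of_mul_pos_left (h3.trans_le h1) (Real.exp_pos _).le

lemma coreProfile_pos (hκ : 1 ≤ κ) {η : ℝ} (hη : 0 < η) : 0 < coreProfile κ η := by
  by_contra hneg
  obtain ⟨r, hr, hr'⟩ := exists_coreProfile_pos_near hκ
  have hrη : r < η := by
    by_contra hc
    exact hneg (hr' η hη (not_lt.1 hc)).1
  set S := Icc r η ∩ coreProfile κ ⁻¹' Iic 0 with hS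
  have hcont : ∀ s > 0, ContinuousOn (coreProfile κ) (Icc r s) := fun s _ y hy =>
    (hasDerivAt_coreProfile hκ (hr.trans_le hy.1)).continuousAt.continuousWithinAt
  have hcl : IsClosed S := (hcont η hη).preimage_isClosed_of_isClosed isClosed_Icc isClosed_Iic
  have hne : S.Nonempty := ⟨η, ⟨hrη.le, le_rfl⟩, not_lt.1 hneg⟩
  have hbd : BddBelow S := ⟨r, fun y hy => hy.1.1⟩
  obtain ⟨⟨h1, h2⟩, h3⟩ := hcl.csInf_mem hne hbd
  set s := sInf S with hs
  have hs0 : 0 < s := hr.trans_le h1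
  have hpos : ∀ y, 0 < y → y < s → 0 < coreProfile κ y := fun y hy hys => by
    by_contra hc
    rcases le_or_gt y r with h | h
    · exact hc (hr' y hy h).1
    · exact absurd (csInf_le hbd ⟨⟨h.le, (hys.trans_le h2).le⟩, not_lt.1 hc⟩) (not_le.2 hys)
  have hmono : MonotoneOn (coreProfile κ) (Icc r s) := by
    refine monotoneOn_of_deriv_nonneg (convex_Icc r s) (hcont s hs0) (fun y hy => ?_)
      fun y hy => ?_
    · rw [interior_Icc] at hy
      exact (hasDerivAt_coreProfile hκ (hr.trans hy.1)).differentiableAt.differentiableWithinAt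
    · rw [interior_Icc] at hy
      rw [(hasDerivAt_coreProfile hκ (hr.trans hy.1)).deriv]
      exact (coreProfile₁_pos_of hκ (hr.trans hy.1) fun x hx hxy => hpos x hx (hxy.trans hy.2)).le
  have h4 := hmono ⟨le_rfl, h1⟩ ⟨h1, le_rfl⟩ h1
  exact absurd ((hr' r hr le_rfl).1.trans_le h4) (not_lt.2 h3)

lemma coreProfile₁_pos (hκ : 1 ≤ κ) {η : ℝ} (hη : 0 < η) : 0 < coreProfile₁ κ η :=
  coreProfile₁_pos_of hκ hη fun _ h _ => coreProfile_pos hκ h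

lemma coreProfile_le_deriv (hκ : 1 ≤ κ) {η : ℝ} (hη : 0 < η) :
    coreProfile κ η ≤ η * coreProfile₁ κ η + η ^ 2 / 4 * coreProfile κ η := by
  set D : ℝ → ℝ := fun η => Real.exp (η ^ 2 / 8) * (η ^ κ *
    (κ * kummerM (κ / 2 + 1) (κ + 1 / 2) (-η ^ 2 / 4)
      + (η ^ 2 / 4 - 1) * kummerM (κ / 2) (κ + 1 / 2) (-η ^ 2 / 4))) with hD
  have hP : Continuous fun η : ℝ => kummerM (κ / 2) (κ + 1 / 2) (-η ^ 2 / 4) :=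
    (continuous_kummerM (by linarith) (by linarith)).comp (by fun_prop)
  have hQ : Continuous fun η : ℝ => kummerM (κ / 2 + 1) (κ + 1 / 2) (-η ^ 2 / 4) :=
    (continuous_kummerM (by linarith) (by linarith)).comp (by fun_prop)
  have hr : Continuous fun η : ℝ => η ^ κ := Real.continuous_rpow_const (by linarith)
  have hDc : Continuous D := by
    refine Continuous.mul (by fun_prop) (hr.mul ((continuous_const.mul hQ).add
      (Continuous.mul (by fun_prop) hP)))
  have hDeq : ∀ η > 0, D η = Real.exp (η ^ 2 / 8) *
      (η * coreProfile₁ κ η + (η ^ 2 / 4 - 1) * coreProfile κ η) := fun η hη => by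
    have e : η ^ κ = η ^ (κ - 1) * η := by
      rw [← Real.rpow_add_one hη.ne']; ring_nf
    simp only [hD, coreProfile₁, coreProfile, e]; ring
  have hd : ∀ η > 0, HasDerivAt D
      (Real.exp (η ^ 2 / 8) * ((κ * (κ - 1) / η + η ^ 3 / 16 + η / 4) * coreProfile κ η)) η :=
    fun η hη => by
    have hz : HasDerivAt (fun η : ℝ => η ^ 2 / 8) (η / 4) η := by
      refine ((hasDerivAt_pow 2 η).div_const 8).congr_deriv ?_
      norm_num; ring
    have hq : HasDerivAt (fun η : ℝ => η ^ 2 / 4 - 1) (η / 2) η := by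
      refine (((hasDerivAt_pow 2 η).div_const 4).sub_const 1).congr_deriv ?_
      norm_num; ring
    have := hz.exp.mul (((hasDerivAt_id η).mul (hasDerivAt_coreProfile₁ hκ hη)).add
      (hq.mul (hasDerivAt_coreProfile hκ hη)))
    refine (this.congr_deriv ?_).congr_of_eventuallyEq ?_
    · simp only [id, Pi.mul_apply, Pi.add_apply]
      field_simp
      ring
    · filter_upwards [lt_mem_nhds hη] with y hy
      exact hDeq y hy
  have hmono : MonotoneOn D (Ici 0) := by
    refine monotoneOn_of_deriv_nonneg (convex_Ici 0) hDc.continuousOn (fun y hy => ?_)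
      fun y hy => ?_
    · rw [interior_Ici] at hy
      exact (hd y hy).differentiableAt.differentiableWithinAt
    · rw [interior_Ici] at hy
      replace hy : 0 < y := hy
      have h0 : 0 ≤ κ * (κ - 1) := mul_nonneg (by linarith) (by linarith)
      have := coreProfile_pos hκ hy
      rw [(hd y hy).deriv]
      positivity
  have h1 := hmono (mem_Ici.2 le_rfl) (mem_Ici.2 hη.le) hη.le
  have h2 : D 0 = 0 := by
    simp only [hD]
    rw [Real.zero_rpow (by linarith)]; ring
  rw [h2, hDeq η hη] at h1
  have := nonneg_of_mul_nonneg_right h1 (Real.exp_pos _)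
  linarith

lemma exists_coreProfile_le (hκ : 1 ≤ κ) (α : ℝ) :
    ∃ C > 0, ∀ η, 0 < η → η ≤ α → coreProfile κ η ≤ C * η := by
  have hP : Continuous fun η : ℝ => kummerM (κ / 2) (κ + 1 / 2) (-η ^ 2 / 4) :=
    (continuous_kummerM (by linarith) (by linarith)).comp (by fun_prop)
  have hr : Continuous fun η : ℝ => η ^ (κ - 1) := Real.continuous_rpow_const (by linarith)
  obtain ⟨C, hC⟩ := (isCompact_Icc (a := (0:ℝ)) (b := α)).exists_bound_of_continuousOn
    (hr.mul hP).continuousOn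
  refine ⟨max C 1, by positivity, fun η h0 h1 => ?_⟩
  have h2 := (le_abs_self _).trans (hC η ⟨h0.le, h1⟩)
  have e : η ^ κ = η ^ (κ - 1) * η := by
    rw [← Real.rpow_add_one h0.ne']; ring_nf
  calc coreProfile κ η = (η ^ (κ - 1) * kummerM (κ / 2) (κ + 1 / 2) (-η ^ 2 / 4)) * η := by
        rw [coreProfile, e]; ring
    _ ≤ max C 1 * η := mul_le_mul_of_nonneg_right (h2.trans (le_max_left _ _)) h0.le

end

/-- The part behind the parabola of the limit profile, normalised. -/
structure Prof (α β γ : ℝ) (φ φ₁ φ₂ : ℝ → ℝ) : Prop where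
  der : ∀ η > 0, HasDerivAt φ (φ₁ η) η
  der2 : ∀ η > 0, HasDerivAt φ₁ (φ₂ η) η
  ode : ∀ η > 0, φ₂ η + η / 2 * φ₁ η = γ / η ^ 2 * φ η
  pos : ∀ η > 0, 0 < φ η
  pos₁ : ∀ η > 0, 0 < φ₁ η
  conv : ∀ η > 0, φ η ≤ η * φ₁ η + η ^ 2 / 4 * φ η
  lin : ∃ C > 0, ∀ η, 0 < η → η ≤ α → φ η ≤ C * η
  jump : φ₁ α + Real.exp (-α ^ 2 / 4) / gtail α * φ α = α * β / 2
  behind : ∀ η, 0 < η → η ≤ α → Phi α β γ η = φ η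
  zero : Phi α β γ 0 = 0
  ahead : ∀ η ≥ α, Phi α β γ η = φ α * (gtail η / gtail α)

theorem exists_prof {α β γ : ℝ} (hα : 0 < α) (hβ : 0 < β) (hγ : 0 ≤ γ) :
    ∃ φ φ₁ φ₂, Prof α β γ φ φ₁ φ₂ := by
  set κ := kappaOf γ with hκdef
  have hsq : Real.sqrt (4 * γ + 1) ^ 2 = 4 * γ + 1 := Real.sq_sqrt (by linarith)
  have hκ : 1 ≤ κ := by
    have : 1 ≤ Real.sqrt (4 * γ + 1) := Real.one_le_sqrt.2 (by linarith)
    simp only [hκdef, kappaOf]; linarith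
  have hκγ : κ * (κ - 1) = γ := by
    simp only [hκdef, kappaOf]; linear_combination hsq / 4
  have hFα := coreProfile_pos hκ hα
  have hF1 := coreProfile₁_pos hκ hα
  have hg := gtail_pos α
  have hratio : κ * kummerM (κ / 2 + 1) (κ + 1 / 2) (-α ^ 2 / 4) /
      (α * kummerM (κ / 2) (κ + 1 / 2) (-α ^ 2 / 4)) = coreProfile₁ κ α / coreProfile κ α := by
    have e : α ^ κ = α ^ (κ - 1) * α := by
      rw [← Real.rpow_add_one hα.ne']; ring_nf
    have hm : 0 < α ^ (κ - 1) := Real.rpow_pos_of_pos hα _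
    rw [coreProfile₁, coreProfile, e]
    rw [show κ * α ^ (κ - 1) * kummerM (κ / 2 + 1) (κ + 1 / 2) (-α ^ 2 / 4) =
      α ^ (κ - 1) * (κ * kummerM (κ / 2 + 1) (κ + 1 / 2) (-α ^ 2 / 4)) by ring,
      show α ^ (κ - 1) * α * kummerM (κ / 2) (κ + 1 / 2) (-α ^ 2 / 4) =
      α ^ (κ - 1) * (α * kummerM (κ / 2) (κ + 1 / 2) (-α ^ 2 / 4)) by ring,
      mul_div_mul_left _ _ hm.ne']
  have hpi : 0 < Real.sqrt Real.pi := Real.sqrt_pos.2 Real.pi_pos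
  set c := ustarGamma α β γ with hc
  have hc' : c = (α * β / 2) *
      (coreProfile₁ κ α / coreProfile κ α + Real.exp (-α ^ 2 / 4) / gtail α)⁻¹ := by
    rw [hc, ustarGamma, ← hκdef, hratio, erfc_half, mul_div_cancel₀ _ hpi.ne']
  have hbr : 0 < coreProfile₁ κ α / coreProfile κ α + Real.exp (-α ^ 2 / 4) / gtail α := by positivity
  have hc0 : 0 < c := by rw [hc']; positivity
  have hself : c / coreProfile κ α * coreProfile κ α = c := div_mul_cancel₀ _ hFα.ne'
  have hk : 0 < c / coreProfile κ α := by positivity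
  have hphi : ∀ η ≥ α, Phi α β γ η = c / coreProfile κ α * coreProfile κ α * (gtail η / gtail α) :=
    fun η hη => by
    rw [Phi, if_neg (not_lt.2 hη), erfc_half, erfc_half, hself, ← hc]
    field_simp
  refine ⟨fun η => c / coreProfile κ α * coreProfile κ η, fun η => c / coreProfile κ α * coreProfile₁ κ η,
    fun η => c / coreProfile κ α * (κ * (κ - 1) / η ^ 2 * coreProfile κ η - η / 2 * coreProfile₁ κ η),
    fun η hη => (hasDerivAt_coreProfile hκ hη).const_mul _,
    fun η hη => (hasDerivAt_coreProfile₁ hκ hη).const_mul _, fun η hη => by rw [hκγ]; ring,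
    fun η hη => mul_pos hk (coreProfile_pos hκ hη), fun η hη => mul_pos hk (coreProfile₁_pos hκ hη),
    fun η hη => ?_, ?_, ?_, ?_, ?_, hphi⟩
  · have := mul_le_mul_of_nonneg_left (coreProfile_le_deriv hκ hη) hk.le
    linarith
  · obtain ⟨C, hC, h⟩ := exists_coreProfile_le hκ α
    refine ⟨c / coreProfile κ α * C, by positivity, fun η h0 h1 => ?_⟩
    have := mul_le_mul_of_nonneg_left (h η h0 h1) hk.le
    linarith
  · show c / coreProfile κ α * coreProfile₁ κ α
      + Real.exp (-α ^ 2 / 4) / gtail α * (c / coreProfile κ α * coreProfile κ α) = α * β / 2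
    rw [hself]
    have : c * (coreProfile₁ κ α / coreProfile κ α + Real.exp (-α ^ 2 / 4) / gtail α) = α * β / 2 := by
      rw [hc', mul_assoc, inv_mul_cancel₀ hbr.ne', mul_one]
    rw [← this]; ring
  · intro η h0 h1
    rcases h1.lt_or_eq with h | rfl
    · rw [Phi, if_pos h, ← hκdef, ← hc]
      show _ = c / coreProfile κ α * coreProfile κ η
      simp only [coreProfile]; ring
    · rw [hphi η le_rfl, div_self hg.ne', mul_one]
  · rw [Phi, if_pos hα, ← hκdef, Real.zero_rpow (by linarith)]; simp

lemma hasDerivAt_inv_sqrt (A : ℝ) {t : ℝ} (ht : 0 < t) :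
    HasDerivAt (fun t => A / √t) (-(A / (2 * t * √t))) t := by
  have hs := Real.sqrt_pos.2 ht
  have := (hasDerivAt_const t A).div ((hasDerivAt_id t).sqrt ht.ne') hs.ne'
  refine this.congr_deriv ?_
  have e : √t ^ 2 = t := Real.sq_sqrt ht.le
  simp only [id, zero_mul, zero_sub, mul_one_div]
  rw [e]; field_simp

/-- The heat kernel. -/
lemma hasBal_heatKernel (A : ℝ) :
    HasBal (fun x t => A / √t * Real.exp (-(x / √t) ^ 2 / 4)) (fun _ _ => 0) {q | 0 < q.2} := by
  have h := hasBal_similarity (g := fun η => Real.exp (-η ^ 2 / 4))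
    (g₁ := fun η => -(η / 2) * Real.exp (-η ^ 2 / 4))
    (g₂ := fun η => -(1 / 2) * Real.exp (-η ^ 2 / 4)
      + -(η / 2) * (-(η / 2) * Real.exp (-η ^ 2 / 4)))
    (θ := fun t : ℝ => A / √t) (θ' := fun t : ℝ => -(A / (2 * t * √t)))
    (S := univ) (U := {q : ℝ × ℝ | 0 < q.2}) (fun η _ => hasDerivAt_gaussExp η)
    (fun η _ => ?_) (by fun_prop) (fun t ht => hasDerivAt_inv_sqrt A ht) ?_
    (fun q hq => ⟨hq, mem_univ _⟩)
  · refine h.congr (isOpen_lt continuous_const continuous_snd) (fun x t _ => rfl) fun x t ht => ?_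
    have ht : 0 < t := ht
    have hs := Real.sqrt_pos.2 ht
    field_simp
    ring
  · have h1 : HasDerivAt (fun η : ℝ => -(η / 2)) (-(1 / 2)) η :=
      ((hasDerivAt_id η).div_const 2).neg
    exact h1.mul (hasDerivAt_gaussExp η)
  · refine (continuousOn_const.div (by fun_prop) fun t ht => ?_).neg
    have ht : 0 < t := ht
    have hs := Real.sqrt_pos.2 ht
    positivity

/-- A comparison principle on a half line: a subsolution that is dominated by a Gaussian tail and
is small on the lateral boundary decays like the heat kernel, up to the lateral bound. -/
lemma le_add_of_gaussian_tail {z : ℝ → ℝ → ℝ} {X T K δ : ℝ} (hX : 0 ≤ X) (hT : 0 < T)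
    (hK : 0 ≤ K) (hδ : 0 < δ)
    (hz : ContinuousOn (fun q : ℝ × ℝ => z q.1 q.2) (Ici X ×ˢ Ici T))
    (hX' : ∀ t ≥ T, z X t ≤ δ) (htail : ∀ x ≥ X, ∀ t ≥ T, z x t ≤ K * gtail (x / √t))
    (h : ∀ x > X, ∀ t > T, 0 < z x t → LocSub z x t ∨ ∃ m₁ m₂, m₁ < m₂ ∧
      HasDerivWithinAt (fun y => z y t) m₁ (Iic x) x ∧
      HasDerivWithinAt (fun y => z y t) m₂ (Ici x) x)
    {x t : ℝ} (hx : X ≤ x) (ht : T ≤ t) : z x t ≤ δ + K * gtail 0 * √T / √t := by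
  have ht0 : 0 < t := hT.trans_le ht
  have hst := Real.sqrt_pos.2 ht0
  have hsT := Real.sqrt_pos.2 hT
  have hg0 := gtail_pos 0
  set A := K * gtail 0 * √T with hA
  have hA0 : 0 ≤ A := by positivity
  obtain ⟨R, hRx, hR⟩ : ∃ R, x ≤ R ∧ K * gtail (R / √t) ≤ δ := by
    have h1 := (tendsto_gtail.comp (tendsto_id.atTop_div_const hst)).const_mul K
    rw [mul_zero] at h1
    obtain ⟨R, h2, h3⟩ := ((h1.eventually (gt_mem_nhds hδ)).and (eventually_ge_atTop x)).exists
    exact ⟨R, h3, h2.le⟩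
  have hB : HasBal (fun x t => A / √t * Real.exp (-(x / √t) ^ 2 / 4) + (δ + 0 * (x - 0) ^ 2 + 0 * t))
      (fun _ _ => 0) {q : ℝ × ℝ | 0 < q.2} := by
    refine ((hasBal_heatKernel A).add (hasBal_quad δ 0 0 0 _)).congr
      (isOpen_lt continuous_const continuous_snd) (fun _ _ _ => rfl) fun x t _ => by ring
  have hopen : IsOpen {q : ℝ × ℝ | 0 < q.2} := isOpen_lt continuous_const continuous_snd
  have key := max_principle_rect (a := X) (b := R) (t₁ := T) (t₂ := t)
    (z := fun x t => z x t - (A / √t * Real.exp (-(x / √t) ^ 2 / 4) +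
      (δ + 0 * (x - 0) ^ 2 + 0 * t))) ?_ ?_ ?_ ?_ ?_ x ⟨hx, hRx⟩ t ⟨ht, le_rfl⟩
  · have h1 : Real.exp (-(x / √t) ^ 2 / 4) ≤ 1 := Real.exp_le_one_iff.2 (by
      have := sq_nonneg (x / √t); linarith)
    have h2 : A / √t * Real.exp (-(x / √t) ^ 2 / 4) ≤ A / √t :=
      mul_le_of_le_one_right (by positivity) h1
    linarith
  · refine (hz.mono (Set.prod_mono Icc_subset_Ici_self Icc_subset_Ici_self)).sub fun q hq => ?_
    exact (hB.continuousAt (hopen.mem_nhds (hT.trans_le hq.2.1))).continuousWithinAt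
  · intro y hy
    have h1 := htail y hy.1 T le_rfl
    have h2 := mul_le_mul_of_nonneg_left
      (gtail_le (y / √T) (div_nonneg (hX.trans hy.1) hsT.le)) hK
    have h3 : A / √T = K * gtail 0 := by rw [hA, mul_div_cancel_right₀ _ hsT.ne']
    rw [h3]
    linarith
  · intro s hs
    have h1 := hX' s hs.1
    have h2 : 0 ≤ A / √s * Real.exp (-(X / √s) ^ 2 / 4) := by positivity
    linarith
  · intro s hs
    have hs0 := hT.trans_le hs.1
    have hR0 : 0 ≤ R := hX.trans (hx.trans hRx)
    have h1 := htail R (hx.trans hRx) s hs.1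
    have h3 : R / √t ≤ R / √s := by
      have := Real.sqrt_pos.2 hs0
      have := Real.sqrt_le_sqrt hs.2
      gcongr
    have h4 := mul_le_mul_of_nonneg_left (gtail_anti h3) hK
    have h2 : 0 ≤ A / √s * Real.exp (-(R / √s) ^ 2 / 4) := by positivity
    linarith
  · intro y hy s hs hpos
    have hs0 : 0 < s := hT.trans hs.1
    have hnn : ∀ q : ℝ × ℝ, 0 ≤ A / √q.2 * Real.exp (-(q.1 / √q.2) ^ 2 / 4) := fun q => by
      positivity
    have h2 := hnn (y, s)
    simp only at h2
    rcases h y hy.1 s hs.1 (by linarith) with ⟨U, hU, f, hf, hsub⟩ | ⟨m₁, m₂, hm, hl, hr⟩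
    · left
      refine ⟨U ∩ {q | 0 < q.2}, inter_mem hU (hopen.mem_nhds hs0), _,
        (hf.mono inter_subset_left).sub (hB.mono inter_subset_right), ?_⟩
      filter_upwards [hsub] with q hq hqU hqs hqpos
      have := hq hqU.1 hqs (by have := hnn q; linarith)
      linarith
    · right
      have hd : HasDerivAt (fun y => A / √s * Real.exp (-(y / √s) ^ 2 / 4)
          + (δ + 0 * (y - 0) ^ 2 + 0 * s))
          (A / √s * (-(y / √s / 2) * Real.exp (-(y / √s) ^ 2 / 4) * (1 / √s))) y := by
        have h1 := (((hasDerivAt_gaussExp (y / √s)).comp y (hasDerivAt_sim_x y)).const_mul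
          (A / √s)).add_const (δ + 0)
        refine h1.congr_of_eventuallyEq (Eventually.of_forall fun y => ?_)
        simp
      exact not_isLocalMax_of_kink (hl.sub hd.hasDerivWithinAt) (hr.sub hd.hasDerivWithinAt)
        (by linarith)

/-- The tail defect of a density relative to the inverse square law. -/
def corr₁ (ps : ℝ → ℝ) (γ x : ℝ) : ℝ := γ / x - ∫ y in Ioi x, ps y

/-- A primitive of the tail defect. -/
def corr (ps : ℝ → ℝ) (γ x : ℝ) : ℝ := ∫ y in (1:ℝ)..x, corr₁ ps γ y

lemma corr_small {ps : ℝ → ℝ} {γ : ℝ}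
    (hG : Tendsto (fun x => x * ∫ y in Ioi x, ps y) atTop (nhds γ)) {ε : ℝ} (hε : 0 < ε) :
    ∃ X > 0, ∀ x ≥ X, |corr₁ ps γ x * x| ≤ ε := by
  obtain ⟨N, hN⟩ := Metric.tendsto_atTop.1 hG ε hε
  refine ⟨max N 1, by positivity, fun x hx => ?_⟩
  have h1 := (hN x ((le_max_left _ _).trans hx)).le
  have hx0 : 0 < x := lt_of_lt_of_le (by positivity) ((le_max_right N 1).trans hx)
  rw [Real.dist_eq, abs_sub_comm] at h1
  have e : corr₁ ps γ x * x = γ - x * ∫ y in Ioi x, ps y := by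
    rw [corr₁]; field_simp
  rwa [e]

namespace Sol
variable {α β ustar : ℝ} {u p w : ℝ → ℝ → ℝ} {ps : ℝ → ℝ} {γ : ℝ}

lemma corr₁_sub (H : Sol α β ustar u p w ps) {x₁ x₂ : ℝ} (h₁ : 0 < x₁) (h₂ : x₁ ≤ x₂) :
    corr₁ ps γ x₂ - corr₁ ps γ x₁ = ∫ y in x₁..x₂, (ps y - γ / y ^ 2) := by
  have h0 : (0:ℝ) ∉ uIcc x₁ x₂ := by
    rw [uIcc_of_le h₂]; exact fun h => absurd h.1 (not_le.2 h₁)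
  have hne : ∀ y ∈ uIcc x₁ x₂, y ≠ 0 := fun y hy h => h0 (h ▸ hy)
  have hi : IntervalIntegrable (fun y => γ / y ^ 2) volume x₁ x₂ :=
    (continuousOn_const.div (by fun_prop) fun y hy => pow_ne_zero 2 (hne y hy)).intervalIntegrable
  rw [intervalIntegral.integral_sub (H.ps_ii _ _) hi]
  have e1 : ∫ y in x₁..x₂, γ / y ^ 2 = γ / x₁ - γ / x₂ := by
    rw [intervalIntegral.integral_eq_sub_of_hasDerivAt (f := fun y => -(γ / y)) (fun y hy => ?_) hi]
    · ring
    · refine ((hasDerivAt_const y γ).div (hasDerivAt_id y) (hne y hy)).neg.congr_deriv ?_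
      simp [neg_div]
  have e2 : (∫ y in x₁..x₂, ps y) = (∫ y in Ioi x₁, ps y) - ∫ y in Ioi x₂, ps y := by
    have := intervalIntegral.integral_Ioi_sub_Ioi
      (H.ps_integrable.mono_set (Ioi_subset_Ioi h₁.le)) h₂
    rw [this]
  rw [e1, e2, corr₁, corr₁]; ring

lemma corr₁_continuousOn (H : Sol α β ustar u p w ps) : ContinuousOn (corr₁ ps γ) (Ioi 0) := by
  have hc : Continuous fun x => ∫ y in (1:ℝ)..x, ps y :=
    intervalIntegral.continuous_primitive H.ps_ii 1
  have h2 : ContinuousOn (fun x => γ / x + ((∫ y in (1:ℝ)..x, ps y) - ∫ y in Ioi (1:ℝ), ps y))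
      (Ioi 0) :=
    (continuousOn_const.div continuousOn_id fun x hx => ne_of_gt hx).add
      (hc.continuousOn.sub continuousOn_const)
  refine h2.congr fun x hx => ?_
  have hx : 0 < x := hx
  have := intervalIntegral.integral_interval_add_Ioi
    (H.ps_integrable.mono_set (Ioi_subset_Ioi zero_le_one))
    (H.ps_integrable.mono_set (Ioi_subset_Ioi hx.le))
  rw [corr₁]; linarith

lemma corr_hasDerivAt (H : Sol α β ustar u p w ps) {x : ℝ} (hx : 0 < x) :
    HasDerivAt (corr ps γ) (corr₁ ps γ x) x := by
  have hc := H.corr₁_continuousOn (γ := γ)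
  refine intervalIntegral.integral_hasDerivAt_right ?_ ?_ (hc.continuousAt (Ioi_mem_nhds hx))
  · refine (hc.mono fun y hy => ?_).intervalIntegrable
    exact lt_of_lt_of_le (lt_min one_pos hx) hy.1
  · exact hc.stronglyMeasurableAtFilter isOpen_Ioi x hx

lemma corr_log (H : Sol α β ustar u p w ps) {X ε x y : ℝ} (hX : 0 < X)
    (h : ∀ x ≥ X, |corr₁ ps γ x * x| ≤ ε) (hx : X ≤ x) (hxy : x ≤ y) :
    |corr ps γ x - corr ps γ y| ≤ ε * Real.log (y / x) := by
  have hx0 := hX.trans_le hx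
  have aux : ∀ σ : ℝ, |σ| = 1 → σ * (corr ps γ y - corr ps γ x) ≤ ε * Real.log (y / x) := by
    intro σ hσ
    have hd : ∀ z ∈ Icc x y, HasDerivAt (fun z => ε * Real.log z - σ * corr ps γ z)
        (ε * z⁻¹ - σ * corr₁ ps γ z) z := fun z hz =>
      ((Real.hasDerivAt_log (hx0.trans_le hz.1).ne').const_mul ε).sub
        ((H.corr_hasDerivAt (hx0.trans_le hz.1)).const_mul σ)
    have hm : MonotoneOn (fun z => ε * Real.log z - σ * corr ps γ z) (Icc x y) := by
      refine monotoneOn_of_deriv_nonneg (convex_Icc x y)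
        (fun z hz => (hd z hz).continuousAt.continuousWithinAt)
        (fun z hz => (hd z (interior_subset hz)).differentiableAt.differentiableWithinAt)
        fun z hz => ?_
      have hz' := interior_subset hz
      have hz0 := hx0.trans_le hz'.1
      rw [(hd z hz').deriv]
      have h1 := h z (hx.trans hz'.1)
      have h2 : σ * (corr₁ ps γ z * z) ≤ ε := by
        refine (le_abs_self _).trans ?_
        rwa [abs_mul, hσ, one_mul]
      have h3 : σ * corr₁ ps γ z ≤ ε * z⁻¹ := by
        rw [← div_eq_mul_inv, le_div_iff₀ hz0]; linarith
      linarith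
    have := hm ⟨le_rfl, hxy⟩ ⟨hxy, le_rfl⟩ hxy
    rw [Real.log_div (hx0.trans_le hxy).ne' hx0.ne']
    simp only at this
    linarith
  have h1 := aux 1 (by simp)
  have h2 := aux (-1) (by simp)
  exact abs_le.2 ⟨by linarith, by linarith⟩

/-- Integral balance for a similarity profile weighted by the corrector. -/
lemma profile_hasBal (H : Sol α β ustar u p w ps) {a : ℝ} (ha : 0 < a) {g g₁ g₂ : ℝ → ℝ}
    {S : Set ℝ} {U : Set (ℝ × ℝ)} (hU : IsOpen U) (hg : ∀ η ∈ S, HasDerivAt g (g₁ η) η)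
    (hg₁ : ∀ η ∈ S, HasDerivAt g₁ (g₂ η) η) (hg₂ : ContinuousOn g₂ S)
    (hUS : ∀ q ∈ U, 0 < q.1 ∧ 0 < q.2 ∧ q.1 / √q.2 ∈ S) :
    HasBal (fun x t => Real.exp (corr ps γ x - corr ps γ (a * √t)) * g (x / √t))
      (fun x t => Real.exp (corr ps γ x - corr ps γ (a * √t)) *
        (-(corr₁ ps γ (a * √t) * (a / (2 * √t)) * g (x / √t)) -
          (g₁ (x / √t) * (x / √t) / (2 * t) + (ps x - γ / x ^ 2) * g (x / √t)
            + corr₁ ps γ x ^ 2 * g (x / √t) + 2 * corr₁ ps γ x * g₁ (x / √t) / √t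
            + g₂ (x / √t) / t))) U := by
  have h : HasBal (fun x t => Real.exp (-corr ps γ (a * √t)) *
      (Real.exp (corr ps γ x) * g (x / √t))) (fun x t => Real.exp (corr ps γ x) *
      (Real.exp (-corr ps γ (a * √t)) * -(corr₁ ps γ (a * √t) * (a * (1 / (2 * √t))))
        * g (x / √t) - Real.exp (-corr ps γ (a * √t)) * (g₁ (x / √t) * (x / √t) / (2 * t)
        + (ps x - γ / x ^ 2) * g (x / √t) + corr₁ ps γ x ^ 2 * g (x / √t)
          + 2 * corr₁ ps γ x * g₁ (x / √t) / √t + g₂ (x / √t) / t))) U := by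
    refine ⟨_, fun x₁ x₂ t₁ t₂ hx ht hsub => bal_profile hg hg₁ hg₂ (fun t ht' => ?_) ?_ ?_
      (fun x hx' => H.corr_hasDerivAt (γ := γ) ?_) (q := fun x => ps x - γ / x ^ 2) ?_
      (fun y₁ y₂ h1 h2 h3 => H.corr₁_sub (lt_of_lt_of_le ?_ h1) h2) ?_⟩
    · have ht0 : 0 < t := (hUS _ (mem_of_box_left hx hsub ht')).2.1
      have hs := Real.sqrt_pos.2 ht0
      exact ((H.corr_hasDerivAt (γ := γ) (mul_pos ha hs)).comp t
        (((hasDerivAt_id t).sqrt ht0.ne').const_mul a)).neg.exp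
    · have hpos : ∀ t ∈ Icc t₁ t₂, 0 < a * √t := fun t ht' =>
        mul_pos ha (Real.sqrt_pos.2 (hUS _ (mem_of_box_left hx hsub ht')).2.1)
      have hc1 : ContinuousOn (fun t => corr ps γ (a * √t)) (Icc t₁ t₂) := fun t ht' =>
        ((H.corr_hasDerivAt (γ := γ) (hpos t ht')).continuousAt.comp
          (f := fun t => a * √t) (by fun_prop)).continuousWithinAt
      have hc2 : ContinuousOn (fun t => corr₁ ps γ (a * √t)) (Icc t₁ t₂) :=
        H.corr₁_continuousOn.comp (by fun_prop) fun t ht' => hpos t ht'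
      refine (Real.continuous_exp.comp_continuousOn hc1.neg).mul (hc2.mul
        (continuousOn_const.mul (continuousOn_const.div (by fun_prop) fun t ht' => ?_))).neg
      have := hpos t ht'
      intro h0
      have h0' : √t = 0 := by linarith
      rw [h0', mul_zero] at this
      exact lt_irrefl _ this
    · exact (hUS _ (mem_of_box_left hx hsub ⟨le_rfl, ht.le⟩)).2.1
    · exact (hUS (x, t₁) (hsub ⟨hx', ⟨le_rfl, ht.le⟩⟩)).1
    · refine (H.ps_integrableOn (by simp)).sub ?_
      refine (continuousOn_const.div (by fun_prop) fun x hx' => ?_).integrableOn_Icc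
      exact pow_ne_zero 2 (hUS (x, t₁) (hsub ⟨hx', ⟨le_rfl, ht.le⟩⟩)).1.ne'
    · exact (hUS _ (mem_of_box_left hx hsub ⟨le_rfl, ht.le⟩)).1
    · exact fun x hx' t ht' => (hUS (x, t) (hsub ⟨hx', ht'⟩)).2.2
  refine h.congr hU (fun x t _ => ?_) fun x t _ => ?_
  · rw [sub_eq_add_neg, Real.exp_add]; ring
  · rw [sub_eq_add_neg (corr ps γ x), Real.exp_add]; ring

end Sol

lemma hasDerivAt_rpow_scaled {α : ℝ} (hα : 0 < α) (τ : ℝ) {η : ℝ} (hη : 0 < η) :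
    HasDerivAt (fun η : ℝ => (η / α) ^ τ) (τ * (η / α) ^ τ / η) η := by
  have hq : 0 < η / α := by positivity
  have h := ((hasDerivAt_id η).div_const α).rpow_const (p := τ) (Or.inl hq.ne')
  refine h.congr_deriv ?_
  simp only [id]
  rw [Real.rpow_sub_one hq.ne']
  field_simp

/-- The perturbation of the source term under a power weight is of lower order. -/
lemma abs_weight_le {ε a τ r s e φ m : ℝ} (hε : 0 < ε) (ha : ε * (6 + a ^ 2) ≤ 1) (hτ : |τ| = ε)
    (hr : |r| ≤ ε ^ 2) (hs : |s| ≤ ε ^ 2) (he : 0 ≤ e) (hea : e ≤ a ^ 2) (hφ : 0 ≤ φ)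
    (hφm : φ ≤ m) :
    |-(τ * (τ - 1) * φ) - 2 * s * m + s * e * φ / 2 - r * e * φ / 2 - s ^ 2 * φ - 2 * s * τ * φ|
      ≤ 2 * ε * m := by
  have hm : 0 ≤ m := hφ.trans hφm
  have hε1 : ε ≤ 1 := by
    have : 0 ≤ ε * (5 + a ^ 2) := by positivity
    linarith
  have b1 : |τ * (τ - 1) * φ| ≤ ε * (1 + ε) * m := by
    rw [abs_mul, abs_mul, hτ, abs_of_nonneg hφ]
    have : |τ - 1| ≤ 1 + ε := by
      have := abs_sub τ 1; rw [hτ, abs_one] at this; linarith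
    gcongr
  have b2 : |2 * s * m| ≤ 2 * ε ^ 2 * m := by
    rw [abs_mul, abs_mul, abs_two, abs_of_nonneg hm]; gcongr
  have b3 : ∀ v, |v| ≤ ε ^ 2 → |v * e * φ| ≤ ε ^ 2 * a ^ 2 * m := fun v hv => by
    rw [abs_mul, abs_mul, abs_of_nonneg he, abs_of_nonneg hφ]; gcongr
  have b4 : |s ^ 2 * φ| ≤ ε ^ 2 * ε ^ 2 * m := by
    rw [sq, abs_mul, abs_mul, abs_of_nonneg hφ]; gcongr
  have b5 : |2 * s * τ * φ| ≤ 2 * ε ^ 2 * ε * m := by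
    rw [abs_mul, abs_mul, abs_mul, abs_two, hτ, abs_of_nonneg hφ]; gcongr
  have c1 := b3 s hs
  have c2 := b3 r hr
  rw [abs_le] at b1 b2 c1 c2 b4 b5
  have t0 : ε ^ 2 * m * (6 + a ^ 2) ≤ ε * m := by
    have := mul_le_mul_of_nonneg_right ha (mul_nonneg hε.le hm)
    linarith
  have t1 : ε ^ 2 * ε * m ≤ ε ^ 2 * m := by
    have := mul_le_mul_of_nonneg_left hε1 (mul_nonneg (sq_nonneg ε) hm); linarith
  have t2 : ε ^ 2 * ε ^ 2 * m ≤ ε ^ 2 * m := by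
    have := mul_le_mul_of_nonneg_left (pow_le_one₀ hε.le hε1 (n := 2))
      (mul_nonneg (sq_nonneg ε) hm)
    linarith
  rw [abs_le]
  constructor <;> linarith [b1.1, b1.2, b2.1, b2.2, c1.1, c1.2, c2.1, c2.2, b4.1, b4.2, b5.1, b5.2]

namespace Prof
variable {α β γ : ℝ} {φ φ₁ φ₂ : ℝ → ℝ}

lemma weight_hasDerivAt (P : Prof α β γ φ φ₁ φ₂) (hα : 0 < α) (τ : ℝ) {η : ℝ} (hη : 0 < η) :
    HasDerivAt (fun η => (η / α) ^ τ * φ η) ((η / α) ^ τ * (τ * φ η / η + φ₁ η)) η := by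
  refine ((hasDerivAt_rpow_scaled hα τ hη).mul (P.der η hη)).congr_deriv ?_
  ring

lemma weight_hasDerivAt₁ (P : Prof α β γ φ φ₁ φ₂) (hα : 0 < α) (τ : ℝ) {η : ℝ} (hη : 0 < η) :
    HasDerivAt (fun η => (η / α) ^ τ * (τ * φ η / η + φ₁ η))
      ((η / α) ^ τ * (τ * (τ - 1) * φ η / η ^ 2 + 2 * τ * φ₁ η / η
        + (γ / η ^ 2 * φ η - η / 2 * φ₁ η))) η := by
  have h1 := (((P.der η hη).const_mul τ).div (hasDerivAt_id η) hη.ne').add (P.der2 η hη)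
  refine ((hasDerivAt_rpow_scaled hα τ hη).mul h1).congr_deriv ?_
  have := P.ode η hη
  rw [show φ₂ η = γ / η ^ 2 * φ η - η / 2 * φ₁ η by linarith]
  simp only [id, Pi.add_apply, Pi.div_apply]
  field_simp
  ring

lemma continuousOn (P : Prof α β γ φ φ₁ φ₂) : ContinuousOn φ (Ioi 0) := fun η hη =>
  (P.der η hη).continuousAt.continuousWithinAt

lemma continuousOn₁ (P : Prof α β γ φ φ₁ φ₂) : ContinuousOn φ₁ (Ioi 0) := fun η hη =>
  (P.der2 η hη).continuousAt.continuousWithinAt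

lemma weight_continuousOn₂ (P : Prof α β γ φ φ₁ φ₂) (hα : 0 < α) (τ : ℝ) :
    ContinuousOn (fun η => (η / α) ^ τ * (τ * (τ - 1) * φ η / η ^ 2 + 2 * τ * φ₁ η / η
        + (γ / η ^ 2 * φ η - η / 2 * φ₁ η))) (Ioi 0) := by
  have h0 := P.continuousOn
  have h1 := P.continuousOn₁
  have hr : ContinuousOn (fun η : ℝ => (η / α) ^ τ) (Ioi 0) := fun η hη =>
    (hasDerivAt_rpow_scaled hα τ hη).continuousAt.continuousWithinAt
  have hne : ∀ η ∈ Ioi (0:ℝ), η ≠ 0 := fun η hη => ne_of_gt hη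
  have hne2 : ∀ η ∈ Ioi (0:ℝ), η ^ 2 ≠ 0 := fun η hη => pow_ne_zero 2 (hne η hη)
  exact hr.mul ((((continuousOn_const.mul h0).div (by fun_prop) hne2).add
    ((continuousOn_const.mul h1).div continuousOn_id hne)).add
    (((continuousOn_const.div (by fun_prop) hne2).mul h0).sub (ContinuousOn.mul (by fun_prop) h1)))

lemma mono (P : Prof α β γ φ φ₁ φ₂) {a b : ℝ} (ha : 0 < a) (hab : a ≤ b) : φ a ≤ φ b := by
  have : MonotoneOn φ (Icc a b) := by
    refine monotoneOn_of_deriv_nonneg (convex_Icc a b)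
      (P.continuousOn.mono fun y hy => ha.trans_le hy.1)
      (fun y hy => (P.der y (ha.trans_le (interior_subset hy).1)).differentiableAt
        |>.differentiableWithinAt) fun y hy => ?_
    have hy0 := ha.trans_le (interior_subset hy).1
    rw [(P.der y hy0).deriv]
    exact (P.pos₁ y hy0).le
  exact this ⟨le_rfl, hab⟩ ⟨hab, le_rfl⟩ hab

lemma phi_nonneg (P : Prof α β γ φ φ₁ φ₂) (hα : 0 < α) {η : ℝ} (hη : 0 ≤ η) :
    0 ≤ Phi α β γ η := by
  rcases hη.eq_or_lt with rfl | h0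
  · rw [P.zero]
  rcases le_total η α with h | h
  · rw [P.behind η h0 h]; exact (P.pos η h0).le
  · rw [P.ahead η h]
    have := P.pos α hα
    have := gtail_pos α
    have := gtail_pos η
    positivity

lemma phi_le (P : Prof α β γ φ φ₁ φ₂) (hα : 0 < α) {η : ℝ} (hη : 0 ≤ η) :
    Phi α β γ η ≤ φ α := by
  rcases hη.eq_or_lt with rfl | h0
  · rw [P.zero]; exact (P.pos α hα).le
  rcases le_total η α with h | h
  · rw [P.behind η h0 h]; exact P.mono h0 h
  · rw [P.ahead η h]
    exact mul_le_of_le_one_right (P.pos α hα).le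
      ((div_le_one (gtail_pos α)).2 (gtail_anti h))

end Prof

/-- The weighted profile behind the parabola, including the corrector. -/
def base (α : ℝ) (ps φ : ℝ → ℝ) (γ τ a x t : ℝ) : ℝ :=
  Real.exp (corr ps γ (min x (a * √t)) - corr ps γ (a * √t)) *
    ((min (x / √t) α / α) ^ τ * φ (min (x / √t) α))

namespace Sol
variable {α β ustar : ℝ} {u p w : ℝ → ℝ → ℝ} {ps : ℝ → ℝ} {γ : ℝ} {φ φ₁ φ₂ : ℝ → ℝ}

lemma base_continuousOn (H : Sol α β ustar u p w ps) (P : Prof α β γ φ φ₁ φ₂) (τ : ℝ) {a : ℝ}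
    (ha : 0 < a) : ContinuousOn (fun q : ℝ × ℝ => base α ps φ γ τ a q.1 q.2)
      {q | 0 < q.1 ∧ 0 < q.2} := by
  have hα := H.hα
  have hcorr : ContinuousOn (corr ps γ) (Ioi 0) := fun x hx =>
    (H.corr_hasDerivAt hx).continuousAt.continuousWithinAt
  have hη : ContinuousOn (fun q : ℝ × ℝ => min (q.1 / √q.2) α) {q | 0 < q.1 ∧ 0 < q.2} :=
    ContinuousOn.inf (continuousOn_fst.div (by fun_prop)
      fun q hq => (Real.sqrt_pos.2 hq.2).ne') continuousOn_const
  have hηp : ∀ q ∈ {q : ℝ × ℝ | 0 < q.1 ∧ 0 < q.2}, 0 < min (q.1 / √q.2) α := fun q hq =>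
    lt_min (div_pos hq.1 (Real.sqrt_pos.2 hq.2)) hα
  have hap : ∀ q ∈ {q : ℝ × ℝ | 0 < q.1 ∧ 0 < q.2}, 0 < a * √q.2 := fun q hq =>
    mul_pos ha (Real.sqrt_pos.2 hq.2)
  have hr : ContinuousOn (fun η : ℝ => (η / α) ^ τ) (Ioi 0) := fun η hη =>
    (hasDerivAt_rpow_scaled hα τ hη).continuousAt.continuousWithinAt
  refine ContinuousOn.mul (Real.continuous_exp.comp_continuousOn (ContinuousOn.sub ?_ ?_))
    (ContinuousOn.mul ?_ ?_)
  · exact hcorr.comp (f := fun q : ℝ × ℝ => min q.1 (a * √q.2)) (by fun_prop)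
      fun q hq => lt_min hq.1 (hap q hq)
  · exact hcorr.comp (f := fun q : ℝ × ℝ => a * √q.2) (by fun_prop) hap
  · exact hr.comp hη hηp
  · exact P.continuousOn.comp hη hηp

lemma base_nonneg (H : Sol α β ustar u p w ps) (P : Prof α β γ φ φ₁ φ₂) (τ a : ℝ) {x t : ℝ}
    (hx : 0 < x) (ht : 0 < t) : 0 < base α ps φ γ τ a x t := by
  have hα := H.hα
  have h1 : 0 < min (x / √t) α := lt_min (div_pos hx (Real.sqrt_pos.2 ht)) hα
  have h2 := P.pos _ h1
  unfold base
  positivity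

/-- Where the corrector is small, the weighted profile is a supersolution for negative weights
and a subsolution for positive ones. -/
lemma base_hasBal (H : Sol α β ustar u p w ps) (P : Prof α β γ φ φ₁ φ₂) {τ ε a X : ℝ}
    (ha : α ≤ a) (hX : 0 < X) (hε : 0 < ε) (hεa : ε * (6 + a ^ 2) ≤ 1) (hτ : |τ| = ε)
    (h : ∀ x ≥ X, |corr₁ ps γ x * x| ≤ ε ^ 2) :
    ∃ f, HasBal (base α ps φ γ τ a) f {q | (X < q.1 ∧ 0 < q.2) ∧ q.1 < α * √q.2} ∧
      ∀ q : ℝ × ℝ, X < q.1 → 0 < q.2 → q.1 < α * √q.2 → ∃ S ≥ 0, ∃ B, |B| ≤ 2 * ε ∧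
        f q.1 q.2 + ps q.1 * base α ps φ γ τ a q.1 q.2 = S * (B - 2 * τ) := by
  have hα := H.hα
  have ha0 := hα.trans_le ha
  have hopen : IsOpen {q : ℝ × ℝ | (X < q.1 ∧ 0 < q.2) ∧ q.1 < α * √q.2} :=
    ((isOpen_lt continuous_const continuous_fst).inter
      (isOpen_lt continuous_const continuous_snd)).inter
      (isOpen_lt (f := fun q : ℝ × ℝ => q.1) (g := fun q => α * √q.2) (by fun_prop) (by fun_prop))
  have hb := H.profile_hasBal (γ := γ) ha0 (S := Ioi 0) hopen
    (fun η hη => P.weight_hasDerivAt hα τ hη) (fun η hη => P.weight_hasDerivAt₁ hα τ hη)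
    (P.weight_continuousOn₂ hα τ) (fun q hq => ⟨hX.trans hq.1.1, hq.1.2,
      div_pos (hX.trans hq.1.1) (Real.sqrt_pos.2 hq.1.2)⟩)
  have heq : ∀ x t, X < x → 0 < t → x < α * √t → base α ps φ γ τ a x t =
      Real.exp (corr ps γ x - corr ps γ (a * √t)) * ((x / √t / α) ^ τ * φ (x / √t)) := by
    intro x t hx ht hxt
    have hs := Real.sqrt_pos.2 ht
    have h1 : x / √t ≤ α := ((div_lt_iff₀ hs).2 hxt).le
    have h2 : x ≤ a * √t := hxt.le.trans (mul_le_mul_of_nonneg_right ha hs.le)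
    rw [base, min_eq_left h1, min_eq_left h2]
  refine ⟨_, hb.congr hopen (fun x t hq => heq x t hq.1.1 hq.1.2 hq.2) fun _ _ _ => rfl, ?_⟩
  rintro ⟨x, t⟩ hx ht hxt
  simp only at hx ht hxt ⊢
  have hs := Real.sqrt_pos.2 ht
  have hx0 := hX.trans hx
  rw [heq x t hx ht hxt]
  set η := x / √t with hη
  have hη0 : 0 < η := div_pos hx0 hs
  have hηα : η ≤ α := ((div_lt_iff₀ hs).2 hxt).le
  have hxe : x = η * √t := by rw [hη]; field_simp
  have h2 : x ≤ a * √t := hxt.le.trans (mul_le_mul_of_nonneg_right ha hs.le)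
  have hr := h (a * √t) (hx.le.trans h2)
  have hs' := h x hx.le
  set s := √t with hsdef
  have hts : t = s ^ 2 := (Real.sq_sqrt ht.le).symm
  set E := Real.exp (corr ps γ x - corr ps γ (a * s))
  set W := (η / α) ^ τ with hW
  have hW0 : 0 < W := Real.rpow_pos_of_pos (by positivity) _
  set m := η * φ₁ η + η ^ 2 / 4 * φ η with hm
  have hφ := P.pos η hη0
  have hφm : φ η ≤ m := P.conv η hη0
  have hm0 : 0 < m := hφ.trans_le hφm
  have hB := abs_weight_le hε hεa hτ hr hs' (sq_nonneg η)
    (pow_le_pow_left₀ hη0.le (hηα.trans ha) 2) hφ.le hφm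
  set r := corr₁ ps γ (a * s) * (a * s) with hrd
  set v := corr₁ ps γ x * x with hvd
  have er : corr₁ ps γ (a * s) = r / (a * s) := by rw [hrd]; field_simp
  have ev : corr₁ ps γ x = v / x := by rw [hvd]; field_simp
  refine ⟨E * W / x ^ 2 * m, by positivity, (-(τ * (τ - 1) * φ η) - 2 * v * m
    + v * η ^ 2 * φ η / 2 - r * η ^ 2 * φ η / 2 - v ^ 2 * φ η - 2 * v * τ * φ η) / m, ?_, ?_⟩
  · rw [abs_div, abs_of_pos hm0, div_le_iff₀ hm0]; exact hB
  · have e3 : E * W / x ^ 2 * m * ((-(τ * (τ - 1) * φ η) - 2 * v * m + v * η ^ 2 * φ η / 2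
        - r * η ^ 2 * φ η / 2 - v ^ 2 * φ η - 2 * v * τ * φ η) / m - 2 * τ) =
        E * W / x ^ 2 * (-(τ * (τ - 1) * φ η) - 2 * v * m + v * η ^ 2 * φ η / 2
        - r * η ^ 2 * φ η / 2 - v ^ 2 * φ η - 2 * v * τ * φ η - 2 * τ * m) := by
      field_simp
    rw [e3, er, ev, hts, hm]
    generalize φ₁ η = y₁
    generalize φ η = y
    clear_value W E v r
    have hη' : η = x / s := hη
    clear_value s
    clear_value η
    subst hη'
    field_simp
    ring

end Sol

section
variable {α γ τ a : ℝ} {ps φ : ℝ → ℝ}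

lemma base_eq_behind (ha : α ≤ a) {x t : ℝ} (ht : 0 < t) (hx : x ≤ α * √t) :
    base α ps φ γ τ a x t =
      Real.exp (corr ps γ x - corr ps γ (a * √t)) * ((x / √t / α) ^ τ * φ (x / √t)) := by
  have hs := Real.sqrt_pos.2 ht
  rw [base, min_eq_left ((div_le_iff₀ hs).2 hx),
    min_eq_left (hx.trans (mul_le_mul_of_nonneg_right ha hs.le))]

lemma base_eq_wedge (hα : 0 < α) {x t : ℝ} (ht : 0 < t) (hx : α * √t ≤ x) (hxa : x ≤ a * √t) :
    base α ps φ γ τ a x t = Real.exp (corr ps γ x - corr ps γ (a * √t)) * φ α := by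
  have hs := Real.sqrt_pos.2 ht
  rw [base, min_eq_right ((le_div_iff₀ hs).2 hx), min_eq_left hxa, div_self hα.ne',
    Real.one_rpow, one_mul]

lemma base_eq_ahead (hα : 0 < α) (ha : α ≤ a) {x t : ℝ} (ht : 0 < t) (hx : a * √t ≤ x) :
    base α ps φ γ τ a x t = φ α := by
  have hs := Real.sqrt_pos.2 ht
  rw [base, min_eq_right ((le_div_iff₀ hs).2
    ((mul_le_mul_of_nonneg_right ha hs.le).trans hx)), min_eq_right hx, div_self hα.ne',
    Real.one_rpow, one_mul, sub_self, Real.exp_zero, one_mul]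

end

/-- The supersolution attached to a profile. -/
def superSol (α : ℝ) (ps φ : ℝ → ℝ) (γ ε x t : ℝ) : ℝ :=
  base α ps φ γ (-ε) α x t * (gtail (max (x / √t) α) / gtail α)

namespace Sol
variable {α β ustar : ℝ} {u p w : ℝ → ℝ → ℝ} {ps : ℝ → ℝ} {γ : ℝ} {φ φ₁ φ₂ : ℝ → ℝ}

lemma base_kink_left (H : Sol α β ustar u p w ps) (P : Prof α β γ φ φ₁ φ₂) (τ : ℝ) {a t : ℝ}
    (ha : α ≤ a) (ht : 0 < t) :
    HasDerivWithinAt (fun y => base α ps φ γ τ a y t)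
      (Real.exp (corr ps γ (α * √t) - corr ps γ (a * √t)) * (corr₁ ps γ (α * √t) * φ α
        + (τ * φ α / α + φ₁ α) / √t)) (Iic (α * √t)) (α * √t) := by
  have hα := H.hα
  have hs := Real.sqrt_pos.2 ht
  have e : α * √t / √t = α := by field_simp
  have hw := P.weight_hasDerivAt hα τ (η := α * √t / √t) (by rw [e]; exact hα)
  have h1 := hw.comp (α * √t) (hasDerivAt_sim_x (t := t) (α * √t))
  have h2 := (((H.corr_hasDerivAt (γ := γ) (x := α * √t) (by positivity)).sub_const
    (corr ps γ (a * √t))).exp.mul h1).hasDerivWithinAt (s := Iic (α * √t))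
  refine (h2.congr (fun y hy => base_eq_behind ha ht hy)
    (base_eq_behind ha ht le_rfl)).congr_deriv ?_
  simp only [Function.comp_apply, e, div_self hα.ne', Real.one_rpow, one_mul]
  ring

lemma continuousOn_gtail_factor :
    ContinuousOn (fun q : ℝ × ℝ => gtail (max (q.1 / √q.2) α) / gtail α)
      {q | 0 < q.1 ∧ 0 < q.2} := by
  refine (continuous_gtail.comp_continuousOn (ContinuousOn.sup (continuousOn_fst.div
    (by fun_prop) fun q hq => (Real.sqrt_pos.2 hq.2).ne') continuousOn_const)).div_const _

lemma superSol_pos (H : Sol α β ustar u p w ps) (P : Prof α β γ φ φ₁ φ₂) (ε : ℝ) {x t : ℝ}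
    (hx : 0 < x) (ht : 0 < t) : 0 < superSol α ps φ γ ε x t :=
  mul_pos (H.base_nonneg P _ _ hx ht) (div_pos (gtail_pos _) (gtail_pos _))

lemma superSol_behind {ε x t : ℝ} (ht : 0 < t) (hx : x ≤ α * √t) :
    superSol α ps φ γ ε x t = base α ps φ γ (-ε) α x t := by
  have hs := Real.sqrt_pos.2 ht
  rw [superSol, max_eq_right ((div_le_iff₀ hs).2 hx), div_self (gtail_pos α).ne', mul_one]

lemma superSol_ahead (hα : 0 < α) {ε x t : ℝ} (ht : 0 < t) (hx : α * √t ≤ x) :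
    superSol α ps φ γ ε x t = φ α / gtail α * gtail (1 * x / √t) := by
  have hs := Real.sqrt_pos.2 ht
  rw [superSol, max_eq_left ((le_div_iff₀ hs).2 hx), base_eq_ahead hα le_rfl ht hx, one_mul]
  ring

lemma superSol_kink_left (H : Sol α β ustar u p w ps) (P : Prof α β γ φ φ₁ φ₂) (ε : ℝ) {t : ℝ}
    (ht : 0 < t) :
    HasDerivWithinAt (fun y => superSol α ps φ γ ε y t)
      (corr₁ ps γ (α * √t) * φ α + (-ε * φ α / α + φ₁ α) / √t) (Iic (α * √t)) (α * √t) := by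
  have h := (H.base_kink_left P (-ε) le_rfl ht).congr (f₁ := fun y => superSol α ps φ γ ε y t)
    (fun y hy => superSol_behind ht hy) (superSol_behind ht le_rfl)
  refine h.congr_deriv ?_
  rw [sub_self, Real.exp_zero, one_mul]

lemma superSol_kink_right (hα : 0 < α) (ε : ℝ) {t : ℝ} (ht : 0 < t) :
    HasDerivWithinAt (fun y => superSol α ps φ γ ε y t)
      (-(Real.exp (-α ^ 2 / 4) / gtail α * φ α) / √t) (Ici (α * √t)) (α * √t) := by
  have hs := Real.sqrt_pos.2 ht
  have e : α * √t / √t = α := by field_simp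
  have h1 := (((hasDerivAt_gtail (α * √t / √t)).comp (α * √t)
    (hasDerivAt_sim_x (t := t) (α * √t))).const_mul (φ α / gtail α)).hasDerivWithinAt
      (s := Ici (α * √t))
  refine (h1.congr (f₁ := fun y => superSol α ps φ γ ε y t)
    (fun y hy => by rw [superSol_ahead hα ht hy, one_mul]; rfl)
    (by rw [superSol_ahead hα ht le_rfl, one_mul]; rfl)).congr_deriv ?_
  rw [e]
  ring

set_option maxHeartbeats 800000 in
/-- Comparison of `u` with the supersolution. -/
theorem le_superSol (H : Sol α β ustar u p w ps) (P : Prof α β γ φ φ₁ φ₂) {ε σ X δ : ℝ}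
    (hε : 0 < ε) (hεa : ε * (6 + α ^ 2) ≤ 1) (hσ : 0 < σ) (hσ1 : σ ≤ 1)
    (hεσ : 8 * ε * φ α < σ * (α ^ 2 * β)) (hX : 0 < X)
    (h : ∀ x ≥ X, |corr₁ ps γ x * x| ≤ ε ^ 2) (hδ : 0 < δ) :
    ∃ T > 0, ∀ x ≥ X, ∀ t ≥ T, u x t ≤ (1 + σ) * superSol α ps φ γ ε x t + δ := by
  have hα := H.hα
  have hβ := H.hβ
  have hpC := psiC_pos hα hβ
  have hφα := P.pos α hα
  have hε1 : ε ≤ 1 := by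
    have : 0 ≤ ε * (5 + α ^ 2) := by positivity
    linarith
  obtain ⟨T, hT, hdec⟩ := H.decay X (half_pos hδ)
  set K := psiC α β * gtail 0 * √T with hK
  have hK0 : 0 < K := by have := gtail_pos 0; positivity
  refine ⟨max T ((K / (δ / 2)) ^ 2), lt_max_of_lt_left hT, fun x hx t ht => ?_⟩
  have hpos : ∀ x ≥ X, ∀ t ≥ T, 0 < superSol α ps φ γ ε x t := fun x hx t ht =>
    H.superSol_pos P ε (hX.trans_le hx) (hT.trans_le ht)
  have hz := le_add_of_gaussian_tail (z := fun x t => u x t - (1 + σ) * superSol α ps φ γ ε x t)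
    (X := X) (T := T) (K := psiC α β) (δ := δ / 2) hX.le hT hpC.le (half_pos hδ) ?_ ?_ ?_ ?_ hx
    ((le_max_left _ _).trans ht)
  · have ht0 : 0 < t := hT.trans_le ((le_max_left _ _).trans ht)
    have hs := Real.sqrt_pos.2 ht0
    have h1 : K / (δ / 2) ≤ √t := Real.le_sqrt_of_sq_le ((le_max_right _ _).trans ht)
    have h2 : K / √t ≤ δ / 2 := by
      rw [div_le_iff₀ (half_pos hδ)] at h1
      rw [div_le_iff₀ hs]; linarith
    linarith
  · intro q hq
    have hq1 : 0 < q.1 := hX.trans_le hq.1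
    have hq2 : 0 < q.2 := hT.trans_le hq.2
    refine ContinuousWithinAt.sub (H.continuousAt hq2).continuousWithinAt
      (continuousWithinAt_const.mul ?_)
    exact (((H.base_continuousOn P (-ε) hα).mul continuousOn_gtail_factor) q
      ⟨hq1, hq2⟩).mono fun r hr => ⟨hX.trans_le hr.1, hT.trans_le hr.2⟩
  · intro t ht
    have h1 := hdec t ht X (abs_of_pos hX).le
    have h2 := mul_pos (show 0 < 1 + σ by linarith) (hpos X le_rfl t ht)
    linarith
  · intro x hx t ht
    have ht0 := hT.trans_le ht
    have h2 := mul_pos (show 0 < 1 + σ by linarith) (hpos x hx t ht)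
    have h3 := H.le_psi x ht0.le
    rw [psi_eq ht0, abs_of_pos (hX.trans_le hx)] at h3
    have h4 := mul_le_mul_of_nonneg_left (gtail_anti (le_max_left (x / √t) α)) hpC.le
    linarith
  · intro x hx t ht hz0
    have hx0 := hX.trans hx
    have ht0 := hT.trans ht
    have hs := Real.sqrt_pos.2 ht0
    rcases lt_trichotomy x (α * √t) with hlt | heq | hgt
    · left
      obtain ⟨f, hf, hfs⟩ := H.base_hasBal P (τ := -ε) le_rfl hX hε hεa
        (by rw [abs_neg, abs_of_pos hε]) h
      set U := {q : ℝ × ℝ | (X < q.1 ∧ 0 < q.2) ∧ q.1 < α * √q.2} with hU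
      have hUo : IsOpen U :=
        ((isOpen_lt continuous_const continuous_fst).inter
          (isOpen_lt continuous_const continuous_snd)).inter
          (isOpen_lt (f := fun q : ℝ × ℝ => q.1) (g := fun q => α * √q.2)
            (by fun_prop) (by fun_prop))
      have hUb : U ⊆ behind α := fun q hq => ⟨hq.1.2, by
        rw [abs_of_pos (hX.trans hq.1.1)]; exact hq.2⟩
      refine ⟨U, hUo.mem_nhds ⟨⟨hx, ht0⟩, hlt⟩, _,
        ((H.u_hasBal_behind.mono hUb).sub ((hf.const_mul (1 + σ)))).congr hUo
          (fun x t hq => by rw [superSol_behind hq.1.2 hq.2.le]) fun _ _ _ => rfl, ?_⟩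
      filter_upwards [Measure.quasiMeasurePreserving_fst.ae
        ((ae_restrict_iff' measurableSet_Ioi).1 H.ps_eq)] with q hps hq _ hqz
      have hq0 : 0 < q.1 := hX.trans hq.1.1
      have hpp : p q.1 q.2 = ps q.1 := by
        refine hps hq0 q.2 ?_
        rw [div_lt_iff₀ (by positivity)]
        have := pow_lt_pow_left₀ hq.2 hq0.le two_ne_zero
        rw [mul_pow, Real.sq_sqrt hq.1.2.le] at this
        linarith
      obtain ⟨S, hS, B, hB, hfe⟩ := hfs q hq.1.1 hq.1.2 hq.2
      rw [superSol_behind hq.1.2 hq.2.le] at hqz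
      have hB' := (abs_le.1 hB).1
      have h1 : 0 ≤ S * (B - 2 * -ε) := mul_nonneg hS (by linarith)
      have h2 := mul_nonneg (H.ps01 q.1).1 hqz.le
      have h3 := mul_nonneg (show 0 ≤ 1 + σ by linarith) h1
      rw [← hfe] at h3
      simp only [hpp]
      linarith
    · right
      subst heq
      refine ⟨_, _, ?_, (H.u_kink_left ht0).sub ((H.superSol_kink_left P ε ht0).const_mul (1 + σ)),
        (H.u_kink_right ht0).sub ((superSol_kink_right hα ε ht0).const_mul (1 + σ))⟩
      have hc := h (α * √t) hx.le
      set c := corr₁ ps γ (α * √t)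
      set s := √t
      have hc1 : -ε ≤ c * (α * s) := by
        have := (abs_le.1 hc).1
        have h2 : ε ^ 2 ≤ ε := by rw [sq]; exact mul_le_of_le_one_right hε.le hε1
        linarith
      have hj := P.jump
      set e := Real.exp (-α ^ 2 / 4) / gtail α * φ α
      have key : 0 < -(α * β / 2) + (1 + σ) * (e + φ₁ α + c * s * φ α - ε * φ α / α) := by
        have h1 : c * s * φ α - ε * φ α / α ≥ -(2 * ε * φ α / α) := by
          have : -ε / α ≤ c * s := by rw [div_le_iff₀ hα]; linarith
          have := mul_le_mul_of_nonneg_right this hφα.le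
          have e1 : -ε / α * φ α = -(ε * φ α / α) := by ring
          have e2 : 2 * ε * φ α / α = 2 * (ε * φ α / α) := by ring
          linarith
        have h2 : 4 * ε * φ α / α < σ * (α * β / 2) := by
          rw [div_lt_iff₀ hα]; linarith
        have h3 := mul_le_mul_of_nonneg_left h1 (show 0 ≤ 1 + σ by linarith)
        have h4 : (1 + σ) * (2 * ε * φ α / α) ≤ 4 * ε * φ α / α := by
          have e2 : 4 * ε * φ α / α = 2 * (2 * ε * φ α / α) := by ring
          rw [e2]
          exact mul_le_mul_of_nonneg_right (by linarith) (by positivity)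
        have h5 : (1 + σ) * (e + φ₁ α) = (1 + σ) * (α * β / 2) := by
          rw [← hj]; ring
        linarith
      have key2 := div_pos key hs
      have e3 : (-(α * β / 2) + (1 + σ) * (e + φ₁ α + c * s * φ α - ε * φ α / α)) / s =
          (w (α * s) t - α * β / 2 / s - (1 + σ) * (-e / s)) -
          (w (α * s) t - (1 + σ) * (c * φ α + (-ε * φ α / α + φ₁ α) / s)) := by
        field_simp
        ring
      linarith
    · left
      have hσ2 : (1 : ℝ) ^ 2 = 1 := one_pow 2
      refine ⟨ahead α 1, isOpen_ahead.mem_nhds ⟨ht0, by simpa using hgt⟩, _,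
        ((H.u_hasBal_ahead hσ2).sub (((hasBal_gtail hσ2 (φ α / gtail α)).mono
          fun q hq => hq.1).const_mul (1 + σ))).congr isOpen_ahead
          (fun x t hq => by
            rw [superSol_ahead hα hq.1 (by have := hq.2; simp only [one_mul] at this; exact this.le)])
          fun _ _ _ => rfl, Eventually.of_forall fun q hq _ _ => ?_⟩
      have := mul_nonneg (H.p01 q.1 q.2 hq.1.le).1 (H.nonneg q.1 hq.1.le)
      linarith

/-- The supersolution is uniformly close to the profile. -/
lemma superSol_le (H : Sol α β ustar u p w ps) (P : Prof α β γ φ φ₁ φ₂) {ε X C : ℝ}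
    (hε : 0 < ε) (hε2 : 2 * ε ≤ 1) (hX : 0 < X) (h : ∀ x ≥ X, |corr₁ ps γ x * x| ≤ ε ^ 2)
    (hC0 : 0 < C) (hC : ∀ η, 0 < η → η ≤ α → φ η ≤ C * η) {x t : ℝ} (hx : X ≤ x) (ht : 0 < t) :
    superSol α ps φ γ ε x t ≤ Phi α β γ (x / √t) + C * α * (2 * ε) := by
  have hα := H.hα
  have hs := Real.sqrt_pos.2 ht
  have hx0 := hX.trans_le hx
  have hrem : 0 ≤ C * α * (2 * ε) := by positivity
  rcases le_total x (α * √t) with hle | hge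
  · rw [superSol_behind ht hle, base_eq_behind le_rfl ht hle]
    have hη0 : 0 < x / √t := div_pos hx0 hs
    have hηα : x / √t ≤ α := (div_le_iff₀ hs).2 hle
    rw [P.behind _ hη0 hηα]
    have hlog := (abs_le.1 (H.corr_log hX h hx hle)).2
    have es : α * √t / x = (x / √t / α)⁻¹ := by field_simp
    rw [es, Real.log_inv] at hlog
    set η := x / √t with hη
    set s := η / α with hsd
    have hs0 : 0 < s := by positivity
    have hs1 : s ≤ 1 := (div_le_one hα).2 hηα
    have hl : Real.log s ≤ 0 := Real.log_nonpos hs0.le hs1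
    have hE : Real.exp (corr ps γ x - corr ps γ (α * √t)) ≤ s ^ (-ε) := by
      rw [Real.rpow_def_of_pos hs0]
      refine Real.exp_le_exp.2 (hlog.trans ?_)
      have h2 : ε ^ 2 ≤ ε := by rw [sq]; exact mul_le_of_le_one_right hε.le (by linarith)
      have := mul_le_mul_of_nonneg_right h2 (neg_nonneg.2 hl)
      linarith
    have hφ := P.pos η hη0
    have hW : 0 < s ^ (-ε) := Real.rpow_pos_of_pos hs0 _
    have h1 : Real.exp (corr ps γ x - corr ps γ (α * √t)) * (s ^ (-ε) * φ η) ≤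
        s ^ (-(2 * ε)) * φ η := by
      have e : s ^ (-(2 * ε)) = s ^ (-ε) * s ^ (-ε) := by
        rw [← Real.rpow_add hs0]; congr 1; ring
      rw [e, mul_assoc]
      exact mul_le_mul_of_nonneg_right hE (by positivity)
    have hge1 : 1 ≤ s ^ (-(2 * ε)) := Real.one_le_rpow_of_pos_of_le_one_of_nonpos hs0 hs1
      (by linarith)
    have h2 : (s ^ (-(2 * ε)) - 1) * φ η ≤ (s ^ (-(2 * ε)) - 1) * (C * (α * s)) := by
      refine mul_le_mul_of_nonneg_left ?_ (by linarith)
      have : α * s = η := by rw [hsd]; field_simp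
      rw [this]; exact hC η hη0 hηα
    have h3 : s ^ (1 - 2 * ε) ≤ (1 - 2 * ε) * s + 2 * ε := by
      have := Real.geom_mean_le_arith_mean2_weighted (w₁ := 1 - 2 * ε) (w₂ := 2 * ε)
        (by linarith) (by linarith) hs0.le zero_le_one (by ring)
      rwa [Real.one_rpow, mul_one, mul_one] at this
    have h4 : s ^ (-(2 * ε)) * s = s ^ (1 - 2 * ε) := by
      rw [sub_eq_neg_add, Real.rpow_add hs0, Real.rpow_one]
    have h5 : s ^ (-(2 * ε)) * s - s ≤ 2 * ε := by
      rw [h4]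
      have : 0 ≤ 2 * ε * s := by positivity
      linarith
    have h6 := mul_le_mul_of_nonneg_left h5 (show 0 ≤ C * α by positivity)
    linarith
  · rw [superSol_ahead hα ht hge, P.ahead _ ((le_div_iff₀ hs).2 hge), one_mul]
    have e : φ α / gtail α * gtail (x / √t) = φ α * (gtail (x / √t) / gtail α) := by ring
    linarith

/-- Asymptotic upper bound by the profile. -/
theorem upper (H : Sol α β ustar u p w ps) (P : Prof α β γ φ φ₁ φ₂)
    (hG : Tendsto (fun x => x * ∫ y in Ioi x, ps y) atTop (nhds γ)) {δ : ℝ} (hδ : 0 < δ) :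
    ∃ X > 0, ∃ T > 0, ∀ x ≥ X, ∀ t ≥ T, u x t ≤ Phi α β γ (x / √t) + δ := by
  have hα := H.hα
  have hβ := H.hβ
  have hφα := P.pos α hα
  obtain ⟨C, hC0, hC⟩ := P.lin
  set σ := min 1 (δ / (4 * φ α)) with hσd
  have hσ : 0 < σ := lt_min one_pos (by positivity)
  set ε := min (1 / (6 + α ^ 2)) (min (σ * (α ^ 2 * β) / (16 * φ α)) (δ / (16 * (C * α))))
    with hεd
  have hε : 0 < ε := lt_min (by positivity) (lt_min (by positivity) (by positivity))
  have hε1 : ε * (6 + α ^ 2) ≤ 1 := (le_div_iff₀ (by positivity)).1 (min_le_left _ _)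
  have hε2 : ε * (16 * φ α) ≤ σ * (α ^ 2 * β) := (le_div_iff₀ (by positivity)).1
    ((min_le_right _ _).trans (min_le_left _ _))
  have hε3 : ε * (16 * (C * α)) ≤ δ := (le_div_iff₀ (by positivity)).1
    ((min_le_right _ _).trans (min_le_right _ _))
  have hσ3 : σ * (4 * φ α) ≤ δ := (le_div_iff₀ (by positivity)).1 (min_le_right _ _)
  obtain ⟨X, hX, h⟩ := corr_small hG (show 0 < ε ^ 2 by positivity)
  have hεφ : 0 < ε * φ α := by positivity
  obtain ⟨T, hT, hu⟩ := H.le_superSol P hε hε1 hσ (min_le_left _ _) (by linarith) hX h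
    (show 0 < δ / 4 by positivity)
  refine ⟨X, hX, T, hT, fun x hx t ht => ?_⟩
  have ht0 := hT.trans_le ht
  have h1 := hu x hx t ht
  have h5 : 0 ≤ ε * α ^ 2 := by positivity
  have h2 := H.superSol_le P hε (by linarith) hX h hC0 hC hx ht0
  have h3 := P.phi_le hα (η := x / √t) (div_nonneg (hX.trans_le hx).le (Real.sqrt_nonneg t))
  have h4 := mul_le_mul_of_nonneg_left h2 (show 0 ≤ 1 + σ by linarith)
  have h6 := mul_le_mul_of_nonneg_left h3 hσ.le
  have h7 : (1 + σ) * (C * α * (2 * ε)) ≤ 2 * (C * α * (2 * ε)) :=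
    mul_le_mul_of_nonneg_right (by linarith [min_le_left 1 (δ / (4 * φ α))]) (by positivity)
  linarith

end Sol

/-- The subsolution attached to a profile: beyond the source the profile is bent down over a
wedge of relative width `d`. -/
def subSol (α : ℝ) (ps φ : ℝ → ℝ) (γ ε d K x t : ℝ) : ℝ :=
  base α ps φ γ ε (α + d) x t * (gtail (max (x / √t) α) / gtail α -
    K * (2 * d * (max α (min (x / √t) (α + d)) - α)
      - (max α (min (x / √t) (α + d)) - α) ^ 2 / 2))

/-- The profile of the subsolution on the wedge. -/
def wedgeProfile (α m d K η : ℝ) : ℝ :=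
  m * (gtail η / gtail α - K * (2 * d * (η - α) - (η - α) ^ 2 / 2))

/-- Derivative of `wedgeProfile`. -/
def wedgeProfile₁ (α m d K η : ℝ) : ℝ :=
  m * (-Real.exp (-η ^ 2 / 4) / gtail α - K * (2 * d - (η - α)))

lemma wedgeProfile_hasDerivAt (α m d K η : ℝ) :
    HasDerivAt (wedgeProfile α m d K) (wedgeProfile₁ α m d K η) η := by
  have h1 := (hasDerivAt_id η).sub_const α
  have h2 := ((h1.const_mul (2 * d)).sub ((h1.pow 2).div_const 2)).const_mul K
  refine ((((hasDerivAt_gtail η).div_const (gtail α)).sub h2).const_mul m).congr_deriv ?_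
  simp only [wedgeProfile₁, id, Nat.cast_ofNat]
  ring

lemma wedgeProfile₁_hasDerivAt (α m d K η : ℝ) :
    HasDerivAt (wedgeProfile₁ α m d K)
      (m * (η / 2 * Real.exp (-η ^ 2 / 4) / gtail α + K)) η := by
  have h1 := ((hasDerivAt_id η).sub_const α).const_sub (2 * d)
  have h0 := ((((hasDerivAt_id η).pow 2).neg.div_const 4).exp.neg).div_const (gtail α)
  refine ((h0.sub (h1.const_mul K)).const_mul m).congr_deriv ?_
  simp only [id, Nat.cast_ofNat, Pi.neg_apply, Pi.pow_apply]
  ring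

/-- Smallness conditions on the parameters of the subsolution. -/
structure Admissible (α β γ m ε σ d K : ℝ) : Prop where
  hε : 0 < ε
  hεa : ε * (6 + (α + d) ^ 2) ≤ 1
  hσ : 0 < σ
  hσ1 : σ ≤ 1
  hd : 0 < d
  hd1 : d ≤ 1
  had : (α + d) * d ≤ 1 / 4
  hγ : 0 ≤ γ
  hK : γ / α ^ 2 + 1 ≤ K / 2
  rho : ((α + d) / α) ^ ε ≤ 1 + σ / 2
  kink : ε * m / α + 2 * K * d * m < σ * (α * β / 4)
  src : ε ^ 2 * (1 / 2 + 2 / (α * gtail α)) ≤ 1 / 4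
  src' : ε ^ 2 * (4 / α) ≤ 1 / 4
  kink' : ε ^ 2 / α < K * d
  small : 2 * K * d ^ 2 ≤ 1

lemma bump_mem {d y : ℝ} (hy : 0 ≤ y) (hyd : y ≤ d) :
    2 * d * y - y ^ 2 / 2 ∈ Icc 0 (2 * d ^ 2) := by
  have h1 := mul_le_mul_of_nonneg_left hyd hy
  have h2 := mul_le_mul_of_nonneg_left hyd (hy.trans hyd)
  have h3 := mul_nonneg hy (hy.trans hyd)
  constructor <;> linarith [sq_nonneg y]

section
variable {α γ ε d K : ℝ} {ps φ : ℝ → ℝ}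

lemma subSol_behind (hd : 0 ≤ d) {x t : ℝ} (ht : 0 < t) (hx : x ≤ α * √t) :
    subSol α ps φ γ ε d K x t = base α ps φ γ ε (α + d) x t := by
  have h1 : x / √t ≤ α := (div_le_iff₀ (Real.sqrt_pos.2 ht)).2 hx
  rw [subSol, max_eq_right h1, div_self (gtail_pos α).ne', min_eq_left (by linarith),
    max_eq_left h1]
  ring

lemma subSol_wedge (hα : 0 < α) {x t : ℝ} (ht : 0 < t) (hx : α * √t ≤ x)
    (hxa : x ≤ (α + d) * √t) :
    subSol α ps φ γ ε d K x t = Real.exp (corr ps γ x - corr ps γ ((α + d) * √t)) *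
      wedgeProfile α (φ α) d K (x / √t) := by
  have h1 : α ≤ x / √t := (le_div_iff₀ (Real.sqrt_pos.2 ht)).2 hx
  have h2 : x / √t ≤ α + d := (div_le_iff₀ (Real.sqrt_pos.2 ht)).2 hxa
  rw [subSol, base_eq_wedge hα ht hx hxa, max_eq_left h1, min_eq_left h2, max_eq_right h1,
    wedgeProfile]
  ring

lemma subSol_ahead (hα : 0 < α) (hd : 0 ≤ d) {x t : ℝ} (ht : 0 < t) (hx : (α + d) * √t ≤ x) :
    subSol α ps φ γ ε d K x t =
      φ α / gtail α * gtail (1 * x / √t) - φ α * (K * (3 / 2 * d ^ 2)) := by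
  have h1 : α + d ≤ x / √t := (le_div_iff₀ (Real.sqrt_pos.2 ht)).2 hx
  rw [subSol, base_eq_ahead hα (by linarith) ht hx, max_eq_left (by linarith), min_eq_right h1,
    max_eq_right (by linarith), one_mul]
  ring

end

namespace Sol
variable {α β ustar : ℝ} {u p w : ℝ → ℝ → ℝ} {ps : ℝ → ℝ} {γ : ℝ} {φ φ₁ φ₂ : ℝ → ℝ}
  {ε σ d K X : ℝ}

lemma exp_corr_bounds (H : Sol α β ustar u p w ps) {a : ℝ} (ha : 0 < a) (hε : 0 < ε)
    (hε1 : ε ≤ 1) (hX : 0 < X) (h : ∀ x ≥ X, |corr₁ ps γ x * x| ≤ ε ^ 2) {x t : ℝ} (hx : X ≤ x)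
    (ht : 0 < t) (hxa : x ≤ a * √t) :
    Real.exp (corr ps γ x - corr ps γ (a * √t)) ∈ Icc ((x / √t / a) ^ ε) ((x / √t / a) ^ (-ε)) := by
  have hs := Real.sqrt_pos.2 ht
  have hx0 := hX.trans_le hx
  have hlog := H.corr_log hX h hx hxa
  have es : a * √t / x = (x / √t / a)⁻¹ := by field_simp
  rw [es, Real.log_inv, abs_le] at hlog
  set s := x / √t / a
  have hs0 : 0 < s := by positivity
  have hs1 : s ≤ 1 := by
    rw [div_le_one ha, div_le_iff₀ hs]; exact hxa
  have hl : Real.log s ≤ 0 := Real.log_nonpos hs0.le hs1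
  have h2 : ε ^ 2 ≤ ε := by rw [sq]; exact mul_le_of_le_one_right hε.le hε1
  have h3 := mul_le_mul_of_nonneg_right h2 (neg_nonneg.2 hl)
  rw [Real.rpow_def_of_pos hs0, Real.rpow_def_of_pos hs0]
  exact ⟨Real.exp_le_exp.2 (by linarith [hlog.1]), Real.exp_le_exp.2 (by linarith [hlog.2])⟩

/-- On the wedge the corrector factor is close to one. -/
lemma exp_corr_wedge (H : Sol α β ustar u p w ps) {m : ℝ} (A : Admissible α β γ m ε σ d K)
    (hX : 0 < X) (h : ∀ x ≥ X, |corr₁ ps γ x * x| ≤ ε ^ 2) {x t : ℝ} (hx : X ≤ x)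
    (ht : 0 < t) (hαx : α * √t ≤ x) (hxa : x ≤ (α + d) * √t) :
    |Real.exp (corr ps γ x - corr ps γ ((α + d) * √t)) - 1| ≤ σ / 2 := by
  have hα := H.hα
  have hs := Real.sqrt_pos.2 ht
  have ha0 : 0 < α + d := by linarith [A.hd]
  have hε1 : ε ≤ 1 := by
    have : 0 ≤ ε * (5 + (α + d) ^ 2) := mul_nonneg A.hε.le (by positivity)
    linarith [A.hεa]
  obtain ⟨h1, h2⟩ := H.exp_corr_bounds ha0 A.hε hε1 hX h hx ht hxa
  have hη : α ≤ x / √t := (le_div_iff₀ hs).2 hαx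
  have hle : α / (α + d) ≤ x / √t / (α + d) := div_le_div_of_nonneg_right hη ha0.le
  have hq : 0 < α / (α + d) := by positivity
  have e1 : (α / (α + d)) ^ (-ε) = ((α + d) / α) ^ ε := by
    rw [Real.rpow_neg hq.le, ← Real.inv_rpow hq.le, inv_div]
  have h3 := Real.rpow_le_rpow_of_nonpos hq hle (show -ε ≤ 0 by linarith [A.hε])
  have h4 := Real.rpow_le_rpow hq.le hle A.hε.le
  have h5 : 1 - σ / 2 ≤ (α / (α + d)) ^ ε := by
    have e2 : (α / (α + d)) ^ ε = (((α + d) / α) ^ ε)⁻¹ := by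
      rw [← e1, Real.rpow_neg hq.le, inv_inv]
    have hp : 0 < ((α + d) / α) ^ ε := Real.rpow_pos_of_pos (by positivity) _
    rw [e2, ← one_div, le_div_iff₀ hp]
    have := mul_le_mul_of_nonneg_left A.rho (show 0 ≤ 1 - σ / 2 by linarith [A.hσ1])
    linarith [sq_nonneg σ]
  rw [e1] at h3
  rw [abs_le]
  constructor <;> linarith [A.rho]

lemma subSol_continuousOn (H : Sol α β ustar u p w ps) (P : Prof α β γ φ φ₁ φ₂) (hd : 0 < d) :
    ContinuousOn (fun q : ℝ × ℝ => subSol α ps φ γ ε d K q.1 q.2) {q | 0 < q.1 ∧ 0 < q.2} := by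
  have hη : ContinuousOn (fun q : ℝ × ℝ => q.1 / √q.2) {q : ℝ × ℝ | 0 < q.1 ∧ 0 < q.2} :=
    continuousOn_fst.div (by fun_prop) fun q hq => (Real.sqrt_pos.2 hq.2).ne'
  have hc : ContinuousOn (fun q : ℝ × ℝ => max α (min (q.1 / √q.2) (α + d)) - α)
      {q : ℝ × ℝ | 0 < q.1 ∧ 0 < q.2} :=
    (ContinuousOn.sup continuousOn_const (ContinuousOn.inf hη continuousOn_const)).sub
      continuousOn_const
  exact (H.base_continuousOn P ε (add_pos H.hα hd)).mul (continuousOn_gtail_factor.sub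
    (continuousOn_const.mul ((continuousOn_const.mul hc).sub ((hc.pow 2).div_const 2))))

lemma base_le_behind (H : Sol α β ustar u p w ps) (P : Prof α β γ φ φ₁ φ₂)
    (A : Admissible α β γ (φ α) ε σ d K)
    (hX : 0 < X) (h : ∀ x ≥ X, |corr₁ ps γ x * x| ≤ ε ^ 2) {x t : ℝ} (hx : X ≤ x)
    (ht : 0 < t) (hxα : x ≤ α * √t) :
    base α ps φ γ ε (α + d) x t ≤ (1 + σ / 2) * φ (x / √t) ∧
      (1 - σ / 2) * ((x / √t / α) ^ (2 * ε) * φ (x / √t)) ≤ base α ps φ γ ε (α + d) x t := by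
  have hα := H.hα
  have hs := Real.sqrt_pos.2 ht
  have hx0 := hX.trans_le hx
  have ha0 : 0 < α + d := by linarith [A.hd]
  have hε1 : ε ≤ 1 := by
    have : 0 ≤ ε * (5 + (α + d) ^ 2) := mul_nonneg A.hε.le (by positivity)
    linarith [A.hεa]
  rw [base_eq_behind (by linarith [A.hd]) ht hxα]
  obtain ⟨h1, h2⟩ := H.exp_corr_bounds ha0 A.hε hε1 hX h hx ht
    (hxα.trans (mul_le_mul_of_nonneg_right (by linarith [A.hd]) hs.le))
  set E := Real.exp (corr ps γ x - corr ps γ ((α + d) * √t))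
  set η := x / √t with hη
  have hη0 : 0 < η := by positivity
  have hφ := P.pos η hη0
  set s := η / α with hsd
  have hs0 : 0 < s := by positivity
  set ρ := ((α + d) / α) ^ ε with hρ
  have hρ0 : 0 < ρ := Real.rpow_pos_of_pos (by positivity) _
  have hW : 0 < s ^ ε := Real.rpow_pos_of_pos hs0 _
  have e1 : (η / (α + d)) ^ ε = s ^ ε / ρ := by
    rw [hρ, ← Real.div_rpow hs0.le (by positivity)]
    congr 1; rw [hsd]; field_simp
  rw [Real.rpow_neg (by positivity), e1] at h2
  rw [e1] at h1
  constructor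
  · have : E * s ^ ε ≤ ρ := by
      rw [inv_div, le_div_iff₀ hW] at h2; exact h2
    have := mul_le_mul_of_nonneg_right (this.trans A.rho) hφ.le
    linarith
  · have h3 : (1 - σ / 2) * s ^ ε ≤ E := by
      refine le_trans ?_ h1
      rw [le_div_iff₀ hρ0]
      have h4 := mul_le_mul_of_nonneg_left A.rho (show 0 ≤ 1 - σ / 2 by linarith [A.hσ1])
      have h5 : (1 - σ / 2) * ρ ≤ 1 := by linarith [sq_nonneg σ]
      have := mul_le_mul_of_nonneg_right h5 hW.le
      linarith
    have e2 : s ^ (2 * ε) = s ^ ε * s ^ ε := by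
      rw [← Real.rpow_add hs0]; congr 1; ring
    rw [e2]
    have := mul_le_mul_of_nonneg_right h3 (show 0 ≤ s ^ ε * φ η by positivity)
    linarith

/-- Tail bound for the subsolution. -/
lemma subSol_le_tail (H : Sol α β ustar u p w ps) (P : Prof α β γ φ φ₁ φ₂)
    (A : Admissible α β γ (φ α) ε σ d K)
    (hX : 0 < X) (h : ∀ x ≥ X, |corr₁ ps γ x * x| ≤ ε ^ 2) {x t : ℝ} (hx : X ≤ x)
    (ht : 0 < t) : subSol α ps φ γ ε d K x t ≤ 2 * φ α ∧
      subSol α ps φ γ ε d K x t ≤ 2 * φ α / gtail (α + d) * gtail (x / √t) := by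
  have hα := H.hα
  have hs := Real.sqrt_pos.2 ht
  have hx0 := hX.trans_le hx
  have hφα := P.pos α hα
  have hd := A.hd
  have hK : 0 < K := by
    have := A.hK
    have : 0 ≤ γ / α ^ 2 := div_nonneg A.hγ (by positivity)
    linarith
  have hga := gtail_pos (α + d)
  have hgα := gtail_pos α
  have hgη := gtail_pos (x / √t)
  rcases le_total x ((α + d) * √t) with hle | hge
  · have key : subSol α ps φ γ ε d K x t ≤ 2 * φ α := by
      rcases le_total x (α * √t) with h1 | h1
      · rw [subSol_behind hd.le ht h1]
        refine (H.base_le_behind P A hX h hx ht h1).1.trans ?_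
        have h2 := P.mono (div_pos hx0 hs) ((div_le_iff₀ hs).2 h1)
        have h3 := mul_le_mul_of_nonneg_left h2 (show 0 ≤ 1 + σ / 2 by linarith [A.hσ])
        have h4 := mul_le_mul_of_nonneg_right A.hσ1 hφα.le
        linarith
      · rw [subSol_wedge hα ht h1 hle, wedgeProfile]
        have hE := (abs_le.1 (H.exp_corr_wedge A hX h hx ht h1 hle)).2
        have hη : α ≤ x / √t := (le_div_iff₀ hs).2 h1
        have hη2 : x / √t ≤ α + d := (div_le_iff₀ hs).2 hle
        have h2 : gtail (x / √t) / gtail α ≤ 1 := (div_le_one hgα).2 (gtail_anti hη)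
        have h3 := mul_nonneg hK.le (bump_mem (d := d) (y := x / √t - α) (by linarith)
          (by linarith)).1
        have h4 : φ α * (gtail (x / √t) / gtail α -
          K * (2 * d * (x / √t - α) - (x / √t - α) ^ 2 / 2)) ≤ φ α :=
          mul_le_of_le_one_right hφα.le (by linarith)
        have h5 := mul_le_mul_of_nonneg_left h4
          (Real.exp_pos (corr ps γ x - corr ps γ ((α + d) * √t))).le
        have h6 := mul_le_mul_of_nonneg_right hE hφα.le
        have h7 := mul_le_mul_of_nonneg_right A.hσ1 hφα.le
        linarith
    refine ⟨key, key.trans ?_⟩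
    rw [div_mul_eq_mul_div, le_div_iff₀ hga]
    exact mul_le_mul_of_nonneg_left (gtail_anti ((div_le_iff₀ hs).2 hle)) (by positivity)
  · rw [subSol_ahead hα hd.le ht hge, one_mul]
    have h1 : 0 ≤ φ α * (K * (3 / 2 * d ^ 2)) := by positivity
    have h2 : φ α / gtail α * gtail (x / √t) ≤ φ α := by
      rw [div_mul_eq_mul_div, div_le_iff₀ hgα]
      exact mul_le_mul_of_nonneg_left (gtail_anti ((le_div_iff₀ hs).2
        ((mul_le_mul_of_nonneg_right (by linarith) hs.le).trans hge))) hφα.le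
    refine ⟨by linarith, ?_⟩
    have h3 : φ α / gtail α * gtail (x / √t) ≤ φ α / gtail (α + d) * gtail (x / √t) := by
      have : φ α / gtail α ≤ φ α / gtail (α + d) :=
        div_le_div_of_nonneg_left hφα.le hga (gtail_anti (by linarith))
      exact mul_le_mul_of_nonneg_right this hgη.le
    have h4 : 0 ≤ φ α / gtail (α + d) * gtail (x / √t) := by positivity
    have e : 2 * φ α / gtail (α + d) * gtail (x / √t) =
      2 * (φ α / gtail (α + d) * gtail (x / √t)) := by ring
    linarith

/-- The profile is uniformly close to the subsolution. -/
lemma le_subSol (H : Sol α β ustar u p w ps) (P : Prof α β γ φ φ₁ φ₂)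
    (A : Admissible α β γ (φ α) ε σ d K) {C : ℝ}
    (hC0 : 0 < C) (hC : ∀ η, 0 < η → η ≤ α → φ η ≤ C * η)
    (hX : 0 < X) (h : ∀ x ≥ X, |corr₁ ps γ x * x| ≤ ε ^ 2) {x t : ℝ} (hx : X ≤ x)
    (ht : 0 < t) : Phi α β γ (x / √t) ≤ subSol α ps φ γ ε d K x t + C * α * (2 * ε)
      + φ α * (σ + 2 * K * d ^ 2) := by
  have hα := H.hα
  have hs := Real.sqrt_pos.2 ht
  have hx0 := hX.trans_le hx
  have hφα := P.pos α hα
  have hd := A.hd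
  have hε := A.hε
  have hσ := A.hσ
  have hK : 0 < K := by
    have := A.hK
    have : 0 ≤ γ / α ^ 2 := div_nonneg A.hγ (by positivity)
    linarith
  have hgα := gtail_pos α
  have hrem : 0 ≤ C * α * (2 * ε) := by positivity
  have hKd : 0 ≤ φ α * (K * d ^ 2) := by positivity
  rcases le_total x (α * √t) with h1 | h1
  · rw [subSol_behind hd.le ht h1]
    have h2 := (H.base_le_behind P A hX h hx ht h1).2
    have hη0 : 0 < x / √t := div_pos hx0 hs
    have hηα : x / √t ≤ α := (div_le_iff₀ hs).2 h1
    rw [P.behind _ hη0 hηα]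
    have hφm := P.mono hη0 hηα
    have hCη := hC _ hη0 hηα
    set η := x / √t with hη
    have hφ := P.pos η hη0
    set s := η / α with hsd
    have hs0 : 0 < s := by positivity
    have hs1 : s ≤ 1 := (div_le_one hα).2 hηα
    have hW : s ^ (2 * ε) ≤ 1 := Real.rpow_le_one hs0.le hs1 (by positivity)
    have h3 : (1 - s ^ (2 * ε)) * φ η ≤ (1 - s ^ (2 * ε)) * (C * (α * s)) := by
      refine mul_le_mul_of_nonneg_left ?_ (by linarith)
      have : α * s = η := by rw [hsd]; field_simp
      rw [this]; exact hCη
    have h4 : s - 2 * ε ≤ s ^ (2 * ε) * s := by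
      have hb := one_add_mul_self_le_rpow_one_add (s := s - 1) (by linarith)
        (p := 1 + 2 * ε) (by linarith)
      rw [add_sub_cancel, add_comm 1 (2 * ε), Real.rpow_add hs0, Real.rpow_one] at hb
      have : 0 ≤ 2 * ε * s := by positivity
      linarith
    have h5 := mul_le_mul_of_nonneg_left h4 (show 0 ≤ C * α by positivity)
    have h6 : σ / 2 * (s ^ (2 * ε) * φ η) ≤ σ / 2 * φ α := by
      refine mul_le_mul_of_nonneg_left ?_ (by positivity)
      exact (mul_le_of_le_one_left hφ.le hW).trans hφm
    have h7 : 0 ≤ σ * φ α := by positivity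
    linarith
  rcases le_total x ((α + d) * √t) with h2 | h2
  · rw [subSol_wedge hα ht h1 h2, wedgeProfile]
    have hη : α ≤ x / √t := (le_div_iff₀ hs).2 h1
    have hη2 : x / √t ≤ α + d := (div_le_iff₀ hs).2 h2
    rw [P.ahead _ hη]
    have hE := H.exp_corr_wedge A hX h hx ht h1 h2
    set E := Real.exp (corr ps γ x - corr ps γ ((α + d) * √t))
    obtain ⟨b1, b2⟩ := bump_mem (d := d) (y := x / √t - α) (by linarith) (by linarith)
    set b := 2 * d * (x / √t - α) - (x / √t - α) ^ 2 / 2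
    have h3 : gtail (x / √t) / gtail α ≤ 1 := (div_le_one hgα).2 (gtail_anti hη)
    have h4 : 0 ≤ gtail (x / √t) / gtail α := (div_pos (gtail_pos _) hgα).le
    set y := gtail (x / √t) / gtail α
    have hKb := mul_nonneg hK.le b1
    have hKb2 := mul_le_mul_of_nonneg_left b2 hK.le
    have hG : |y - K * b| ≤ 1 := abs_le.2 ⟨by linarith [A.small], by linarith⟩
    have h5 : |(E - 1) * (y - K * b)| ≤ σ / 2 * 1 := by
      rw [abs_mul]; exact mul_le_mul hE hG (abs_nonneg _) (by positivity)
    have h6 := (abs_le.1 h5).1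
    have h7 : 0 ≤ E * (y - K * b) + (σ + 2 * K * d ^ 2) - y := by linarith
    have := mul_nonneg hφα.le h7
    linarith
  · rw [subSol_ahead hα hd.le ht h2, one_mul, P.ahead _ ((le_div_iff₀ hs).2 h1)]
    have e : φ α / gtail α * gtail (x / √t) = φ α * (gtail (x / √t) / gtail α) := by ring
    have h7 : 0 ≤ σ * φ α := by positivity
    linarith

end Sol

/-- The wedge profile is a strict subsolution. -/
lemma wedge_source_nonpos {α β γ m ε σ d K G η r v : ℝ} (A : Admissible α β γ m ε σ d K)
    (hα : 0 < α) (hη : α ≤ η) (hηd : η ≤ α + d) (hG : 0 ≤ G) (hG1 : G ≤ 1)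
    (hr : |r| ≤ ε ^ 2) (hv : |v| ≤ ε ^ 2) :
    -(r * G) / 2 - ((-Real.exp (-η ^ 2 / 4) / gtail α - K * (2 * d - (η - α))) * η / 2
      - γ / η ^ 2 * G + v ^ 2 / η ^ 2 * G
      + 2 * v * (-Real.exp (-η ^ 2 / 4) / gtail α - K * (2 * d - (η - α))) / η
      + (η / 2 * Real.exp (-η ^ 2 / 4) / gtail α + K)) ≤ 0 := by
  have hη0 := hα.trans_le hη
  have hg := gtail_pos α
  have hd := A.hd
  have hγ := A.hγ
  have hK0 : 0 < K := by
    have := A.hK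
    have : 0 ≤ γ / α ^ 2 := div_nonneg hγ (by positivity)
    linarith
  have he0 := Real.exp_pos (-η ^ 2 / 4)
  have he1 : Real.exp (-η ^ 2 / 4) ≤ 1 := Real.exp_le_one_iff.2 (by
    have := sq_nonneg η; linarith)
  set e := Real.exp (-η ^ 2 / 4)
  set k := 2 * d - (η - α) with hk
  have hk0 : 0 ≤ k := by linarith
  have hk2 : k ≤ 2 * d := by linarith
  have b1 : -(r * G) ≤ ε ^ 2 := by
    have : |r * G| ≤ ε ^ 2 * 1 := by
      rw [abs_mul, abs_of_nonneg hG]; exact mul_le_mul hr hG1 hG (sq_nonneg _)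
    linarith [(abs_le.1 this).1]
  have b2 : K * k * η / 2 ≤ K / 4 := by
    have h1 : k * η ≤ 2 * d * (α + d) := mul_le_mul hk2 hηd hη0.le (by linarith)
    have h2 := mul_le_mul_of_nonneg_left h1 hK0.le
    have h3 := mul_le_mul_of_nonneg_left A.had hK0.le
    linarith
  have b3 : γ / η ^ 2 * G ≤ γ / α ^ 2 := by
    have h1 : γ / η ^ 2 ≤ γ / α ^ 2 := by gcongr
    exact (mul_le_of_le_one_right (by positivity) hG1).trans h1
  have b4 : 0 ≤ v ^ 2 / η ^ 2 * G := by positivity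
  have b5 : -(2 * v * (-e / gtail α - K * k) / η) ≤
      ε ^ 2 * (2 / (α * gtail α)) + ε ^ 2 * (4 / α) * (K * d) := by
    have e1 : -(2 * v * (-e / gtail α - K * k) / η) = v * (2 * (e / gtail α + K * k) / η) := by
      ring
    have h1 : 2 * (e / gtail α + K * k) / η ≤ 2 * (1 / gtail α + K * (2 * d)) / α := by gcongr
    have h0 : 0 ≤ 2 * (e / gtail α + K * k) / η := by positivity
    have h2 : v * (2 * (e / gtail α + K * k) / η) ≤
        ε ^ 2 * (2 * (1 / gtail α + K * (2 * d)) / α) :=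
      mul_le_mul ((le_abs_self v).trans hv) h1 h0 (sq_nonneg _)
    rw [e1]
    refine h2.trans (le_of_eq ?_)
    field_simp
    ring
  have b6 : ε ^ 2 * (4 / α) * (K * d) ≤ K / 4 := by
    have h1 : K * d ≤ K := mul_le_of_le_one_right hK0.le A.hd1
    have := mul_le_mul A.src' h1 (by positivity) (by norm_num)
    linarith
  have b7 := A.src
  have b8 := A.hK
  have e2 : (-e / gtail α - K * k) * η / 2 + (η / 2 * e / gtail α + K) = K - K * k * η / 2 := by
    ring
  linarith

namespace Sol
variable {α β ustar : ℝ} {u p w : ℝ → ℝ → ℝ} {ps : ℝ → ℝ} {γ : ℝ} {φ φ₁ φ₂ : ℝ → ℝ}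
  {ε σ d K X : ℝ}

lemma u_hasDerivAt_ahead (H : Sol α β ustar u p w ps) {x t : ℝ} (ht : 0 < t)
    (hx : α * √t < x) : ∃ D, HasDerivAt (fun y => u y t) D x := by
  have hs := Real.sqrt_pos.2 ht
  have h1 := ((hasDerivAt_gtail (x / √t)).comp x
    (hasDerivAt_sim_x (t := t) x)).const_mul (psiC α β)
  have h2 := h1.congr_of_eventuallyEq (f₁ := fun y => psi α β y t) (by
    filter_upwards [Ioi_mem_nhds hx] with y hy
    have hy0 : 0 < y := (mul_pos H.hα hs).trans hy
    rw [psi_ahead ht (by rw [abs_of_pos hy0]; exact (mem_Ioi.1 hy).le), abs_of_pos hy0]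
    rfl)
  refine ⟨_, ((H.heat.der t ht.le x).add h2).congr_of_eventuallyEq
    (Eventually.of_forall fun y => ?_)⟩
  simp

lemma p_eq_zero_ahead (H : Sol α β ustar u p w ps) (hd : 0 < d) : ∃ T > 0, ∀ x ≥ 1, ∀ t ≥ T,
    (α + d) * √t < x → p x t = 0 := by
  obtain ⟨C, hC, h⟩ := H.ahead_reach
  refine ⟨(C / d) ^ 2, by positivity, fun x hx t ht hxt => ?_⟩
  by_contra hp
  have hx0 : 0 < x := by linarith
  have ht0 : 0 ≤ t := (sq_nonneg _).trans ht
  obtain ⟨s, hs, hus⟩ := H.exists_of_p_ne_zero hx0.ne' ht0 hp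
  have hst := Real.sqrt_le_sqrt hs.2
  have h1 := mul_le_mul_of_nonneg_left hst H.hα.le
  have h2 : 0 ≤ d * √t := by positivity
  have h3 := h x s hx0 hs.1 hus (by linarith)
  have h4 : C / √x ≤ C := div_le_self hC.le (Real.one_le_sqrt.2 hx)
  have h5 : C / d ≤ √t := Real.le_sqrt_of_sq_le ht
  rw [div_le_iff₀ hd] at h5
  linarith

/-- Kink of the subsolution at the source. -/
lemma subSol_kink_source (H : Sol α β ustar u p w ps) (P : Prof α β γ φ φ₁ φ₂)
    (A : Admissible α β γ (φ α) ε σ d K)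
    (hX : 0 < X) (h : ∀ x ≥ X, |corr₁ ps γ x * x| ≤ ε ^ 2) {t : ℝ} (ht : 0 < t)
    (hx : X ≤ α * √t) :
    ∃ m₁ m₂, (1 - σ) * (m₁ - m₂) < α * β / 2 / √t ∧
      HasDerivWithinAt (fun y => subSol α ps φ γ ε d K y t) m₁ (Iic (α * √t)) (α * √t) ∧
      HasDerivWithinAt (fun y => subSol α ps φ γ ε d K y t) m₂ (Ici (α * √t)) (α * √t) := by
  have hα := H.hα
  have hβ := H.hβ
  have hs := Real.sqrt_pos.2 ht
  have hd := A.hd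
  have hσ := A.hσ
  have hφα := P.pos α hα
  have hlt : α * √t < (α + d) * √t := mul_lt_mul_of_pos_right (by linarith) hs
  have e : α * √t / √t = α := by field_simp
  have hl := (H.base_kink_left P ε (a := α + d) (by linarith) ht).congr
    (f₁ := fun y => subSol α ps φ γ ε d K y t)
    (fun y hy => subSol_behind hd.le ht hy) (subSol_behind hd.le ht le_rfl)
  have hr0 := (((H.corr_hasDerivAt (γ := γ) (x := α * √t) (by positivity)).sub_const
    (corr ps γ ((α + d) * √t))).exp.mul ((wedgeProfile_hasDerivAt α (φ α) d K (α * √t / √t)).comp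
    (α * √t) (hasDerivAt_sim_x (t := t) (α * √t)))).hasDerivWithinAt (s := Ici (α * √t))
  have hr := hr0.congr_of_eventuallyEq (f₁ := fun y => subSol α ps φ γ ε d K y t) (by
      filter_upwards [self_mem_nhdsWithin, mem_nhdsWithin_of_mem_nhds (Iio_mem_nhds hlt)]
        with y hy hy2
      exact subSol_wedge hα ht hy (mem_Iio.1 hy2).le)
    (subSol_wedge hα ht le_rfl hlt.le)
  refine ⟨_, _, ?_, hl, hr⟩
  simp only [Function.comp_apply, e]
  have hE := (abs_le.1 (H.exp_corr_wedge A hX h hx ht le_rfl hlt.le)).2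
  have hE0 := Real.exp_pos (corr ps γ (α * √t) - corr ps γ ((α + d) * √t))
  set E := Real.exp (corr ps γ (α * √t) - corr ps γ ((α + d) * √t))
  have hw : wedgeProfile α (φ α) d K α = φ α := by
    rw [wedgeProfile, div_self (gtail_pos α).ne']; ring
  have hw1 : wedgeProfile₁ α (φ α) d K α =
      -(Real.exp (-α ^ 2 / 4) / gtail α * φ α) - 2 * K * d * φ α := by
    rw [wedgeProfile₁]; ring
  rw [hw, hw1]
  have hj := P.jump
  set g := Real.exp (-α ^ 2 / 4) / gtail α * φ α
  have hk := A.kink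
  set q := ε * φ α / α + 2 * K * d * φ α with hq
  have hφ₁ : φ₁ α = α * β / 2 - g := by linarith
  have e3 : (1 - σ) * (E * (corr₁ ps γ (α * √t) * φ α + (ε * φ α / α + φ₁ α) / √t) -
      (E * corr₁ ps γ (α * √t) * φ α + E * ((-g - 2 * K * d * φ α) * (1 / √t)))) =
      (1 - σ) * E * (α * β / 2 + q) / √t := by
    rw [hq, hφ₁]; ring
  rw [e3]
  have hq0 : 0 ≤ q := by
    have : 0 < K := by
      have := A.hK
      have : 0 ≤ γ / α ^ 2 := div_nonneg A.hγ (by positivity)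
      linarith
    have := A.hε
    positivity
  refine div_lt_div_of_pos_right ?_ hs
  have h1 : (1 - σ) * E ≤ 1 - σ / 2 := by
    have := mul_le_mul_of_nonneg_left hE (show 0 ≤ 1 - σ by linarith [A.hσ1])
    have := sq_nonneg σ
    linarith
  have h2 := mul_le_mul_of_nonneg_right h1 (show 0 ≤ α * β / 2 + q by positivity)
  have h3 : 0 ≤ σ * q := by positivity
  linarith

/-- Kink of the subsolution at the edge of the wedge. -/
lemma subSol_kink_edge (H : Sol α β ustar u p w ps) (P : Prof α β γ φ φ₁ φ₂)
    (A : Admissible α β γ (φ α) ε σ d K)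
    (h : ∀ x ≥ X, |corr₁ ps γ x * x| ≤ ε ^ 2) {t : ℝ} (ht : 0 < t)
    (hx : X ≤ (α + d) * √t) (hpos : 0 < subSol α ps φ γ ε d K ((α + d) * √t) t) :
    ∃ m₁ m₂, m₁ < m₂ ∧
      HasDerivWithinAt (fun y => subSol α ps φ γ ε d K y t) m₁ (Iic ((α + d) * √t))
        ((α + d) * √t) ∧
      HasDerivWithinAt (fun y => subSol α ps φ γ ε d K y t) m₂ (Ici ((α + d) * √t))
        ((α + d) * √t) := by
  have hα := H.hα
  have hs := Real.sqrt_pos.2 ht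
  have hd := A.hd
  have hφα := P.pos α hα
  have ha0 : 0 < α + d := by linarith
  have hlt : α * √t < (α + d) * √t := mul_lt_mul_of_pos_right (by linarith) hs
  have e : (α + d) * √t / √t = α + d := by field_simp
  have hl0 := (((H.corr_hasDerivAt (γ := γ) (x := (α + d) * √t) (by positivity)).sub_const
    (corr ps γ ((α + d) * √t))).exp.mul ((wedgeProfile_hasDerivAt α (φ α) d K
    ((α + d) * √t / √t)).comp ((α + d) * √t) (hasDerivAt_sim_x (t := t)
    ((α + d) * √t)))).hasDerivWithinAt (s := Iic ((α + d) * √t))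
  have hl := hl0.congr_of_eventuallyEq (f₁ := fun y => subSol α ps φ γ ε d K y t) (by
      filter_upwards [self_mem_nhdsWithin, mem_nhdsWithin_of_mem_nhds (Ioi_mem_nhds hlt)]
        with y hy hy2
      exact subSol_wedge hα ht (mem_Ioi.1 hy2).le hy)
    (subSol_wedge hα ht hlt.le le_rfl)
  have hr0 := ((((hasDerivAt_gtail ((α + d) * √t / √t)).comp ((α + d) * √t)
    (hasDerivAt_sim_x (t := t) ((α + d) * √t))).const_mul (φ α / gtail α)).sub_const
    (φ α * (K * (3 / 2 * d ^ 2)))).hasDerivWithinAt (s := Ici ((α + d) * √t))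
  have hr := hr0.congr (f₁ := fun y => subSol α ps φ γ ε d K y t)
    (fun y hy => by rw [subSol_ahead hα hd.le ht hy, one_mul]; rfl)
    (by rw [subSol_ahead hα hd.le ht le_rfl, one_mul]; rfl)
  refine ⟨_, _, ?_, hl, hr⟩
  rw [subSol_wedge hα ht hlt.le le_rfl, e, sub_self, Real.exp_zero, one_mul] at hpos
  simp only [Function.comp_apply, e, sub_self, Real.exp_zero, one_mul]
  have hK0 : 0 < K := by
    have := A.hK
    have : 0 ≤ γ / α ^ 2 := div_nonneg A.hγ (by positivity)
    linarith
  have hwle : wedgeProfile α (φ α) d K (α + d) ≤ φ α := by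
    rw [wedgeProfile]
    refine mul_le_of_le_one_right hφα.le ?_
    have h1 : gtail (α + d) / gtail α ≤ 1 :=
      (div_le_one (gtail_pos α)).2 (gtail_anti (by linarith))
    have h2 := mul_nonneg hK0.le (bump_mem (d := d) (y := α + d - α) (by linarith)
      (by linarith)).1
    linarith
  have hc := h _ hx
  set c := corr₁ ps γ ((α + d) * √t)
  set W := wedgeProfile α (φ α) d K (α + d)
  have h1 : c * √t ≤ ε ^ 2 / α := by
    rw [le_div_iff₀ hα]
    rcases le_total c 0 with hc0 | hc0
    · have : c * (√t * α) ≤ 0 := mul_nonpos_of_nonpos_of_nonneg hc0 (by positivity)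
      linarith [sq_nonneg ε]
    · have h2 : 0 ≤ c * √t * d := by positivity
      linarith [(abs_le.1 hc).2]
  have h2 : c * √t * W < K * d * φ α := by
    have h3 : c * √t * W ≤ ε ^ 2 / α * W := mul_le_mul_of_nonneg_right h1 hpos.le
    have h4 : ε ^ 2 / α * W ≤ ε ^ 2 / α * φ α := mul_le_mul_of_nonneg_left hwle (by positivity)
    have h5 := mul_lt_mul_of_pos_right A.kink' hφα
    linarith
  have h3 := div_lt_div_of_pos_right h2 hs
  have e1 : c * √t * W / √t = c * W := by field_simp
  have e2 : wedgeProfile₁ α (φ α) d K (α + d) =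
      -(φ α / gtail α * Real.exp (-(α + d) ^ 2 / 4)) - K * d * φ α := by
    rw [wedgeProfile₁]; ring
  rw [e1] at h3
  rw [e2]
  have e3 : (-(φ α / gtail α * Real.exp (-(α + d) ^ 2 / 4)) - K * d * φ α) * (1 / √t) =
    φ α / gtail α * (-Real.exp (-(α + d) ^ 2 / 4) * (1 / √t)) - K * d * φ α / √t := by ring
  rw [e3]
  linarith

/-- The subsolution property on the wedge. -/
lemma subSol_wedge_hasBal (H : Sol α β ustar u p w ps) (P : Prof α β γ φ φ₁ φ₂)
    (A : Admissible α β γ (φ α) ε σ d K)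
    (hX : 0 < X) (h : ∀ x ≥ X, |corr₁ ps γ x * x| ≤ ε ^ 2) :
    ∃ f, HasBal (subSol α ps φ γ ε d K) f
        {q | (X < q.1 ∧ 0 < q.2) ∧ α * √q.2 < q.1 ∧ q.1 < (α + d) * √q.2} ∧
      ∀ q : ℝ × ℝ, X < q.1 → 0 < q.2 → α * √q.2 < q.1 → q.1 < (α + d) * √q.2 →
        0 < subSol α ps φ γ ε d K q.1 q.2 →
        f q.1 q.2 + ps q.1 * subSol α ps φ γ ε d K q.1 q.2 ≤ 0 := by
  have hα := H.hα
  have hd := A.hd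
  have hφα := P.pos α hα
  have ha0 : 0 < α + d := by linarith
  have hK0 : 0 < K := by
    have := A.hK
    have : 0 ≤ γ / α ^ 2 := div_nonneg A.hγ (by positivity)
    linarith
  have hopen : IsOpen {q : ℝ × ℝ | (X < q.1 ∧ 0 < q.2) ∧ α * √q.2 < q.1 ∧
      q.1 < (α + d) * √q.2} :=
    ((isOpen_lt continuous_const continuous_fst).inter
      (isOpen_lt continuous_const continuous_snd)).inter
      ((isOpen_lt (f := fun q : ℝ × ℝ => α * √q.2) (g := fun q => q.1) (by fun_prop)
        (by fun_prop)).inter (isOpen_lt (f := fun q : ℝ × ℝ => q.1)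
        (g := fun q => (α + d) * √q.2) (by fun_prop) (by fun_prop)))
  have hb := H.profile_hasBal (γ := γ) ha0 (S := univ) hopen
    (fun η _ => wedgeProfile_hasDerivAt α (φ α) d K η)
    (fun η _ => wedgeProfile₁_hasDerivAt α (φ α) d K η)
    (by fun_prop) (fun q hq => ⟨hX.trans hq.1.1, hq.1.2, mem_univ _⟩)
  refine ⟨_, hb.congr hopen (fun x t hq => subSol_wedge hα hq.1.2 hq.2.1.le hq.2.2.le)
    fun _ _ _ => rfl, ?_⟩
  rintro ⟨x, t⟩ hx ht hαx hxa hpos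
  simp only at hx ht hαx hxa hpos ⊢
  have hs := Real.sqrt_pos.2 ht
  have hx0 := hX.trans hx
  rw [subSol_wedge hα ht hαx.le hxa.le] at hpos ⊢
  have hη : α ≤ x / √t := (le_div_iff₀ hs).2 hαx.le
  have hη2 : x / √t ≤ α + d := (div_le_iff₀ hs).2 hxa.le
  have hr := h ((α + d) * √t) (hx.le.trans hxa.le)
  have hv := h x hx.le
  have hE0 := Real.exp_pos (corr ps γ x - corr ps γ ((α + d) * √t))
  have hts : t = √t ^ 2 := (Real.sq_sqrt ht.le).symm
  set s := √t with hsdef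
  set E := Real.exp (corr ps γ x - corr ps γ ((α + d) * s))
  have hg1 : gtail (x / s) / gtail α ≤ 1 := (div_le_one (gtail_pos α)).2 (gtail_anti hη)
  have hG1 : gtail (x / s) / gtail α - K * (2 * d * (x / s - α) - (x / s - α) ^ 2 / 2) ≤ 1 := by
    have := mul_nonneg hK0.le (bump_mem (d := d) (y := x / s - α) (by linarith)
      (by linarith)).1
    linarith
  rw [wedgeProfile] at hpos ⊢
  set G := gtail (x / s) / gtail α - K * (2 * d * (x / s - α) - (x / s - α) ^ 2 / 2)
  have hG : 0 ≤ G := by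
    by_contra hc
    push Not at hc
    have := mul_neg_of_pos_of_neg hE0 (mul_neg_of_pos_of_neg hφα hc)
    linarith
  have key := wedge_source_nonpos A hα hη hη2 hG hG1 hr hv
  set r := corr₁ ps γ ((α + d) * s) * ((α + d) * s) with hrd
  set v := corr₁ ps γ x * x with hvd
  have er : corr₁ ps γ ((α + d) * s) = r / ((α + d) * s) := by rw [hrd]; field_simp
  have ev : corr₁ ps γ x = v / x := by rw [hvd]; field_simp
  have hmul := mul_nonpos_of_nonneg_of_nonpos (show 0 ≤ E * φ α / s ^ 2 by positivity) key
  refine le_trans (le_of_eq ?_) hmul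
  rw [er, ev, wedgeProfile₁]
  generalize -Real.exp (-(x / s) ^ 2 / 4) / gtail α - K * (2 * d - (x / s - α)) = g₁
  generalize x / s / 2 * Real.exp (-(x / s) ^ 2 / 4) / gtail α + K = g₂
  rw [hts]
  clear_value E r v G s
  generalize φ α = m
  field_simp
  ring

end Sol

/-- Admissible parameters exist, with arbitrarily small profile error. -/
lemma exists_admissible {α β γ m C δ : ℝ} (hα : 0 < α) (hβ : 0 < β) (hγ : 0 ≤ γ) (hm : 0 < m)
    (hδ : 0 < δ) :
    ∃ ε σ d K, Admissible α β γ m ε σ d K ∧ σ * m ≤ δ ∧ 2 * K * d ^ 2 * m ≤ δ ∧ C * ε ≤ δ := by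
  obtain ⟨σ, hσ, hσ1, hσm⟩ : ∃ σ > 0, σ ≤ 1 ∧ σ * m ≤ δ :=
    ⟨min 1 (δ / m), lt_min one_pos (by positivity), min_le_left _ _,
      (le_div_iff₀ hm).1 (min_le_right _ _)⟩
  set K := 2 * (γ / α ^ 2 + 1) with hK
  have hK0 : 0 < K := by positivity
  have ev : ∀ f : ℝ → ℝ, ∀ c : ℝ, Continuous f → f 0 < c → ∀ᶠ y in nhdsWithin 0 (Ioi 0), f y < c :=
    fun f c hf hc => nhdsWithin_le_nhds (hf.continuousAt.eventually (gt_mem_nhds hc))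
  have hσβ : 0 < σ * (α * β / 4) := by positivity
  obtain ⟨d, hd, d1, d2, d3, d4, d5⟩ : ∃ d > 0, d < 1 ∧ (α + d) * d < 1 / 4 ∧
      2 * K * d * m < σ * (α * β / 4) ∧ 2 * K * d ^ 2 < 1 ∧ 2 * K * d ^ 2 * m < δ := by
    have h1 := ev (fun d => d) 1 (by fun_prop) one_pos
    have h2 := ev (fun d => (α + d) * d) (1 / 4) (by fun_prop) (by norm_num)
    have h3 := ev (fun d => 2 * K * d * m) _ (by fun_prop) (by simpa using hσβ)
    have h4 := ev (fun d => 2 * K * d ^ 2) 1 (by fun_prop) (by norm_num)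
    have h5 := ev (fun d => 2 * K * d ^ 2 * m) δ (by fun_prop) (by simpa using hδ)
    have h0 : ∀ᶠ y : ℝ in nhdsWithin 0 (Ioi 0), y ∈ Ioi (0 : ℝ) := self_mem_nhdsWithin
    obtain ⟨d, hd⟩ := (h0.and (h1.and (h2.and (h3.and (h4.and h5))))).exists
    exact ⟨d, hd⟩
  have hKd : 0 < K * d := by positivity
  obtain ⟨ε, hε, e1, e2, e3, e4, e5, e6, e7⟩ : ∃ ε > 0, ε * (6 + (α + d) ^ 2) < 1 ∧
      ((α + d) / α) ^ ε < 1 + σ / 2 ∧ ε * m / α + 2 * K * d * m < σ * (α * β / 4) ∧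
      ε ^ 2 * (1 / 2 + 2 / (α * gtail α)) < 1 / 4 ∧ ε ^ 2 * (4 / α) < 1 / 4 ∧
      ε ^ 2 / α < K * d ∧ C * ε < δ := by
    have h1 := ev (fun ε => ε * (6 + (α + d) ^ 2)) 1 (by fun_prop) (by norm_num)
    have h2 := ev (fun ε => ((α + d) / α) ^ ε) (1 + σ / 2)
      (Real.continuous_const_rpow (by positivity)) (by simpa using hσ)
    have h3 := ev (fun ε => ε * m / α + 2 * K * d * m) _ (by fun_prop) (by simpa using d3)
    have h4 := ev (fun ε => ε ^ 2 * (1 / 2 + 2 / (α * gtail α))) (1 / 4) (by fun_prop)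
      (by norm_num)
    have h5 := ev (fun ε => ε ^ 2 * (4 / α)) (1 / 4) (by fun_prop) (by norm_num)
    have h6 := ev (fun ε => ε ^ 2 / α) _ (by fun_prop) (by simpa using hKd)
    have h7 := ev (fun ε => C * ε) δ (by fun_prop) (by simpa using hδ)
    have h0 : ∀ᶠ y : ℝ in nhdsWithin 0 (Ioi 0), y ∈ Ioi (0 : ℝ) := self_mem_nhdsWithin
    obtain ⟨ε, hε⟩ := (h0.and
      (h1.and (h2.and (h3.and (h4.and (h5.and (h6.and h7))))))).exists
    exact ⟨ε, hε⟩
  exact ⟨ε, σ, d, K, ⟨hε, e1.le, hσ, hσ1, hd, d1.le, d2.le, hγ, by rw [hK]; linarith, e2.le, e3,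
    e4.le, e5.le, e6, d4.le⟩, hσm, d5.le, e7.le⟩

namespace Sol
variable {α β ustar : ℝ} {u p w : ℝ → ℝ → ℝ} {ps : ℝ → ℝ} {γ : ℝ} {φ φ₁ φ₂ : ℝ → ℝ}
  {ε σ d K X : ℝ}

lemma subSol_locSub_behind (H : Sol α β ustar u p w ps) (P : Prof α β γ φ φ₁ φ₂)
    (A : Admissible α β γ (φ α) ε σ d K)
    (hX : 0 < X) (h : ∀ x ≥ X, |corr₁ ps γ x * x| ≤ ε ^ 2) {x t : ℝ} (hx : X < x) (ht : 0 < t)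
    (hlt : x < α * √t) :
    LocSub (fun x t => (1 - σ) * subSol α ps φ γ ε d K x t - u x t) x t := by
  have hα := H.hα
  have hd := A.hd
  have hσ1 := A.hσ1
  obtain ⟨f, hf, hfs⟩ := H.base_hasBal P (τ := ε) (a := α + d) (by linarith) hX A.hε A.hεa
    (abs_of_pos A.hε) h
  set U := {q : ℝ × ℝ | (X < q.1 ∧ 0 < q.2) ∧ q.1 < α * √q.2} with hU
  have hUo : IsOpen U :=
    ((isOpen_lt continuous_const continuous_fst).inter
      (isOpen_lt continuous_const continuous_snd)).inter
      (isOpen_lt (f := fun q : ℝ × ℝ => q.1) (g := fun q => α * √q.2)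
        (by fun_prop) (by fun_prop))
  have hUb : U ⊆ behind α := fun q hq => ⟨hq.1.2, by
    rw [abs_of_pos (hX.trans hq.1.1)]; exact hq.2⟩
  refine ⟨U, hUo.mem_nhds ⟨⟨hx, ht⟩, hlt⟩, _,
    ((hf.const_mul (1 - σ)).sub (H.u_hasBal_behind.mono hUb)).congr hUo
      (fun x t hq => by rw [subSol_behind hd.le hq.1.2 hq.2.le]) fun _ _ _ => rfl, ?_⟩
  filter_upwards [Measure.quasiMeasurePreserving_fst.ae
    ((ae_restrict_iff' measurableSet_Ioi).1 H.ps_eq)] with q hps hq _ hqz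
  have hq0 : 0 < q.1 := hX.trans hq.1.1
  have hpp : p q.1 q.2 = ps q.1 := by
    refine hps hq0 q.2 ?_
    rw [div_lt_iff₀ (by positivity)]
    have := pow_lt_pow_left₀ hq.2 hq0.le two_ne_zero
    rw [mul_pow, Real.sq_sqrt hq.1.2.le] at this
    linarith
  obtain ⟨S, hS, B, hB, hfe⟩ := hfs q hq.1.1 hq.1.2 hq.2
  rw [subSol_behind hd.le hq.1.2 hq.2.le] at hqz
  have h1 : S * (B - 2 * ε) ≤ 0 := mul_nonpos_of_nonneg_of_nonpos hS
    (by linarith [(abs_le.1 hB).2])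
  have h2 := mul_nonneg (H.ps01 q.1).1 hqz.le
  have h3 := mul_nonpos_of_nonneg_of_nonpos (show 0 ≤ 1 - σ by linarith) h1
  rw [← hfe] at h3
  simp only [hpp]
  linarith

lemma subSol_locSub_wedge (H : Sol α β ustar u p w ps) (P : Prof α β γ φ φ₁ φ₂)
    (A : Admissible α β γ (φ α) ε σ d K)
    (hX : 0 < X) (h : ∀ x ≥ X, |corr₁ ps γ x * x| ≤ ε ^ 2) {x t : ℝ} (hx : X < x) (ht : 0 < t)
    (hgt : α * √t < x) (hlt : x < (α + d) * √t) :
    LocSub (fun x t => (1 - σ) * subSol α ps φ γ ε d K x t - u x t) x t := by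
  have hα := H.hα
  have hσ1 := A.hσ1
  obtain ⟨f, hf, hfs⟩ := H.subSol_wedge_hasBal P A hX h
  set U := {q : ℝ × ℝ | (X < q.1 ∧ 0 < q.2) ∧ α * √q.2 < q.1 ∧ q.1 < (α + d) * √q.2} with hU
  have hUo : IsOpen U :=
    ((isOpen_lt continuous_const continuous_fst).inter
      (isOpen_lt continuous_const continuous_snd)).inter
      ((isOpen_lt (f := fun q : ℝ × ℝ => α * √q.2) (g := fun q => q.1) (by fun_prop)
        (by fun_prop)).inter (isOpen_lt (f := fun q : ℝ × ℝ => q.1)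
        (g := fun q => (α + d) * √q.2) (by fun_prop) (by fun_prop)))
  have hUa : U ⊆ ahead α 1 := fun q hq => ⟨hq.1.2, by rw [one_mul]; exact hq.2.1⟩
  refine ⟨U, hUo.mem_nhds ⟨⟨hx, ht⟩, hgt, hlt⟩, _,
    (hf.const_mul (1 - σ)).sub ((H.u_hasBal_ahead (one_pow 2)).mono hUa), ?_⟩
  filter_upwards [Measure.quasiMeasurePreserving_fst.ae
    ((ae_restrict_iff' measurableSet_Ioi).1 H.ps_eq)] with q hps hq _ hqz
  have hq0 : 0 < q.1 := hX.trans hq.1.1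
  have hpp : p q.1 q.2 ≤ ps q.1 := by
    have h1 : q.2 ≤ max q.2 (q.1 ^ 2 / α ^ 2 + 1) := le_max_left _ _
    rw [← hps hq0 _ (lt_of_lt_of_le (lt_add_one _) (le_max_right q.2 _))]
    exact H.p_mono q.1 hq.1.2.le (hq.1.2.le.trans h1) h1
  have hu0 := H.nonneg q.1 hq.1.2.le
  have hzpos : 0 < subSol α ps φ γ ε d K q.1 q.2 := by
    by_contra hc
    push Not at hc
    have := mul_nonpos_of_nonneg_of_nonpos (show 0 ≤ 1 - σ by linarith) hc
    linarith
  have h1 := hfs q hq.1.1 hq.1.2 hq.2.1 hq.2.2 hzpos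
  have h2 := mul_nonpos_of_nonneg_of_nonpos (show 0 ≤ 1 - σ by linarith) h1
  have h3 := mul_le_mul_of_nonneg_right hpp hu0
  have h4 := mul_nonneg (H.ps01 q.1).1 hqz.le
  linarith

lemma subSol_locSub_ahead (H : Sol α β ustar u p w ps) (hd : 0 < d) {T : ℝ} (hT : 0 < T)
    (hp : ∀ x ≥ 1, ∀ t ≥ T, (α + d) * √t < x → p x t = 0) {x t : ℝ} (hx : 1 < x) (ht : T < t)
    (hgt : (α + d) * √t < x) :
    LocSub (fun x t => (1 - σ) * subSol α ps φ γ ε d K x t - u x t) x t := by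
  have hα := H.hα
  set U := {q : ℝ × ℝ | (1 < q.1 ∧ T < q.2) ∧ (α + d) * √q.2 < q.1} with hU
  have hUo : IsOpen U :=
    ((isOpen_lt continuous_const continuous_fst).inter
      (isOpen_lt continuous_const continuous_snd)).inter
      (isOpen_lt (f := fun q : ℝ × ℝ => (α + d) * √q.2) (g := fun q => q.1) (by fun_prop)
        (by fun_prop))
  have hUa : U ⊆ ahead α 1 := fun q hq => ⟨hT.trans hq.1.2, by
    rw [one_mul]
    refine lt_of_le_of_lt ?_ hq.2
    exact mul_le_mul_of_nonneg_right (by linarith) (Real.sqrt_nonneg _)⟩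
  refine ⟨U, hUo.mem_nhds ⟨⟨hx, ht⟩, hgt⟩, _,
    (((((hasBal_gtail (one_pow 2) (φ α / gtail α)).mono fun q hq => (hUa hq).1).sub
      (hasBal_quad (φ α * (K * (3 / 2 * d ^ 2))) 0 0 0 U)).const_mul (1 - σ)).sub
      ((H.u_hasBal_ahead (one_pow 2)).mono hUa)).congr hUo
      (fun x t hq => by rw [subSol_ahead hα hd.le (hT.trans hq.1.2) hq.2.le]; ring)
      fun _ _ _ => rfl, Eventually.of_forall fun q hq _ _ => ?_⟩
  simp [hp q.1 hq.1.1.le q.2 hq.1.2.le hq.2]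

lemma subSol_kinks (H : Sol α β ustar u p w ps) (P : Prof α β γ φ φ₁ φ₂)
    (A : Admissible α β γ (φ α) ε σ d K)
    (hX : 0 < X) (h : ∀ x ≥ X, |corr₁ ps γ x * x| ≤ ε ^ 2) {x t : ℝ} (hx : X ≤ x) (ht : 0 < t)
    (hz : 0 < (1 - σ) * subSol α ps φ γ ε d K x t - u x t)
    (hxt : x = α * √t ∨ x = (α + d) * √t) :
    ∃ m₁ m₂, m₁ < m₂ ∧
      HasDerivWithinAt (fun y => (1 - σ) * subSol α ps φ γ ε d K y t - u y t) m₁ (Iic x) x ∧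
      HasDerivWithinAt (fun y => (1 - σ) * subSol α ps φ γ ε d K y t - u y t) m₂ (Ici x) x := by
  have hα := H.hα
  have hs := Real.sqrt_pos.2 ht
  have hσ1 := A.hσ1
  rcases hxt with rfl | rfl
  · obtain ⟨m₁, m₂, hm, h1, h2⟩ := H.subSol_kink_source P A hX h ht hx
    refine ⟨_, _, ?_, (h1.const_mul (1 - σ)).sub (H.u_kink_left ht),
      (h2.const_mul (1 - σ)).sub (H.u_kink_right ht)⟩
    linarith
  · have hu0 := H.nonneg ((α + d) * √t) ht.le
    have h1 : 0 < (1 - σ) * subSol α ps φ γ ε d K ((α + d) * √t) t := by linarith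
    have hσ0 : 0 < 1 - σ := by
      rcases hσ1.lt_or_eq with h | h
      · linarith
      · rw [h, sub_self, zero_mul] at h1; exact absurd h1 (lt_irrefl 0)
    obtain ⟨m₁, m₂, hm, h1, h2⟩ := H.subSol_kink_edge P A h ht hx
      ((mul_pos_iff_of_pos_left hσ0).1 h1)
    obtain ⟨D, hD⟩ := H.u_hasDerivAt_ahead (x := (α + d) * √t) ht
      (mul_lt_mul_of_pos_right (by linarith [A.hd]) hs)
    refine ⟨_, _, ?_, (h1.const_mul (1 - σ)).sub hD.hasDerivWithinAt,
      (h2.const_mul (1 - σ)).sub hD.hasDerivWithinAt⟩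
    have := mul_lt_mul_of_pos_left hm hσ0
    linarith

/-- Comparison of `u` with the subsolution. -/
theorem subSol_le (H : Sol α β ustar u p w ps) (P : Prof α β γ φ φ₁ φ₂)
    (A : Admissible α β γ (φ α) ε σ d K) {δ : ℝ}
    (hX : 1 ≤ X) (h : ∀ x ≥ X, |corr₁ ps γ x * x| ≤ ε ^ 2) (hδ : 0 < δ) :
    ∃ T > 0, ∀ x ≥ X, ∀ t ≥ T, (1 - σ) * subSol α ps φ γ ε d K x t ≤ u x t + δ := by
  have hα := H.hα
  have hX0 : 0 < X := by linarith
  have hφα := P.pos α hα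
  have hσ := A.hσ
  have hσ1 := A.hσ1
  have hd := A.hd
  obtain ⟨C, hC0, hC⟩ := P.lin
  obtain ⟨T₀, hT₀, hp⟩ := H.p_eq_zero_ahead hd
  set T := max T₀ (max ((X / α) ^ 2) ((2 * C * X / (δ / 2)) ^ 2)) with hTd
  have hT : 0 < T := lt_max_of_lt_left hT₀
  set K' := 2 * φ α / gtail (α + d) with hK'
  have hK'0 : 0 < K' := by have := gtail_pos (α + d); positivity
  set B := K' * gtail 0 * √T with hB
  refine ⟨max T ((B / (δ / 2)) ^ 2), lt_max_of_lt_left hT, fun x hx t ht => ?_⟩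
  have hshrink : ∀ y c : ℝ, y ≤ c → 0 ≤ c → (1 - σ) * y ≤ c := fun y c hyc hc => by
    have h1 := mul_le_mul_of_nonneg_left hyc (show 0 ≤ 1 - σ by linarith)
    have h2 := mul_nonneg hσ.le hc
    linarith
  have hz := le_add_of_gaussian_tail
    (z := fun x t => (1 - σ) * subSol α ps φ γ ε d K x t - u x t)
    (X := X) (T := T) (K := K') (δ := δ / 2) hX0.le hT hK'0.le (half_pos hδ) ?_ ?_ ?_ ?_ hx
    ((le_max_left _ _).trans ht)
  · have ht0 : 0 < t := hT.trans_le ((le_max_left _ _).trans ht)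
    have hs := Real.sqrt_pos.2 ht0
    have h1 : B / (δ / 2) ≤ √t := Real.le_sqrt_of_sq_le ((le_max_right _ _).trans ht)
    have h2 : B / √t ≤ δ / 2 := by
      rw [div_le_iff₀ (half_pos hδ)] at h1
      rw [div_le_iff₀ hs]; linarith
    linarith
  · intro q hq
    have hq1 : 0 < q.1 := hX0.trans_le hq.1
    have hq2 : 0 < q.2 := hT.trans_le hq.2
    refine ContinuousWithinAt.sub (continuousWithinAt_const.mul ?_)
      (H.continuousAt hq2).continuousWithinAt
    exact ((H.subSol_continuousOn P hd) q ⟨hq1, hq2⟩).mono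
      fun r hr => ⟨hX0.trans_le hr.1, hT.trans_le hr.2⟩
  · intro t ht
    have ht0 := hT.trans_le ht
    have hs := Real.sqrt_pos.2 ht0
    have h1 : X / α ≤ √t := Real.le_sqrt_of_sq_le
      (((le_max_left _ _).trans (le_max_right _ _)).trans ht)
    have h2 : 2 * C * X / (δ / 2) ≤ √t := Real.le_sqrt_of_sq_le
      (((le_max_right _ _).trans (le_max_right _ _)).trans ht)
    rw [div_le_iff₀ hα] at h1
    rw [div_le_iff₀ (half_pos hδ)] at h2
    have h3 : X ≤ α * √t := by linarith
    have hη0 : 0 < X / √t := by positivity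
    have hb := (H.base_le_behind P A hX0 h le_rfl ht0 h3).1
    have hc := hC _ hη0 ((div_le_iff₀ hs).2 h3)
    have h5 : 2 * (C * (X / √t)) ≤ δ / 2 := by
      have e : 2 * (C * (X / √t)) = 2 * C * X / √t := by ring
      rw [e, div_le_iff₀ hs]; linarith
    have h6 : (1 + σ / 2) * φ (X / √t) ≤ 2 * φ (X / √t) :=
      mul_le_mul_of_nonneg_right (by linarith) (P.pos _ hη0).le
    rw [← subSol_behind (K := K) hd.le ht0 h3] at hb
    have := hshrink (subSol α ps φ γ ε d K X t) (δ / 2) (by linarith) (half_pos hδ).le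
    linarith [H.nonneg X ht0.le]
  · intro x hx t ht
    have ht0 := hT.trans_le ht
    have := hshrink _ _ (H.subSol_le_tail P A hX0 h hx ht0).2
      (mul_nonneg hK'0.le (gtail_pos _).le)
    linarith [H.nonneg x ht0.le]
  · intro x hx t ht hz0
    have ht0 := hT.trans ht
    rcases lt_trichotomy x (α * √t) with hlt | heq | hgt
    · exact Or.inl (H.subSol_locSub_behind P A hX0 h hx ht0 hlt)
    · exact Or.inr (H.subSol_kinks P A hX0 h (le_of_lt hx) ht0 hz0 (Or.inl heq))
    rcases lt_trichotomy x ((α + d) * √t) with hlt2 | heq2 | hgt2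
    · exact Or.inl (H.subSol_locSub_wedge P A hX0 h hx ht0 hgt hlt2)
    · exact Or.inr (H.subSol_kinks P A hX0 h (le_of_lt hx) ht0 hz0 (Or.inr heq2))
    · exact Or.inl (H.subSol_locSub_ahead hd hT₀ hp (hX.trans_lt hx)
        ((le_max_left _ _).trans_lt ht) hgt2)

/-- Asymptotic lower bound by the profile. -/
theorem lower (H : Sol α β ustar u p w ps) (P : Prof α β γ φ φ₁ φ₂) (hγ : 0 ≤ γ)
    (hG : Tendsto (fun x => x * ∫ y in Ioi x, ps y) atTop (nhds γ)) {δ : ℝ} (hδ : 0 < δ) :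
    ∃ X > 0, ∃ T > 0, ∀ x ≥ X, ∀ t ≥ T, Phi α β γ (x / √t) ≤ u x t + δ := by
  have hα := H.hα
  have hφα := P.pos α hα
  obtain ⟨C, hC0, hC⟩ := P.lin
  obtain ⟨ε, σ, d, K, A, h1, h2, h3⟩ := exists_admissible (C := 2 * C * α) hα H.hβ hγ hφα
    (show 0 < δ / 8 by positivity)
  obtain ⟨X₀, hX₀, h₀⟩ := corr_small hG (show 0 < ε ^ 2 by have := A.hε; positivity)
  have hX : 1 ≤ max X₀ 1 := le_max_right _ _
  have h : ∀ x ≥ max X₀ 1, |corr₁ ps γ x * x| ≤ ε ^ 2 := fun x hx =>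
    h₀ x ((le_max_left _ _).trans hx)
  obtain ⟨T, hT, hu⟩ := H.subSol_le P A hX h (show 0 < δ / 8 by positivity)
  have hX0 : 0 < max X₀ 1 := by linarith
  refine ⟨_, hX0, T, hT, fun x hx t ht => ?_⟩
  have ht0 := hT.trans_le ht
  have b1 := hu x hx t ht
  have b2 := H.le_subSol P A hC0 hC hX0 h hx ht0
  have b3 := mul_le_mul_of_nonneg_left (H.subSol_le_tail P A hX0 h hx ht0).1 A.hσ.le
  linarith

end Sol

namespace Sol
variable {α β ustar : ℝ} {u p w : ℝ → ℝ → ℝ} {ps : ℝ → ℝ} {γ : ℝ} {φ φ₁ φ₂ : ℝ → ℝ}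

theorem convUnif (H : Sol α β ustar u p w ps) (P : Prof α β γ φ φ₁ φ₂) (hγ : 0 ≤ γ)
    (hG : Tendsto (fun x => x * ∫ y in Ioi x, ps y) atTop (nhds γ)) :
    ConvUnif u (Phi α β γ) := by
  intro ε hε
  have hα := H.hα
  obtain ⟨X₁, hX₁, T₁, hT₁, h₁⟩ := H.upper P hG (half_pos hε)
  obtain ⟨X₂, hX₂, T₂, hT₂, h₂⟩ := H.lower P hγ hG (half_pos hε)
  obtain ⟨C, hC0, hC⟩ := P.lin
  set X := max X₁ X₂
  have hX : 0 < X := hX₁.trans_le (le_max_left _ _)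
  obtain ⟨T₃, hT₃, h₃⟩ := H.decay X (half_pos hε)
  refine ⟨max (max T₁ T₂) (max T₃ (max ((X / α) ^ 2) ((C * X / (ε / 2)) ^ 2))),
    fun t ht η hη => ?_⟩
  simp only [ge_iff_le, max_le_iff] at ht
  obtain ⟨⟨t1, t2⟩, t3, t4, t5⟩ := ht
  have ht0 : 0 < t := hT₁.trans_le t1
  have hs : 0 < √t := Real.sqrt_pos.2 ht0
  rw [abs_lt]
  rcases le_total X (η * √t) with hx | hx
  · have a1 := h₁ _ ((le_max_left _ _).trans hx) t t1
    have a2 := h₂ _ ((le_max_right _ _).trans hx) t t2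
    rw [mul_div_cancel_right₀ _ hs.ne'] at a1 a2
    constructor <;> linarith
  · have a1 := h₃ t t3 _ ((abs_of_nonneg (mul_nonneg hη hs.le)).trans_le hx)
    have a2 := H.nonneg (η * √t) ht0.le
    have a3 := P.phi_nonneg hα hη
    have a4 : Phi α β γ η ≤ ε / 2 := by
      rcases hη.eq_or_lt with rfl | h0
      · rw [P.zero]; positivity
      have b1 := Real.le_sqrt_of_sq_le t4
      have b2 := Real.le_sqrt_of_sq_le t5
      rw [div_le_iff₀ hα] at b1
      rw [div_le_iff₀ (half_pos hε)] at b2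
      have b3 : η ≤ α := le_of_mul_le_mul_right (by linarith) hs
      rw [P.behind η h0 b3]
      refine (hC η h0 b3).trans (le_of_mul_le_mul_right ?_ hs)
      have := mul_le_mul_of_nonneg_left hx hC0.le
      linarith
    constructor <;> linarith

theorem phi_le_ustar (H : Sol α β ustar u p w ps) (P : Prof α β γ φ φ₁ φ₂) (hγ : 0 ≤ γ)
    (hG : Tendsto (fun x => x * ∫ y in Ioi x, ps y) atTop (nhds γ)) :
    Phi α β γ α ≤ ustar := by
  have hα := H.hα
  refine le_of_forall_pos_le_add fun δ hδ => ?_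
  obtain ⟨X, hX, T, hT, h⟩ := H.lower P hγ hG (half_pos hδ)
  obtain ⟨C, hC, Y, hY, hu⟩ := H.excess
  set x := max (max X Y) (max (C / (δ / 2)) (α * √T))
  have x1 : X ≤ x := (le_max_left _ _).trans (le_max_left _ _)
  have x2 : Y ≤ x := (le_max_right _ _).trans (le_max_left _ _)
  have x3 : C / (δ / 2) ≤ x := (le_max_left _ _).trans (le_max_right _ _)
  have x4 : α * √T ≤ x := (le_max_right _ _).trans (le_max_right _ _)
  have hx : 1 ≤ x := hY.trans x2
  have hx0 : 0 < x := by linarith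
  have e1 : √((x / α) ^ 2) = x / α := Real.sqrt_sq (by positivity)
  have e2 : T ≤ (x / α) ^ 2 := by
    rw [← Real.sqrt_le_sqrt_iff (by positivity), e1, le_div_iff₀ hα, mul_comm]; exact x4
  have a1 := h x x1 _ e2
  rw [e1, div_div_cancel₀ hx0.ne'] at a1
  have a2 := hu x x2 ((x / α) ^ 2) (by positivity)
  have a3 : C / (x * √x) ≤ δ / 2 := by
    have hs := Real.one_le_sqrt.2 hx
    rw [div_le_iff₀ (half_pos hδ)] at x3
    rw [div_le_iff₀ (by positivity)]
    have := mul_le_mul_of_nonneg_left hs (mul_nonneg hx0.le (half_pos hδ).le)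
    linarith
  linarith

theorem ustar_le_phi (H : Sol α β ustar u p w ps) (P : Prof α β γ φ φ₁ φ₂) (hγ : 0 < γ)
    (hG : Tendsto (fun x => x * ∫ y in Ioi x, ps y) atTop (nhds γ)) :
    ustar ≤ Phi α β γ α := by
  have hα := H.hα
  refine le_of_forall_pos_le_add fun δ hδ => ?_
  obtain ⟨X, hX, T, hT, h⟩ := H.upper P hG hδ
  obtain ⟨L, hL1, hLα, hL⟩ := H.exists_reach
  obtain ⟨Y, hY0, hY, hYX⟩ := ((hG.eventually (lt_mem_nhds hγ)).and
    ((eventually_ge_atTop X).and (eventually_ge_atTop (L * √T)))).exists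
  have hY00 : 0 < Y := hX.trans_le hY
  obtain ⟨x, hxY, hx⟩ : ∃ x > Y, ps x ≠ 0 ∧ ∀ t, x ^ 2 / α ^ 2 < t → p x t = ps x := by
    by_contra hc
    push Not at hc
    have h0 : ∫ y in Ioi Y, ps y = 0 := by
      refine (setIntegral_congr_ae measurableSet_Ioi ?_).trans (integral_zero _ _)
      have := (ae_restrict_iff' measurableSet_Ioi).1 H.ps_eq
      filter_upwards [this] with x hx hxY
      by_contra hne
      obtain ⟨t, ht, ht'⟩ := hc x hxY hne
      exact ht' (hx (hY00.trans hxY) t ht)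
    rw [h0, mul_zero] at hY0
    exact lt_irrefl _ hY0
  obtain ⟨hx1, hx2⟩ := hx
  have hx0 : 0 < x := hY00.trans hxY
  obtain ⟨s, hs, hsu⟩ := H.exists_ahead hx0.ne' (T := x ^ 2 / α ^ 2) (by positivity)
    fun t ht => by rw [hx2 t ht]; exact hx1
  obtain ⟨hs0, hsL⟩ := hL x s hx0 hs.1 hsu
  have hTs : T ≤ s := by
    rw [← Real.sqrt_le_sqrt_iff hs0.le]
    exact le_of_mul_le_mul_left (by linarith) (by linarith : 0 < L)
  have a1 := h x (hY.trans hxY.le) s hTs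
  have a2 := P.phi_le hα (show 0 ≤ x / √s by positivity)
  rw [← P.behind α hα le_rfl] at a2
  linarith

end Sol

theorem tail_congr {ps pstar : ℝ → ℝ} {γ : ℝ} (h : ps =ᵐ[volume.restrict (Ioi 0)] pstar)
    (hG : Tendsto (fun x : ℝ => x * ∫ y in Ioi x, pstar y) atTop (nhds γ)) :
    Tendsto (fun x : ℝ => x * ∫ y in Ioi x, ps y) atTop (nhds γ) := by
  refine hG.congr' ?_
  filter_upwards [eventually_ge_atTop 0] with x hx
  rw [integral_congr_ae (ae_restrict_of_ae_restrict_of_subset (Ioi_subset_Ioi hx) h)]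

/-- if `p` satisfies condition (P) and its tail functional
`x ∫_x^∞ p*` converges to `γ ≥ 0`, then `u` converges uniformly to `Φ_γ`; moreover
`Φ_γ(α) = u*` when `γ > 0` and `0 < Φ₀(α) ≤ u*` when `γ = 0`. -/
theorem hhmo_uniform_convergence (α β ustar : ℝ) (hα : 0 < α) (hβ : 0 < β)
    (hu : 0 < ustar) (hsub : ustar < PsiP α β α)
    (u p : ℝ → ℝ → ℝ) (hsol : IsWeakSolution α β ustar u p)
    (pstar : ℝ → ℝ) (hP : CondP α p pstar)
    (γ : ℝ) (hγ : 0 ≤ γ)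
    (htail : Filter.Tendsto (fun x : ℝ => x * ∫ ξ in Set.Ioi x, pstar ξ)
      Filter.atTop (nhds γ)) :
    ConvUnif u (Phi α β γ) ∧
    (0 < γ → Phi α β γ α = ustar) ∧
    (γ = 0 → 0 < Phi α β 0 α ∧ Phi α β 0 α ≤ ustar) := by
  obtain ⟨w, ps, H, hps⟩ := Sol.of_hyp hα hβ hu hsub hsol hP
  obtain ⟨φ, φ₁, φ₂, P⟩ := exists_prof hα hβ hγ
  have hG := tail_congr hps htail
  refine ⟨H.convUnif P hγ hG, fun h => (H.phi_le_ustar P hγ hG).antisymm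
    (H.ustar_le_phi P h hG), ?_⟩
  rintro rfl
  exact ⟨(P.pos α hα).trans_eq (P.behind α hα le_rfl).symm, H.phi_le_ustar P hγ hG⟩

end
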